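/- For every choice of positive real numbers ε, c, N with 0 < ε < 1/2 and every positive integer d, there exist constants C > 0 and m₀ ∈ ℕ depending only on c, d, N such that: for every n ≥ 1 and every polynomial p : ℝⁿ → ℝ of degree at most d, there exists a polynomial p₀ : ℝⁿ → ℝ of degree at most d with |p − p₀|₂ ≤ C·ε^N·|p|₂, such that p₀ admits an (ε, ε^{−c})-diffuse decomposition of size at most m₀. -/

import Mathlib

open MeasureTheory ProbabilityTheory

/-- The standard Gaussian measure on `ℝⁿ`. -/
noncomputable def stdGaussian (n : ℕ) : Measure (Fin n → ℝ) :=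
  Measure.pi fun _ => gaussianReal 0 1

/-- The Gaussian `L²` norm of a polynomial on `ℝⁿ`. -/
noncomputable def gaussL2 {n : ℕ} (p : MvPolynomial (Fin n) ℝ) : ℝ :=
  Real.sqrt (∫ x, (MvPolynomial.eval x p) ^ 2 ∂(stdGaussian n))

/-- `(h, q)` is a decomposition of the degree-`d` polynomial `p`:
`p = h(q₁, …, q_m)` and every monomial `∏ xᵢ^{aᵢ}` of `h` satisfies
`∑ aᵢ · deg(qᵢ) ≤ d`. -/
def IsDecomposition {n m : ℕ} (d : ℕ) (p : MvPolynomial (Fin n) ℝ)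
    (h : MvPolynomial (Fin m) ℝ) (q : Fin m → MvPolynomial (Fin n) ℝ) : Prop :=
  MvPolynomial.aeval q h = p ∧
    ∀ a ∈ h.support, (∑ i, a i * (q i).totalDegree) ≤ d

/-- `(q₁, …, q_m)` is an `(ε, N)`-diffuse set. -/
def IsDiffuseSet {n : ℕ} (m : ℕ) (ε N : ℝ) (q : Fin m → MvPolynomial (Fin n) ℝ) : Prop :=
  (∀ i, ∫ x, (MvPolynomial.eval x (q i)) ^ 2 ∂(stdGaussian n) ≤ 1) ∧
    ∀ a : Fin m → ℝ,
      stdGaussian n {x | ∀ i, |MvPolynomial.eval x (q i) - a i| ≤ ε} ≤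
        ENNReal.ofReal (ε ^ m * N)

/-- `p` has an `(ε, N)`-diffuse decomposition of size `m`. -/
def HasDiffuseDecomposition {n : ℕ} (d m : ℕ) (ε N : ℝ)
    (p : MvPolynomial (Fin n) ℝ) : Prop :=
  ∃ (h : MvPolynomial (Fin m) ℝ) (q : Fin m → MvPolynomial (Fin n) ℝ),
    IsDecomposition d p h q ∧ IsDiffuseSet m ε N q


set_option linter.unusedSectionVars false
set_option linter.unusedVariables false

/-- Continuous functions of polynomial growth. -/
@[fun_prop]
def PG {E F : Type*} [NormedAddCommGroup E] [NormedAddCommGroup F] (f : E → F) : Prop :=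
  Continuous f ∧ ∃ (k : ℕ) (C : ℝ), ∀ x, ‖f x‖ ≤ C * (1 + ‖x‖) ^ k

section PGsec
variable {E F G : Type*} [NormedAddCommGroup E] [NormedAddCommGroup F] [NormedAddCommGroup G]

lemma one_le_onorm (x : E) (k : ℕ) : 1 ≤ (1 + ‖x‖) ^ k :=
  one_le_pow₀ (by linarith [norm_nonneg x])

lemma PG.cont {f : E → F} (h : PG f) : Continuous f := h.1

lemma PG.bd {f : E → F} (h : PG f) : ∃ (k : ℕ) (C : ℝ), 0 ≤ C ∧ ∀ x, ‖f x‖ ≤ C * (1 + ‖x‖) ^ k := by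
  obtain ⟨_, k, C, hC⟩ := h
  refine ⟨k, C, ?_, hC⟩
  have h0 := (norm_nonneg _).trans (hC 0)
  simpa using h0

@[fun_prop]
lemma PG.id : PG (fun x : E => x) :=
  ⟨continuous_id, 1, 1, fun x => by simp⟩

@[fun_prop]
lemma PG.const (c : F) : PG (fun _ : E => c) :=
  ⟨continuous_const, 0, ‖c‖, fun x => by simp⟩

@[fun_prop]
lemma PG.comp {g : F → G} {f : E → F} (hg : PG g) (hf : PG f) : PG (fun x => g (f x)) := by
  obtain ⟨k, C, hC, h1⟩ := hg.bd
  obtain ⟨l, D, hD, h2⟩ := hf.bd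
  refine ⟨hg.1.comp hf.1, l * k, C * (1 + D) ^ k, fun x => ?_⟩
  refine (h1 _).trans ?_
  rw [mul_assoc, pow_mul, ← mul_pow]
  gcongr
  have := one_le_onorm x l
  nlinarith [h2 x]

lemma PG.of_le {f : E → F} {g : E → ℝ} (hf : Continuous f) (hg : PG g) (h : ∀ x, ‖f x‖ ≤ g x) :
    PG f := by
  obtain ⟨k, C, hC, h1⟩ := hg.bd
  exact ⟨hf, k, C, fun x => (h x).trans ((le_abs_self _).trans (h1 x))⟩

@[fun_prop]
lemma PG.norm {f : E → F} (hf : PG f) : PG (fun x => ‖f x‖) := by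
  obtain ⟨k, C, hC, h1⟩ := hf.bd
  exact ⟨hf.1.norm, k, C, fun x => by simpa using h1 x⟩

@[fun_prop]
lemma PG.add {f g : E → F} (hf : PG f) (hg : PG g) : PG (fun x => f x + g x) := by
  obtain ⟨k, C, hC, h1⟩ := hf.bd
  obtain ⟨l, D, hD, h2⟩ := hg.bd
  refine ⟨hf.1.add hg.1, k + l, C + D, fun x => ?_⟩
  have a1 := one_le_onorm x k
  have a2 := one_le_onorm x l
  calc ‖f x + g x‖ ≤ ‖f x‖ + ‖g x‖ := norm_add_le _ _
    _ ≤ C * (1 + ‖x‖) ^ k + D * (1 + ‖x‖) ^ l := add_le_add (h1 x) (h2 x)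
    _ ≤ C * ((1 + ‖x‖) ^ k * (1 + ‖x‖) ^ l) + D * ((1 + ‖x‖) ^ k * (1 + ‖x‖) ^ l) := by
        gcongr
        · nlinarith
        · nlinarith
    _ = _ := by rw [pow_add]; ring

@[fun_prop]
lemma PG.neg {f : E → F} (hf : PG f) : PG (fun x => - f x) := by
  obtain ⟨k, C, hC, h1⟩ := hf.bd
  exact ⟨hf.1.neg, k, C, fun x => by simpa using h1 x⟩

@[fun_prop]
lemma PG.sub {f g : E → F} (hf : PG f) (hg : PG g) : PG (fun x => f x - g x) := by
  simpa [sub_eq_add_neg] using hf.add hg.neg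

@[fun_prop]
lemma PG.mul {f g : E → ℝ} (hf : PG f) (hg : PG g) : PG (fun x => f x * g x) := by
  obtain ⟨k, C, hC, h1⟩ := hf.bd
  obtain ⟨l, D, hD, h2⟩ := hg.bd
  refine ⟨hf.1.mul hg.1, k + l, C * D, fun x => ?_⟩
  rw [norm_mul, pow_add, show C * D * ((1 + ‖x‖) ^ k * (1 + ‖x‖) ^ l)
    = (C * (1 + ‖x‖) ^ k) * (D * (1 + ‖x‖) ^ l) by ring]
  exact mul_le_mul (h1 x) (h2 x) (norm_nonneg _) (by positivity)

@[fun_prop]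
lemma PG.smul [NormedSpace ℝ F] {f : E → ℝ} {g : E → F} (hf : PG f) (hg : PG g) :
    PG (fun x => f x • g x) := by
  obtain ⟨k, C, hC, h1⟩ := hf.bd
  obtain ⟨l, D, hD, h2⟩ := hg.bd
  refine ⟨hf.1.smul hg.1, k + l, C * D, fun x => ?_⟩
  rw [norm_smul, pow_add, show C * D * ((1 + ‖x‖) ^ k * (1 + ‖x‖) ^ l)
    = (C * (1 + ‖x‖) ^ k) * (D * (1 + ‖x‖) ^ l) by ring]
  exact mul_le_mul (h1 x) (h2 x) (norm_nonneg _) (by positivity)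

@[fun_prop]
lemma PG.pow {f : E → ℝ} (hf : PG f) (n : ℕ) : PG (fun x => f x ^ n) := by
  induction n with
  | zero => simpa using PG.const (E := E) (1 : ℝ)
  | succ n ih => simpa only [pow_succ] using ih.mul hf

@[fun_prop]
lemma PG.div_const {f : E → ℝ} (hf : PG f) (c : ℝ) : PG (fun x => f x / c) := by
  simpa only [div_eq_mul_inv] using hf.mul (PG.const c⁻¹)

@[fun_prop]
lemma PG.sum {ι : Type*} (s : Finset ι) {f : ι → E → F} (hf : ∀ i, PG (f i)) :
    PG (fun x => ∑ i ∈ s, f i x) := by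
  classical
  induction s using Finset.induction_on with
  | empty => simpa using PG.const (E := E) (0 : F)
  | insert a s ha ih => simpa only [Finset.sum_insert ha] using (hf a).add ih

@[fun_prop]
lemma PG.prod {ι : Type*} (s : Finset ι) {f : ι → E → ℝ} (hf : ∀ i, PG (f i)) :
    PG (fun x => ∏ i ∈ s, f i x) := by
  classical
  induction s using Finset.induction_on with
  | empty => simpa using PG.const (E := E) (1 : ℝ)
  | insert a s ha ih => simpa only [Finset.prod_insert ha] using (hf a).mul ih

@[fun_prop]
lemma PG.apply {ι : Type*} [Fintype ι] {H : ι → Type*} [∀ i, NormedAddCommGroup (H i)] (i : ι) :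
    PG (fun x : (∀ i, H i) => x i) :=
  ⟨continuous_apply i, 1, 1, fun x => by
    have := norm_le_pi_norm x i
    simp; linarith⟩

@[fun_prop]
lemma PG.pi {ι : Type*} [Fintype ι] {H : ι → Type*} [∀ i, NormedAddCommGroup (H i)]
    {f : E → ∀ i, H i} (hf : ∀ i, PG (fun x => f x i)) : PG f := by
  have : PG (fun x => ∑ i, ‖f x i‖) := PG.sum _ fun i => (hf i).norm
  refine PG.of_le (continuous_pi fun i => (hf i).1) this fun x => ?_
  rw [pi_norm_le_iff_of_nonneg (Finset.sum_nonneg fun i _ => norm_nonneg _)]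
  intro i
  exact Finset.single_le_sum (f := fun i => ‖f x i‖) (fun i _ => norm_nonneg _) (Finset.mem_univ i)

@[fun_prop]
lemma PG.fst {f : E → F × G} (hf : PG f) : PG (fun x => (f x).1) :=
  PG.of_le (continuous_fst.comp hf.1) hf.norm fun x => norm_fst_le _

@[fun_prop]
lemma PG.snd {f : E → F × G} (hf : PG f) : PG (fun x => (f x).2) :=
  PG.of_le (continuous_snd.comp hf.1) hf.norm fun x => norm_snd_le _

@[fun_prop]
lemma PG.prodMk {f : E → F} {g : E → G} (hf : PG f) (hg : PG g) : PG (fun x => (f x, g x)) := by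
  refine PG.of_le (hf.1.prodMk hg.1) (hf.norm.add hg.norm) fun x => ?_
  rw [Prod.norm_def]
  exact max_le (by simp) (by simp)

@[fun_prop]
lemma PG.abs {f : E → ℝ} (hf : PG f) : PG (fun x => |f x|) := hf.norm

lemma PG.of_bounded {f : E → F} (hf : Continuous f) (C : ℝ) (h : ∀ x, ‖f x‖ ≤ C) : PG f :=
  PG.of_le hf (PG.const C) h

@[fun_prop]
lemma PG.eval {σ : Type*} [Fintype σ] {f : E → σ → ℝ} (hf : PG f) (p : MvPolynomial σ ℝ) :
    PG (fun x => MvPolynomial.eval (f x) p) := by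
  induction p using MvPolynomial.induction_on with
  | C a => simpa using PG.const (E := E) a
  | add p q hp hq => simpa using hp.add hq
  | mul_X p i hp => simp only [map_mul, MvPolynomial.eval_X]; fun_prop

end PGsec

/-- Measures with all polynomial moments. -/
class PM {E : Type*} [NormedAddCommGroup E] [MeasurableSpace E] (μ : Measure E) : Prop where
  prob : IsProbabilityMeasure μ
  mom : ∀ k : ℕ, Integrable (fun x => (1 + ‖x‖) ^ k) μ

attribute [instance] PM.prob

section PMsec
variable {E F G : Type*} [NormedAddCommGroup E] [NormedAddCommGroup F]

lemma PG.integrable [MeasurableSpace E] [OpensMeasurableSpace E] {f : E → ℝ} (hf : PG f)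
    (μ : Measure E) [PM μ] : Integrable f μ := by
  obtain ⟨k, C, hC, h1⟩ := hf.bd
  exact ((PM.mom (μ := μ) k).const_mul C).mono' hf.1.measurable.aestronglyMeasurable
    (Filter.Eventually.of_forall h1)
end PMsec

instance : PM (gaussianReal 0 1) where
  prob := inferInstance
  mom k := by
    have h : MemLp (fun x : ℝ => 1 + ‖x‖) k (gaussianReal 0 1) := by
      refine (memLp_const (1 : ℝ)).add ?_
      exact (memLp_id_gaussianReal' (μ := 0) (v := 1) (k : ENNReal) (by simp)).norm
    rcases Nat.eq_zero_or_pos k with rfl | hk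
    · simp
    · have := h.integrable_norm_pow (by omega)
      refine this.congr (Filter.Eventually.of_forall fun x => ?_)
      simp only
      rw [Real.norm_of_nonneg (by positivity)]

instance PM.pi {ι : Type*} [Fintype ι] {H : ι → Type*} [∀ i, NormedAddCommGroup (H i)]
    [∀ i, MeasurableSpace (H i)] [∀ i, BorelSpace (H i)] [∀ i, SecondCountableTopology (H i)]
    (μ : ∀ i, Measure (H i)) [∀ i, PM (μ i)] : PM (Measure.pi μ) where
  prob := inferInstance
  mom k := by
    have h1 : Integrable (fun x : (∀ i, H i) => 1 + ∑ i, (1 + ‖x i‖) ^ k) (Measure.pi μ) := by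
      refine (integrable_const 1).add (integrable_finsetSum _ fun i _ => ?_)
      exact (measurePreserving_eval μ i).integrable_comp_of_integrable (PM.mom k)
    refine h1.mono' (by fun_prop) (Filter.Eventually.of_forall fun x => ?_)
    rw [Real.norm_of_nonneg (by positivity)]
    rcases isEmpty_or_nonempty ι with he | he
    · simp [Subsingleton.elim x 0]
    · obtain ⟨i, hi⟩ : ∃ i, ‖x‖ = ‖x i‖ := by
        obtain ⟨i, _, hi⟩ := Finset.exists_mem_eq_sup' (Finset.univ_nonempty (α := ι))
          (fun i => ‖x i‖)
        refine ⟨i, le_antisymm ?_ (norm_le_pi_norm x i)⟩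
        rw [pi_norm_le_iff_of_nonneg (norm_nonneg _), ← hi]
        intro j
        exact Finset.le_sup' (fun i => ‖x i‖) (Finset.mem_univ j)
      rw [hi]
      have := Finset.single_le_sum (f := fun i => (1 + ‖x i‖) ^ k) (fun i _ => by positivity)
        (Finset.mem_univ i)
      exact this.trans (by linarith)

instance PM.prod {E F : Type*} [NormedAddCommGroup E] [NormedAddCommGroup F]
    [MeasurableSpace E] [MeasurableSpace F] [BorelSpace E] [BorelSpace F]
    [SecondCountableTopology E] [SecondCountableTopology F]
    (μ : Measure E) (ν : Measure F) [PM μ] [PM ν] : PM (μ.prod ν) where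
  prob := inferInstance
  mom k := by
    have h1 : Integrable (fun x : E × F => (1 + ‖x.1‖) ^ k + (1 + ‖x.2‖) ^ k) (μ.prod ν) :=
      ((PM.mom k).comp_fst ν).add ((PM.mom k).comp_snd μ)
    refine h1.mono' (by fun_prop) (Filter.Eventually.of_forall fun x => ?_)
    rw [Real.norm_of_nonneg (by positivity), Prod.norm_def]
    rcases max_cases ‖x.1‖ ‖x.2‖ with ⟨h, _⟩ | ⟨h, _⟩ <;> rw [h]
    · have : 0 ≤ (1 + ‖x.2‖) ^ k := by positivity
      linarith
    · have : 0 ≤ (1 + ‖x.1‖) ^ k := by positivity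
      linarith

/-- Standard Gaussian on an arbitrary finite index type. -/
noncomputable abbrev gs (ι : Type*) [Fintype ι] : Measure (ι → ℝ) :=
  Measure.pi fun _ : ι => gaussianReal 0 1

section Frames
open Complex

/-- `μ` is the centred Gaussian whose covariance is given by the frame `b`. -/
def Frame {E J : Type*} [NormedAddCommGroup E] [NormedSpace ℝ E] [MeasurableSpace E] [Fintype J]
    (μ : Measure E) (b : J → E) : Prop :=
  ∀ L : StrongDual ℝ E, charFunDual μ L = cexp (-((∑ j, (L (b j)) ^ 2 : ℝ) : ℂ) / 2)

variable {E F J K : Type*} [NormedAddCommGroup E] [NormedSpace ℝ E] [MeasurableSpace E]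
  [BorelSpace E] [SecondCountableTopology E]
  [NormedAddCommGroup F] [NormedSpace ℝ F] [MeasurableSpace F] [BorelSpace F]
  [SecondCountableTopology F] [Fintype J] [Fintype K]

lemma Frame.map {μ : Measure E} {b : J → E} (h : Frame μ b) (A : E →L[ℝ] F) :
    Frame (μ.map A) (fun j => A (b j)) := by
  intro L
  rw [charFunDual_map, h]
  simp

lemma Frame.eq [CompleteSpace E] {μ ν : Measure E} [IsFiniteMeasure μ] [IsFiniteMeasure ν]
    {b : J → E} {c : K → E}
    (h : Frame μ b) (h' : Frame ν c)
    (hbc : ∀ L : StrongDual ℝ E, ∑ j, (L (b j)) ^ 2 = ∑ j, (L (c j)) ^ 2) : μ = ν := by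
  apply Measure.ext_of_charFunDual
  ext L
  rw [h, h', hbc]

lemma Frame.gaussianReal : Frame (gaussianReal 0 1) (fun _ : Unit => (1 : ℝ)) := by
  intro L
  rw [charFunDual_eq_charFun_map_one]
  have : (L : ℝ → ℝ) = fun x => L 1 * x := by
    ext x
    have := L.map_smul x 1
    simp only [smul_eq_mul, mul_one] at this
    rw [this]; ring
  rw [this, gaussianReal_map_const_mul, charFun_gaussianReal]
  simp
  ring_nf

lemma Frame.prod {μ : Measure E} {ν : Measure F} [IsProbabilityMeasure μ] [IsProbabilityMeasure ν]
    {b : J → E} {c : K → F} (h : Frame μ b) (h' : Frame ν c) :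
    Frame (μ.prod ν) (Sum.elim (fun j => (b j, (0 : F))) (fun k => ((0 : E), c k))) := by
  intro L
  rw [charFunDual_prod, h, h', ← Complex.exp_add]
  congr 1
  simp
  ring

lemma Frame.pi {ι : Type*} [Fintype ι] [DecidableEq ι] {μ : Measure E} [IsProbabilityMeasure μ]
    {b : J → E} (h : Frame μ b) :
    Frame (Measure.pi fun _ : ι => μ) (fun p : ι × J => Pi.single p.1 (b p.2)) := by
  intro L
  rw [charFunDual_pi]
  simp_rw [h _]
  rw [← Complex.exp_sum]
  congr 1
  rw [Fintype.sum_prod_type]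
  push_cast
  rw [← Finset.sum_neg_distrib, Finset.sum_div]
  simp

lemma gsFrame {ι : Type*} [Fintype ι] [DecidableEq ι] :
    Frame (gs ι) (fun p : ι × Unit => (Pi.single p.1 (1 : ℝ) : ι → ℝ)) := by
  have := Frame.pi (ι := ι) Frame.gaussianReal
  exact this

lemma gpFrame {ι κ : Type*} [Fintype ι] [DecidableEq ι] [Fintype κ] [DecidableEq κ] :
    Frame (Measure.pi fun _ : κ => gs ι)
      (fun p : κ × (ι × Unit) => (Pi.single p.1 (Pi.single p.2.1 (1 : ℝ)) : κ → ι → ℝ)) := by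
  have := Frame.pi (ι := κ) (gsFrame (ι := ι))
  exact this

end Frames

lemma orth_sum {J K : Type*} [Fintype J] [Fintype K] [DecidableEq J] (M : Matrix J K ℝ)
    (hM : M * M.transpose = 1) (l : J → ℝ) : ∑ k, (∑ j, M j k * l j) ^ 2 = ∑ j, l j ^ 2 := by
  have h : ∀ j j', ∑ k, M j k * M j' k = if j = j' then 1 else 0 := by
    intro j j'
    have := congrFun (congrFun hM j) j'
    simpa [Matrix.mul_apply, Matrix.one_apply] using this
  calc ∑ k, (∑ j, M j k * l j) ^ 2 = ∑ k, ∑ j, ∑ j', (M j k * M j' k) * (l j * l j') := by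
        refine Finset.sum_congr rfl fun k _ => ?_
        rw [sq, Finset.sum_mul_sum]
        refine Finset.sum_congr rfl fun j _ => Finset.sum_congr rfl fun j' _ => by ring
    _ = ∑ j, ∑ j', (∑ k, M j k * M j' k) * (l j * l j') := by
        rw [Finset.sum_comm]
        refine Finset.sum_congr rfl fun j _ => ?_
        rw [Finset.sum_comm]
        refine Finset.sum_congr rfl fun j' _ => ?_
        rw [Finset.sum_mul]
    _ = _ := by
        simp [h, sq]

/-- Gaussian vectors are preserved by matrices with orthonormal rows acting on copies. -/
lemma mp_copies {ι J K : Type*} [Fintype ι] [Fintype J] [Fintype K] [DecidableEq J]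
    (M : Matrix J K ℝ) (hM : M * M.transpose = 1) :
    MeasurePreserving (fun (z : K → ι → ℝ) (j : J) => ∑ k, M j k • z k)
      (Measure.pi fun _ : K => gs ι) (Measure.pi fun _ : J => gs ι) := by
  classical
  let A : (K → ι → ℝ) →L[ℝ] (J → ι → ℝ) :=
    ContinuousLinearMap.pi fun j => ∑ k, M j k • ContinuousLinearMap.proj k
  have hA : (fun (z : K → ι → ℝ) (j : J) => ∑ k, M j k • z k) = A := by
    ext z j i
    simp [A]
  rw [hA]
  refine ⟨A.continuous.measurable, ?_⟩
  have : IsProbabilityMeasure ((Measure.pi fun _ : K => gs ι).map A) :=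
    Measure.isProbabilityMeasure_map A.continuous.measurable.aemeasurable
  refine Frame.eq (gpFrame.map A) gpFrame fun L => ?_
  rw [Fintype.sum_prod_type, Fintype.sum_prod_type, Finset.sum_comm]
  conv_rhs => rw [Finset.sum_comm]
  refine Finset.sum_congr rfl fun i _ => ?_
  rw [← orth_sum M hM]
  refine Finset.sum_congr rfl fun k _ => ?_
  congr 1
  have : A (Pi.single k (Pi.single i.1 1)) = ∑ j, M j k • (Pi.single j (Pi.single i.1 (1:ℝ)) : J → ι → ℝ) := by
    ext j' i'
    simp only [A, ContinuousLinearMap.coe_pi', ContinuousLinearMap.coe_sum', Finset.sum_apply,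
      ContinuousLinearMap.coe_smul', Pi.smul_apply, ContinuousLinearMap.proj_apply, smul_eq_mul]
    rw [Finset.sum_eq_single k (by intro b _ hb; simp [hb]) (by simp),
      Finset.sum_eq_single j' (by intro b _ hb; simp [hb.symm]) (by simp)]
    simp
  rw [this, map_sum]
  simp

/-- Gaussian vectors are preserved by orthogonal matrices. -/
lemma mp_orth {J K : Type*} [Fintype J] [Fintype K] [DecidableEq J]
    (M : Matrix J K ℝ) (hM : M * M.transpose = 1) :
    MeasurePreserving (fun (z : K → ℝ) => M.mulVec z) (gs K) (gs J) := by
  classical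
  let A : (K → ℝ) →L[ℝ] (J → ℝ) := LinearMap.toContinuousLinearMap M.mulVecLin
  have hA : (fun (z : K → ℝ) => M.mulVec z) = A := by
    ext z j
    simp [A]
  rw [hA]
  refine ⟨A.continuous.measurable, ?_⟩
  have : IsProbabilityMeasure ((gs K).map A) :=
    Measure.isProbabilityMeasure_map A.continuous.measurable.aemeasurable
  refine Frame.eq (gsFrame.map A) gsFrame fun L => ?_
  rw [Fintype.sum_prod_type, Fintype.sum_prod_type]
  simp only [Finset.univ_unique, Finset.sum_singleton]
  rw [← orth_sum M hM]
  refine Finset.sum_congr rfl fun k _ => ?_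
  congr 1
  have : A (Pi.single k 1) = ∑ j, M j k • (Pi.single j (1:ℝ) : J → ℝ) := by
    ext j'
    simp [A, Finset.sum_apply, Pi.single_apply]
  rw [this, map_sum]
  simp

lemma mp_comb {ι K : Type*} [Fintype ι] [Fintype K] (a : K → ℝ) (ha : ∑ k, a k ^ 2 = 1) :
    MeasurePreserving (fun (z : K → ι → ℝ) => ∑ k, a k • z k)
      (Measure.pi fun _ : K => gs ι) (gs ι) := by
  have h1 := mp_copies (ι := ι) (J := Unit) (K := K) (Matrix.of fun _ k => a k) (by
    ext i j; simp [Matrix.mul_apply, ← sq, ha])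
  exact (measurePreserving_eval (fun _ : Unit => gs ι) ()).comp h1

/-- Rotation invariance for pairs. -/
lemma mp_rot {ι : Type*} [Fintype ι] (c s : ℝ) (h : c ^ 2 + s ^ 2 = 1) :
    MeasurePreserving (fun (w : (ι → ℝ) × (ι → ℝ)) => (c • w.1 + s • w.2, -s • w.1 + c • w.2))
      ((gs ι).prod (gs ι)) ((gs ι).prod (gs ι)) := by
  classical
  let A : ((ι → ℝ) × (ι → ℝ)) →L[ℝ] ((ι → ℝ) × (ι → ℝ)) :=
    ContinuousLinearMap.prod (c • ContinuousLinearMap.fst ℝ _ _ + s • ContinuousLinearMap.snd ℝ _ _)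
      (-s • ContinuousLinearMap.fst ℝ _ _ + c • ContinuousLinearMap.snd ℝ _ _)
  have hA : (fun (w : (ι → ℝ) × (ι → ℝ)) => (c • w.1 + s • w.2, -s • w.1 + c • w.2)) = A := by
    ext w <;> simp [A]
  rw [hA]
  refine ⟨A.continuous.measurable, ?_⟩
  have : IsProbabilityMeasure (((gs ι).prod (gs ι)).map A) :=
    Measure.isProbabilityMeasure_map A.continuous.measurable.aemeasurable
  have hF := Frame.prod (gsFrame (ι := ι)) (gsFrame (ι := ι))
  refine Frame.eq (hF.map A) hF fun L => ?_
  rw [Fintype.sum_sum_type, Fintype.sum_sum_type, ← Finset.sum_add_distrib, ← Finset.sum_add_distrib]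
  refine Finset.sum_congr rfl fun i _ => ?_
  simp only [Sum.elim_inl, Sum.elim_inr]
  have e1 : A (Pi.single i.1 1, 0) = c • (Pi.single i.1 1, 0) - s • (0, Pi.single i.1 1) := by
    ext <;> simp [A]
  have e2 : A (0, Pi.single i.1 1) = s • (Pi.single i.1 1, 0) + c • (0, Pi.single i.1 1) := by
    ext <;> simp [A]
  rw [e1, e2]
  simp only [map_sub, map_add, map_smul, smul_eq_mul]
  linear_combination (L (Pi.single i.1 1, 0) ^ 2 + L (0, Pi.single i.1 1) ^ 2) * h

lemma mp_rot1 {ι : Type*} [Fintype ι] (c s : ℝ) (h : c ^ 2 + s ^ 2 = 1) :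
    MeasurePreserving (fun (w : (ι → ℝ) × (ι → ℝ)) => c • w.1 + s • w.2)
      ((gs ι).prod (gs ι)) (gs ι) :=
  measurePreserving_fst.comp (mp_rot c s h)

/-- Change of variables for continuous functions. -/
lemma mp_int {E F : Type*} [MeasurableSpace E] [MeasurableSpace F]
    [TopologicalSpace F] [BorelSpace F] {μ : Measure E} {ν : Measure F}
    {φ : E → F} (h : MeasurePreserving φ μ ν) {f : F → ℝ} (hf : Continuous f) :
    ∫ x, f (φ x) ∂μ = ∫ y, f y ∂ν := by
  rw [← h.map_eq, integral_map h.aemeasurable]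
  exact hf.measurable.aestronglyMeasurable


section Calc
open MvPolynomial

lemma hasDerivAt_eval {ι : Type*} [Fintype ι] {γ : ℝ → ι → ℝ} {γ' : ι → ℝ} {t : ℝ}
    (hγ : ∀ i, HasDerivAt (fun s => γ s i) (γ' i) t) (f : MvPolynomial ι ℝ) :
    HasDerivAt (fun s => eval (γ s) f) (∑ i, γ' i * eval (γ t) (pderiv i f)) t := by
  classical
  induction f using MvPolynomial.induction_on with
  | C a => simpa using hasDerivAt_const t a
  | add p q hp hq =>
    have := hp.add hq
    simp only [map_add, mul_add, Finset.sum_add_distrib]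
    exact this
  | mul_X p i hp =>
    have := hp.mul (hγ i)
    simp only [map_mul, eval_X, pderiv_mul, map_add, pderiv_X]
    refine this.congr_deriv ?_
    simp only [mul_add, Finset.sum_add_distrib, Finset.sum_mul]
    congr 1
    · exact Finset.sum_congr rfl fun _ _ => by ring
    · rw [Finset.sum_eq_single i]
      · simp; ring
      · intro b _ hb
        simp [Pi.single_apply, hb.symm]
      · simp

lemma td_aeval {σ τ : Type*} (f : MvPolynomial σ ℝ) (g : σ → MvPolynomial τ ℝ) (w : σ → ℕ) (e : ℕ)
    (hg : ∀ i, (g i).totalDegree ≤ w i) (hf : ∀ a ∈ f.support, (a.sum fun i k => k * w i) ≤ e) :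
    (aeval g f).totalDegree ≤ e := by
  classical
  rw [aeval_def, eval₂_eq]
  refine totalDegree_finsetSum_le fun a ha => ?_
  refine (totalDegree_mul _ _).trans ?_
  have h1 : (algebraMap ℝ (MvPolynomial τ ℝ) (coeff a f)).totalDegree = 0 := by
    rw [algebraMap_eq]; exact totalDegree_C _
  rw [h1, zero_add]
  refine (totalDegree_finsetProd _ _).trans (le_trans ?_ (hf a ha))
  refine Finset.sum_le_sum fun i _ => ?_
  refine (totalDegree_pow _ _).trans ?_
  exact Nat.mul_le_mul le_rfl (hg i)

lemma td_aeval1 {σ τ : Type*} (f : MvPolynomial σ ℝ) (g : σ → MvPolynomial τ ℝ)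
    (hg : ∀ i, (g i).totalDegree ≤ 1) : (aeval g f).totalDegree ≤ f.totalDegree := by
  refine td_aeval f g (fun _ => 1) _ hg fun a ha => ?_
  simp only [mul_one]
  exact le_totalDegree ha

lemma td_pderiv {σ : Type*} (f : MvPolynomial σ ℝ) (i : σ) :
    (pderiv i f).totalDegree ≤ f.totalDegree - 1 := by
  classical
  refine Finset.sup_le fun a ha => ?_
  rw [mem_support_iff, coeff_pderiv] at ha
  have h1 : a + Finsupp.single i 1 ∈ f.support := by
    rw [mem_support_iff]; intro h; simp [h] at ha
  have := le_totalDegree h1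
  rw [Finsupp.sum_add_index' (by simp) (by simp)] at this
  simp at this
  omega

/-- The substitution `x, z ↦ X₀ x + X₁ z`. -/
noncomputable def lineSub {ι : Type*} (x z : ι → ℝ) (f : MvPolynomial ι ℝ) : MvPolynomial (Fin 2) ℝ :=
  aeval (fun i => C (x i) * X 0 + C (z i) * X 1) f

lemma td_lineSub {ι : Type*} (x z : ι → ℝ) (f : MvPolynomial ι ℝ) :
    (lineSub x z f).totalDegree ≤ f.totalDegree := by
  refine td_aeval1 _ _ fun i => ?_
  refine (totalDegree_add _ _).trans (max_le ?_ ?_)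
  all_goals
    refine (totalDegree_mul _ _).trans ?_
    simp

lemma eval_lineSub {ι : Type*} (x z : ι → ℝ) (f : MvPolynomial ι ℝ) (v : Fin 2 → ℝ) :
    eval v (lineSub x z f) = eval (v 0 • x + v 1 • z) f := by
  induction f using MvPolynomial.induction_on with
  | C a => simp [lineSub]
  | add p q hp hq => simp [lineSub] at hp hq ⊢; rw [hp, hq]
  | mul_X p i hp => simp [lineSub] at hp ⊢; rw [hp]; ring

/-- Rotational derivative functional. -/
noncomputable def rotD (t : ℝ) : MvPolynomial (Fin 2) ℝ →ₗ[ℝ] ℝ :=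
  (-Real.sin t) • ((aeval ![Real.cos t, Real.sin t]).toLinearMap ∘ₗ (pderiv (R := ℝ) (0 : Fin 2)).toLinearMap)
  + (Real.cos t) • ((aeval ![Real.cos t, Real.sin t]).toLinearMap ∘ₗ (pderiv (R := ℝ) (1 : Fin 2)).toLinearMap)

noncomputable def rotE (t : ℝ) : MvPolynomial (Fin 2) ℝ →ₗ[ℝ] ℝ :=
  (aeval ![Real.cos t, Real.sin t]).toLinearMap

lemma rotE_hasDeriv (P : MvPolynomial (Fin 2) ℝ) (t : ℝ) :
    HasDerivAt (fun s => rotE s P) (rotD t P) t := by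
  have h := hasDerivAt_eval (γ := fun s => ![Real.cos s, Real.sin s])
    (γ' := ![-Real.sin t, Real.cos t]) (t := t) (by
      intro i; fin_cases i
      · exact Real.hasDerivAt_cos t
      · exact Real.hasDerivAt_sin t) P
  simpa [rotE, rotD, Fin.sum_univ_two, coe_aeval_eq_eval] using h

lemma rotE_line {ι : Type*} (x z : ι → ℝ) (f : MvPolynomial ι ℝ) (t : ℝ) :
    rotE t (lineSub x z f) = eval (Real.cos t • x + Real.sin t • z) f := by
  have := eval_lineSub x z f ![Real.cos t, Real.sin t]
  simpa [rotE, coe_aeval_eq_eval] using this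

lemma rotD_line {ι : Type*} [Fintype ι] (x z : ι → ℝ) (f : MvPolynomial ι ℝ) (t : ℝ) :
    rotD t (lineSub x z f) = ∑ i, (-Real.sin t • x + Real.cos t • z) i *
      eval (Real.cos t • x + Real.sin t • z) (pderiv i f) := by
  have h1 := rotE_hasDeriv (lineSub x z f) t
  simp only [rotE_line] at h1
  have h2 := hasDerivAt_eval (γ := fun s => Real.cos s • x + Real.sin s • z)
    (γ' := -Real.sin t • x + Real.cos t • z) (t := t) (by
      intro i
      simp only [Pi.add_apply, Pi.smul_apply, smul_eq_mul]
      exact ((Real.hasDerivAt_cos t).mul_const _).add ((Real.hasDerivAt_sin t).mul_const _)) f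
  exact h1.unique h2

lemma interp (d : ℕ) (L : ℝ → MvPolynomial (Fin 2) ℝ →ₗ[ℝ] ℝ) (l : MvPolynomial (Fin 2) ℝ →ₗ[ℝ] ℝ)
    (h : ∀ P, (∀ t, L t P = 0) → l P = 0) :
    ∃ c : ℝ →₀ ℝ, ∀ P : MvPolynomial (Fin 2) ℝ, P.totalDegree ≤ d →
      l P = c.sum fun t a => a * L t P := by
  let W := restrictTotalDegree (Fin 2) ℝ d
  have h1 := FiniteDimensional.mem_span_of_iInf_ker_le_ker (𝕜 := ℝ) (E := W)
    (L := fun t => L t ∘ₗ W.subtype) (K := l ∘ₗ W.subtype) (by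
      intro P hP
      rw [Submodule.mem_iInf] at hP
      exact h _ hP)
  rw [Finsupp.mem_span_range_iff_exists_finsupp] at h1
  obtain ⟨c, hc⟩ := h1
  refine ⟨c, fun P hP => ?_⟩
  have := LinearMap.congr_fun hc ⟨P, (mem_restrictTotalDegree _ _ _ ).2 hP⟩
  simp only [LinearMap.comp_apply, Submodule.subtype_apply] at this
  rw [← this, Finsupp.sum, LinearMap.sum_apply, Finsupp.sum]
  rfl

lemma interp_deriv (d : ℕ) : ∃ c : ℝ →₀ ℝ, ∀ (ι : Type) [Fintype ι] (f : MvPolynomial ι ℝ),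
    f.totalDegree ≤ d → ∀ x z : ι → ℝ, ∑ i, z i * eval x (pderiv i f) =
      c.sum fun t a => a * eval (Real.cos t • x + Real.sin t • z) f := by
  obtain ⟨c, hc⟩ := interp d rotE (rotD 0) (fun P hP => by
    have h := rotE_hasDeriv P 0
    simp only [hP] at h
    exact h.unique (hasDerivAt_const _ _))
  refine ⟨c, fun ι _ f hf x z => ?_⟩
  have := hc (lineSub x z f) ((td_lineSub x z f).trans hf)
  rw [rotD_line] at this
  simpa [rotE_line] using this

lemma interp_poinc (d : ℕ) : ∃ c : ℝ →₀ ℝ, ∀ (ι : Type) [Fintype ι] (f : MvPolynomial ι ℝ),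
    f.totalDegree ≤ d → ∀ x z : ι → ℝ, eval x f - eval z f =
      c.sum fun t a => a * ∑ i, (-Real.sin t • x + Real.cos t • z) i *
      eval (Real.cos t • x + Real.sin t • z) (pderiv i f) := by
  obtain ⟨c, hc⟩ := interp d rotD (rotE 0 - rotE (Real.pi / 2)) (fun P hP => by
    have h : ∀ t, HasDerivAt (fun s => rotE s P) 0 t := fun t => by
      have := rotE_hasDeriv P t
      rwa [hP t] at this
    have := is_const_of_deriv_eq_zero (fun t => (h t).differentiableAt) (fun t => (h t).deriv)
      0 (Real.pi / 2)
    simp only [LinearMap.sub_apply]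
    rw [this, sub_self])
  refine ⟨c, fun ι _ f hf x z => ?_⟩
  have := hc (lineSub x z f) ((td_lineSub x z f).trans hf)
  simpa [rotE_line, rotD_line] using this

end Calc


section Energy
open MvPolynomial

lemma gauss_second : ∫ t : ℝ, t ^ 2 ∂(gaussianReal 0 1) = 1 := by
  have h := variance_id_gaussianReal (μ := 0) (v := 1)
  rw [variance_eq_integral (by fun_prop)] at h
  simpa using h

lemma gs_cov {ι : Type*} [Fintype ι] [DecidableEq ι] (i j : ι) :
    ∫ z, z i * z j ∂(gs ι) = if i = j then 1 else 0 := by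
  split_ifs with h
  · subst h
    have := mp_int (measurePreserving_eval (fun _ : ι => gaussianReal 0 1) i)
      (f := fun t => t ^ 2) (by fun_prop)
    rw [gauss_second] at this
    simpa [sq] using this
  · have h1 := mp_orth (Matrix.diagonal fun k : ι => if k = i then (-1 : ℝ) else 1) (by
      rw [Matrix.diagonal_transpose, Matrix.diagonal_mul_diagonal, ← Matrix.diagonal_one]
      congr 1; ext k; split_ifs <;> simp)
    have h2 := mp_int h1 (f := fun z => z i * z j) (by fun_prop)
    simp only [Matrix.mulVec_diagonal, if_true, Ne.symm h, if_false, one_mul, neg_mul,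
      integral_neg] at h2
    linarith

lemma gs_lin {ι : Type*} [Fintype ι] (a : ι → ℝ) : ∫ z, (∑ i, z i * a i) ^ 2 ∂(gs ι) = ∑ i, a i ^ 2 := by
  classical
  have h1 : ∀ z : ι → ℝ, (∑ i, z i * a i) ^ 2 = ∑ i, ∑ j, (a i * a j) * (z i * z j) := fun z => by
    rw [sq, Finset.sum_mul_sum]
    exact Finset.sum_congr rfl fun i _ => Finset.sum_congr rfl fun j _ => by ring
  simp only [h1]
  rw [integral_finsetSum _ fun i _ => (by fun_prop : PG _).integrable _]
  refine Finset.sum_congr rfl fun i _ => ?_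
  rw [integral_finsetSum _ fun i _ => (by fun_prop : PG _).integrable _]
  simp only [integral_const_mul, gs_cov]
  simp [sq]

lemma lin_energy {ι : Type} [Fintype ι] (F : ι → (ι → ℝ) → ℝ) (hF : ∀ i, PG (F i)) :
    ∫ w, (∑ i, w.2 i * F i w.1) ^ 2 ∂((gs ι).prod (gs ι)) = ∑ i, ∫ x, F i x ^ 2 ∂(gs ι) := by
  have hF' := hF
  rw [integral_prod]
  · simp only [gs_lin]
    exact integral_finsetSum _ fun i _ => ((hF i).pow 2).integrable _
  · refine PG.integrable (PG.pow (PG.sum _ fun i => PG.mul (by fun_prop) ?_) 2) _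
    exact (hF i).comp (by fun_prop)

lemma finsupp_sq_int {E : Type*} [NormedAddCommGroup E] [MeasurableSpace E] [BorelSpace E]
    (μ : Measure E) [PM μ]
    (c : ℝ →₀ ℝ) (F : ℝ → E → ℝ) (hF : ∀ t, PG (F t)) (A : ℝ) (hA : ∀ t, ∫ x, F t x ^ 2 ∂μ = A) :
    ∫ x, (c.sum fun t a => a * F t x) ^ 2 ∂μ ≤ (c.support.card * ∑ t ∈ c.support, c t ^ 2) * A := by
  have h1 : ∫ x, (c.sum fun t a => a * F t x) ^ 2 ∂μ ≤
      ∫ x, c.support.card * ∑ t ∈ c.support, c t ^ 2 * F t x ^ 2 ∂μ := by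
    refine integral_mono (PG.integrable ?_ _) (PG.integrable ?_ _) fun x => ?_
    · unfold Finsupp.sum
      exact PG.pow (PG.sum _ fun t => PG.mul (PG.const _) (hF t)) 2
    · exact PG.mul (PG.const _) (PG.sum _ fun t => PG.mul (PG.const _) ((hF t).pow 2))
    · have := sq_sum_le_card_mul_sum_sq (s := c.support) (f := fun t => c t * F t x)
      simpa only [Finsupp.sum, mul_pow] using this
  refine h1.trans (le_of_eq ?_)
  rw [integral_const_mul, integral_finsetSum _ fun t _ => PG.integrable (PG.mul (PG.const _) ((hF t).pow 2)) _]
  simp only [integral_const_mul, hA]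
  rw [← Finset.sum_mul, mul_assoc]

lemma energy (d : ℕ) : ∃ C : ℝ, 0 < C ∧ ∀ (ι : Type) [Fintype ι] (f : MvPolynomial ι ℝ),
    f.totalDegree ≤ d →
    ∑ i, ∫ x, eval x (pderiv i f) ^ 2 ∂(gs ι) ≤ C * ∫ x, eval x f ^ 2 ∂(gs ι) := by
  obtain ⟨c, hc⟩ := interp_deriv d
  refine ⟨c.support.card * ∑ t ∈ c.support, c t ^ 2 + 1, by positivity, fun ι _ f hf => ?_⟩
  rw [← lin_energy (fun i x => eval x (pderiv i f)) (fun i => by fun_prop)]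
  simp only [hc ι f hf]
  refine (finsupp_sq_int _ c (fun t (w : (ι → ℝ) × (ι → ℝ)) =>
    eval (Real.cos t • w.1 + Real.sin t • w.2) f)
    (fun t => by fun_prop) (∫ x, eval x f ^ 2 ∂(gs ι)) fun t => ?_).trans ?_
  · exact mp_int (mp_rot1 (ι := ι) (Real.cos t) (Real.sin t) (Real.cos_sq_add_sin_sq t))
      (f := fun x => eval x f ^ 2) ((by fun_prop : PG _).cont)
  · have : 0 ≤ ∫ x, eval x f ^ 2 ∂(gs ι) := integral_nonneg fun x => sq_nonneg _
    linarith

lemma poincare (d : ℕ) : ∃ C : ℝ, 0 < C ∧ ∀ (ι : Type) [Fintype ι] (f : MvPolynomial ι ℝ),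
    f.totalDegree ≤ d →
    ∫ x, eval x f ^ 2 ∂(gs ι) ≤ (∫ x, eval x f ∂(gs ι)) ^ 2 +
      C * ∑ i, ∫ x, eval x (pderiv i f) ^ 2 ∂(gs ι) := by
  obtain ⟨c, hc⟩ := interp_poinc d
  refine ⟨c.support.card * ∑ t ∈ c.support, c t ^ 2 + 1, by positivity, fun ι _ f hf => ?_⟩
  have h1 : ∫ w, (eval w.1 f - eval w.2 f) ^ 2 ∂((gs ι).prod (gs ι)) ≤
      (c.support.card * ∑ t ∈ c.support, c t ^ 2) * ∑ i, ∫ x, eval x (pderiv i f) ^ 2 ∂(gs ι) := by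
    simp only [hc ι f hf]
    refine finsupp_sq_int _ c (fun t (w : (ι → ℝ) × (ι → ℝ)) =>
      ∑ i, (-Real.sin t • w.1 + Real.cos t • w.2) i *
      eval (Real.cos t • w.1 + Real.sin t • w.2) (pderiv i f))
      (fun t => by fun_prop) _ fun t => ?_
    rw [← lin_energy (fun i x => eval x (pderiv i f)) (fun i => by fun_prop)]
    exact mp_int (mp_rot (ι := ι) (Real.cos t) (Real.sin t) (Real.cos_sq_add_sin_sq t))
      (f := fun w => (∑ i, w.2 i * eval w.1 (pderiv i f)) ^ 2) ((by fun_prop : PG _).cont)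
  have h2 : ∫ w, (eval w.1 f - eval w.2 f) ^ 2 ∂((gs ι).prod (gs ι)) =
      2 * ∫ x, eval x f ^ 2 ∂(gs ι) - 2 * (∫ x, eval x f ∂(gs ι)) ^ 2 := by
    have e : ∀ w : (ι → ℝ) × (ι → ℝ), (eval w.1 f - eval w.2 f) ^ 2 =
      eval w.1 f ^ 2 - 2 * (eval w.1 f * eval w.2 f) + eval w.2 f ^ 2 := fun w => by ring
    simp only [e]
    rw [integral_add ((by fun_prop : PG _).integrable _) ((by fun_prop : PG _).integrable _),
      integral_sub ((by fun_prop : PG _).integrable _) ((by fun_prop : PG _).integrable _),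
      integral_const_mul, integral_prod_mul (fun x => eval x f) (fun x => eval x f)]
    have a1 := mp_int (measurePreserving_fst (μ := gs ι) (ν := gs ι)) (f := fun x => eval x f ^ 2)
      ((by fun_prop : PG _).cont)
    have a2 := mp_int (measurePreserving_snd (μ := gs ι) (ν := gs ι)) (f := fun x => eval x f ^ 2)
      ((by fun_prop : PG _).cont)
    rw [a1, a2]; ring
  have h3 : 0 ≤ ∑ i, ∫ x, eval x (pderiv i f) ^ 2 ∂(gs ι) :=
    Finset.sum_nonneg fun i _ => integral_nonneg fun x => sq_nonneg _
  have h4 : 0 ≤ (c.support.card * ∑ t ∈ c.support, c t ^ 2) * ∑ i, ∫ x, eval x (pderiv i f) ^ 2 ∂(gs ι) := by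
    positivity
  rw [h2] at h1
  nlinarith

lemma cs_int {E : Type*} [NormedAddCommGroup E] [MeasurableSpace E] [BorelSpace E]
    (μ : Measure E) [PM μ] {F G : E → ℝ} (hF : PG F) (hG : PG G) :
    (∫ x, F x * G x ∂μ) ^ 2 ≤ (∫ x, F x ^ 2 ∂μ) * ∫ x, G x ^ 2 ∂μ := by
  have h : ∀ t : ℝ, 0 ≤ (∫ x, F x ^ 2 ∂μ) * (t * t) + (2 * ∫ x, F x * G x ∂μ) * t + ∫ x, G x ^ 2 ∂μ := by
    intro t
    have : 0 ≤ ∫ x, (t * F x + G x) ^ 2 ∂μ := integral_nonneg fun x => sq_nonneg _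
    have e : ∀ x, (t * F x + G x) ^ 2 = t * t * F x ^ 2 + 2 * t * (F x * G x) + G x ^ 2 :=
      fun x => by ring
    simp only [e] at this
    rw [integral_add ((by fun_prop : PG _).integrable _) ((by fun_prop : PG _).integrable _),
      integral_add ((by fun_prop : PG _).integrable _) ((by fun_prop : PG _).integrable _),
      integral_const_mul, integral_const_mul] at this
    linarith
  have := discrim_le_zero h
  unfold discrim at this
  nlinarith

lemma cs_sqrt {E : Type*} [NormedAddCommGroup E] [MeasurableSpace E] [BorelSpace E]
    (μ : Measure E) [PM μ] {F G : E → ℝ} (hF : PG F) (hG : PG G) :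
    ∫ x, F x * G x ∂μ ≤ √(∫ x, F x ^ 2 ∂μ) * √(∫ x, G x ^ 2 ∂μ) := by
  rw [← Real.sqrt_mul (integral_nonneg fun x => sq_nonneg _)]
  exact Real.le_sqrt_of_sq_le (cs_int μ hF hG)

lemma hyper4 (d : ℕ) : ∃ C : ℝ, 1 ≤ C ∧ ∀ (ι : Type) [Fintype ι] (f : MvPolynomial ι ℝ),
    f.totalDegree ≤ d →
    ∫ x, eval x f ^ 4 ∂(gs ι) ≤ (C * ∫ x, eval x f ^ 2 ∂(gs ι)) ^ 2 := by
  induction d with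
  | zero =>
    refine ⟨1, le_rfl, fun ι _ f hf => ?_⟩
    obtain ⟨a, rfl⟩ : ∃ a, f = C a := ⟨_, (totalDegree_eq_zero_iff_eq_C.1 (by omega))⟩
    simp; apply le_of_eq; ring
  | succ d ih =>
    obtain ⟨C1, hC1, h1⟩ := ih
    obtain ⟨C2, hC2, h2⟩ := poincare (2 * (d + 1))
    obtain ⟨C3, hC3, h3⟩ := energy (d + 1)
    refine ⟨1 + 4 * C2 * C1 * C3, by nlinarith [mul_pos (mul_pos hC2 (by linarith : 0 < C1)) hC3], fun ι _ f hf => ?_⟩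
    set A := √(∫ x, eval x f ^ 4 ∂(gs ι)) with hA
    set B := ∫ x, eval x f ^ 2 ∂(gs ι) with hB
    have hA0 : 0 ≤ A := Real.sqrt_nonneg _
    have hB0 : 0 ≤ B := integral_nonneg fun x => sq_nonneg _
    have hA2 : ∫ x, eval x f ^ 4 ∂(gs ι) = A ^ 2 :=
      (Real.sq_sqrt (integral_nonneg fun x => by positivity)).symm
    have key : A ^ 2 ≤ B ^ 2 + 4 * C2 * C1 * C3 * (A * B) := by
      have p := h2 ι (f ^ 2) ((totalDegree_pow _ _).trans (by gcongr))
      simp only [map_pow, ← pow_mul] at p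
      rw [show 2 * 2 = 4 from rfl, hA2] at p
      refine p.trans (add_le_add (le_of_eq rfl) ?_)
      have e : ∀ i, ∫ x, eval x (pderiv i (f ^ 2)) ^ 2 ∂(gs ι) ≤
          4 * (A * (C1 * ∫ x, eval x (pderiv i f) ^ 2 ∂(gs ι))) := by
        intro i
        have e1 : ∀ x, eval x (pderiv i (f ^ 2)) ^ 2 = 4 * (eval x f ^ 2 * eval x (pderiv i f) ^ 2) := by
          intro x
          rw [sq f, pderiv_mul]; simp only [map_add, map_mul]; ring
        simp only [e1, integral_const_mul]
        gcongr
        refine (cs_sqrt _ (by fun_prop) (by fun_prop)).trans ?_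
        simp only [← pow_mul]
        norm_num
        refine mul_le_mul le_rfl ?_ (Real.sqrt_nonneg _) hA0
        refine Real.sqrt_le_iff.2 ⟨mul_nonneg (by linarith) (integral_nonneg fun x => sq_nonneg _), ?_⟩
        exact h1 ι _ ((td_pderiv f i).trans (by omega))
      calc C2 * ∑ i, ∫ x, eval x (pderiv i (f ^ 2)) ^ 2 ∂(gs ι)
          ≤ C2 * ∑ i, 4 * (A * (C1 * ∫ x, eval x (pderiv i f) ^ 2 ∂(gs ι))) := by
            gcongr with i; exact e i
        _ = 4 * C2 * A * C1 * ∑ i, ∫ x, eval x (pderiv i f) ^ 2 ∂(gs ι) := by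
            simp only [Finset.mul_sum]
            exact Finset.sum_congr rfl fun _ _ => by ring
        _ ≤ 4 * C2 * A * C1 * (C3 * B) := by
            have : 0 ≤ C1 := by linarith
            gcongr; exact h3 ι f hf
        _ = _ := by ring
    rw [hA2]
    set K := 4 * C2 * C1 * C3
    have hK : 0 ≤ K := by positivity
    have : A ≤ (1 + K) * B := by
      by_contra! hcon
      nlinarith [mul_nonneg hK hB0, mul_nonneg hA0 hB0, mul_nonneg hK hA0]
    gcongr

lemma hyper (j : ℕ) : ∀ d : ℕ, ∃ C : ℝ, 1 ≤ C ∧ ∀ (ι : Type) [Fintype ι] (f : MvPolynomial ι ℝ),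
    f.totalDegree ≤ d →
    ∫ x, eval x f ^ (2 * 2 ^ j) ∂(gs ι) ≤ (C * ∫ x, eval x f ^ 2 ∂(gs ι)) ^ (2 ^ j) := by
  induction j with
  | zero => exact fun d => ⟨1, le_rfl, fun ι _ f hf => by simp⟩
  | succ j ih =>
    intro d
    obtain ⟨C1, h1, H1⟩ := ih (2 * d)
    obtain ⟨C2, h2, H2⟩ := hyper4 d
    refine ⟨C1 * C2, one_le_mul_of_one_le_of_one_le h1 h2, fun ι _ f hf => ?_⟩
    have a := H1 ι (f ^ 2) ((totalDegree_pow _ _).trans (by gcongr))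
    have b := H2 ι f hf
    simp only [map_pow, ← pow_mul] at a
    have hB0 : 0 ≤ ∫ x, eval x f ^ 2 ∂(gs ι) := integral_nonneg fun x => sq_nonneg _
    have h40 : 0 ≤ ∫ x, eval x f ^ 4 ∂(gs ι) := integral_nonneg fun x => by positivity
    have e : 2 * 2 ^ (j + 1) = 2 * (2 * 2 ^ j) := by ring
    rw [e]
    refine a.trans ?_
    norm_num
    calc _ ≤ (C1 * (C2 * ∫ x, eval x f ^ 2 ∂(gs ι)) ^ 2) ^ 2 ^ j := by
          have : 0 ≤ C1 := by linarith
          gcongr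
      _ ≤ ((C1 * C2 * ∫ x, eval x f ^ 2 ∂(gs ι)) ^ 2) ^ 2 ^ j := by
          gcongr
          rw [mul_assoc C1 C2, mul_pow C1]
          gcongr
          nlinarith
      _ = _ := by rw [← pow_mul]; congr 1; ring

lemma norm_mul_bd (d : ℕ) : ∃ C : ℝ, 1 ≤ C ∧ ∀ (ι : Type) [Fintype ι] (f g : MvPolynomial ι ℝ),
    f.totalDegree ≤ d → g.totalDegree ≤ d →
    ∫ x, (eval x f * eval x g) ^ 2 ∂(gs ι) ≤
      C * (∫ x, eval x f ^ 2 ∂(gs ι)) * (∫ x, eval x g ^ 2 ∂(gs ι)) := by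
  obtain ⟨C, h1, H⟩ := hyper4 d
  refine ⟨C ^ 2, by nlinarith, fun ι _ f g hf hg => ?_⟩
  simp only [mul_pow]
  refine (cs_sqrt _ (by fun_prop) (by fun_prop)).trans ?_
  simp only [← pow_mul]
  norm_num
  have h : ∀ f : MvPolynomial ι ℝ, f.totalDegree ≤ d → √(∫ x, eval x f ^ 4 ∂(gs ι)) ≤
      C * ∫ x, eval x f ^ 2 ∂(gs ι) := fun f hf => by
    refine Real.sqrt_le_iff.2 ⟨mul_nonneg (by linarith) (integral_nonneg fun x => sq_nonneg _), ?_⟩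
    exact H ι f hf
  calc _ ≤ (C * ∫ x, eval x f ^ 2 ∂(gs ι)) * (C * ∫ x, eval x g ^ 2 ∂(gs ι)) := by
        refine mul_le_mul (h f hf) (h g hg) (Real.sqrt_nonneg _) ?_
        exact mul_nonneg (by linarith) (integral_nonneg fun x => sq_nonneg _)
    _ = _ := by ring

end Energy


/-- The filter of small positive parameters. -/
noncomputable abbrev sm : Filter ℝ := nhdsWithin (0 : ℝ) (Set.Ioi 0)

lemma sm_pos : ∀ᶠ ε in sm, (0 : ℝ) < ε := eventually_nhdsWithin_of_forall fun _ h => h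

lemma sm_lt {a : ℝ} (ha : 0 < a) : ∀ᶠ ε in sm, ε < a :=
  (Filter.Eventually.filter_mono nhdsWithin_le_nhds (eventually_lt_nhds ha))

lemma sm_small (C : ℝ) {a : ℝ} (ha : 0 < a) : ∀ᶠ ε in sm, C * ε ^ a ≤ 1 := by
  have h1 : Filter.Tendsto (fun ε : ℝ => C * ε ^ a) (nhds 0) (nhds (C * (0:ℝ) ^ a)) :=
    (tendsto_const_nhds).mul ((Real.continuousAt_rpow_const 0 a (Or.inr ha.le)).tendsto)
  rw [Real.zero_rpow ha.ne', mul_zero] at h1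
  have h2 := h1.eventually (eventually_lt_nhds (zero_lt_one))
  filter_upwards [Filter.Eventually.filter_mono nhdsWithin_le_nhds h2] with ε h using h.le

lemma sm_le (C : ℝ) {a b : ℝ} (hab : b < a) : ∀ᶠ ε in sm, C * ε ^ a ≤ ε ^ b := by
  filter_upwards [sm_small C (sub_pos.2 hab), sm_pos] with ε h h0
  have : ε ^ a = ε ^ (a - b) * ε ^ b := by rw [← Real.rpow_add h0]; ring_nf
  rw [this, ← mul_assoc]
  exact mul_le_of_le_one_left (by positivity) h

lemma markov_real {E : Type*} [NormedAddCommGroup E] [MeasurableSpace E] [BorelSpace E]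
    (μ : Measure E) [PM μ] {F : E → ℝ} (hF : PG F) (h0 : ∀ x, 0 ≤ F x) {s : ℝ} (hs : 0 < s) :
    μ.real {x | s ≤ F x} ≤ (∫ x, F x ∂μ) / s := by
  rw [le_div_iff₀ hs, mul_comm]
  exact mul_meas_ge_le_integral_of_nonneg (Filter.Eventually.of_forall h0) (hF.integrable μ) s

open MvPolynomial in
lemma tail (d : ℕ) {κ : ℝ} (hκ : 0 < κ) (M : ℝ) : ∀ᶠ ε in sm, ∀ (ι : Type) [Fintype ι]
    (f : MvPolynomial ι ℝ), f.totalDegree ≤ d → ∫ x, eval x f ^ 2 ∂(gs ι) ≤ 1 →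
    (gs ι).real {x | ε ^ (-κ) ≤ |eval x f|} ≤ ε ^ M := by
  obtain ⟨j, hj⟩ : ∃ j : ℕ, M < κ * (2 * 2 ^ j : ℕ) := by
    obtain ⟨n, hn⟩ := exists_nat_gt (M / κ)
    refine ⟨n, ?_⟩
    rw [div_lt_iff₀ hκ] at hn
    have : (n : ℝ) ≤ (2 * 2 ^ n : ℕ) := by
      have := Nat.lt_two_pow_self (n := n)
      exact_mod_cast (by omega)
    nlinarith
  obtain ⟨C, hC, H⟩ := hyper j d
  filter_upwards [sm_pos, sm_le (C ^ 2 ^ j) hj] with ε h0 h1 ι _ f hf hn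
  have hs : 0 < (ε ^ (-κ)) ^ (2 * 2 ^ j) := by positivity
  have a := markov_real (gs ι) (F := fun x => eval x f ^ (2 * 2 ^ j)) (by fun_prop)
    (fun x => by rw [pow_mul]; positivity) hs
  have e : (ε ^ (-κ)) ^ (2 * 2 ^ j) = (ε ^ (κ * (2 * 2 ^ j : ℕ)))⁻¹ := by
    rw [← Real.rpow_natCast, ← Real.rpow_mul h0.le, ← Real.rpow_neg h0.le]; ring_nf
  calc _ ≤ (gs ι).real {x | (ε ^ (-κ)) ^ (2 * 2 ^ j) ≤ eval x f ^ (2 * 2 ^ j)} := by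
        refine measureReal_mono (fun x hx => ?_)
        simp only [Set.mem_ofPred_eq] at hx ⊢
        have : eval x f ^ (2 * 2 ^ j) = |eval x f| ^ (2 * 2 ^ j) := by
          rw [pow_mul, pow_mul, sq_abs]
        rw [this]
        gcongr
    _ ≤ _ := a
    _ ≤ C ^ 2 ^ j / (ε ^ (-κ)) ^ (2 * 2 ^ j) := by
        gcongr
        refine (H ι f hf).trans ?_
        refine pow_le_pow_left₀ (mul_nonneg (by linarith) (integral_nonneg fun x => sq_nonneg _)) ?_ _
        exact mul_le_of_le_one_right (by linarith) hn
    _ = C ^ 2 ^ j * ε ^ (κ * (2 * 2 ^ j : ℕ)) := by rw [e, div_inv_eq_mul]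
    _ ≤ _ := h1

lemma mp_update {J α : Type*} [Fintype J] [DecidableEq J] [MeasurableSpace α] (μ : Measure α)
    [IsProbabilityMeasure μ] (j : J) :
    MeasurePreserving (fun p : (J → α) × α => Function.update p.1 j p.2)
      ((Measure.pi fun _ => μ).prod μ) (Measure.pi fun _ => μ) := by
  have hm : Measurable (fun p : (J → α) × α => Function.update p.1 j p.2) := by
    refine measurable_pi_lambda _ fun k => ?_
    by_cases h : k = j
    · subst h; simpa using measurable_snd
    · simp only [Function.update_of_ne h]; fun_prop
  refine ⟨hm, ?_⟩
  symm
  refine Measure.pi_eq fun s hs => ?_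
  rw [Measure.map_apply hm (MeasurableSet.univ_pi hs)]
  have : (fun p : (J → α) × α => Function.update p.1 j p.2) ⁻¹' (Set.univ.pi s) =
      (Set.univ.pi (Function.update s j Set.univ)) ×ˢ (s j) := by
    ext ⟨x, t⟩
    simp only [Set.mem_preimage, Set.mem_univ_pi, Set.mem_prod]
    constructor
    · intro h
      refine ⟨fun k => ?_, by simpa using h j⟩
      by_cases hk : k = j
      · subst hk; simp
      · have := h k
        simpa [Function.update_of_ne hk] using this
    · rintro ⟨h, ht⟩ k
      by_cases hk : k = j
      · subst hk; simpa using ht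
      · have := h k
        simpa [Function.update_of_ne hk] using this
  rw [this, Measure.prod_prod, Measure.pi_pi, ← Finset.mul_prod_erase _ _ (Finset.mem_univ j),
    ← Finset.mul_prod_erase Finset.univ (fun i => μ (s i)) (Finset.mem_univ j)]
  simp only [Function.update_self, measure_univ, one_mul]
  rw [mul_comm]
  congr 1
  refine Finset.prod_congr rfl fun k hk => ?_
  rw [Function.update_of_ne (Finset.ne_of_mem_erase hk)]

lemma lint_sq {α : Type*} [MeasurableSpace α] (μ : Measure α) [IsProbabilityMeasure μ]
    {f : α → ENNReal} (hf : Measurable f) : (∫⁻ a, f a ∂μ) ^ 2 ≤ ∫⁻ a, f a ^ 2 ∂μ := by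
  have h := ENNReal.lintegral_mul_le_Lp_mul_Lq μ (Real.HolderConjugate.two_two)
    hf.aemeasurable (aemeasurable_const (b := (1 : ENNReal)))
  simp only [Pi.mul_apply, mul_one, ENNReal.one_rpow, lintegral_one, measure_univ,
    ENNReal.rpow_two] at h
  have h2 : ((∫⁻ a, f a ^ 2 ∂μ) ^ (1 / 2 : ℝ)) ^ 2 = ∫⁻ a, f a ^ 2 ∂μ := by
    rw [← ENNReal.rpow_two, ← ENNReal.rpow_mul]; norm_num
  rw [← h2]
  have h3 : ∫⁻ a : α, (1 : ENNReal) ^ 2 ∂μ = 1 := by simp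
  rw [h3, ENNReal.one_rpow, mul_one] at h
  gcongr

set_option maxHeartbeats 1000000 in
/-- Box Cauchy–Schwarz. -/
lemma box_cs {J α : Type*} [Fintype J] [DecidableEq J] [MeasurableSpace α] (μ : Measure α)
    [IsProbabilityMeasure μ] (G : Set (J → α)) (hG : MeasurableSet G) :
    (Measure.pi (fun _ : J => μ) G) ^ (2 ^ Fintype.card J) ≤
      ((Measure.pi fun _ : J => μ).prod (Measure.pi fun _ : J => μ))
        {p | ∀ ω : Finset J, ω.piecewise p.2 p.1 ∈ G} := by
  set P := Measure.pi fun _ : J => μ with hP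
  let f : (J → α) → ENNReal := G.indicator 1
  have hf : Measurable f := measurable_one.indicator hG
  have hpw : ∀ ω : Finset J, Measurable (fun p : (J → α) × (J → α) => ω.piecewise p.2 p.1) := by
    intro ω
    refine measurable_pi_lambda _ fun k => ?_
    by_cases h : k ∈ ω
    · simp only [Finset.piecewise, h, if_true]; fun_prop
    · simp only [Finset.piecewise, h, if_false]; fun_prop
  let H : Finset J → (J → α) × (J → α) → ENNReal := fun S p =>
    ∏ ω ∈ S.powerset, f (ω.piecewise p.2 p.1)
  have hH : ∀ S, Measurable (H S) := fun S =>
    Finset.measurable_prod _ fun ω _ => hf.comp (hpw ω)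
  have hu : ∀ j, Measurable (fun p : (J → α) × α => Function.update p.1 j p.2) :=
    fun j => (mp_update μ j).measurable
  have key : ∀ S : Finset J, (P G) ^ (2 ^ S.card) ≤ ∫⁻ p, H S p ∂(P.prod P) := by
    intro S
    induction S using Finset.induction_on with
    | empty =>
      have : ∫⁻ p, H ∅ p ∂(P.prod P) = ∫⁻ z, f z ∂P := by
        simp only [H, Finset.powerset_empty, Finset.prod_singleton, Finset.piecewise_empty]
        exact (measurePreserving_fst (μ := P) (ν := P)).lintegral_comp hf
      rw [this]
      simp [f, lintegral_indicator hG]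
    | insert j S hj ih =>
      rw [Finset.card_insert_of_notMem hj, pow_succ, pow_mul]
      refine (pow_le_pow_left₀ zero_le ih 2).trans ?_
      have e1 : ∀ p : (J → α) × (J → α), H (insert j S) p =
          H S p * H S (Function.update p.1 j (p.2 j), p.2) := by
        intro p
        simp only [H]
        rw [Finset.prod_powerset_insert hj]
        congr 1
        refine Finset.prod_congr rfl fun ω hω => ?_
        have hjω : j ∉ ω := fun h => hj (Finset.mem_powerset.1 hω h)
        rw [Finset.piecewise_insert, Finset.update_piecewise_of_notMem _ _ _ hjω]
      have e2 : ∀ (z0 z1 : J → α) (b : α), H S (z0, Function.update z1 j b) = H S (z0, z1) := by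
        intro z0 z1 b
        refine Finset.prod_congr rfl fun ω hω => ?_
        have hjω : j ∉ ω := fun h => hj (Finset.mem_powerset.1 hω h)
        congr 1
        ext k
        by_cases hk : k ∈ ω
        · simp only [Finset.piecewise, hk, if_true]
          rw [Function.update_of_ne (by rintro rfl; exact hjω hk)]
        · simp [Finset.piecewise, hk]
      -- resample both coordinates
      have r0 : ∀ z1, ∫⁻ z0, H S (z0, z1) ∂P = ∫⁻ z0, ∫⁻ a, H S (Function.update z0 j a, z1) ∂μ ∂P := by
        intro z1
        have := (mp_update μ j).lintegral_comp (f := fun z0 => H S (z0, z1)) ((hH S).comp (by fun_prop))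
        rw [← this, lintegral_prod]
        exact (((hH S).comp (by fun_prop : Measurable fun z0 => (z0, z1))).comp (hu j)).aemeasurable
      have hmeas : Measurable (fun q : ((J → α) × (J → α)) × α => H S (Function.update q.1.2 j q.2, q.1.1)) :=
        (hH S).comp (((hu j).comp (by fun_prop : Measurable fun q : ((J → α) × (J → α)) × α => (q.1.2, q.2))).prodMk (by fun_prop))
      have hins : Measurable (fun p : (J → α) × (J → α) => H S p * H S (Function.update p.1 j (p.2 j), p.2)) :=
        (hH S).mul ((hH S).comp (((hu j).comp (by fun_prop : Measurable fun p : (J → α) × (J → α) => (p.1, p.2 j))).prodMk (by fun_prop)))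
      have L : ∫⁻ p, H S p ∂(P.prod P) = ∫⁻ q, ∫⁻ a, H S (Function.update q.2 j a, q.1) ∂μ ∂(P.prod P) := by
        rw [lintegral_prod_symm _ (hH S).aemeasurable]
        simp only [r0]
        rw [lintegral_prod]
        exact (hmeas.lintegral_prod_right').aemeasurable
      have Rr : ∫⁻ p, H (insert j S) p ∂(P.prod P) =
          ∫⁻ q, (∫⁻ a, H S (Function.update q.2 j a, q.1) ∂μ) ^ 2 ∂(P.prod P) := by
        simp only [e1]
        rw [lintegral_prod_symm _ hins.aemeasurable]
        rw [lintegral_prod _ ((hmeas.lintegral_prod_right').pow_const 2).aemeasurable]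
        have c1 := (mp_update μ j).lintegral_comp (f := fun z1 => ∫⁻ z0, H S (z0, z1) *
          H S (Function.update z0 j (z1 j), z1) ∂P) (hins.lintegral_prod_left')
        have c0 : Measurable fun z1 => ∫⁻ z0, H S (z0, z1) *
          H S (Function.update z0 j (z1 j), z1) ∂P := hins.lintegral_prod_left'
        rw [← c1, lintegral_prod (fun a : (J → α) × α => ∫⁻ z0, H S (z0, Function.update a.1 j a.2) *
          H S (Function.update z0 j (Function.update a.1 j a.2 j), Function.update a.1 j a.2) ∂P)
          (c0.comp (hu j)).aemeasurable]
        refine lintegral_congr fun z1 => ?_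
        simp only [e2, Function.update_self]
        have hm1 : Measurable (fun z0 => H S (z0, z1)) := (hH S).comp (by fun_prop)
        have c2 : ∀ b, ∫⁻ z0, H S (z0, z1) * H S (Function.update z0 j b, z1) ∂P =
            ∫⁻ z0, (∫⁻ a, H S (Function.update z0 j a, z1) ∂μ) * H S (Function.update z0 j b, z1) ∂P := by
          intro b
          have hm2 : Measurable (fun z0 => H S (z0, z1) * H S (Function.update z0 j b, z1)) :=
            hm1.mul (hm1.comp ((hu j).comp (by fun_prop : Measurable fun z0 : J → α => (z0, b))))
          have := (mp_update μ j).lintegral_comp hm2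
          have hm4 : Measurable (fun a : (J → α) × α => H S (Function.update a.1 j a.2, z1) *
            H S (Function.update (Function.update a.1 j a.2) j b, z1)) := hm2.comp (hu j)
          rw [← this, lintegral_prod _ hm4.aemeasurable]
          refine lintegral_congr fun z0 => ?_
          simp only [Function.update_idem]
          exact lintegral_mul_const _ (hm1.comp ((hu j).comp (by fun_prop : Measurable fun a : α => (z0, a))))
        simp only [c2]
        have hm3 : Measurable (fun q : (J → α) × α => H S (Function.update q.1 j q.2, z1)) := hm1.comp (hu j)
        rw [lintegral_lintegral_swap]
        · refine lintegral_congr fun z0 => ?_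
          have hm5 : Measurable (fun a => H S (Function.update z0 j a, z1)) :=
            hm1.comp ((hu j).comp (by fun_prop : Measurable fun a : α => (z0, a)))
          rw [lintegral_const_mul _ hm5, sq]
        · refine Measurable.aemeasurable ?_
          have k1 : Measurable fun q : α × (J → α) => H S (Function.update q.2 j q.1, z1) :=
            hm3.comp measurable_swap
          have k2 : Measurable fun q : α × (J → α) => ∫⁻ a, H S (Function.update q.2 j a, z1) ∂μ :=
            (hm3.lintegral_prod_right').comp measurable_snd
          exact k2.mul k1
      rw [L, Rr]
      exact lint_sq _ hmeas.lintegral_prod_right'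
  have := key Finset.univ
  rw [Finset.card_univ] at this
  refine this.trans (le_of_eq ?_)
  have hmG : MeasurableSet {p : (J → α) × (J → α) | ∀ ω : Finset J, ω.piecewise p.2 p.1 ∈ G} := by
    simp only [Set.ofPred_forall]
    exact MeasurableSet.iInter fun ω => hpw ω hG
  rw [← lintegral_indicator_one hmG]
  refine lintegral_congr fun p => ?_
  simp only [H, f]
  by_cases h : ∀ ω : Finset J, ω.piecewise p.2 p.1 ∈ G
  · rw [Set.indicator_of_mem (by exact h)]
    exact Finset.prod_eq_one fun ω _ => by rw [Set.indicator_of_mem (h ω)]; rfl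
  · rw [Set.indicator_of_notMem (by exact h)]
    push Not at h
    obtain ⟨ω, hω⟩ := h
    exact Finset.prod_eq_zero (i := ω) (by simp) (by rw [Set.indicator_of_notMem hω])

lemma tensor_energy {ι κ : Type} [Fintype ι] [Fintype κ] [DecidableEq κ] (c : (κ → ι) → ℝ) :
    ∫ z : κ → ι → ℝ, (∑ i, c i * ∏ j, z j (i j)) ^ 2 ∂(Measure.pi fun _ : κ => gs ι) = ∑ i, c i ^ 2 := by
  classical
  have h1 : ∀ z : κ → ι → ℝ, (∑ i, c i * ∏ j, z j (i j)) ^ 2 =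
      ∑ i, ∑ i', (c i * c i') * ∏ j, (z j (i j) * z j (i' j)) := fun z => by
    rw [sq, Finset.sum_mul_sum]
    refine Finset.sum_congr rfl fun i _ => Finset.sum_congr rfl fun j _ => ?_
    rw [Finset.prod_mul_distrib]; ring
  simp only [h1]
  rw [integral_finsetSum _ fun i _ => (by fun_prop : PG _).integrable _]
  refine Finset.sum_congr rfl fun i _ => ?_
  rw [integral_finsetSum _ fun i _ => (by fun_prop : PG _).integrable _]
  have h2 : ∀ i', ∫ z : κ → ι → ℝ, (∏ j, (z j (i j) * z j (i' j))) ∂(Measure.pi fun _ : κ => gs ι)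
      = if i = i' then 1 else 0 := by
    intro i'
    have := integral_fintype_prod_eq_prod (μ := fun _ : κ => gs ι) (fun j (y : ι → ℝ) => y (i j) * y (i' j))
    rw [this]
    simp only [gs_cov]
    split_ifs with h
    · subst h; simp
    · obtain ⟨j, hj⟩ := Function.ne_iff.1 h
      exact Finset.prod_eq_zero (Finset.mem_univ j) (by simp [hj])
  simp only [integral_const_mul, h2]
  simp [sq]

lemma stein1 (f f' : ℝ → ℝ) (hf : PG f) (hf' : PG f') (h : ∀ t, HasDerivAt f (f' t) t) :
    ∫ t, t * f t ∂(gaussianReal 0 1) = ∫ t, f' t ∂(gaussianReal 0 1) := by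
  have hI : ∀ g : ℝ → ℝ, PG g → Integrable (fun t => gaussianPDFReal 0 1 t * g t) := by
    intro g hg
    have := hg.integrable (gaussianReal 0 1)
    rw [gaussianReal_of_var_ne_zero _ one_ne_zero,
      integrable_withDensity_iff_integrable_smul' (measurable_gaussianPDF _ _)
        (Filter.Eventually.of_forall fun x => gaussianPDF_lt_top)] at this
    simpa using this
  have hd : ∀ t, HasDerivAt (gaussianPDFReal 0 1) (-t * gaussianPDFReal 0 1 t) t := by
    intro t
    have h1 : HasDerivAt (fun t : ℝ => -(t - 0) ^ 2 / (2 * ((1 : NNReal) : ℝ))) (-t) t := by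
      have := (((hasDerivAt_id t).sub_const 0).pow 2).neg.div_const (2 * ((1 : NNReal) : ℝ))
      refine this.congr_deriv ?_
      simp; ring
    have := (h1.exp).const_mul ((√(2 * Real.pi * ((1 : NNReal) : ℝ)))⁻¹)
    rw [gaussianPDFReal_def]
    refine this.congr_deriv ?_
    ring
  rw [integral_gaussianReal_eq_integral_smul one_ne_zero,
    integral_gaussianReal_eq_integral_smul one_ne_zero]
  simp only [smul_eq_mul]
  have := integral_mul_deriv_eq_deriv_mul_of_integrable (u := f) (v := gaussianPDFReal 0 1)
    (u' := f') (v' := fun t => -t * gaussianPDFReal 0 1 t) (fun x _ => h x) (fun x _ => hd x)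
    ((hI _ (by fun_prop : PG fun t => -t * f t)).congr (Filter.Eventually.of_forall fun t => by
      simp only [Pi.mul_apply]; ring))
    ((hI f' hf').congr (Filter.Eventually.of_forall fun t => by simp only [Pi.mul_apply]; ring))
    ((hI f hf).congr (Filter.Eventually.of_forall fun t => by simp only [Pi.mul_apply]; ring))
  have e1 : ∫ x, f x * (-x * gaussianPDFReal 0 1 x) = - ∫ x, gaussianPDFReal 0 1 x * (x * f x) := by
    rw [← integral_neg]; congr 1; ext x; ring
  have e2 : ∫ x, f' x * gaussianPDFReal 0 1 x = ∫ x, gaussianPDFReal 0 1 x * f' x := by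
    congr 1; ext x; ring
  rw [e1, e2] at this
  linarith

lemma PG.update {ι : Type} [Fintype ι] [DecidableEq ι] (j : ι) :
    PG (fun p : (ι → ℝ) × ℝ => Function.update p.1 j p.2) := by
  refine PG.pi fun k => ?_
  by_cases h : k = j
  · subst h; simp only [Function.update_self]; fun_prop
  · simp only [Function.update_of_ne h]; fun_prop

lemma stein {ι : Type} [Fintype ι] [DecidableEq ι] (i : ι) (F F' : (ι → ℝ) → ℝ) (hF : PG F) (hF' : PG F')
    (h : ∀ x, HasDerivAt (fun t => F (Function.update x i t)) (F' x) (x i)) :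
    ∫ x, x i * F x ∂(gs ι) = ∫ x, F' x ∂(gs ι) := by
  have hU := PG.update i
  have h1 := mp_int (mp_update (gaussianReal 0 1) i) (f := fun x => x i * F x) (by have := hF.cont; fun_prop)
  have h2 := mp_int (mp_update (gaussianReal 0 1) i) (f := fun x => F' x) hF'.cont
  rw [← h1, ← h2, integral_prod _ (PG.integrable (PG.mul (PG.comp (PG.apply i) hU) (hF.comp hU)) _),
    integral_prod _ (PG.integrable (hF'.comp hU) _)]
  congr 1; ext x
  simp only [Function.update_self]
  have hx : PG (fun t : ℝ => Function.update x i t) :=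
    PG.comp (f := fun t : ℝ => (x, t)) hU (by fun_prop)
  refine stein1 _ _ (hF.comp hx) (hF'.comp hx) fun t => ?_
  have := h (Function.update x i t)
  simpa using this


section IBP
open MvPolynomial

lemma hasDerivAt_upd {ι : Type} [Fintype ι] [DecidableEq ι] (f : MvPolynomial ι ℝ) (x : ι → ℝ) (i : ι) :
    HasDerivAt (fun t => eval (Function.update x i t) f) (eval x (pderiv i f)) (x i) := by
  have := hasDerivAt_eval (γ := fun t => Function.update x i t) (γ' := Pi.single i 1) (t := x i) (by
    intro k
    by_cases h : k = i
    · subst h; simpa using hasDerivAt_id' _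
    · simpa [h] using hasDerivAt_const _ _) f
  refine this.congr_deriv ?_
  rw [Finset.sum_eq_single i]
  · simp
  · intro b _ hb; simp [hb]
  · simp

/-- The test function. -/
noncomputable def psi (t : ℝ) : ℝ := (1 + t ^ 2)⁻¹

lemma psi_pos (t : ℝ) : 0 < psi t := by unfold psi; positivity
lemma psi_le (t : ℝ) : psi t ≤ 1 := by
  unfold psi; exact inv_le_one_of_one_le₀ (by nlinarith [sq_nonneg t])

lemma psi_deriv (t : ℝ) : HasDerivAt psi (-2 * t * psi t ^ 2) t := by
  have h : HasDerivAt (fun t : ℝ => 1 + t ^ 2) (2 * t) t := by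
    have := (hasDerivAt_pow 2 t).const_add 1
    refine this.congr_deriv (by simp)
  have := h.inv (by positivity)
  refine this.congr_deriv ?_
  unfold psi
  rw [inv_pow]
  ring

lemma psi_cont : Continuous psi := by
  unfold psi
  exact Continuous.inv₀ (by fun_prop) fun t => by positivity

@[fun_prop]
lemma PG.psi {E : Type*} [NormedAddCommGroup E] {f : E → ℝ} (hf : PG f) : PG (fun x => psi (f x)) :=
  PG.of_bounded (psi_cont.comp hf.cont) 1 fun x => by
    rw [Real.norm_of_nonneg (psi_pos _).le]; exact psi_le _

lemma abs_arctan_le (t : ℝ) : |Real.arctan t| ≤ 2 := by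
  have h1 := Real.arctan_lt_pi_div_two t
  have h2 := Real.neg_pi_div_two_lt_arctan t
  have := Real.pi_le_four
  exact abs_le.2 ⟨by linarith, by linarith⟩

@[fun_prop]
lemma PG.arctan {E : Type*} [NormedAddCommGroup E] {f : E → ℝ} (hf : PG f) :
    PG (fun x => Real.arctan (f x)) :=
  PG.of_bounded (Real.continuous_arctan.comp hf.cont) 2 fun x => abs_arctan_le _

variable {ι : Type} [Fintype ι]

/-- Divergence (Skorokhod) of a polynomial field. -/
noncomputable def dvg (w : ι → MvPolynomial ι ℝ) : MvPolynomial ι ℝ :=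
  ∑ i, (X i * w i - pderiv i (w i))

/-- Test product. -/
noncomputable def tp (R : ℕ → MvPolynomial ι ℝ) (a : ℕ → ℝ) (ε : ℝ) (m : ℕ) (x : ι → ℝ) : ℝ :=
  ∏ j ∈ Finset.range m, psi ((eval x (R j) - a j) / ε)

lemma tp_pg (R : ℕ → MvPolynomial ι ℝ) (a : ℕ → ℝ) (ε : ℝ) (m : ℕ) : PG (tp R a ε m) := by
  unfold tp; fun_prop

lemma tp_nonneg (R : ℕ → MvPolynomial ι ℝ) (a : ℕ → ℝ) (ε : ℝ) (m : ℕ) (x : ι → ℝ) :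
    0 ≤ tp R a ε m x := Finset.prod_nonneg fun j _ => (psi_pos _).le

lemma tp_le (R : ℕ → MvPolynomial ι ℝ) (a : ℕ → ℝ) (ε : ℝ) (m : ℕ) (x : ι → ℝ) :
    tp R a ε m x ≤ 1 := Finset.prod_le_one (fun j _ => (psi_pos _).le) fun j _ => psi_le _

lemma ibp_core (R : ℕ → MvPolynomial ι ℝ) (a : ℕ → ℝ) {ε : ℝ} (hε : 0 < ε) (m : ℕ)
    (w : ι → MvPolynomial ι ℝ) (G : MvPolynomial ι ℝ)
    (h1 : ∀ j < m, ∑ i, w i * pderiv i (R j) = 0) (h2 : ∑ i, w i * pderiv i (R m) = G) :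
    ∫ x, tp R a ε (m + 1) x * eval x G ∂(gs ι) =
      ε * ∫ x, tp R a ε m x * (Real.arctan ((eval x (R m) - a m) / ε) * eval x (dvg w)) ∂(gs ι) := by
  classical
  let T : ℕ → (ι → ℝ) → ℝ := fun j x => (eval x (R j) - a j) / ε
  have hT : ∀ j x i, HasDerivAt (fun t => T j (Function.update x i t)) (eval x (pderiv i (R j)) / ε) (x i) :=
    fun j x i => ((hasDerivAt_upd (R j) x i).sub_const _).div_const _
  let F : ι → (ι → ℝ) → ℝ := fun i x => tp R a ε m x * (Real.arctan (T m x) * eval x (w i))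
  let F' : ι → (ι → ℝ) → ℝ := fun i x =>
    (∑ j ∈ Finset.range m, (∏ k ∈ (Finset.range m).erase j, psi (T k x)) •
      ((-2 * T j x * psi (T j x) ^ 2) * (eval x (pderiv i (R j)) / ε))) * (Real.arctan (T m x) * eval x (w i))
    + tp R a ε m x * ((psi (T m x) * (eval x (pderiv i (R m)) / ε)) * eval x (w i) +
        Real.arctan (T m x) * eval x (pderiv i (w i)))
  have hTpg : ∀ j, PG (T j) := fun j => by simp only [T]; fun_prop
  have htp := tp_pg R a ε m
  have hs : ∀ i, ∫ x, x i * F i x ∂(gs ι) = ∫ x, F' i x ∂(gs ι) := by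
    intro i
    refine stein i _ _ (by fun_prop) ?_ fun x => ?_
    · simp only [F', smul_eq_mul]
      fun_prop
    · have hx : Function.update x i (x i) = x := Function.update_eq_self i x
      have d1 : HasDerivAt (fun t => tp R a ε m (Function.update x i t))
          (∑ j ∈ Finset.range m, (∏ k ∈ (Finset.range m).erase j, psi (T k x)) •
            ((-2 * T j x * psi (T j x) ^ 2) * (eval x (pderiv i (R j)) / ε))) (x i) := by
        have := HasDerivAt.fun_finsetProd (u := Finset.range m) (x := x i)
          (f := fun j t => psi (T j (Function.update x i t)))
          (f' := fun j => (-2 * T j x * psi (T j x) ^ 2) * (eval x (pderiv i (R j)) / ε)) (by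
            intro j _
            have := (psi_deriv (T j (Function.update x i (x i)))).comp (x i) (hT j x i)
            rw [hx] at this
            exact this)
        rw [hx] at this
        exact this
      have d2 : HasDerivAt (fun t => Real.arctan (T m (Function.update x i t)))
          (psi (T m x) * (eval x (pderiv i (R m)) / ε)) (x i) := by
        have := (Real.hasDerivAt_arctan (T m (Function.update x i (x i)))).comp (x i) (hT m x i)
        rw [hx] at this
        refine this.congr_deriv ?_
        rw [one_div]; rfl
      have d3 := hasDerivAt_upd (w i) x i
      have d4 := d1.mul (d2.mul d3)
      simp only [Pi.mul_apply, hx] at d4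
      exact d4
  have hPF' : ∀ i, PG (F' i) := fun i => by simp only [F', smul_eq_mul]; fun_prop
  have hsum : ∫ x, ∑ i, x i * F i x ∂(gs ι) = ∫ x, ∑ i, F' i x ∂(gs ι) := by
    rw [integral_finsetSum _ fun i _ => (by fun_prop : PG _).integrable _,
      integral_finsetSum _ fun i _ => (hPF' i).integrable _]
    exact Finset.sum_congr rfl fun i _ => hs i
  have e2 : ∀ x, ∑ i, F' i x = ε⁻¹ * (tp R a ε (m + 1) x * eval x G) +
      ∑ i, tp R a ε m x * (Real.arctan (T m x) * eval x (pderiv i (w i))) := by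
    intro x
    have a1 : ∀ j < m, ∑ i, eval x (w i) * eval x (pderiv i (R j)) = 0 := fun j hj => by
      have := congrArg (eval x) (h1 j hj); simpa using this
    have a2 : ∑ i, eval x (w i) * eval x (pderiv i (R m)) = eval x G := by
      have := congrArg (eval x) h2; simpa using this
    have a3 : tp R a ε (m + 1) x = tp R a ε m x * psi (T m x) := Finset.prod_range_succ _ _
    simp only [F', Finset.sum_add_distrib, mul_add]
    rw [← add_assoc]
    congr 1
    have z : ∑ i, (∑ j ∈ Finset.range m, (∏ k ∈ (Finset.range m).erase j, psi (T k x)) •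
      ((-2 * T j x * psi (T j x) ^ 2) * (eval x (pderiv i (R j)) / ε))) *
        (Real.arctan (T m x) * eval x (w i)) = 0 := by
      simp only [Finset.sum_mul]
      rw [Finset.sum_comm]
      refine Finset.sum_eq_zero fun j hj => ?_
      have := a1 j (Finset.mem_range.1 hj)
      calc _ = ((∏ k ∈ (Finset.range m).erase j, psi (T k x)) * (-2 * T j x * psi (T j x) ^ 2) / ε *
          Real.arctan (T m x)) * ∑ i, eval x (w i) * eval x (pderiv i (R j)) := by
            rw [Finset.mul_sum]
            exact Finset.sum_congr rfl fun i _ => by rw [smul_eq_mul]; ring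
        _ = 0 := by rw [this, mul_zero]
    rw [z, zero_add, a3, ← a2, Finset.mul_sum, Finset.mul_sum]
    exact Finset.sum_congr rfl fun i _ => by ring
  have e1 : ∀ x, tp R a ε m x * (Real.arctan (T m x) * eval x (dvg w)) =
      ∑ i, x i * F i x - ∑ i, tp R a ε m x * (Real.arctan (T m x) * eval x (pderiv i (w i))) := by
    intro x
    simp only [dvg, map_sum, map_sub, map_mul, eval_X, F, ← Finset.sum_sub_distrib, Finset.mul_sum]
    exact Finset.sum_congr rfl fun i _ => by ring
  have fin : ∫ x, tp R a ε m x * (Real.arctan (T m x) * eval x (dvg w)) ∂(gs ι) =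
      ε⁻¹ * ∫ x, tp R a ε (m + 1) x * eval x G ∂(gs ι) := by
    have htp' := tp_pg R a ε (m + 1)
    simp only [e1]
    rw [integral_sub ((by fun_prop : PG _).integrable _) ((by fun_prop : PG _).integrable _), hsum]
    simp only [e2]
    rw [integral_add ((by fun_prop : PG _).integrable _) ((by fun_prop : PG _).integrable _),
      integral_const_mul]
    ring
  rw [fin, ← mul_assoc, mul_inv_cancel₀ hε.ne', one_mul]

lemma ibp_dual (w : ι → MvPolynomial ι ℝ) (h : MvPolynomial ι ℝ) :
    ∫ x, eval x h * eval x (dvg w) ∂(gs ι) = ∫ x, ∑ i, eval x (w i) * eval x (pderiv i h) ∂(gs ι) := by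
  classical
  have hs : ∀ i, ∫ x, x i * eval x (h * w i) ∂(gs ι) = ∫ x, eval x (pderiv i (h * w i)) ∂(gs ι) :=
    fun i => stein i _ _ (by fun_prop) (by fun_prop) fun x => hasDerivAt_upd _ x i
  have e : ∀ x : ι → ℝ, eval x h * eval x (dvg w) = ∑ i, (x i * eval x (h * w i) - eval x (pderiv i (h * w i))
      + eval x (w i) * eval x (pderiv i h)) := by
    intro x
    simp only [dvg, map_sum, map_sub, map_mul, eval_X, Finset.mul_sum, pderiv_mul, map_add]
    exact Finset.sum_congr rfl fun i _ => by ring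
  simp only [e]
  rw [integral_finsetSum _ fun i _ => (by fun_prop : PG _).integrable _,
    integral_finsetSum _ fun i _ => (by fun_prop : PG _).integrable _]
  refine Finset.sum_congr rfl fun i _ => ?_
  rw [integral_add ((by fun_prop : PG _).integrable _) ((by fun_prop : PG _).integrable _),
    integral_sub ((by fun_prop : PG _).integrable _) ((by fun_prop : PG _).integrable _), hs]
  ring

lemma dvg_bound (d : ℕ) : ∃ C : ℝ, 0 < C ∧ ∀ (ι : Type) [Fintype ι] (w : ι → MvPolynomial ι ℝ),
    (dvg w).totalDegree ≤ d →
    ∫ x, eval x (dvg w) ^ 2 ∂(gs ι) ≤ C * ∫ x, ∑ i, eval x (w i) ^ 2 ∂(gs ι) := by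
  obtain ⟨C, hC, H⟩ := energy d
  refine ⟨C, hC, fun ι _ w hw => ?_⟩
  have h1 := ibp_dual w (dvg w)
  have h2 := H ι _ hw
  set A := ∫ x, eval x (dvg w) ^ 2 ∂(gs ι) with hA
  set B := ∫ x, ∑ i, eval x (w i) ^ 2 ∂(gs ι) with hB
  set D := ∑ i, ∫ x, eval x (pderiv i (dvg w)) ^ 2 ∂(gs ι)
  have h3 : A = ∫ x, ∑ i, eval x (w i) * eval x (pderiv i (dvg w)) ∂(gs ι) := by
    rw [← h1, hA]; congr 1; ext x; ring
  have h4 : ∀ t : ℝ, 0 < t → 2 * A ≤ t * B + t⁻¹ * D := by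
    intro t ht
    have hD : D = ∫ x, ∑ i, eval x (pderiv i (dvg w)) ^ 2 ∂(gs ι) :=
      (integral_finsetSum _ fun i _ => (by fun_prop : PG _).integrable _).symm
    rw [h3, hD, hB, ← integral_const_mul, ← integral_const_mul, ← integral_const_mul,
      ← integral_add ((by fun_prop : PG _).integrable _) ((by fun_prop : PG _).integrable _)]
    refine integral_mono ((by fun_prop : PG _).integrable _) ((by fun_prop : PG _).integrable _) fun x => ?_
    simp only [Finset.mul_sum, ← Finset.sum_add_distrib]
    refine Finset.sum_le_sum fun i _ => ?_
    have : 0 ≤ t⁻¹ * (t * eval x (w i) - eval x (pderiv i (dvg w))) ^ 2 := by positivity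
    have e : t⁻¹ * (t * eval x (w i) - eval x (pderiv i (dvg w))) ^ 2 = t * eval x (w i) ^ 2
      + t⁻¹ * eval x (pderiv i (dvg w)) ^ 2 - 2 * (eval x (w i) * eval x (pderiv i (dvg w))) := by
      field_simp; ring
    linarith
  have h5 := h4 C hC
  have : C⁻¹ * D ≤ A := by
    rw [inv_mul_le_iff₀ hC]; exact h2
  linarith

end IBP


section Gram
open MvPolynomial

/-- Bounded degree and norm. -/
def Bd {ι : Type} [Fintype ι] (d : ℕ) (B : ℝ) (f : MvPolynomial ι ℝ) : Prop :=
  f.totalDegree ≤ d ∧ ∫ x, eval x f ^ 2 ∂(gs ι) ≤ B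

lemma Bd.nonneg {ι : Type} [Fintype ι] {d : ℕ} {B : ℝ} {f : MvPolynomial ι ℝ} (h : Bd d B f) : 0 ≤ B :=
  (integral_nonneg fun x => sq_nonneg _).trans h.2

lemma Bd.mono {ι : Type} [Fintype ι] {d d' : ℕ} {B B' : ℝ} {f : MvPolynomial ι ℝ} (h : Bd d B f)
    (hd : d ≤ d') (hB : B ≤ B') : Bd d' B' f := ⟨h.1.trans hd, h.2.trans hB⟩

lemma bd_const {ι : Type} [Fintype ι] (d : ℕ) (a : ℝ) : Bd (ι := ι) d (a ^ 2) (C a) := by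
  refine ⟨by simp, ?_⟩
  simp

lemma bd_smul {ι : Type} [Fintype ι] {d : ℕ} {B : ℝ} {f : MvPolynomial ι ℝ} (h : Bd d B f) (a : ℝ) :
    Bd d (a ^ 2 * B) (C a * f) := by
  refine ⟨(totalDegree_mul _ _).trans (by simpa using h.1), ?_⟩
  simp only [map_mul, eval_C, mul_pow, integral_const_mul]
  exact mul_le_mul_of_nonneg_left h.2 (sq_nonneg _)

lemma bd_mul (d : ℕ) (B : ℝ) : ∃ B' : ℝ, ∀ (ι : Type) [Fintype ι] (f g : MvPolynomial ι ℝ),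
    Bd d B f → Bd d B g → Bd (2 * d) B' (f * g) := by
  obtain ⟨C, hC, H⟩ := norm_mul_bd d
  refine ⟨C * B * B, fun ι _ f g hf hg => ⟨?_, ?_⟩⟩
  · refine (totalDegree_mul _ _).trans ?_
    have := hf.1; have := hg.1; omega
  · simp only [map_mul]
    refine (H ι f g hf.1 hg.1).trans ?_
    have h1 := hf.2; have h2 := hg.2
    have h3 : 0 ≤ ∫ x, eval x g ^ 2 ∂(gs ι) := integral_nonneg fun x => sq_nonneg _
    have := hf.nonneg
    have : 0 ≤ C := by linarith
    gcongr

lemma bd_prod (k d : ℕ) (B : ℝ) : ∃ (d' : ℕ) (B' : ℝ), ∀ (ι : Type) [Fintype ι] (f : ℕ → MvPolynomial ι ℝ),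
    (∀ j < k, Bd d B (f j)) → Bd d' B' (∏ j ∈ Finset.range k, f j) := by
  induction k with
  | zero => exact ⟨0, 1, fun ι _ f hf => by simpa using bd_const (ι := ι) 0 1⟩
  | succ k ih =>
    obtain ⟨d', B', h⟩ := ih
    obtain ⟨B'', h2⟩ := bd_mul (max d' d) (max B' B)
    refine ⟨2 * max d' d, B'', fun ι _ f hf => ?_⟩
    rw [Finset.prod_range_succ]
    exact h2 ι _ _ ((h ι f fun j hj => hf j (by omega)).mono (le_max_left _ _) (le_max_left _ _))
      ((hf k (by omega)).mono (le_max_right _ _) (le_max_right _ _))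

lemma bd_sum {ι : Type} [Fintype ι] {κ : Type*} (s : Finset κ) (d : ℕ) (B : ℝ) (f : κ → MvPolynomial ι ℝ)
    (hf : ∀ j ∈ s, Bd d B (f j)) : Bd d (s.card * (s.card * B)) (∑ j ∈ s, f j) := by
  refine ⟨totalDegree_finsetSum_le fun j hj => (hf j hj).1, ?_⟩
  simp only [map_sum]
  calc _ ≤ ∫ x, s.card * ∑ j ∈ s, eval x (f j) ^ 2 ∂(gs ι) := by
        refine integral_mono ((by fun_prop : PG _).integrable _) ((by fun_prop : PG _).integrable _) fun x => ?_
        exact sq_sum_le_card_mul_sum_sq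
    _ = s.card * ∑ j ∈ s, ∫ x, eval x (f j) ^ 2 ∂(gs ι) := by
        rw [integral_const_mul, integral_finsetSum _ fun i _ => (by fun_prop : PG _).integrable _]
    _ ≤ s.card * ∑ j ∈ s, B := by
        gcongr with j hj
        exact (hf j hj).2
    _ = _ := by simp

lemma bd_det (k d : ℕ) (B : ℝ) : ∃ (d' : ℕ) (B' : ℝ), ∀ (ι : Type) [Fintype ι]
    (A : Matrix (Fin k) (Fin k) (MvPolynomial ι ℝ)), (∀ i j, Bd d B (A i j)) → Bd d' B' A.det := by
  classical
  obtain ⟨d', B', h⟩ := bd_prod k d B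
  refine ⟨d', ((Finset.univ : Finset (Equiv.Perm (Fin k))).card * ((Finset.univ : Finset (Equiv.Perm (Fin k))).card * B')), fun ι _ A hA => ?_⟩
  rw [Matrix.det_apply']
  have := bd_sum (ι := ι) (Finset.univ : Finset (Equiv.Perm (Fin k))) d' B'
    (fun σ => ((Equiv.Perm.sign σ : ℤ) : MvPolynomial ι ℝ) * ∏ i, A (σ i) i) (by
      intro σ _
      have h1 : ∏ i, A (σ i) i = ∏ j ∈ Finset.range k, (if hj : j < k then A (σ ⟨j, hj⟩) ⟨j, hj⟩ else 0) := by
        rw [Finset.prod_range]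
        exact Finset.prod_congr rfl fun i _ => by simp
      have h2 : Bd d' B' (∏ i, A (σ i) i) := by
        rw [h1]
        refine h ι _ fun j hj => ?_
        simp only [hj, dif_pos]
        exact hA _ _
      rcases Int.units_eq_one_or (Equiv.Perm.sign σ) with e | e
      · rw [e]; simpa using h2
      · rw [e]
        have := bd_smul h2 (-1)
        simpa using this)
  exact this

/-- Gradient inner product as a polynomial. -/
noncomputable def gip {ι : Type} [Fintype ι] (f g : MvPolynomial ι ℝ) : MvPolynomial ι ℝ :=
  ∑ i, pderiv i f * pderiv i g

lemma gip_bd (d : ℕ) : ∃ B : ℝ, ∀ (ι : Type) [Fintype ι] (f g : MvPolynomial ι ℝ),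
    Bd d 1 f → Bd d 1 g → Bd (2 * d) B (gip f g) := by
  obtain ⟨C, hC, H⟩ := norm_mul_bd d
  obtain ⟨C', hC', H'⟩ := energy d
  have key : ∀ (ι : Type) [Fintype ι] (f : MvPolynomial ι ℝ), Bd d 1 f →
      ∫ x, (∑ i, eval x (pderiv i f) ^ 2) ^ 2 ∂(gs ι) ≤ C * C' * C' := by
    intro ι _ f hf
    have e : ∀ x, (∑ i, eval x (pderiv i f) ^ 2) ^ 2 =
        ∑ i, ∑ j, (eval x (pderiv i f) * eval x (pderiv j f)) ^ 2 := fun x => by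
      rw [sq, Finset.sum_mul_sum]
      exact Finset.sum_congr rfl fun i _ => Finset.sum_congr rfl fun j _ => by ring
    simp only [e]
    rw [integral_finsetSum _ fun i _ => (by fun_prop : PG _).integrable _]
    have hE : ∑ i, ∫ x, eval x (pderiv i f) ^ 2 ∂(gs ι) ≤ C' := by
      refine (H' ι f hf.1).trans ?_
      exact mul_le_of_le_one_right hC'.le hf.2
    have hE0 : 0 ≤ ∑ i, ∫ x, eval x (pderiv i f) ^ 2 ∂(gs ι) :=
      Finset.sum_nonneg fun i _ => integral_nonneg fun x => sq_nonneg _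
    have hdeg : ∀ i, (pderiv i f).totalDegree ≤ d := fun i =>
      (td_pderiv f i).trans (by have := hf.1; omega)
    calc _ ≤ ∑ i, ∑ j, C * (∫ x, eval x (pderiv i f) ^ 2 ∂(gs ι)) * ∫ x, eval x (pderiv j f) ^ 2 ∂(gs ι) := by
          refine Finset.sum_le_sum fun i _ => ?_
          rw [integral_finsetSum _ fun i _ => (by fun_prop : PG _).integrable _]
          exact Finset.sum_le_sum fun j _ => H ι _ _ (hdeg i) (hdeg j)
      _ = C * (∑ i, ∫ x, eval x (pderiv i f) ^ 2 ∂(gs ι)) * ∑ i, ∫ x, eval x (pderiv i f) ^ 2 ∂(gs ι) := by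
          simp only [← Finset.mul_sum, ← Finset.sum_mul]
      _ ≤ _ := by
          have : 0 ≤ C := by linarith
          gcongr
  refine ⟨C * C' * C', fun ι _ f g hf hg => ⟨?_, ?_⟩⟩
  · refine totalDegree_finsetSum_le fun i _ => (totalDegree_mul _ _).trans ?_
    have := td_pderiv f i; have := td_pderiv g i; have := hf.1; have := hg.1
    omega
  · have h1 := key ι f hf
    have h2 := key ι g hg
    have : ∫ x, eval x (gip f g) ^ 2 ∂(gs ι) ≤ ∫ x, ((1/2) * (∑ i, eval x (pderiv i f) ^ 2) ^ 2 +
        (1/2) * (∑ i, eval x (pderiv i g) ^ 2) ^ 2) ∂(gs ι) := by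
      refine integral_mono ((by fun_prop : PG _).integrable _) ((by fun_prop : PG _).integrable _) fun x => ?_
      have := Finset.sum_mul_sq_le_sq_mul_sq Finset.univ (fun i => eval x (pderiv i f)) (fun i => eval x (pderiv i g))
      simp only [gip, map_sum, map_mul]
      refine this.trans ?_
      nlinarith [sq_nonneg (∑ i, eval x (pderiv i f) ^ 2 - ∑ i, eval x (pderiv i g) ^ 2)]
    refine this.trans ?_
    rw [integral_add ((by fun_prop : PG _).integrable _) ((by fun_prop : PG _).integrable _),
      integral_const_mul, integral_const_mul]
    linarith

variable {ι : Type} [Fintype ι]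

/-- Gram matrix. -/
noncomputable def GM (R : ℕ → MvPolynomial ι ℝ) (k : ℕ) : Matrix (Fin k) (Fin k) (MvPolynomial ι ℝ) :=
  Matrix.of fun a b => gip (R a) (R b)

/-- Gram determinant. -/
noncomputable def Gam (R : ℕ → MvPolynomial ι ℝ) (k : ℕ) : MvPolynomial ι ℝ := (GM R k).det

/-- Degenerate set. -/
def Bad (R : ℕ → MvPolynomial ι ℝ) (j : ℕ) (s : ℝ) : Set (ι → ℝ) :=
  {x | eval x (Gam R (j + 1)) < s ^ 2 * eval x (Gam R j)}

lemma bad_meas (R : ℕ → MvPolynomial ι ℝ) (j : ℕ) (s : ℝ) : MeasurableSet (Bad R j s) := by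
  refine measurableSet_lt ?_ ?_
  · exact ((by fun_prop : PG fun x => eval x (Gam R (j + 1))).cont).measurable
  · exact ((by fun_prop : PG fun x => s ^ 2 * eval x (Gam R j)).cont).measurable

lemma eval_gip (f g : MvPolynomial ι ℝ) (x : ι → ℝ) :
    eval x (gip f g) = ∑ i, eval x (pderiv i f) * eval x (pderiv i g) := by simp [gip]

lemma eval_Gam (R : ℕ → MvPolynomial ι ℝ) (k : ℕ) (x : ι → ℝ) :
    eval x (Gam R k) = (Matrix.of fun (a b : Fin k) => ∑ i, eval x (pderiv i (R a)) * eval x (pderiv i (R b))).det := by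
  rw [Gam, RingHom.map_det]
  congr 1
  ext a b
  simp [GM, gip]

lemma Gam_nonneg (R : ℕ → MvPolynomial ι ℝ) (k : ℕ) (x : ι → ℝ) : 0 ≤ eval x (Gam R k) := by
  classical
  rw [eval_Gam]
  let D : Matrix (Fin k) ι ℝ := Matrix.of fun a i => eval x (pderiv i (R a))
  have h := (Matrix.posSemidef_self_mul_conjTranspose D).det_nonneg
  have e : (Matrix.of fun (a b : Fin k) => ∑ i, eval x (pderiv i (R a)) * eval x (pderiv i (R b))) = D * D.conjTranspose := by
    ext a b
    simp [D, Matrix.mul_apply]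
  rw [e]
  exact h

lemma Gam_zero (R : ℕ → MvPolynomial ι ℝ) : Gam R 0 = 1 := by simp [Gam]

lemma Gam_good (R : ℕ → MvPolynomial ι ℝ) (s : ℕ → ℝ) (k : ℕ) (x : ι → ℝ)
    (hx : ∀ j < k, x ∉ Bad R j (s j)) : ∏ j ∈ Finset.range k, s j ^ 2 ≤ eval x (Gam R k) := by
  induction k with
  | zero => simp [Gam_zero]
  | succ k ih =>
    have h1 := ih fun j hj => hx j (by omega)
    have h2 := hx k (by omega)
    simp only [Bad, Set.mem_ofPred_eq, not_lt] at h2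
    rw [Finset.prod_range_succ, mul_comm]
    exact (mul_le_mul_of_nonneg_left h1 (sq_nonneg _)).trans h2

/-- The dual field. -/
noncomputable def wf (R : ℕ → MvPolynomial ι ℝ) (m : ℕ) (i : ι) : MvPolynomial ι ℝ :=
  ∑ a : Fin (m + 1), (GM R (m + 1)).adjugate (Fin.last m) a * pderiv i (R a)

lemma wf_pair (R : ℕ → MvPolynomial ι ℝ) (m : ℕ) (b : Fin (m + 1)) :
    ∑ i, wf R m i * pderiv i (R b) = if b = Fin.last m then Gam R (m + 1) else 0 := by
  have h := congrFun (congrFun (Matrix.adjugate_mul (GM R (m + 1))) (Fin.last m)) b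
  rw [Matrix.mul_apply] at h
  have e : ∑ i, wf R m i * pderiv i (R b) = ∑ a, (GM R (m + 1)).adjugate (Fin.last m) a * GM R (m + 1) a b := by
    simp only [wf, GM, Matrix.of_apply, gip, Finset.sum_mul, Finset.mul_sum]
    rw [Finset.sum_comm]
    exact Finset.sum_congr rfl fun a _ => Finset.sum_congr rfl fun i _ => by ring
  rw [e, h]
  simp [Matrix.one_apply, Gam, eq_comm]

lemma bd_adj (m d : ℕ) : ∃ (d' : ℕ) (B' : ℝ), ∀ (ι : Type) [Fintype ι] (R : ℕ → MvPolynomial ι ℝ),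
    (∀ j ≤ m, Bd d 1 (R j)) → ∀ b a, Bd d' B' ((GM R (m + 1)).adjugate b a) := by
  obtain ⟨B, hB⟩ := gip_bd d
  obtain ⟨d', B', h⟩ := bd_det m (2 * d) B
  refine ⟨d', B', fun ι _ R hR b a => ?_⟩
  rw [Matrix.adjugate_fin_succ_eq_det_submatrix]
  have h1 : Bd d' B' ((GM R (m + 1)).submatrix a.succAbove b.succAbove).det := by
    refine h ι _ fun i j => ?_
    simp only [Matrix.submatrix_apply, GM, Matrix.of_apply]
    exact hB ι _ _ (hR _ (by omega)) (hR _ (by omega))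
  rcases neg_one_pow_eq_or (MvPolynomial ι ℝ) ((a : ℕ) + (b : ℕ)) with e | e
  · have e' : (-1 : MvPolynomial ι ℝ) ^ ((a : ℕ) + b) = 1 := e
    rw [e', one_mul]; exact h1
  · have e' : (-1 : MvPolynomial ι ℝ) ^ ((a : ℕ) + b) = -1 := e
    rw [e']
    have := bd_smul h1 (-1)
    simpa using this

lemma int_le_sqrt {E : Type*} [NormedAddCommGroup E] [MeasurableSpace E] [BorelSpace E]
    (μ : Measure E) [PM μ] {F : E → ℝ} (hF : PG F) : ∫ x, F x ∂μ ≤ (1 + ∫ x, F x ^ 2 ∂μ) / 2 := by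
  have : ∫ x, F x ∂μ ≤ ∫ x, (1 / 2 + 1 / 2 * F x ^ 2) ∂μ := by
    refine integral_mono (hF.integrable _) ((by fun_prop : PG _).integrable _) fun x => ?_
    simp only
    nlinarith [sq_nonneg (F x - 1)]
  refine this.trans (le_of_eq ?_)
  rw [integral_add ((by fun_prop : PG _).integrable _) ((by fun_prop : PG _).integrable _),
    integral_const_mul]
  simp; ring

lemma dvg_wf_bd (m d : ℕ) : ∃ (d' : ℕ) (B : ℝ), ∀ (ι : Type) [Fintype ι] (R : ℕ → MvPolynomial ι ℝ),
    (∀ j ≤ m, Bd d 1 (R j)) → Bd d' B (dvg (wf R m)) := by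
  obtain ⟨d1, B1, h1⟩ := bd_adj m d
  obtain ⟨B2, h2⟩ := bd_mul d1 B1
  obtain ⟨B3, h3⟩ := gip_bd d
  obtain ⟨B4, h4⟩ := bd_mul (max (2 * d1) (2 * d)) (max B2 B3)
  obtain ⟨C, hC, H⟩ := dvg_bound (1 + d1 + d)
  let D4 := 2 * max (2 * d1) (2 * d)
  let B5 : ℝ := ((Finset.univ : Finset (Fin (m + 1) × Fin (m + 1))).card *
    ((Finset.univ : Finset (Fin (m + 1) × Fin (m + 1))).card * B4))
  refine ⟨1 + d1 + d, C * ((1 + B5) / 2), fun ι _ R hR => ?_⟩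
  have hdeg : ∀ i, (wf R m i).totalDegree ≤ d1 + d := by
    intro i
    refine totalDegree_finsetSum_le fun a _ => (totalDegree_mul _ _).trans ?_
    have := (h1 ι R hR (Fin.last m) a).1
    have := td_pderiv (R a) i
    have := (hR a (by omega)).1
    omega
  have hd : (dvg (wf R m)).totalDegree ≤ 1 + d1 + d := by
    refine totalDegree_finsetSum_le fun i _ => (totalDegree_sub _ _).trans (max_le ?_ ?_)
    · refine (totalDegree_mul _ _).trans ?_
      have := hdeg i
      simp; omega
    · have := hdeg i; have := td_pderiv (wf R m i) i; omega
  refine ⟨hd, (H ι _ hd).trans ?_⟩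
  gcongr
  let Q : MvPolynomial ι ℝ := ∑ p : Fin (m + 1) × Fin (m + 1),
    ((GM R (m + 1)).adjugate (Fin.last m) p.1 * (GM R (m + 1)).adjugate (Fin.last m) p.2) * gip (R p.1) (R p.2)
  have hQ : Bd D4 B5 Q := by
    refine bd_sum _ _ _ _ fun p _ => ?_
    refine h4 ι _ _ ?_ ?_
    · exact (h2 ι _ _ (h1 ι R hR _ _) (h1 ι R hR _ _)).mono (le_max_left _ _) (le_max_left _ _)
    · exact (h3 ι _ _ (hR _ (by omega)) (hR _ (by omega))).mono (le_max_right _ _) (le_max_right _ _)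
  have e : ∀ x, ∑ i, eval x (wf R m i) ^ 2 = eval x Q := by
    intro x
    simp only [wf, Q, gip, map_sum, map_mul, Fintype.sum_prod_type, Finset.mul_sum]
    have e1 : ∀ i : ι, (∑ a : Fin (m + 1), eval x ((GM R (m + 1)).adjugate (Fin.last m) a) * eval x (pderiv i (R a))) ^ 2 =
        ∑ a : Fin (m + 1), ∑ b : Fin (m + 1), eval x ((GM R (m + 1)).adjugate (Fin.last m) a) *
          eval x ((GM R (m + 1)).adjugate (Fin.last m) b) * (eval x (pderiv i (R a)) * eval x (pderiv i (R b))) := fun i => by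
      rw [sq, Finset.sum_mul_sum]
      exact Finset.sum_congr rfl fun a _ => Finset.sum_congr rfl fun b _ => by ring
    simp only [e1]
    rw [Finset.sum_comm]
    refine Finset.sum_congr rfl fun a _ => ?_
    rw [Finset.sum_comm]
  simp only [e]
  refine (int_le_sqrt (gs ι) (F := fun x => eval x Q) (by fun_prop)).trans ?_
  have := hQ.2
  linarith

end Gram


section Antic
open MvPolynomial

lemma trunc (d : ℕ) (B : ℝ) {κ : ℝ} (hκ : 0 < κ) (M : ℝ) : ∀ᶠ ε in sm, ∀ (ι : Type) [Fintype ι]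
    (f : MvPolynomial ι ℝ), Bd d B f → ∀ F : (ι → ℝ) → ℝ, PG F → (∀ x, 0 ≤ F x) → (∀ x, F x ≤ 1) →
    ∫ x, F x * |eval x f| ∂(gs ι) ≤ ε ^ (-κ) * (∫ x, F x ∂(gs ι)) + ε ^ M := by
  obtain ⟨j, hj⟩ : ∃ j : ℕ, M < κ * (2 * 2 ^ j - 1 : ℕ) := by
    obtain ⟨n, hn⟩ := exists_nat_gt (M / κ)
    refine ⟨n, ?_⟩
    rw [div_lt_iff₀ hκ] at hn
    have : (n : ℝ) ≤ (2 * 2 ^ n - 1 : ℕ) := by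
      have := Nat.lt_two_pow_self (n := n)
      exact_mod_cast (by omega)
    nlinarith
  obtain ⟨C, hC, H⟩ := hyper j d
  filter_upwards [sm_pos, sm_le ((C * B) ^ 2 ^ j) hj] with ε h0 h1 ι _ f hf F hF hF0 hF1
  have hu : 0 < ε ^ κ := by positivity
  set P := 2 * 2 ^ j with hP
  have hP1 : P = (P - 1) + 1 := by have := Nat.one_le_two_pow (n := j); omega
  have pw : ∀ x, F x * |eval x f| ≤ (ε ^ κ)⁻¹ * F x + (ε ^ κ) ^ (P - 1) * eval x f ^ P := by
    intro x
    have e : eval x f ^ P = |eval x f| ^ P := by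
      rw [hP, pow_mul, pow_mul, sq_abs]
    rw [e]
    have ht := abs_nonneg (eval x f)
    generalize |eval x f| = t at ht
    have h2 : 0 ≤ (ε ^ κ) ^ (P - 1) * t ^ P := by positivity
    by_cases h : ε ^ κ * t ≤ 1
    · have : t ≤ (ε ^ κ)⁻¹ := by rw [inv_eq_one_div, le_div_iff₀ hu, mul_comm]; exact h
      nlinarith [hF0 x, mul_le_mul_of_nonneg_left this (hF0 x)]
    · push Not at h
      have h3 : (1 : ℝ) ≤ (ε ^ κ * t) ^ (P - 1) := one_le_pow₀ h.le
      have h4 : (ε ^ κ) ^ (P - 1) * t ^ P = t * (ε ^ κ * t) ^ (P - 1) := by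
        rw [mul_pow, hP1, pow_succ]; simp; ring
      rw [h4]
      have h5 : 0 ≤ (ε ^ κ)⁻¹ * F x := mul_nonneg (by positivity) (hF0 x)
      nlinarith [mul_le_mul_of_nonneg_left h3 ht, mul_le_mul_of_nonneg_right (hF1 x) ht]
  calc _ ≤ ∫ x, ((ε ^ κ)⁻¹ * F x + (ε ^ κ) ^ (P - 1) * eval x f ^ P) ∂(gs ι) :=
        integral_mono ((by fun_prop : PG _).integrable _) ((by fun_prop : PG _).integrable _) pw
    _ = (ε ^ κ)⁻¹ * (∫ x, F x ∂(gs ι)) + (ε ^ κ) ^ (P - 1) * ∫ x, eval x f ^ P ∂(gs ι) := by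
        rw [integral_add ((by fun_prop : PG _).integrable _) ((by fun_prop : PG _).integrable _),
          integral_const_mul, integral_const_mul]
    _ ≤ _ := by
        rw [← Real.rpow_neg h0.le]
        gcongr
        refine le_trans ?_ h1
        have e : (ε ^ κ) ^ (P - 1) = ε ^ (κ * ((P - 1 : ℕ) : ℝ)) := by
          rw [← Real.rpow_natCast, ← Real.rpow_mul h0.le]
        rw [e, mul_comm]
        gcongr
        refine (H ι f hf.1).trans ?_
        refine pow_le_pow_left₀ (mul_nonneg (by linarith) (integral_nonneg fun x => sq_nonneg _)) ?_ _
        exact mul_le_mul_of_nonneg_left hf.2 (by linarith)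

lemma antic (d : ℕ) (δ : ℕ → ℝ) (hδ : ∀ j, 0 ≤ δ j) (m : ℕ) : ∀ c : ℝ, 
    (∑ i ∈ Finset.range m, ∑ j ∈ Finset.range (i + 1), 2 * δ j) < c →
    ∀ᶠ ε in sm, ∀ (ι : Type) [Fintype ι] (R : ℕ → MvPolynomial ι ℝ), (∀ j < m, Bd d 1 (R j)) →
    (∀ j < m, (gs ι).real (Bad R j (ε ^ δ j)) ≤ ε ^ (m : ℝ)) → ∀ a : ℕ → ℝ,
    ∫ x, tp R a ε m x ∂(gs ι) ≤ ε ^ (m - c) := by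
  induction m with
  | zero =>
    intro c hc
    simp only [Finset.range_zero, Finset.sum_empty] at hc
    filter_upwards [sm_pos, sm_lt one_pos] with ε h0 h1 ι _ R hR hB a
    simp only [tp, Finset.range_zero, Finset.prod_empty, integral_const, probReal_univ, smul_eq_mul, mul_one]
    exact Real.one_le_rpow_of_pos_of_le_one_of_nonpos h0 h1.le (by simp; linarith)
  | succ m ih =>
    intro c hc
    rw [Finset.sum_range_succ] at hc
    set L := ∑ i ∈ Finset.range m, ∑ j ∈ Finset.range (i + 1), 2 * δ j with hL
    set Δ := ∑ j ∈ Finset.range (m + 1), 2 * δ j with hΔ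
    have hL0 : 0 ≤ L := Finset.sum_nonneg fun i _ => Finset.sum_nonneg fun j _ => by have := hδ j; linarith
    have hΔ0 : 0 ≤ Δ := Finset.sum_nonneg fun j _ => by have := hδ j; linarith
    set κ := (c - L - Δ) / 4 with hκ
    have hκ0 : 0 < κ := by rw [hκ]; linarith
    obtain ⟨d', B, hw⟩ := dvg_wf_bd m d
    filter_upwards [sm_pos, sm_lt one_pos, ih (L + κ) (by linarith), trunc d' B hκ0 m,
      sm_le (2 + 2 + (m + 1)) (show (m + 1 - c : ℝ) < m + 1 - c + κ by linarith)] with ε h0 h1 hI hT hf ι _ R hR hB a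
    have hBm : ∀ j < m + 1, (gs ι).real (Bad R j (ε ^ δ j)) ≤ ε ^ ((m : ℝ) + 1) := by
      intro j hj; simpa using hB j hj
    have I1 := hI ι R (fun j hj => hR j (by omega)) (fun j hj => (hBm j (by omega)).trans
      (Real.rpow_le_rpow_of_exponent_ge h0 h1.le (by linarith))) a
    have I2 := hT ι _ (hw ι R fun j hj => hR j (by omega)) (tp R a ε m) (tp_pg ..) (tp_nonneg R a ε m) (tp_le R a ε m)
    have hp : ∀ b : Fin (m + 1), ∑ i, wf R m i * pderiv i (R b) = if b = Fin.last m then Gam R (m + 1) else 0 := wf_pair R m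
    have I3 := ibp_core R a h0 m (wf R m) (Gam R (m + 1)) (fun j hj => by
      have := hp ⟨j, by omega⟩
      rw [if_neg (by simp [Fin.ext_iff]; omega)] at this
      exact this) (by simpa using hp (Fin.last m))
    have I4 : ∫ x, tp R a ε m x * (Real.arctan ((eval x (R m) - a m) / ε) * eval x (dvg (wf R m))) ∂(gs ι) ≤
        2 * ∫ x, tp R a ε m x * |eval x (dvg (wf R m))| ∂(gs ι) := by
      rw [← integral_const_mul]
      have h := tp_pg R a ε m
      refine integral_mono ((by fun_prop : PG _).integrable _) ((by fun_prop : PG _).integrable _) fun x => ?_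
      have h3 : Real.arctan ((eval x (R m) - a m) / ε) * eval x (dvg (wf R m)) ≤ 2 * |eval x (dvg (wf R m))| := by
        refine (le_abs_self _).trans ?_
        rw [abs_mul]
        exact mul_le_mul_of_nonneg_right (abs_arctan_le _) (abs_nonneg _)
      have := mul_le_mul_of_nonneg_left h3 (tp_nonneg R a ε m x)
      simp only
      linarith
    have hS : ∏ j ∈ Finset.range (m + 1), (ε ^ δ j) ^ 2 = ε ^ Δ := by
      rw [hΔ, Real.rpow_sum_of_pos h0]
      refine Finset.prod_congr rfl fun j _ => ?_
      rw [← Real.rpow_natCast, ← Real.rpow_mul h0.le]; push_cast; ring_nf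
    have I5 : ∫ x, tp R a ε (m + 1) x ∂(gs ι) ≤ ε ^ (-Δ) * (∫ x, tp R a ε (m + 1) x * eval x (Gam R (m + 1)) ∂(gs ι)) +
        ∑ j ∈ Finset.range (m + 1), (gs ι).real (Bad R j (ε ^ δ j)) := by
      have h := tp_pg R a ε (m + 1)
      have hi : ∀ j, Integrable ((Bad R j (ε ^ δ j)).indicator (fun _ => (1 : ℝ))) (gs ι) := fun j =>
        (integrable_const 1).indicator (bad_meas _ _ _)
      calc _ ≤ ∫ x, (ε ^ (-Δ) * (tp R a ε (m + 1) x * eval x (Gam R (m + 1))) +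
            ∑ j ∈ Finset.range (m + 1), (Bad R j (ε ^ δ j)).indicator (fun _ => (1 : ℝ)) x) ∂(gs ι) := by
              refine integral_mono (h.integrable _) (((by fun_prop : PG _).integrable _).add
                (integrable_finsetSum _ fun j _ => hi j)) fun x => ?_
              have t0 := tp_nonneg R a ε (m + 1) x
              have s0 : ∀ j, 0 ≤ (Bad R j (ε ^ δ j)).indicator (fun _ => (1 : ℝ)) x := fun j =>
                Set.indicator_nonneg (fun _ _ => zero_le_one) _
              have ε0 : 0 < ε ^ (-Δ) := by positivity
              by_cases hx : ∀ j < m + 1, x ∉ Bad R j (ε ^ δ j)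
              · have hg := Gam_good R (fun j => ε ^ δ j) (m + 1) x hx
                rw [hS] at hg
                have : 1 ≤ ε ^ (-Δ) * eval x (Gam R (m + 1)) := by
                  calc (1 : ℝ) = ε ^ (-Δ) * ε ^ Δ := by rw [← Real.rpow_add h0]; simp
                    _ ≤ _ := by gcongr
                have h5 : 0 ≤ ∑ j ∈ Finset.range (m + 1), (Bad R j (ε ^ δ j)).indicator (fun _ => (1 : ℝ)) x :=
                  Finset.sum_nonneg fun j _ => s0 j
                simp only
                nlinarith [mul_le_mul_of_nonneg_left this t0]
              · push Not at hx
                obtain ⟨j, hj, hx⟩ := hx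
                have h5 := Finset.single_le_sum (f := fun j => (Bad R j (ε ^ δ j)).indicator (fun _ => (1 : ℝ)) x)
                  (fun j _ => s0 j) (Finset.mem_range.2 hj)
                simp only [Set.indicator_of_mem hx] at h5
                have h6 : 0 ≤ ε ^ (-Δ) * (tp R a ε (m + 1) x * eval x (Gam R (m + 1))) :=
                  mul_nonneg ε0.le (mul_nonneg t0 (Gam_nonneg _ _ _))
                have := tp_le R a ε (m + 1) x
                simp only
                linarith
        _ = _ := by
              rw [integral_add ((by fun_prop : PG _).integrable _) (integrable_finsetSum _ fun j _ => hi j),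
                integral_const_mul, integral_finsetSum _ fun j _ => hi j]
              congr 1
              refine Finset.sum_congr rfl fun j _ => ?_
              rw [integral_indicator_const _ (bad_meas _ _ _)]
              simp
    have I6 : ∑ j ∈ Finset.range (m + 1), (gs ι).real (Bad R j (ε ^ δ j)) ≤ (m + 1) * ε ^ ((m : ℝ) + 1) := by
      refine (Finset.sum_le_sum fun j hj => hBm j (Finset.mem_range.1 hj)).trans ?_
      simp
    have I7 : ε ^ (-Δ) * (∫ x, tp R a ε (m + 1) x * eval x (Gam R (m + 1)) ∂(gs ι)) ≤
        ε ^ (-Δ) * (ε ^ (1 : ℝ) * (2 * (ε ^ (-κ) * ε ^ (m - (L + κ)) + ε ^ (m : ℝ)))) := by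
      rw [I3, Real.rpow_one]
      gcongr
      refine I4.trans ?_
      gcongr
      refine I2.trans ?_
      gcongr
    have e1 : ε ^ (-Δ) * (ε ^ (1 : ℝ) * (2 * (ε ^ (-κ) * ε ^ (m - (L + κ)) + ε ^ (m : ℝ)))) =
        2 * ε ^ (-Δ + 1 - κ + (m - (L + κ))) + 2 * ε ^ (-Δ + 1 + m) := by
      simp only [sub_eq_add_neg, Real.rpow_add h0]; ring
    have hle : ∀ b : ℝ, m + 1 - c + κ ≤ b → ε ^ b ≤ ε ^ (m + 1 - c + κ) := fun b hb =>
      Real.rpow_le_rpow_of_exponent_ge h0 h1.le hb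
    have g1 := hle (-Δ + 1 - κ + (m - (L + κ))) (by rw [hκ]; linarith)
    have g2 := hle (-Δ + 1 + m) (by rw [hκ]; linarith)
    have g3 := hle (m + 1) (by rw [hκ]; linarith)
    push_cast
    have g4 : ((m : ℝ) + 1) * ε ^ ((m : ℝ) + 1) ≤ (m + 1) * ε ^ (m + 1 - c + κ) := by gcongr
    linarith

lemma antic_meas (d : ℕ) (δ : ℕ → ℝ) (hδ : ∀ j, 0 ≤ δ j) (m : ℕ) (c : ℝ)
    (hc : (∑ i ∈ Finset.range m, ∑ j ∈ Finset.range (i + 1), 2 * δ j) < c) :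
    ∀ᶠ ε in sm, ∀ (ι : Type) [Fintype ι] (R : ℕ → MvPolynomial ι ℝ), (∀ j < m, Bd d 1 (R j)) →
    (∀ j < m, (gs ι).real (Bad R j (ε ^ δ j)) ≤ ε ^ (m : ℝ)) → ∀ a : ℕ → ℝ,
    (gs ι).real {x | ∀ j < m, |eval x (R j) - a j| ≤ ε} ≤ ε ^ (m - c) := by
  obtain ⟨c', h1, h2⟩ := exists_between hc
  filter_upwards [sm_pos, antic d δ hδ m c' h1, sm_le (2 ^ m) (show (m - c : ℝ) < m - c' by linarith)]
    with ε h0 h H ι _ R hR hB a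
  refine le_trans ?_ H
  refine le_trans ?_ (mul_le_mul_of_nonneg_left (h ι R hR hB a) (by positivity))
  have h3 := markov_real (gs ι) (tp_pg R a ε m) (tp_nonneg R a ε m) (s := (2 ^ m)⁻¹) (by positivity)
  rw [div_inv_eq_mul, mul_comm] at h3
  refine le_trans (measureReal_mono fun x hx => ?_) h3
  simp only [Set.mem_ofPred_eq, tp] at hx ⊢
  have : ((2 : ℝ) ^ m)⁻¹ = ∏ j ∈ Finset.range m, (2 : ℝ)⁻¹ := by simp
  rw [this]
  refine Finset.prod_le_prod (fun _ _ => by norm_num) fun j hj => ?_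
  have h4 := hx j (Finset.mem_range.1 hj)
  unfold psi
  have h5 : |(eval x (R j) - a j) / ε| ≤ 1 := by
    rw [abs_div, abs_of_pos h0, div_le_one h0]; exact h4
  have h6 := (sq_le_one_iff_abs_le_one _).2 h5
  exact inv_anti₀ (by positivity) (by linarith)

end Antic


section Tens
open MvPolynomial

/-- Lower order. -/
def Lo {ι : Type} (k : ℕ) (f : MvPolynomial ι ℝ) : Prop := f = 0 ∨ f.totalDegree < k

lemma Lo.add {ι : Type} {k : ℕ} {f g : MvPolynomial ι ℝ} (hf : Lo k f) (hg : Lo k g) : Lo k (f + g) := by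
  rcases hf with rfl | hf
  · simpa using hg
  rcases hg with rfl | hg
  · rw [add_zero]; exact Or.inr hf
  exact Or.inr ((totalDegree_add _ _).trans_lt (max_lt hf hg))

lemma Lo.neg {ι : Type} {k : ℕ} {f : MvPolynomial ι ℝ} (hf : Lo k f) : Lo k (-f) := by
  rcases hf with rfl | hf
  · exact Or.inl (by simp)
  · exact Or.inr (by rwa [totalDegree_neg])

lemma Lo.sub {ι : Type} {k : ℕ} {f g : MvPolynomial ι ℝ} (hf : Lo k f) (hg : Lo k g) : Lo k (f - g) := by
  rw [sub_eq_add_neg]; exact hf.add hg.neg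

lemma lo_zero {ι : Type} (k : ℕ) : Lo k (0 : MvPolynomial ι ℝ) := Or.inl rfl

lemma lo_sum {ι κ : Type} {k : ℕ} (s : Finset κ) (f : κ → MvPolynomial ι ℝ) (hf : ∀ i ∈ s, Lo k (f i)) :
    Lo k (∑ i ∈ s, f i) := by
  classical
  induction s using Finset.induction_on with
  | empty => simpa using lo_zero k
  | insert a s ha ih =>
    rw [Finset.sum_insert ha]
    exact (hf a (by simp)).add (ih fun i hi => hf i (by simp [hi]))

lemma Lo.mul {ι : Type} {k l : ℕ} {f g : MvPolynomial ι ℝ} (hf : Lo k f) (hg : g.totalDegree ≤ l) :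
    Lo (k + l) (f * g) := by
  rcases hf with rfl | hf
  · exact Or.inl (by simp)
  · exact Or.inr ((totalDegree_mul _ _).trans_lt (by omega))

lemma Lo.smul {ι : Type} {k : ℕ} {f : MvPolynomial ι ℝ} (hf : Lo k f) (a : ℝ) : Lo k (C a * f) := by
  rw [mul_comm]; exact hf.mul (l := 0) (by simp)

lemma Lo.deg {ι : Type} {k : ℕ} {f : MvPolynomial ι ℝ} (hf : Lo (k + 1) f) : f.totalDegree ≤ k := by
  rcases hf with rfl | hf
  · simp
  · omega

/-- Polynomial of a tensor. -/
noncomputable def tpoly {S ι : Type} [Fintype S] [Fintype ι] [DecidableEq S] (E : (S → ι) → ℝ) : MvPolynomial ι ℝ :=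
  ∑ i, C (E i) * ∏ s, X (i s)

lemma sum_cons {k : ℕ} {ι M : Type*} [Fintype ι] [AddCommMonoid M] (F : (Fin (k + 1) → ι) → M) :
    ∑ i, F i = ∑ a, ∑ i, F (Fin.cons a i) := by
  rw [← Fintype.sum_prod_type']
  exact (Fintype.sum_equiv (Fin.consEquiv fun _ => ι) _ _ fun p => rfl).symm

lemma tpoly_deg {S ι : Type} [Fintype S] [Fintype ι] [DecidableEq S] (E : (S → ι) → ℝ) :
    (tpoly E).totalDegree ≤ Fintype.card S := by
  refine totalDegree_finsetSum_le fun i _ => (totalDegree_mul _ _).trans ?_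
  rw [totalDegree_C, zero_add]
  refine (totalDegree_finsetProd _ _).trans ?_
  simp

lemma tpoly_cons {k : ℕ} {ι : Type} [Fintype ι] (E : (Fin (k + 1) → ι) → ℝ) :
    tpoly E = ∑ a, X a * tpoly (fun i => E (Fin.cons a i)) := by
  unfold tpoly
  rw [sum_cons]
  refine Finset.sum_congr rfl fun a _ => ?_
  rw [Finset.mul_sum]
  refine Finset.sum_congr rfl fun i _ => ?_
  rw [Fin.prod_univ_succ]
  simp only [Fin.cons_zero, Fin.cons_succ]
  ring

lemma wick (k : ℕ) : ∃ C : ℝ, 0 < C ∧ ∀ (ι : Type) [Fintype ι] (E : (Fin k → ι) → ℝ),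
    ∃ r : MvPolynomial ι ℝ, r.totalDegree ≤ k ∧ ∫ x, eval x r ^ 2 ∂(gs ι) ≤ C * ∑ i, E i ^ 2 ∧
      Lo k (r - tpoly E) := by
  induction k with
  | zero =>
    refine ⟨1, one_pos, fun ι _ E => ⟨C (E default), by simp, ?_, Or.inl ?_⟩⟩
    · simp [Fintype.sum_unique]
    · simp [tpoly, Fintype.sum_unique]
  | succ k ih =>
    obtain ⟨C1, hC1, H1⟩ := ih
    obtain ⟨C2, hC2, H2⟩ := dvg_bound (k + 1)
    refine ⟨C2 * C1, by positivity, fun ι _ E => ?_⟩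
    choose r hr1 hr2 hr3 using fun a => H1 ι (fun i => E (Fin.cons a i))
    have hd : (dvg r).totalDegree ≤ k + 1 := by
      refine totalDegree_finsetSum_le fun i _ => (totalDegree_sub _ _).trans (max_le ?_ ?_)
      · refine (totalDegree_mul _ _).trans ?_
        have := hr1 i
        simp; omega
      · have := hr1 i; have := td_pderiv (r i) i; omega
    refine ⟨dvg r, hd, (H2 ι r hd).trans ?_, ?_⟩
    · rw [mul_assoc, integral_finsetSum _ fun i _ => (by fun_prop : PG _).integrable _]
      gcongr
      rw [sum_cons, Finset.mul_sum]
      exact Finset.sum_le_sum fun a _ => hr2 a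
    · rw [tpoly_cons, dvg, ← Finset.sum_sub_distrib]
      refine lo_sum _ _ fun i _ => ?_
      have e : X i * r i - pderiv i (r i) - X i * tpoly (fun j => E (Fin.cons i j)) =
        (r i - tpoly (fun j => E (Fin.cons i j))) * X i - pderiv i (r i) := by ring
      rw [e]
      refine ((hr3 i).mul (by simp)).sub (Or.inr ?_)
      have := hr1 i; have := td_pderiv (r i) i; omega

lemma wick' (k : ℕ) : ∃ C : ℝ, 0 < C ∧ ∀ (ι S : Type) [Fintype ι] [Fintype S] [DecidableEq S],
    Fintype.card S = k → ∀ (E : (S → ι) → ℝ),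
    ∃ r : MvPolynomial ι ℝ, r.totalDegree ≤ k ∧ ∫ x, eval x r ^ 2 ∂(gs ι) ≤ C * ∑ i, E i ^ 2 ∧
      Lo k (r - tpoly E) := by
  obtain ⟨C1, hC1, H⟩ := wick k
  refine ⟨C1, hC1, fun ι S _ _ _ hS E => ?_⟩
  let e : S ≃ Fin k := Fintype.equivFinOfCardEq hS
  obtain ⟨r, h1, h2, h3⟩ := H ι (fun i => E (i ∘ e))
  have h4 : ∑ i : Fin k → ι, E (i ∘ e) ^ 2 = ∑ i, E i ^ 2 :=
    Fintype.sum_equiv (Equiv.arrowCongr e.symm (Equiv.refl ι)) _ _ fun i => by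
      simp [Equiv.arrowCongr]
  have h5 : tpoly (fun i : Fin k → ι => E (i ∘ e)) = tpoly E := by
    unfold tpoly
    refine Fintype.sum_equiv (Equiv.arrowCongr e.symm (Equiv.refl ι)) _ _ fun i => ?_
    simp only [Equiv.arrowCongr, Equiv.coe_refl, Equiv.symm_symm, Equiv.coe_fn_mk, Function.id_comp]
    congr 1
    exact (Fintype.prod_equiv e _ _ fun s => rfl).symm
  rw [h4] at h2
  rw [h5] at h3
  exact ⟨r, h1, h2, h3⟩

end Tens

section Ryser

/-- Alternating sum expansion. -/
lemma ryser_gen {K J : Type} [Fintype K] [Fintype J] [DecidableEq J] [DecidableEq K] (b : K → ℝ) (p q : K → J → ℝ) :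
    ∑ ω : Finset J, (-1 : ℝ) ^ ωᶜ.card * ∏ r, (b r + ∑ j, if j ∈ ω then p r j else q r j) =
      ∑ φ : K → Option J, (∏ r, if φ r = none then b r else 1) *
        ∏ j, ((∏ r, if φ r = some j then p r j else 1) - ∏ r, if φ r = some j then q r j else 1) := by
  have h1 : ∀ ω : Finset J, ∏ r, (b r + ∑ j, if j ∈ ω then p r j else q r j) =
      ∑ φ : K → Option J, (∏ r, if φ r = none then b r else 1) *
        ((∏ j ∈ ω, ∏ r, if φ r = some j then p r j else 1) * ∏ j ∈ ωᶜ, ∏ r, if φ r = some j then q r j else 1) := by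
    intro ω
    have e : ∀ r, (b r + ∑ j, if j ∈ ω then p r j else q r j) =
        ∑ o : Option J, o.elim (b r) (fun j => if j ∈ ω then p r j else q r j) := fun r => by
      rw [Fintype.sum_option]; rfl
    simp only [e]
    rw [Finset.prod_univ_sum]
    simp only [Fintype.piFinset_univ]
    refine Finset.sum_congr rfl fun φ _ => ?_
    have e2 : ((∏ j ∈ ω, ∏ r, if φ r = some j then p r j else 1) * ∏ j ∈ ωᶜ, ∏ r, if φ r = some j then q r j else 1)
        = ∏ r, ∏ j, if φ r = some j then (if j ∈ ω then p r j else q r j) else 1 := by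
      symm
      rw [Finset.prod_comm, ← Finset.prod_mul_prod_compl ω]
      congr 1
      · refine Finset.prod_congr rfl fun j hj => Finset.prod_congr rfl fun r _ => by simp [hj]
      · refine Finset.prod_congr rfl fun j hj => Finset.prod_congr rfl fun r _ => by
          rw [Finset.mem_compl] at hj; simp [hj]
    rw [e2, ← Finset.prod_mul_distrib]
    refine Finset.prod_congr rfl fun r _ => ?_
    rcases h : φ r with _ | j
    · simp
    · simp [Finset.prod_ite_eq]
  simp only [h1, Finset.mul_sum]
  rw [Finset.sum_comm]
  refine Finset.sum_congr rfl fun φ _ => ?_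
  have h2 : ∏ j, ((∏ r, if φ r = some j then p r j else 1) - ∏ r, if φ r = some j then q r j else 1) =
      ∏ j, ((∏ r, if φ r = some j then p r j else 1) + (-1) * ∏ r, if φ r = some j then q r j else 1) :=
    Finset.prod_congr rfl fun j _ => by ring
  rw [h2, Fintype.prod_add, Finset.mul_sum]
  refine Finset.sum_congr rfl fun ω _ => ?_
  rw [Finset.prod_mul_distrib, Finset.prod_const]
  ring

lemma ryser_zero {K J : Type} [Fintype K] [Fintype J] [DecidableEq J] [DecidableEq K] (b : K → ℝ) (p q : K → J → ℝ)
    (h : Fintype.card K < Fintype.card J) :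
    ∑ ω : Finset J, (-1 : ℝ) ^ ωᶜ.card * ∏ r, (b r + ∑ j, if j ∈ ω then p r j else q r j) = 0 := by
  rw [ryser_gen]
  refine Finset.sum_eq_zero fun φ _ => ?_
  obtain ⟨j, hj⟩ : ∃ j, ∀ r, φ r ≠ some j := by
    by_contra hc
    push Not at hc
    choose g hg using hc
    have : Function.Injective g := fun a b hab => by
      have := hg a; rw [hab, hg b] at this; exact (Option.some.inj this).symm
    exact absurd (Fintype.card_le_of_injective g this) (by omega)
  refine mul_eq_zero_of_right _ (Finset.prod_eq_zero (Finset.mem_univ j) ?_)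
  simp [hj]

lemma ryser {J : Type} [Fintype J] [DecidableEq J] (b : J → ℝ) (p q : J → J → ℝ) :
    ∑ ω : Finset J, (-1 : ℝ) ^ ωᶜ.card * ∏ r, (b r + ∑ j, if j ∈ ω then p r j else q r j) =
      ∑ σ : Equiv.Perm J, ∏ r, (p r (σ r) - q r (σ r)) := by
  rw [ryser_gen]
  symm
  refine Finset.sum_of_injOn (fun σ r => some (σ r)) ?_ ?_ ?_ ?_
  · intro σ _ τ _ h
    ext r
    exact Option.some.inj (congrFun h r)
  · intro σ _; simp
  · intro φ _ hφ
    by_cases hs : ∀ j, ∃ r, φ r = some j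
    · exfalso
      apply hφ
      choose g hg using hs
      have hi : Function.Injective g := fun a b hab => by
        have := hg a; rw [hab, hg b] at this; exact (Option.some.inj this).symm
      have hb := Finite.injective_iff_bijective.1 hi
      refine ⟨(Equiv.ofBijective g hb).symm, by simp, ?_⟩
      funext r
      have := hg ((Equiv.ofBijective g hb).symm r)
      have e : g ((Equiv.ofBijective g hb).symm r) = r := (Equiv.ofBijective g hb).apply_symm_apply r
      rw [e] at this
      exact this.symm
    · push Not at hs
      obtain ⟨j, hj⟩ := hs
      refine mul_eq_zero_of_right _ (Finset.prod_eq_zero (Finset.mem_univ j) ?_)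
      simp [hj]
  · intro σ _
    simp only [reduceCtorEq, if_false, Finset.prod_const_one, one_mul, Option.some.injEq]
    rw [← Equiv.prod_comp σ (fun j => (∏ r, if σ r = j then p r j else 1) - ∏ r, if σ r = j then q r j else 1)]
    refine Finset.prod_congr rfl fun r _ => ?_
    simp [Finset.prod_ite_eq]

end Ryser


section MP
instance PM.pigs {J ι : Type} [Fintype J] [Fintype ι] :
    PM (Measure.pi fun _ : J => gs ι) := PM.pi _
instance PM.pp {J K ι : Type} [Fintype J] [Fintype K] [Fintype ι] :
    PM ((Measure.pi fun _ : J => gs ι).prod (Measure.pi fun _ : K => gs ι)) := PM.prod _ _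

lemma mp_cons {l : ℕ} {V : Type} [MeasurableSpace V] (μ : Measure V) [SigmaFinite μ] :
    MeasurePreserving (fun p : V × (Fin l → V) => (Fin.cons p.1 p.2 : Fin (l + 1) → V))
      (μ.prod (Measure.pi fun _ => μ)) (Measure.pi fun _ => μ) := by
  have h := (measurePreserving_piFinSuccAbove (fun _ : Fin (l + 1) => μ) 0).symm
  have e : (fun p : V × (Fin l → V) => (Fin.cons p.1 p.2 : Fin (l + 1) → V)) =
      (MeasurableEquiv.piFinSuccAbove (fun _ => V) (0 : Fin (l + 1))).symm := by
    funext p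
    simp [MeasurableEquiv.piFinSuccAbove]
    rfl
  rw [e]
  exact h

lemma mp_zip {J α β γ : Type} [Fintype J] [MeasurableSpace α] [MeasurableSpace β] [MeasurableSpace γ]
    (μ : Measure α) (ν : Measure β) (ρ : Measure γ) [SigmaFinite μ] [SigmaFinite ν] [SigmaFinite ρ]
    (f : J → α × β → γ) (hf : ∀ j, MeasurePreserving (f j) (μ.prod ν) ρ) :
    MeasurePreserving (fun (p : (J → α) × (J → β)) j => f j (p.1 j, p.2 j))
      ((Measure.pi fun _ => μ).prod (Measure.pi fun _ => ν)) (Measure.pi fun _ => ρ) := by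
  have h1 := (measurePreserving_arrowProdEquivProdArrow α β J (fun _ => μ) (fun _ => ν)).symm
  have h2 := measurePreserving_pi (fun _ : J => μ.prod ν) (fun _ => ρ) hf
  exact h2.comp h1

lemma mp_piece {J α : Type} [Fintype J] [DecidableEq J] [MeasurableSpace α] (μ : Measure α)
    [IsProbabilityMeasure μ] (ω : Finset J) :
    MeasurePreserving (fun p : (J → α) × (J → α) => ω.piecewise p.2 p.1)
      ((Measure.pi fun _ => μ).prod (Measure.pi fun _ => μ)) (Measure.pi fun _ => μ) := by
  have := mp_zip μ μ μ (fun (j : J) (p : α × α) => if j ∈ ω then p.2 else p.1) (fun j => by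
    by_cases h : j ∈ ω
    · simpa [h] using measurePreserving_snd
    · simpa [h] using measurePreserving_fst)
  refine this

lemma mp_diff {J ι : Type} [Fintype J] [Fintype ι] :
    MeasurePreserving (fun (p : (J → ι → ℝ) × (J → ι → ℝ)) j => (-(√2)⁻¹) • p.1 j + (√2)⁻¹ • p.2 j)
      ((Measure.pi fun _ => gs ι).prod (Measure.pi fun _ => gs ι)) (Measure.pi fun _ => gs ι) :=
  mp_zip _ _ _ (fun (j : J) p => (-(√2)⁻¹) • p.1 + (√2)⁻¹ • p.2) fun j => mp_rot1 _ _ (by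
    have : (√2)⁻¹ ^ 2 = (1 / 2 : ℝ) := by rw [inv_pow, Real.sq_sqrt (by norm_num)]; norm_num
    rw [neg_sq, this]; norm_num)

lemma mp_point {k : ℕ} {ι : Type} [Fintype ι] :
    MeasurePreserving (fun (p : (ι → ℝ) × (Fin k → ι → ℝ)) => (√(k + 1 : ℝ))⁻¹ • p.1 + ∑ j, (√(k + 1 : ℝ))⁻¹ • p.2 j)
      ((gs ι).prod (Measure.pi fun _ => gs ι)) (gs ι) := by
  have h := (mp_comb (ι := ι) (K := Fin (k + 1)) (fun _ => (√(k + 1 : ℝ))⁻¹) (by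
    simp only [inv_pow, Finset.sum_const, Finset.card_univ, Fintype.card_fin]
    rw [Real.sq_sqrt (by positivity)]
    simp
    field_simp)).comp (mp_cons (l := k) (gs ι))
  convert h using 2 with p
  simp [Fin.sum_univ_succ]

end MP

section TopTensor
open MvPolynomial

/-- top tensor relation -/
def TopT {ι : Type} [Fintype ι] (k : ℕ) (g : MvPolynomial ι ℝ) (T : (Fin k → ι) → ℝ) : Prop :=
  (∀ (b : ι → ℝ) (y0 y1 : Fin k → ι → ℝ), ∑ ω : Finset (Fin k), (-1 : ℝ) ^ ωᶜ.card *
      eval (fun a => b a + ∑ j, if j ∈ ω then y1 j a else y0 j a) g = ∑ i, T i * ∏ j, (y1 j (i j) - y0 j (i j))) ∧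
  Lo k (C (k.factorial : ℝ) * g - tpoly T)

lemma TopT.add {ι : Type} [Fintype ι] {k : ℕ} {g g' : MvPolynomial ι ℝ} {T T' : (Fin k → ι) → ℝ}
    (h : TopT k g T) (h' : TopT k g' T') : TopT k (g + g') (fun i => T i + T' i) := by
  refine ⟨fun b y0 y1 => ?_, ?_⟩
  · simp only [map_add, mul_add, add_mul, Finset.sum_add_distrib]
    rw [h.1, h'.1]
  · have e : C (k.factorial : ℝ) * (g + g') - tpoly (fun i => T i + T' i) =
      (C (k.factorial : ℝ) * g - tpoly T) + (C (k.factorial : ℝ) * g' - tpoly T') := by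
      simp only [tpoly, map_add, add_mul, Finset.sum_add_distrib]; ring
    rw [e]
    exact h.2.add h'.2

lemma TopT.smul {ι : Type} [Fintype ι] {k : ℕ} {g : MvPolynomial ι ℝ} {T : (Fin k → ι) → ℝ}
    (h : TopT k g T) (c : ℝ) : TopT k (C c * g) (fun i => c * T i) := by
  refine ⟨fun b y0 y1 => ?_, ?_⟩
  · simp only [map_mul, eval_C, mul_assoc]
    rw [← Finset.mul_sum, ← h.1, Finset.mul_sum]
    exact Finset.sum_congr rfl fun ω _ => by ring
  · have e : C (k.factorial : ℝ) * (C c * g) - tpoly (fun i => c * T i) =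
      C c * (C (k.factorial : ℝ) * g - tpoly T) := by
      simp only [tpoly, map_mul, mul_sub, Finset.mul_sum]
      congr 1
      · ring
      · exact Finset.sum_congr rfl fun ω _ => by ring
    rw [e]
    exact h.2.smul c

lemma topT_prod {ι : Type} [Fintype ι] {k l : ℕ} (hl : l ≤ k) (f : Fin l → ι) :
    ∃ T, TopT k (∏ r, X (f r) : MvPolynomial ι ℝ) T := by
  classical
  rcases hl.lt_or_eq with h | rfl
  · refine ⟨fun _ => 0, fun b y0 y1 => ?_, ?_⟩
    · have := ryser_zero (K := Fin l) (J := Fin k) (fun r => b (f r)) (fun r j => y1 j (f r)) (fun r j => y0 j (f r))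
        (by simpa using h)
      simpa [map_prod] using this
    · have : tpoly (fun _ : Fin k → ι => (0 : ℝ)) = 0 := by simp [tpoly]
      rw [this, sub_zero]
      refine Lo.smul (Or.inr (lt_of_le_of_lt (totalDegree_finsetProd _ _) ?_)) _
      simpa using h
  · refine ⟨fun i => ∑ σ : Equiv.Perm (Fin l), if i = f ∘ σ.symm then 1 else 0, fun b y0 y1 => ?_, Or.inl ?_⟩
    · have := ryser (J := Fin l) (fun r => b (f r)) (fun r j => y1 j (f r)) (fun r j => y0 j (f r))
      simp only [map_prod, eval_X]
      rw [this]
      simp only [Finset.sum_mul]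
      rw [Finset.sum_comm]
      refine Finset.sum_congr rfl fun σ _ => ?_
      simp only [ite_mul, one_mul, zero_mul, Finset.sum_ite_eq', Finset.mem_univ, if_true]
      symm
      rw [← Equiv.prod_comp σ]
      simp
    · have : tpoly (fun i => ∑ σ : Equiv.Perm (Fin l), if i = f ∘ σ.symm then (1:ℝ) else 0) =
        ∑ σ : Equiv.Perm (Fin l), (∏ r, X (f r) : MvPolynomial ι ℝ) := by
        unfold tpoly
        simp only [map_sum, Finset.sum_mul]
        rw [Finset.sum_comm]
        refine Finset.sum_congr rfl fun σ _ => ?_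
        rw [Finset.sum_eq_single (f ∘ σ.symm)]
        · simp only [if_true, map_one, one_mul]
          rw [← Equiv.prod_comp σ]
          simp
        · intro i _ hi; simp [hi]
        · simp
      rw [this]
      simp [Fintype.card_perm]

lemma topT_ex {ι : Type} [Fintype ι] {k : ℕ} (g : MvPolynomial ι ℝ) (hg : g.totalDegree ≤ k) :
    ∃ T, TopT k g T := by
  classical
  have hm : ∀ s ∈ g.support, ∃ T, TopT k (monomial s (coeff s g)) T := by
    intro s hs
    have hd : s.toMultiset.toList.length ≤ k := by
      rw [Multiset.length_toList, Finsupp.card_toMultiset]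
      exact (le_totalDegree hs).trans hg
    obtain ⟨T, hT⟩ := topT_prod hd (fun r => s.toMultiset.toList.get r)
    refine ⟨fun i => coeff s g * T i, ?_⟩
    have e : (monomial s (coeff s g) : MvPolynomial ι ℝ) = C (coeff s g) * ∏ r, X (s.toMultiset.toList.get r) := by
      rw [monomial_eq]
      congr 1
      have : ∏ r, (X (s.toMultiset.toList.get r) : MvPolynomial ι ℝ) = (s.toMultiset.toList.map X).prod := by
        rw [← List.prod_ofFn]
        congr 1
        apply List.ext_get <;> simp
      rw [this, ← Multiset.prod_coe, ← Multiset.map_coe, Multiset.coe_toList]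
      rw [Finsupp.toMultiset_map, Finsupp.prod_toMultiset]
      rw [Finsupp.prod_mapDomain_index] <;> simp [pow_add]
    rw [e]
    exact hT.smul _
  have hsum : ∀ S : Finset (ι →₀ ℕ), S ⊆ g.support → ∃ T, TopT k (∑ s ∈ S, monomial s (coeff s g)) T := by
    intro S
    induction S using Finset.induction_on with
    | empty =>
      intro _
      exact ⟨fun _ => 0, fun b y0 y1 => by simp, Or.inl (by simp [tpoly])⟩
    | insert a S ha ih =>
      intro hS
      obtain ⟨T, hT⟩ := ih fun x hx => hS (by simp [hx])
      obtain ⟨T', hT'⟩ := hm a (hS (by simp))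
      rw [Finset.sum_insert ha]
      exact ⟨_, hT'.add hT⟩
  have := hsum g.support subset_rfl
  rwa [support_sum_monomial_coeff] at this

set_option maxHeartbeats 1000000 in
lemma topT_bd {ι : Type} [Fintype ι] {k : ℕ} {g : MvPolynomial ι ℝ} {T : (Fin k → ι) → ℝ} (h : TopT k g T) :
    ∑ i, T i ^ 2 ≤ (4 * (k + 1)) ^ k * ∫ x, eval x g ^ 2 ∂(gs ι) := by
  classical
  set a : ℝ := (√(k + 1 : ℝ))⁻¹ with ha
  have ha2 : a ^ 2 = (k + 1 : ℝ)⁻¹ := by rw [ha, inv_pow, Real.sq_sqrt (by positivity)]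
  let pt : Finset (Fin k) → (ι → ℝ) × ((Fin k → ι → ℝ) × (Fin k → ι → ℝ)) → ι → ℝ := fun ω q i =>
    (a • q.1) i + ∑ j, if j ∈ ω then (a • q.2.2) j i else (a • q.2.1) j i
  have hpt : ∀ ω, MeasurePreserving (pt ω) ((gs ι).prod ((Measure.pi fun _ : Fin k => gs ι).prod (Measure.pi fun _ : Fin k => gs ι))) (gs ι) := by
    intro ω
    have h1 := (mp_point (k := k) (ι := ι)).comp ((MeasurePreserving.id (gs ι)).prod (mp_piece (gs ι) ω))
    convert h1 using 2
    funext q i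
    simp only [pt, Function.comp, Prod.map, Finset.piecewise, Pi.smul_apply, id]
    simp only [Pi.add_apply, Finset.sum_apply, Pi.smul_apply]
    refine congrArg₂ (fun (x y : ℝ) => x + y) rfl (Finset.sum_congr rfl fun (j : Fin k) _ => ?_)
    split_ifs <;> simp [ha]
  have hptg : ∀ ω, PG (pt ω) := by
    intro ω
    refine PG.pi fun i => PG.add (by fun_prop) (PG.sum _ fun j => ?_)
    split_ifs <;> fun_prop
  have h1 : ∀ q : (ι → ℝ) × ((Fin k → ι → ℝ) × (Fin k → ι → ℝ)), (∑ i, T i * ∏ j, (a * q.2.2 j (i j) - a * q.2.1 j (i j))) ^ 2 ≤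
      2 ^ k * ∑ ω, eval (pt ω q) g ^ 2 := by
    intro q
    have := h.1 (a • q.1) (a • q.2.1) (a • q.2.2)
    simp only [Pi.smul_apply, smul_eq_mul] at this
    rw [← this]
    refine (sq_sum_le_card_mul_sum_sq).trans ?_
    simp only [Finset.card_univ, Fintype.card_finset, Fintype.card_fin, Nat.cast_pow, Nat.cast_ofNat]
    refine mul_le_mul_of_nonneg_left (Finset.sum_le_sum fun ω _ => ?_) (by positivity)
    rw [mul_pow, ← pow_mul, mul_comm ωᶜ.card, pow_mul]
    simp [pt]
  have hPGq : ∀ i j, PG (fun q : (ι → ℝ) × ((Fin k → ι → ℝ) × (Fin k → ι → ℝ)) => q.2.2 j i) := fun i j => by fun_prop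
  have h2 := integral_mono (μ := (gs ι).prod ((Measure.pi fun _ : Fin k => gs ι).prod (Measure.pi fun _ : Fin k => gs ι))) ((by fun_prop : PG (fun q : (ι → ℝ) × ((Fin k → ι → ℝ) × (Fin k → ι → ℝ)) =>
      (∑ i, T i * ∏ j, (a * q.2.2 j (i j) - a * q.2.1 j (i j))) ^ 2)).integrable _)
    ((PG.mul (PG.const _) (PG.sum _ fun ω => (PG.eval (hptg ω) g).pow 2)).integrable _) h1
  have h3 : ∫ q : (ι → ℝ) × ((Fin k → ι → ℝ) × (Fin k → ι → ℝ)), 2 ^ k * ∑ ω, eval (pt ω q) g ^ 2 ∂((gs ι).prod ((Measure.pi fun _ : Fin k => gs ι).prod (Measure.pi fun _ : Fin k => gs ι)))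
      = 4 ^ k * ∫ x, eval x g ^ 2 ∂(gs ι) := by
    rw [integral_const_mul, integral_finsetSum _ fun ω _ => (((PG.eval (hptg ω) g).pow 2).integrable _)]
    have : ∀ ω, ∫ q, eval (pt ω q) g ^ 2 ∂((gs ι).prod ((Measure.pi fun _ : Fin k => gs ι).prod (Measure.pi fun _ : Fin k => gs ι))) = ∫ x, eval x g ^ 2 ∂(gs ι) := fun ω =>
      mp_int (hpt ω) (f := fun x => eval x g ^ 2) ((by fun_prop : PG (fun x => eval x g ^ 2)).cont)
    simp only [this]
    simp only [Finset.sum_const, Finset.card_univ, Fintype.card_finset, Fintype.card_fin, nsmul_eq_mul]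
    push_cast
    rw [← mul_assoc, ← mul_pow]; norm_num
  have h4 : ∫ q : (ι → ℝ) × ((Fin k → ι → ℝ) × (Fin k → ι → ℝ)), (∑ i, T i * ∏ j, (a * q.2.2 j (i j) - a * q.2.1 j (i j))) ^ 2
      ∂((gs ι).prod ((Measure.pi fun _ : Fin k => gs ι).prod (Measure.pi fun _ : Fin k => gs ι))) = ((a * √2) ^ k) ^ 2 * ∑ i, T i ^ 2 := by
    have e : ∀ q : (ι → ℝ) × ((Fin k → ι → ℝ) × (Fin k → ι → ℝ)), (∑ i, T i * ∏ j, (a * q.2.2 j (i j) - a * q.2.1 j (i j))) ^ 2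
        = ((a * √2) ^ k) ^ 2 * (∑ i, T i * ∏ j, ((-(√2)⁻¹) • q.2.1 j + (√2)⁻¹ • q.2.2 j) (i j)) ^ 2 := by
      intro q
      rw [← mul_pow, Finset.mul_sum]
      congr 1
      refine Finset.sum_congr rfl fun i _ => ?_
      have : ∏ j, (a * q.2.2 j (i j) - a * q.2.1 j (i j)) = ∏ j : Fin k, ((a * √2) * ((-(√2)⁻¹) • q.2.1 j + (√2)⁻¹ • q.2.2 j) (i j)) := by
        refine Finset.prod_congr rfl fun j _ => ?_
        have : √2 * (√2)⁻¹ = (1 : ℝ) := mul_inv_cancel₀ (by positivity)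
        simp only [Pi.add_apply, Pi.smul_apply, smul_eq_mul]
        linear_combination (a * q.2.1 j (i j) - a * q.2.2 j (i j)) * this
      rw [this, Finset.prod_mul_distrib]
      simp
      ring
    simp only [e]
    rw [integral_const_mul, ← tensor_energy T]
    congr 1
    exact mp_int ((mp_diff (J := Fin k) (ι := ι)).comp (measurePreserving_snd (μ := gs ι)))
      (f := fun z : Fin k → ι → ℝ => (∑ i, T i * ∏ j, z j (i j)) ^ 2)
      ((by fun_prop : PG (fun z : Fin k → ι → ℝ => (∑ i, T i * ∏ j, z j (i j)) ^ 2)).cont)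
  rw [h3, h4] at h2
  have h5 : ((a * √2) ^ k) ^ 2 = (2 / (k + 1 : ℝ)) ^ k := by
    rw [← pow_mul, mul_comm k 2, pow_mul, mul_pow, ha2, Real.sq_sqrt (by norm_num)]
    congr 1; field_simp
  rw [h5] at h2
  have h6 : (1 : ℝ) ≤ 2 ^ k := one_le_pow₀ (by norm_num)
  have h7 : (0 : ℝ) ≤ ∑ i, T i ^ 2 := Finset.sum_nonneg fun i _ => sq_nonneg _
  have h8 : (0 : ℝ) < (k + 1 : ℝ) ^ k := by positivity
  rw [div_pow, div_mul_eq_mul_div, div_le_iff₀ h8] at h2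
  rw [mul_pow]
  nlinarith [mul_le_mul_of_nonneg_right h6 h7]

lemma euler_lo {ι : Type} [Fintype ι] {k : ℕ} (g : MvPolynomial ι ℝ) (hg : g.totalDegree ≤ k) :
    Lo k (C (k : ℝ) * g - ∑ w, X w * pderiv w g) := by
  classical
  have e : C (k : ℝ) * g - ∑ w, X w * pderiv w g =
      ∑ s ∈ g.support, monomial s (((k : ℝ) - ((s.sum fun _ e => e : ℕ) : ℝ)) * coeff s g) := by
    conv_lhs => rw [← support_sum_monomial_coeff g]
    simp only [map_sum, Finset.mul_sum]
    rw [Finset.sum_comm, ← Finset.sum_sub_distrib]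
    refine Finset.sum_congr rfl fun s _ => ?_
    have : ∀ w, X w * pderiv w (monomial s (coeff s g)) = monomial s ((s w : ℝ) * coeff s g) := by
      intro w
      rw [X_mul_pderiv_monomial]
      rw [← map_nsmul]; simp
    simp only [this]
    rw [← map_sum, C_mul_monomial, ← map_sub, ← Finset.sum_mul, Finsupp.sum_fintype _ _ (by simp)]
    push_cast
    congr 1; ring
  rw [e]
  refine lo_sum _ _ fun s hs => ?_
  have h1 := (le_totalDegree hs).trans hg
  rcases h1.lt_or_eq with h | h
  · exact Or.inr ((totalDegree_monomial_le _ _).trans_lt h)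
  · left; rw [h]; simp

end TopTensor


section DetBound

lemma gauss_exp (l : ℝ) (hl : 0 ≤ l) :
    ∫ x, Real.exp (-(l * x ^ 2) / 2) ∂(gaussianReal 0 1) = (√(1 + l))⁻¹ := by
  rw [integral_gaussianReal_eq_integral_smul (by norm_num)]
  have e : ∀ x : ℝ, gaussianPDFReal 0 1 x • Real.exp (-(l * x ^ 2) / 2) =
      (√(2 * Real.pi))⁻¹ * Real.exp (-((1 + l) / 2) * x ^ 2) := by
    intro x
    simp only [gaussianPDFReal, NNReal.coe_one, mul_one, sub_zero, smul_eq_mul]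
    rw [mul_assoc, ← Real.exp_add]
    congr 2; ring
  simp only [e]
  rw [integral_const_mul, integral_gaussian, ← Real.sqrt_inv, ← Real.sqrt_inv, ← Real.sqrt_mul (by positivity)]
  congr 1
  have := Real.pi_pos
  field_simp

lemma gauss_exp_pi {α : Type} [Fintype α] (l : α → ℝ) (hl : ∀ a, 0 ≤ l a) :
    ∫ v, Real.exp (-(∑ a, l a * v a ^ 2) / 2) ∂(gs α) = ∏ a, (√(1 + l a))⁻¹ := by
  have e : ∀ v : α → ℝ, Real.exp (-(∑ a, l a * v a ^ 2) / 2) = ∏ a, Real.exp (-(l a * v a ^ 2) / 2) := by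
    intro v
    rw [← Real.exp_sum, ← Finset.sum_div, Finset.sum_neg_distrib]
  simp only [e]
  rw [integral_fintype_prod_eq_prod (fun a (x : ℝ) => Real.exp (-(l a * x ^ 2) / 2))]
  exact Finset.prod_congr rfl fun a _ => gauss_exp _ (hl a)

lemma det_cols {κ Ω α : Type} [Fintype κ] [DecidableEq κ] [Fintype α] (M : Ω → α → ℝ) (w : κ → Ω) (V : κ → α → ℝ) :
    Matrix.det (Matrix.of fun r c => ∑ a, M (w r) a * V c a) =
      ∑ i : κ → α, Matrix.det (Matrix.of fun r c => M (w r) (i c)) * ∏ c, V c (i c) := by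
  classical
  simp only [Matrix.det_apply', Matrix.of_apply, Finset.prod_univ_sum, Fintype.piFinset_univ, Finset.sum_mul, Finset.mul_sum]
  rw [Finset.sum_comm]
  refine Finset.sum_congr rfl fun i _ => Finset.sum_congr rfl fun σ _ => ?_
  rw [Finset.prod_mul_distrib]; ring

lemma det_sq_sum {κ Ω α : Type} [Fintype κ] [DecidableEq κ] [Fintype α] [Fintype Ω] (M : Ω → α → ℝ) (i : κ → α) :
    ∑ w : κ → Ω, Matrix.det (Matrix.of fun r c => M (w r) (i c)) ^ 2 ≤
      ((Fintype.card κ).factorial : ℝ) ^ 2 * ∏ r, ∑ w, M w (i r) ^ 2 := by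
  classical
  have h1 : ∀ w : κ → Ω, Matrix.det (Matrix.of fun r c => M (w r) (i c)) ^ 2 ≤
      ((Fintype.card κ).factorial : ℝ) * ∑ σ : Equiv.Perm κ, ∏ c, M (w (σ c)) (i c) ^ 2 := by
    intro w
    rw [Matrix.det_apply']
    refine (sq_sum_le_card_mul_sum_sq).trans ?_
    simp only [Finset.card_univ, Fintype.card_perm]
    refine mul_le_mul_of_nonneg_left (Finset.sum_le_sum fun σ _ => ?_) (by positivity)
    rw [mul_pow, Finset.prod_pow]
    have : ((Equiv.Perm.sign σ : ℤ) : ℝ) ^ 2 = 1 := by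
      rcases Int.units_eq_one_or (Equiv.Perm.sign σ) with h | h <;> simp [h]
    rw [this, one_mul]; simp
  refine (Finset.sum_le_sum fun w _ => h1 w).trans ?_
  rw [← Finset.mul_sum, Finset.sum_comm]
  have h2 : ∀ σ : Equiv.Perm κ, ∑ w : κ → Ω, ∏ c, M (w (σ c)) (i c) ^ 2 = ∏ r, ∑ w, M w (i r) ^ 2 := by
    intro σ
    rw [Finset.prod_univ_sum, Fintype.piFinset_univ]
    exact (Equiv.sum_comp (Equiv.arrowCongr σ (Equiv.refl Ω)) _).symm.trans (by simp [Equiv.arrowCongr])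
  simp only [h2]
  simp only [Finset.sum_const, Finset.card_univ, Fintype.card_perm, nsmul_eq_mul]
  rw [sq, mul_assoc]

lemma sum_inj {κ α : Type} [Fintype κ] [DecidableEq κ] [Fintype α] (l : α → ℝ) (hl : ∀ a, 0 ≤ l a) :
    ∑ i : κ → α, (open Classical in if Function.Injective i then ∏ r, l (i r) else 0) ≤
      (Fintype.card κ : ℝ) ^ (Fintype.card κ) * ∏ a, (1 + l a) := by
  classical
  rw [Finset.prod_one_add, ← Finset.sum_filter, Finset.mul_sum]
  rw [← Finset.sum_fiberwise_of_maps_to (g := fun i : κ → α => Finset.univ.image i) (t := Finset.univ.powerset) (by simp)]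
  refine Finset.sum_le_sum fun s _ => ?_
  have h1 : ∀ i ∈ (Finset.univ.filter fun i : κ → α => Function.Injective i).filter (fun i => Finset.univ.image i = s),
      ∏ r, l (i r) = ∏ a ∈ s, l a := by
    intro i hi
    simp only [Finset.mem_filter, Finset.mem_univ, true_and] at hi
    rw [← hi.2, Finset.prod_image (fun x _ y _ h => hi.1 h)]
  rw [Finset.sum_congr rfl h1, Finset.sum_const, nsmul_eq_mul]
  refine mul_le_mul_of_nonneg_right ?_ (Finset.prod_nonneg fun a _ => hl a)
  rcases ((Finset.univ.filter fun i : κ → α => Function.Injective i).filter (fun i => Finset.univ.image i = s)).eq_empty_or_nonempty with h | ⟨i, hi⟩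
  · rw [h]; simp
  · have hc : s.card = Fintype.card κ := by
      simp only [Finset.mem_filter, Finset.mem_univ, true_and] at hi
      rw [← hi.2, Finset.card_image_of_injective _ hi.1, Finset.card_univ]
    have h2 : ((Finset.univ.filter fun i : κ → α => Function.Injective i).filter (fun i => Finset.univ.image i = s)) ⊆
        Fintype.piFinset (fun _ : κ => s) := by
      intro i hi
      simp only [Finset.mem_filter, Finset.mem_univ, true_and] at hi
      rw [Fintype.mem_piFinset]
      intro r; rw [← hi.2]; simp
    have := Finset.card_le_card h2
    rw [Fintype.card_piFinset, Finset.prod_const, hc, Finset.card_univ] at this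
    exact_mod_cast this

/-- determinant bound, general part -/
lemma det_bound_le {κ Ω α : Type} [Fintype κ] [DecidableEq κ] [Fintype α] [Fintype Ω] (M : Ω → α → ℝ) :
    ∫ V : κ → α → ℝ, ∑ w : κ → Ω, Matrix.det (Matrix.of fun r c => ∑ a, M (w r) a * V c a) ^ 2 ∂(Measure.pi fun _ => gs α) ≤
      ((Fintype.card κ).factorial : ℝ) ^ 2 * ((Fintype.card κ : ℝ) ^ (Fintype.card κ) * ∏ a, (1 + ∑ w, M w a ^ 2)) := by
  classical
  simp only [det_cols]
  rw [integral_finsetSum _ fun w _ => (by fun_prop : PG _).integrable _]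
  simp only [tensor_energy]
  rw [Finset.sum_comm]
  refine le_trans ?_ (mul_le_mul_of_nonneg_left (sum_inj (κ := κ) (fun a => ∑ w, M w a ^ 2) (fun a => by positivity)) (by positivity))
  rw [Finset.mul_sum]
  refine Finset.sum_le_sum fun i _ => ?_
  split_ifs with h
  · exact det_sq_sum M i
  · rw [mul_zero]
    refine (Finset.sum_eq_zero fun w _ => ?_).le
    obtain ⟨a, b, hab, hne⟩ : ∃ a b, i a = i b ∧ a ≠ b := by
      simpa [Function.Injective] using h
    rw [Matrix.det_zero_of_column_eq hne (fun r => by simp [hab])]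
    simp

lemma det_bound_orth {κ Ω α : Type} [Fintype κ] [DecidableEq κ] [Fintype α] [DecidableEq α] [Fintype Ω] (M : Ω → α → ℝ) (l : α → ℝ)
    (hM : ∀ a b, ∑ w, M w a * M w b = if a = b then l a else 0) (ρ : ℝ) (hρ : 0 < ρ)
    (h : ρ ≤ (gs α).real {v | ∑ w, (∑ a, M w a * v a) ^ 2 ≤ 1}) :
    ∫ V : κ → α → ℝ, ∑ w : κ → Ω, Matrix.det (Matrix.of fun r c => ∑ a, M (w r) a * V c a) ^ 2 ∂(Measure.pi fun _ => gs α) ≤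
      3 * ((Fintype.card κ).factorial : ℝ) ^ 2 * (Fintype.card κ : ℝ) ^ (Fintype.card κ) * (ρ ^ 2)⁻¹ := by
  have hl : ∀ a, l a = ∑ w, M w a ^ 2 := fun a => by
    have := hM a a; simp only [if_true] at this; rw [← this]; simp only [sq]
  have hl0 : ∀ a, 0 ≤ l a := fun a => by rw [hl]; positivity
  have hq : ∀ v : α → ℝ, ∑ w, (∑ a, M w a * v a) ^ 2 = ∑ a, l a * v a ^ 2 := by
    intro v
    simp only [sq, Finset.sum_mul_sum]
    rw [Finset.sum_comm]
    refine Finset.sum_congr rfl fun a _ => ?_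
    rw [Finset.sum_comm]
    have : ∀ b, ∑ w, M w a * v a * (M w b * v b) = (if a = b then l a else 0) * (v a * v b) := by
      intro b
      rw [← hM a b, Finset.sum_mul]
      exact Finset.sum_congr rfl fun w _ => by ring
    simp only [this]
    simp [ite_mul]
  have h1 : Real.exp (-1 / 2) * ρ ≤ ∏ a, (√(1 + l a))⁻¹ := by
    rw [← gauss_exp_pi l hl0]
    have hc : Continuous fun v : α → ℝ => Real.exp (-(∑ a, l a * v a ^ 2) / 2) := by fun_prop
    have hm : MeasurableSet {v : α → ℝ | ∑ w, (∑ a, M w a * v a) ^ 2 ≤ 1} :=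
      (isClosed_le (by fun_prop) continuous_const).measurableSet
    have hi : Integrable (fun v : α → ℝ => Real.exp (-(∑ a, l a * v a ^ 2) / 2)) (gs α) := by
      refine Integrable.of_bound hc.measurable.aestronglyMeasurable 1 (Filter.Eventually.of_forall fun v => ?_)
      rw [Real.norm_of_nonneg (Real.exp_pos _).le, Real.exp_le_one_iff]
      have : 0 ≤ ∑ a, l a * v a ^ 2 := Finset.sum_nonneg fun a _ => mul_nonneg (hl0 a) (sq_nonneg _)
      linarith
    calc Real.exp (-1 / 2) * ρ ≤ Real.exp (-1 / 2) * (gs α).real {v | ∑ w, (∑ a, M w a * v a) ^ 2 ≤ 1} := by gcongr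
      _ = ∫ v in {v : α → ℝ | ∑ w, (∑ a, M w a * v a) ^ 2 ≤ 1}, Real.exp (-1 / 2) ∂(gs α) := by
        rw [setIntegral_const]; simp [mul_comm]
      _ ≤ ∫ v in {v : α → ℝ | ∑ w, (∑ a, M w a * v a) ^ 2 ≤ 1}, Real.exp (-(∑ a, l a * v a ^ 2) / 2) ∂(gs α) := by
        refine setIntegral_mono_on (by simp) hi.integrableOn hm fun v hv => ?_
        rw [Real.exp_le_exp]
        have := hq v
        have hv' : ∑ w, (∑ a, M w a * v a) ^ 2 ≤ 1 := hv
        linarith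
      _ ≤ _ := setIntegral_le_integral hi (Filter.Eventually.of_forall fun v => (Real.exp_pos _).le)
  have h2 : ∏ a, (1 + l a) ≤ 3 * (ρ ^ 2)⁻¹ := by
    have h3 : (∏ a, (√(1 + l a))⁻¹) ^ 2 = (∏ a, (1 + l a))⁻¹ := by
      rw [← Finset.prod_pow, ← Finset.prod_inv_distrib]
      refine Finset.prod_congr rfl fun a _ => ?_
      rw [inv_pow, Real.sq_sqrt (by linarith [hl0 a])]
    have h4 : 0 < ∏ a, (1 + l a) := Finset.prod_pos fun a _ => by linarith [hl0 a]
    have h5 : (Real.exp (-1 / 2) * ρ) ^ 2 ≤ (∏ a, (1 + l a))⁻¹ := by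
      rw [← h3]; exact pow_le_pow_left₀ (by positivity) h1 2
    rw [mul_pow, ← Real.exp_nat_mul] at h5
    have h6 : Real.exp ((2 : ℕ) * (-1 / 2)) = (Real.exp 1)⁻¹ := by rw [← Real.exp_neg]; norm_num
    rw [h6] at h5
    have h7 := Real.exp_one_lt_three
    have h8 := Real.exp_pos 1
    have h9 := inv_anti₀ (by positivity) h5
    rw [inv_inv, mul_inv, inv_inv] at h9
    refine h9.trans ?_
    gcongr
  refine (det_bound_le (κ := κ) M).trans ?_
  simp only [← hl]
  have h10 : (0:ℝ) ≤ ((Fintype.card κ).factorial : ℝ) ^ 2 * (Fintype.card κ : ℝ) ^ (Fintype.card κ) := by positivity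
  nlinarith [mul_le_mul_of_nonneg_left h2 h10]

lemma det_bound {κ Ω α : Type} [Fintype κ] [DecidableEq κ] [Fintype α] [Fintype Ω] (M : Ω → α → ℝ) (ρ : ℝ) (hρ : 0 < ρ)
    (h : ρ ≤ (gs α).real {v | ∑ w, (∑ a, M w a * v a) ^ 2 ≤ 1}) :
    ∫ V : κ → α → ℝ, ∑ w : κ → Ω, Matrix.det (Matrix.of fun r c => ∑ a, M (w r) a * V c a) ^ 2 ∂(Measure.pi fun _ => gs α) ≤
      3 * ((Fintype.card κ).factorial : ℝ) ^ 2 * (Fintype.card κ : ℝ) ^ (Fintype.card κ) * (ρ ^ 2)⁻¹ := by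
  classical
  let N : Matrix α α ℝ := (Matrix.of M).transpose * Matrix.of M
  have hN : N.IsHermitian := by
    have := Matrix.isHermitian_conjTranspose_mul_self (Matrix.of M)
    simpa [Matrix.conjTranspose_eq_transpose_of_trivial] using this
  let U : Matrix α α ℝ := (hN.eigenvectorUnitary : Matrix α α ℝ)
  have hU1 : U * U.transpose = 1 := by
    have := Unitary.coe_mul_star_self hN.eigenvectorUnitary
    simpa [Matrix.star_eq_conjTranspose, Matrix.conjTranspose_eq_transpose_of_trivial] using this
  have hU2 : U.transpose * U = 1 := by
    have := Unitary.coe_star_mul_self hN.eigenvectorUnitary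
    simpa [Matrix.star_eq_conjTranspose, Matrix.conjTranspose_eq_transpose_of_trivial] using this
  have hdiag : U.transpose * N * U = Matrix.diagonal hN.eigenvalues := by
    have := hN.conjStarAlgAut_star_eigenvectorUnitary
    simpa [Unitary.conjStarAlgAut_apply, Matrix.star_eq_conjTranspose, Matrix.conjTranspose_eq_transpose_of_trivial, Function.comp_def] using this
  let M' : Matrix Ω α ℝ := Matrix.of M * U
  have hM' : M'.transpose * M' = Matrix.diagonal hN.eigenvalues := by
    rw [← hdiag]; simp only [M', N, Matrix.transpose_mul, Matrix.mul_assoc]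
  have hmp : MeasurePreserving (fun v => U.transpose.mulVec v) (gs α) (gs α) :=
    mp_orth _ (by rw [Matrix.transpose_transpose]; exact hU2)
  have hrow : ∀ (w : Ω) (v : α → ℝ), ∑ a, M' w a * (U.transpose.mulVec v) a = ∑ a, M w a * v a := by
    intro w v
    have : M'.mulVec (U.transpose.mulVec v) = (Matrix.of M).mulVec v := by
      rw [Matrix.mulVec_mulVec, Matrix.mul_assoc, hU1, Matrix.mul_one]
    exact congrFun this w
  have hm : MeasurableSet {v : α → ℝ | ∑ w, (∑ a, M' w a * v a) ^ 2 ≤ 1} :=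
    (isClosed_le (by fun_prop) continuous_const).measurableSet
  have hpr : ρ ≤ (gs α).real {v | ∑ w, (∑ a, M' w a * v a) ^ 2 ≤ 1} := by
    rw [measureReal_def, ← hmp.measure_preimage hm.nullMeasurableSet]
    refine h.trans (le_of_eq ?_)
    rw [measureReal_def]
    congr 2
    ext v
    simp only [Set.mem_preimage, Set.mem_ofPred_eq, hrow]
  have key := det_bound_orth (κ := κ) M' hN.eigenvalues (fun a b => by
    have := congrFun (congrFun hM' a) b
    simpa [Matrix.mul_apply, Matrix.diagonal_apply] using this) ρ hρ hpr
  refine le_trans (le_of_eq ?_) key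
  have hmp2 := measurePreserving_pi (fun _ : κ => gs α) (fun _ => gs α) (fun _ => hmp)
  rw [← mp_int hmp2 (f := fun V => ∑ w : κ → Ω, Matrix.det (Matrix.of fun r c => ∑ a, M' (w r) a * V c a) ^ 2)]
  · simp only [hrow]
  · refine continuous_finset_sum _ fun w _ => (Continuous.matrix_det ?_).pow 2
    refine continuous_matrix fun r c => ?_
    simp only [Matrix.of_apply]
    fun_prop

end DetBound


section ML
open Function

/-- basis vector -/
noncomputable def bs {ι : Type} (a : ι) : ι → ℝ := fun b => open Classical in if b = a then 1 else 0

/-- linear in each slot -/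
def IsML {S ι : Type} [DecidableEq S] (F : (S → ι → ℝ) → ℝ) : Prop :=
  ∀ (y : S → ι → ℝ) (s : S) (c : ℝ) (u v : ι → ℝ), F (update y s (c • u + v)) = c * F (update y s u) + F (update y s v)

lemma IsML.expand {S ι : Type} [instS : DecidableEq S] [Fintype S] [Fintype ι] {F : (S → ι → ℝ) → ℝ} (h : IsML F) (y : S → ι → ℝ) :
    F y = ∑ i : S → ι, F (fun s => bs (i s)) * ∏ s, y s (i s) := by
  have h0 : ∀ y s, F (update y s 0) = 0 := by
    intro y s
    have := h y s 1 0 0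
    simp at this
    exact this
  let G : MultilinearMap ℝ (fun _ : S => ι → ℝ) ℝ :=
    { toFun := F
      map_update_add' := by
        intro inst m s u v
        rw [Subsingleton.elim inst instS]
        have := h m s 1 u v
        simpa using this
      map_update_smul' := by
        intro inst m s c u
        rw [Subsingleton.elim inst instS]
        have := h m s c u 0
        rw [h0, add_zero, add_zero] at this
        simpa using this }
  have hy : y = fun s => ∑ a, y s a • bs a := by
    funext s b
    rw [Finset.sum_apply, Finset.sum_eq_single b]
    · simp [bs]
    · intro c _ hc; simp [bs, Ne.symm hc]
    · simp
  have h1 : F y = G (fun s => ∑ a, y s a • bs a) := by rw [← hy]; rfl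
  rw [h1, MultilinearMap.map_sum]
  refine Finset.sum_congr rfl fun i _ => ?_
  rw [MultilinearMap.map_smul_univ, smul_eq_mul, mul_comm]
  rfl

lemma IsML.energy {S ι : Type} [DecidableEq S] [Fintype S] [Fintype ι] {F : (S → ι → ℝ) → ℝ} (h : IsML F) :
    ∫ y, F y ^ 2 ∂(Measure.pi fun _ : S => gs ι) = ∑ i : S → ι, F (fun s => bs (i s)) ^ 2 := by
  rw [← tensor_energy (fun i : S → ι => F (fun s => bs (i s)))]
  congr 1
  funext y
  rw [h.expand y]

lemma IsML.pg {S ι : Type} [DecidableEq S] [Fintype S] [Fintype ι] {F : (S → ι → ℝ) → ℝ} (h : IsML F) : PG F := by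
  have : F = fun y => ∑ i : S → ι, F (fun s => bs (i s)) * ∏ s, y s (i s) := by
    funext y; exact h.expand y
  rw [this]
  fun_prop

lemma IsML.sum {S ι K : Type} [DecidableEq S] {F : K → (S → ι → ℝ) → ℝ} (t : Finset K) (h : ∀ k, IsML (F k)) :
    IsML (fun y => ∑ k ∈ t, F k y) := by
  intro y s c u v
  simp only [h _ y s c u v, Finset.sum_add_distrib, Finset.mul_sum]

lemma IsML.cmul {S ι : Type} [DecidableEq S] {F : (S → ι → ℝ) → ℝ} (h : IsML F) (b : ℝ) :
    IsML (fun y => b * F y) := by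
  intro y s c u v
  simp only [h y s c u v]; ring

lemma IsML.comp {S A ι : Type} [DecidableEq S] [DecidableEq A] {F : (S → ι → ℝ) → ℝ} (h : IsML F) (Φ : (A → ι → ℝ) → S → ι → ℝ)
    (φ : A → S) (hΦ : ∀ y a x, Φ (update y a x) = update (Φ y) (φ a) x) : IsML (fun y => F (Φ y)) := by
  intro y s c u v
  simp only [hΦ, h (Φ y) (φ s) c u v]

/-- multilinear form -/
noncomputable def bf {S ι Ω : Type} [Fintype S] [DecidableEq S] [Fintype ι] (T : (S → ι) → Ω → ℝ) (z : S → ι → ℝ) (w : Ω) : ℝ :=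
  ∑ i, T i w * ∏ s, z s (i s)

lemma bf_bs {S ι Ω : Type} [Fintype S] [DecidableEq S] [Fintype ι] (T : (S → ι) → Ω → ℝ) (i : S → ι) (w : Ω) :
    bf T (fun s => bs (i s)) w = T i w := by
  classical
  unfold bf
  rw [Finset.sum_eq_single i]
  · simp [bs]
  · intro j _ hj
    obtain ⟨s, hs⟩ := Function.ne_iff.1 hj
    rw [Finset.prod_eq_zero (Finset.mem_univ s) (by simp [bs, hs]), mul_zero]
  · simp

lemma bf_ml {S ι Ω : Type} [Fintype S] [DecidableEq S] [Fintype ι] (T : (S → ι) → Ω → ℝ) (w : Ω) :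
    IsML (fun z => bf T z w) := by
  have key : ∀ (y : S → ι → ℝ) s x (i : S → ι), ∏ s', update y s x s' (i s') = x (i s) * ∏ s' ∈ Finset.univ.erase s, y s' (i s') := by
    intro y s x i
    rw [← Finset.mul_prod_erase Finset.univ _ (Finset.mem_univ s), update_self]
    congr 1
    refine Finset.prod_congr rfl fun s' hs' => ?_
    rw [update_of_ne (Finset.ne_of_mem_erase hs')]
  intro y s c u v
  simp only [bf, key, Finset.mul_sum]
  rw [← Finset.sum_add_distrib]
  refine Finset.sum_congr rfl fun i _ => ?_
  simp only [Pi.add_apply, Pi.smul_apply, smul_eq_mul]; ring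

lemma bf_energy {S ι Ω : Type} [Fintype S] [DecidableEq S] [Fintype ι] [Fintype Ω] (T : (S → ι) → Ω → ℝ) :
    ∑ w, ∫ z, bf T z w ^ 2 ∂(Measure.pi fun _ : S => gs ι) = ∑ i, ∑ w, T i w ^ 2 := by
  rw [Finset.sum_comm]
  refine Finset.sum_congr rfl fun w _ => ?_
  rw [(bf_ml T w).energy]
  simp only [bf_bs]

/-- permuted product -/
noncomputable def FF {S ι Ω κ : Type} [Fintype S] [DecidableEq S] [Fintype ι] [Fintype κ] (T : (S → ι) → Ω → ℝ)
    (σ : S → Equiv.Perm κ) (Z : S × κ → ι → ℝ) (w : κ → Ω) : ℝ := ∏ r, bf T (fun s => Z (s, σ s r)) (w r)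

lemma FF_ml {S ι Ω κ : Type} [Fintype S] [DecidableEq S] [Fintype ι] [Fintype κ] [DecidableEq κ] (T : (S → ι) → Ω → ℝ)
    (σ : S → Equiv.Perm κ) (w : κ → Ω) : IsML (fun Z => FF T σ Z w) := by
  have key : ∀ (Z : S × κ → ι → ℝ) (p : S × κ) x, FF T σ (update Z p x) w =
      bf T (update (fun s => Z (s, σ s ((σ p.1).symm p.2))) p.1 x) (w ((σ p.1).symm p.2)) *
        ∏ r ∈ Finset.univ.erase ((σ p.1).symm p.2), bf T (fun s => Z (s, σ s r)) (w r) := by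
    rintro Z ⟨s0, r0⟩ x
    unfold FF
    rw [← Finset.mul_prod_erase Finset.univ _ (Finset.mem_univ ((σ s0).symm r0))]
    congr 1
    · congr 1
      funext s
      by_cases h : s = s0
      · subst h; simp
      · rw [update_of_ne (by simp [h]), update_of_ne h]
    · refine Finset.prod_congr rfl fun r hr => ?_
      congr 1
      funext s
      rw [update_of_ne]
      intro h
      have h1 := (Prod.mk.inj h).1
      have h2 := (Prod.mk.inj h).2
      subst h1
      exact Finset.ne_of_mem_erase hr (by rw [← h2]; simp)
  intro Z p c u v
  simp only [key]
  have := bf_ml T (w ((σ p.1).symm p.2)) (fun s => Z (s, σ s ((σ p.1).symm p.2))) p.1 c u v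
  simp only at this
  rw [this]
  ring

/-- the permanent-determinant polynomial -/
noncomputable def PP {D : ℕ} {ι Ω κ : Type} [Fintype ι] [Fintype κ] [DecidableEq κ] (T : (Fin (D + 1) → ι) → Ω → ℝ)
    (Z : Fin (D + 1) × κ → ι → ℝ) (w : κ → Ω) : ℝ :=
  ∑ σ : Fin (D + 1) → Equiv.Perm κ, ((Equiv.Perm.sign (σ 0) : ℤ) : ℝ) * FF T σ Z w

lemma PP_ml {D : ℕ} {ι Ω κ : Type} [Fintype ι] [Fintype κ] [DecidableEq κ] (T : (Fin (D + 1) → ι) → Ω → ℝ) (w : κ → Ω) :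
    IsML (fun Z => PP T Z w) := IsML.sum _ fun σ => (FF_ml T σ w).cmul _

lemma FF_bs {S ι Ω κ : Type} [Fintype S] [DecidableEq S] [Fintype ι] [Fintype κ] (T : (S → ι) → Ω → ℝ)
    (σ : S → Equiv.Perm κ) (I : S × κ → ι) (w : κ → Ω) :
    FF T σ (fun p => bs (I p)) w = ∏ r, T (fun s => I (s, σ s r)) (w r) :=
  Finset.prod_congr rfl fun r _ => bf_bs T (fun s => I (s, σ s r)) (w r)

lemma FF_energy {S ι Ω κ : Type} [Fintype S] [DecidableEq S] [Fintype ι] [Fintype κ] [DecidableEq κ] [Fintype Ω] (T : (S → ι) → Ω → ℝ)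
    (σ : S → Equiv.Perm κ) :
    ∑ I : S × κ → ι, ∑ w : κ → Ω, FF T σ (fun p => bs (I p)) w ^ 2 = (∑ i, ∑ w, T i w ^ 2) ^ (Fintype.card κ) := by
  classical
  simp only [FF_bs]
  let e : (S × κ → ι) ≃ (κ → S → ι) :=
    { toFun := fun I r s => I (s, σ s r)
      invFun := fun I p => I ((σ p.1).symm p.2) p.1
      left_inv := fun I => by funext p; simp
      right_inv := fun I => by funext r s; simp }
  have h1 : ∑ I : S × κ → ι, ∑ w : κ → Ω, (∏ r, T (fun s => I (s, σ s r)) (w r)) ^ 2 =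
      ∑ I : κ → S → ι, ∑ w : κ → Ω, (∏ r, T (I r) (w r)) ^ 2 :=
    Fintype.sum_equiv e _ _ fun I => rfl
  rw [h1, ← Finset.card_univ, ← Finset.prod_const, Finset.prod_univ_sum, Fintype.piFinset_univ]
  refine Finset.sum_congr rfl fun I _ => ?_
  rw [Finset.prod_univ_sum, Fintype.piFinset_univ]
  refine Finset.sum_congr rfl fun w _ => ?_
  rw [Finset.prod_pow]

/-- add slot `0` -/
def zc {D : ℕ} {κ V : Type} (v : κ → V) (Y : Fin D × κ → V) : Fin (D + 1) × κ → V :=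
  fun p => Fin.cases (v p.2) (fun s => Y (s, p.2)) p.1

/-- add copy `0` -/
def cb {S : Type} {l : ℕ} {V : Type} (j : S → V) (Z : S × Fin l → V) : S × Fin (l + 1) → V :=
  fun p => Fin.cases (j p.1) (fun r => Z (p.1, r)) p.2

@[simp] lemma zc_zero {D : ℕ} {κ V : Type} (v : κ → V) (Y : Fin D × κ → V) (r : κ) : zc v Y (0, r) = v r := rfl
@[simp] lemma zc_succ {D : ℕ} {κ V : Type} (v : κ → V) (Y : Fin D × κ → V) (s : Fin D) (r : κ) : zc v Y (s.succ, r) = Y (s, r) := rfl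
@[simp] lemma cb_zero {S : Type} {l : ℕ} {V : Type} (j : S → V) (Z : S × Fin l → V) (s : S) : cb j Z (s, 0) = j s := rfl
@[simp] lemma cb_succ {S : Type} {l : ℕ} {V : Type} (j : S → V) (Z : S × Fin l → V) (s : S) (r : Fin l) : cb j Z (s, r.succ) = Z (s, r) := rfl

lemma zc_cb {D l : ℕ} {V : Type} (v0 : V) (v : Fin l → V) (y : Fin D → V) (Y : Fin D × Fin l → V) :
    zc (Fin.cons v0 v : Fin (l + 1) → V) (cb y Y) = cb (Fin.cons v0 y : Fin (D + 1) → V) (zc v Y) := by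
  funext ⟨s, r⟩
  refine Fin.cases ?_ (fun s => ?_) s <;> refine Fin.cases ?_ (fun r => ?_) r <;> simp

lemma zc_map {D : ℕ} {κ V W : Type} (g : V → W) (v : κ → V) (Y : Fin D × κ → V) :
    zc (fun r => g (v r)) (fun p => g (Y p)) = fun p => g (zc v Y p) := by
  funext ⟨s, r⟩
  refine Fin.cases ?_ (fun s => ?_) s <;> simp

lemma cb_map {S : Type} {l : ℕ} {V W : Type} (g : V → W) (j : S → V) (Z : S × Fin l → V) :
    cb (fun r => g (j r)) (fun p => g (Z p)) = fun p => g (cb j Z p) := by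
  funext ⟨s, r⟩
  refine Fin.cases ?_ (fun s => ?_) r <;> simp

lemma zc_upd {D : ℕ} {κ V : Type} [DecidableEq κ] (v : κ → V) (Y : Fin D × κ → V) (p : Fin D × κ) (x : V) :
    zc v (update Y p x) = update (zc v Y) (p.1.succ, p.2) x := by
  funext ⟨s, r⟩
  refine Fin.cases ?_ (fun s => ?_) s
  · rw [update_of_ne (by simp [Fin.succ_ne_zero, Ne.symm (Fin.succ_ne_zero _)])]; simp
  · simp [update_apply, Prod.ext_iff]

lemma cb_upd1 {S : Type} [DecidableEq S] {l : ℕ} {V : Type} (j : S → V) (Z : S × Fin l → V) (s : S) (x : V) :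
    cb (update j s x) Z = update (cb j Z) (s, 0) x := by
  funext ⟨s', r⟩
  refine Fin.cases ?_ (fun r => ?_) r
  · simp [update_apply, Prod.ext_iff]
  · rw [update_of_ne (by simp [Fin.succ_ne_zero])]; simp

lemma cb_upd2 {S : Type} [DecidableEq S] {l : ℕ} {V : Type} (j : S → V) (Z : S × Fin l → V) (p : S × Fin l) (x : V) :
    cb j (update Z p x) = update (cb j Z) (p.1, p.2.succ) x := by
  funext ⟨s', r⟩
  refine Fin.cases ?_ (fun r => ?_) r
  · rw [update_of_ne (by simp [Ne.symm (Fin.succ_ne_zero _)])]; simp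
  · simp [update_apply, Prod.ext_iff]

lemma PP_expand {D l : ℕ} {ι Ω : Type} [Fintype ι] (T : (Fin (D + 1) → ι) → Ω → ℝ)
    (j : Fin (D + 1) → ι → ℝ) (Z : Fin (D + 1) × Fin l → ι → ℝ) (w0 : Ω) (w : Fin l → Ω) :
    PP T (cb j Z) (Fin.cons w0 w : Fin (l + 1) → Ω) = bf T j w0 * PP T Z w +
      ∑ σ : {σ : Fin (D + 1) → Equiv.Perm (Fin (l + 1)) // ∃ s, σ s 0 ≠ 0},
        ((Equiv.Perm.sign (σ.1 0) : ℤ) : ℝ) * FF T σ.1 (cb j Z) (Fin.cons w0 w : Fin (l + 1) → Ω) := by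
  classical
  unfold PP
  rw [← Finset.sum_filter_add_sum_filter_not Finset.univ (fun σ : Fin (D + 1) → Equiv.Perm (Fin (l + 1)) => ¬ ∃ s, σ s 0 ≠ 0)]
  congr 1
  · rw [Finset.mul_sum]
    symm
    refine Finset.sum_bij (fun τ _ s => Equiv.Perm.decomposeFin.symm (0, τ s)) ?_ ?_ ?_ ?_
    · intro τ _; simp
    · intro τ _ τ' _ h
      funext s
      have := congrFun h s
      simpa using this
    · intro σ hσ
      simp only [Finset.mem_filter, Finset.mem_univ, true_and, not_exists, not_not] at hσ
      refine ⟨fun s => (Equiv.Perm.decomposeFin (σ s)).2, Finset.mem_univ _, ?_⟩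
      funext s
      rw [Equiv.symm_apply_eq]
      refine Prod.ext ?_ rfl
      have h1 : (Equiv.Perm.decomposeFin.symm (Equiv.Perm.decomposeFin (σ s))) 0 = (Equiv.Perm.decomposeFin (σ s)).1 := by
        rw [← Prod.mk.eta (p := Equiv.Perm.decomposeFin (σ s)), Equiv.Perm.decomposeFin_symm_apply_zero]
      rw [Equiv.symm_apply_apply, hσ s] at h1
      exact h1
    · intro τ _
      rw [Equiv.Perm.decomposeFin.symm_sign]
      unfold FF
      rw [Fin.prod_univ_succ]
      simp only [Equiv.Perm.decomposeFin_symm_apply_zero, Equiv.Perm.decomposeFin_symm_apply_succ, Equiv.swap_self,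
        Equiv.refl_apply, cb_zero, cb_succ, Fin.cons_zero, Fin.cons_succ]
      simp
      ring
  · rw [← Finset.sum_subtype_eq_sum_filter]
    refine Finset.sum_bij' (fun a _ => ⟨a.1, by have := a.2; simpa using this⟩) (fun a _ => ⟨a.1, by have := a.2; simpa using this⟩) ?_ ?_ ?_ ?_ ?_ <;> simp

lemma sum_inj_le {A B : Type} [Fintype A] [Fintype B] (φ : A → B) (hφ : Injective φ) (H : B → ℝ) (h0 : ∀ b, 0 ≤ H b) :
    ∑ a, H (φ a) ≤ ∑ b, H b := by
  classical
  rw [← Finset.sum_image (f := H) (s := Finset.univ) (g := φ) (fun x _ y _ h => hφ h)]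
  exact Finset.sum_le_sum_of_subset_of_nonneg (Finset.subset_univ _) fun b _ _ => h0 b

/-- size of the extended terms -/
noncomputable def szf {D l : ℕ} {ι Ω : Type} [Fintype ι] [Fintype Ω] (T : (Fin (D + 1) → ι) → Ω → ℝ)
    (σ : Fin (D + 1) → Equiv.Perm (Fin (l + 1))) (a : Fin l → ι) (w : Fin l → Ω) (Y : Fin D × Fin l → ι → ℝ) : ℝ :=
  ∑ j : Fin (D + 1) → ι, ∑ w0, FF T σ (cb (fun s => bs (j s)) (zc (fun r => bs (a r)) Y)) (Fin.cons w0 w : Fin (l + 1) → Ω) ^ 2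

lemma szf_ml {D l : ℕ} {ι Ω : Type} [Fintype ι] [Fintype Ω] (T : (Fin (D + 1) → ι) → Ω → ℝ)
    (σ : Fin (D + 1) → Equiv.Perm (Fin (l + 1))) (j : Fin (D + 1) → ι → ℝ) (a : Fin l → ι → ℝ) (w : Fin (l + 1) → Ω) :
    IsML (fun Y : Fin D × Fin l → ι → ℝ => FF T σ (cb j (zc a Y)) w) :=
  (FF_ml T σ w).comp _ (fun p => (p.1.succ, p.2.succ)) fun y a x => by rw [zc_upd, cb_upd2]

lemma szf_pg {D l : ℕ} {ι Ω : Type} [Fintype ι] [Fintype Ω] (T : (Fin (D + 1) → ι) → Ω → ℝ)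
    (σ : Fin (D + 1) → Equiv.Perm (Fin (l + 1))) (a : Fin l → ι) (w : Fin l → Ω) : PG (szf T σ a w) :=
  PG.sum _ fun j => PG.sum _ fun w0 => (szf_ml T σ _ _ _).pg.pow 2

lemma szf_energy {D l : ℕ} {ι Ω : Type} [Fintype ι] [Fintype Ω] (T : (Fin (D + 1) → ι) → Ω → ℝ)
    (σ : Fin (D + 1) → Equiv.Perm (Fin (l + 1))) :
    ∑ w, ∑ a, ∫ Y, szf T σ a w Y ∂(Measure.pi fun _ : Fin D × Fin l => gs ι) ≤ (∑ i, ∑ w, T i w ^ 2) ^ (l + 1) := by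
  classical
  have h1 : ∀ w a, ∫ Y, szf T σ a w Y ∂(Measure.pi fun _ : Fin D × Fin l => gs ι) =
      ∑ j : Fin (D + 1) → ι, ∑ w0, ∑ K : Fin D × Fin l → ι, FF T σ (fun p => bs (cb j (zc a K) p)) (Fin.cons w0 w : Fin (l + 1) → Ω) ^ 2 := by
    intro w a
    unfold szf
    rw [integral_finsetSum _ fun j _ => (PG.sum _ fun w0 => (szf_ml T σ _ _ _).pg.pow 2).integrable _]
    refine Finset.sum_congr rfl fun j _ => ?_
    rw [integral_finsetSum _ fun j _ => ((szf_ml T σ _ _ _).pg.pow 2).integrable _]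
    refine Finset.sum_congr rfl fun w0 _ => ?_
    rw [(szf_ml T σ _ _ _).energy]
    simp only [zc_map, cb_map]
  simp only [h1]
  have h2 := FF_energy T σ
  rw [Fintype.card_fin] at h2
  rw [← h2]
  let φ : ((Fin l → Ω) × (Fin l → ι) × (Fin (D + 1) → ι) × Ω × (Fin D × Fin l → ι)) → ((Fin (D + 1) × Fin (l + 1) → ι) × (Fin (l + 1) → Ω)) :=
    fun q => (cb q.2.2.1 (zc q.2.1 q.2.2.2.2), Fin.cons q.2.2.2.1 q.1)
  have hφ : Injective φ := by
    rintro ⟨w, a, j, w0, K⟩ ⟨w', a', j', w0', K'⟩ h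
    have h1 := (Prod.mk.inj h).1
    have h2 := (Prod.mk.inj h).2
    rw [Fin.cons_inj] at h2
    have e1 : j = j' := funext fun s => by simpa using congrFun h1 (s, 0)
    have e2 : a = a' := funext fun r => by simpa using congrFun h1 (0, r.succ)
    have e3 : K = K' := funext fun p => by simpa using congrFun h1 (p.1.succ, p.2.succ)
    have e4 : w0 = w0' := h2.1
    have e5 : w = w' := h2.2
    rw [e1, e2, e3, e4, e5]
  have h3 := sum_inj_le φ hφ (fun p => FF T σ (fun q => bs (p.1 q)) p.2 ^ 2) fun p => sq_nonneg _
  simpa only [Fintype.sum_prod_type] using h3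

end ML


section Ry
open Function

lemma ryser_slots {S κ : Type} [Fintype S] [DecidableEq S] [Fintype κ] [DecidableEq κ] (p q : S → κ → κ → ℝ) :
    ∑ ω : Finset (S × κ), (-1 : ℝ) ^ ωᶜ.card * ∏ s, ∏ r, ∑ j, (if (s, j) ∈ ω then p s r j else q s r j) =
      ∑ π : S → Equiv.Perm κ, ∏ s, ∏ r, (p s r (π s r) - q s r (π s r)) := by
  have h := ryser (J := S × κ) (fun _ => 0) (fun x y => if x.1 = y.1 then p x.1 x.2 y.2 else 0)
    (fun x y => if x.1 = y.1 then q x.1 x.2 y.2 else 0)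
  have h1 : ∀ ω : Finset (S × κ), ∏ x : S × κ, ((0:ℝ) + ∑ y : S × κ, if y ∈ ω then (if x.1 = y.1 then p x.1 x.2 y.2 else 0) else (if x.1 = y.1 then q x.1 x.2 y.2 else 0))
      = ∏ s, ∏ r, ∑ j, (if (s, j) ∈ ω then p s r j else q s r j) := by
    intro ω
    rw [Fintype.prod_prod_type]
    refine Finset.prod_congr rfl fun s _ => Finset.prod_congr rfl fun r _ => ?_
    rw [zero_add, Fintype.sum_prod_type, Finset.sum_eq_single s]
    · simp
    · intro s' _ hs
      exact Finset.sum_eq_zero fun j _ => by simp [Ne.symm hs]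
    · simp
  simp only [h1] at h
  rw [h]
  symm
  refine Finset.sum_of_injOn (fun π => Equiv.prodCongrRight π) ?_ ?_ ?_ ?_
  · intro π _ π' _ h
    funext s
    ext r
    have := congrArg (fun e : Equiv.Perm (S × κ) => (e (s, r)).2) h
    simpa using this
  · intro π _; simp
  · intro σ _ hσ
    by_contra hne
    apply hσ
    have h2 : ∀ x : S × κ, x.1 = (σ x).1 := by
      intro x
      by_contra hx
      exact hne (Finset.prod_eq_zero (Finset.mem_univ x) (by simp [hx]))
    have h3 : ∀ x : S × κ, x.1 = (σ.symm x).1 := by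
      intro x
      have := h2 (σ.symm x)
      rw [Equiv.apply_symm_apply] at this
      exact this.symm
    refine ⟨fun s => ⟨fun r => (σ (s, r)).2, fun r => (σ.symm (s, r)).2, ?_, ?_⟩, by simp, ?_⟩
    · intro r
      have e : (s, (σ (s, r)).2) = σ (s, r) := Prod.ext (h2 (s, r)) rfl
      simp [e]
    · intro r
      have e : (s, (σ.symm (s, r)).2) = σ.symm (s, r) := Prod.ext (h3 (s, r)) rfl
      simp [e]
    · ext ⟨s, r⟩
      · exact h2 (s, r)
      · rfl
  · intro π _
    rw [Fintype.prod_prod_type]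
    simp

lemma bf_cons {D : ℕ} {ι Ω : Type} [Fintype ι] (T : (Fin (D + 1) → ι) → Ω → ℝ) (v : ι → ℝ) (x : Fin D → ι → ℝ) (w : Ω) :
    bf T (Fin.cons v x : Fin (D + 1) → ι → ℝ) w = ∑ i, T i w * v (i 0) * ∏ s, x s (i s.succ) := by
  unfold bf
  refine Finset.sum_congr rfl fun i _ => ?_
  rw [Fin.prod_univ_succ]
  simp [mul_assoc]

lemma prod_bf {D : ℕ} {ι Ω κ : Type} [Fintype ι] [Fintype κ] [DecidableEq κ] (T : (Fin (D + 1) → ι) → Ω → ℝ) (u : κ → ι → ℝ)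
    (x : κ → Fin D → ι → ℝ) (w : κ → Ω) :
    ∏ r, bf T (Fin.cons (u r) (x r) : Fin (D + 1) → ι → ℝ) (w r) =
      ∑ I : κ → Fin (D + 1) → ι, (∏ r, (T (I r) (w r) * u r (I r 0))) * ∏ s, ∏ r, x r s (I r s.succ) := by
  simp only [bf_cons]
  rw [Finset.prod_univ_sum, Fintype.piFinset_univ]
  refine Finset.sum_congr rfl fun I _ => ?_
  rw [Finset.prod_mul_distrib, Finset.prod_comm]

lemma ryser_bf {D : ℕ} {ι Ω κ : Type} [Fintype ι] [Fintype κ] [DecidableEq κ] (T : (Fin (D + 1) → ι) → Ω → ℝ) (u : κ → ι → ℝ)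
    (w : κ → Ω) (z0 z1 : Fin D × κ → ι → ℝ) :
    ∑ ω : Finset (Fin D × κ), (-1 : ℝ) ^ ωᶜ.card * ∏ r, bf T (Fin.cons (u r) (fun s => ∑ j, if (s, j) ∈ ω then z1 (s, j) else z0 (s, j)) : Fin (D + 1) → ι → ℝ) (w r) =
      ∑ π : Fin D → Equiv.Perm κ, ∏ r, bf T (Fin.cons (u r) (fun s => z1 (s, π s r) - z0 (s, π s r)) : Fin (D + 1) → ι → ℝ) (w r) := by
  simp only [prod_bf T u]
  rw [Finset.sum_comm]
  simp only [Finset.mul_sum]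
  rw [Finset.sum_comm]
  refine Finset.sum_congr rfl fun I _ => ?_
  rw [← Finset.mul_sum]
  have h := ryser_slots (fun (s : Fin D) (r : κ) (j : κ) => z1 (s, j) (I r s.succ)) (fun s r j => z0 (s, j) (I r s.succ))
  simp only [Pi.sub_apply]
  rw [← h, Finset.mul_sum]
  refine Finset.sum_congr rfl fun ω _ => ?_
  have : ∀ s r, (∑ j, if (s, j) ∈ ω then z1 (s, j) else z0 (s, j)) (I r s.succ) = ∑ j, if (s, j) ∈ ω then z1 (s, j) (I r s.succ) else z0 (s, j) (I r s.succ) := by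
    intro s r
    rw [Finset.sum_apply]
    exact Finset.sum_congr rfl fun j _ => by split_ifs <;> rfl
  simp only [this]
  ring

lemma PP_cons {D : ℕ} {ι Ω κ : Type} [Fintype ι] [Fintype κ] [DecidableEq κ] (T : (Fin (D + 1) → ι) → Ω → ℝ)
    (v : κ → ι → ℝ) (Y : Fin D × κ → ι → ℝ) (w : κ → Ω) :
    PP T (zc v Y) w = ∑ τ : Equiv.Perm κ, ((Equiv.Perm.sign τ : ℤ) : ℝ) * ∑ π : Fin D → Equiv.Perm κ,
      ∏ r, bf T (Fin.cons (v (τ r)) (fun s => Y (s, π s r)) : Fin (D + 1) → ι → ℝ) (w r) := by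
  unfold PP
  rw [sum_cons]
  refine Finset.sum_congr rfl fun τ _ => ?_
  rw [Finset.mul_sum]
  refine Finset.sum_congr rfl fun π _ => ?_
  rw [Fin.cons_zero]
  congr 1
  unfold FF
  refine Finset.prod_congr rfl fun r _ => ?_
  congr 1
  funext s
  refine Fin.cases ?_ (fun s => ?_) s <;> simp

lemma ryser_PP {D : ℕ} {ι Ω κ : Type} [Fintype ι] [Fintype κ] [DecidableEq κ] (T : (Fin (D + 1) → ι) → Ω → ℝ) (v : κ → ι → ℝ)
    (w : κ → Ω) (z0 z1 : Fin D × κ → ι → ℝ) :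
    ∑ ω : Finset (Fin D × κ), (-1 : ℝ) ^ ωᶜ.card * Matrix.det (Matrix.of fun r c =>
        bf T (Fin.cons (v c) (fun s => ∑ j, if (s, j) ∈ ω then z1 (s, j) else z0 (s, j)) : Fin (D + 1) → ι → ℝ) (w r)) =
      PP T (zc v (fun p => z1 p - z0 p)) w := by
  rw [PP_cons]
  simp only [← ryser_bf]
  simp only [← Matrix.det_transpose (Matrix.of _), Matrix.det_apply', Matrix.transpose_apply, Matrix.of_apply, Finset.mul_sum]
  rw [Finset.sum_comm]
  refine Finset.sum_congr rfl fun τ _ => Finset.sum_congr rfl fun ω _ => ?_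
  ring

lemma PP_scale {D : ℕ} {ι Ω κ : Type} [Fintype ι] [Fintype κ] [DecidableEq κ] (T : (Fin (D + 1) → ι) → Ω → ℝ)
    (v : κ → ι → ℝ) (Y : Fin D × κ → ι → ℝ) (w : κ → Ω) (c : ℝ) :
    PP T (zc v (fun p => c • Y p)) w = (c ^ D) ^ (Fintype.card κ) * PP T (zc v Y) w := by
  have h : ∀ (u : ι → ℝ) (x : Fin D → ι → ℝ) (w : Ω), bf T (Fin.cons u (fun s => c • x s) : Fin (D + 1) → ι → ℝ) w =
      c ^ D * bf T (Fin.cons u x : Fin (D + 1) → ι → ℝ) w := by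
    intro u x w
    rw [bf_cons, bf_cons, Finset.mul_sum]
    refine Finset.sum_congr rfl fun i _ => ?_
    simp only [Pi.smul_apply, smul_eq_mul, Finset.prod_mul_distrib, Finset.prod_const, Finset.card_univ, Fintype.card_fin]
    ring
  rw [PP_cons, PP_cons, Finset.mul_sum]
  refine Finset.sum_congr rfl fun τ _ => ?_
  simp only [Finset.mul_sum]
  refine Finset.sum_congr rfl fun π _ => ?_
  simp only [h (v (τ _)) (fun s => Y (s, π s _)), Finset.prod_mul_distrib, Finset.prod_const, Finset.card_univ]
  ring

/-- discrete total size of `PP` -/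
noncomputable def SS {D : ℕ} {ι Ω κ : Type} [Fintype ι] [Fintype Ω] [Fintype κ] [DecidableEq κ] (T : (Fin (D + 1) → ι) → Ω → ℝ)
    (Y : Fin D × κ → ι → ℝ) : ℝ := ∑ w : κ → Ω, ∑ a : κ → ι, PP T (zc (fun r => bs (a r)) Y) w ^ 2

lemma SS_pg {D : ℕ} {ι Ω κ : Type} [Fintype ι] [Fintype Ω] [Fintype κ] [DecidableEq κ] (T : (Fin (D + 1) → ι) → Ω → ℝ) :
    PG (SS (κ := κ) T) :=
  PG.sum _ fun w => PG.sum _ fun a =>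
    ((PP_ml T w).comp _ (fun p : Fin D × κ => (p.1.succ, p.2)) fun y p x => zc_upd _ y p x).pg.pow 2

lemma bf_row {D : ℕ} {ι Ω : Type} [Fintype ι] (T : (Fin (D + 1) → ι) → Ω → ℝ) (v : ι → ℝ) (x : Fin D → ι → ℝ) (w : Ω) :
    ∑ a, bf T (Fin.cons (bs a) x : Fin (D + 1) → ι → ℝ) w * v a = bf T (Fin.cons v x : Fin (D + 1) → ι → ℝ) w := by
  simp only [bf_cons, Finset.sum_mul]
  rw [Finset.sum_comm]
  refine Finset.sum_congr rfl fun i _ => ?_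
  rw [Finset.sum_eq_single (i 0)]
  · simp [bs]; ring
  · intro a _ ha; simp [bs, Ne.symm ha]
  · simp

lemma det_disc {κ Ω α : Type} [Fintype κ] [DecidableEq κ] [Fintype α] [Fintype Ω] (M : Ω → α → ℝ) (ρ : ℝ) (hρ : 0 < ρ)
    (h : ρ ≤ (gs α).real {v | ∑ w, (∑ a, M w a * v a) ^ 2 ≤ 1}) :
    ∑ w : κ → Ω, ∑ i : κ → α, Matrix.det (Matrix.of fun r c => M (w r) (i c)) ^ 2 ≤
      3 * ((Fintype.card κ).factorial : ℝ) ^ 2 * (Fintype.card κ : ℝ) ^ (Fintype.card κ) * (ρ ^ 2)⁻¹ := by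
  refine le_trans (le_of_eq ?_) (det_bound (κ := κ) M ρ hρ h)
  simp only [det_cols]
  rw [integral_finsetSum _ fun w _ => (by fun_prop : PG _).integrable _]
  simp only [tensor_energy]

end Ry


section Prob
open Function

lemma fub_good {X Y : Type*} [MeasurableSpace X] [MeasurableSpace Y] (μ : Measure X) (ν : Measure Y)
    [IsProbabilityMeasure μ] [IsProbabilityMeasure ν] (A : Set (X × Y)) (hA : MeasurableSet A) (ρ : ℝ) (hρ : 0 ≤ ρ)
    (h : ρ ≤ (μ.prod ν).real A) : ρ / 2 ≤ μ.real {x | ρ / 2 ≤ ν.real (Prod.mk x ⁻¹' A)} := by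
  have hm : Measurable fun x => ν.real (Prod.mk x ⁻¹' A) := (measurable_measure_prodMk_left hA).ennreal_toReal
  have h1 : (μ.prod ν).real A = ∫ x, ν.real (Prod.mk x ⁻¹' A) ∂μ := by
    rw [measureReal_def, Measure.prod_apply hA, ← integral_toReal]
    · rfl
    · exact (measurable_measure_prodMk_left hA).aemeasurable
    · exact Filter.Eventually.of_forall fun x => measure_lt_top _ _
  set S := {x | ρ / 2 ≤ ν.real (Prod.mk x ⁻¹' A)} with hS
  have hSm : MeasurableSet S := measurableSet_le measurable_const hm
  have hi : Integrable (fun x => ν.real (Prod.mk x ⁻¹' A)) μ :=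
    Integrable.of_bound hm.aestronglyMeasurable 1 (Filter.Eventually.of_forall fun x => by
      rw [Real.norm_of_nonneg measureReal_nonneg]; exact measureReal_le_one)
  have h2 : ∫ x, ν.real (Prod.mk x ⁻¹' A) ∂μ ≤ ∫ x, (S.indicator (fun _ => (1:ℝ)) x + ρ / 2) ∂μ := by
    refine integral_mono hi (((integrable_const _).indicator hSm).add (integrable_const _)) fun x => ?_
    by_cases hx : x ∈ S
    · have : ν.real (Prod.mk x ⁻¹' A) ≤ 1 := measureReal_le_one
      simp only [Set.indicator_of_mem hx]; linarith
    · simp only [Set.indicator_of_notMem hx]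
      have : ν.real (Prod.mk x ⁻¹' A) < ρ / 2 := not_le.1 hx
      linarith
  rw [integral_add ((integrable_const _).indicator hSm) (integrable_const _), integral_indicator hSm] at h2
  simp at h2
  linarith


lemma SS_prob (D L : ℕ) (hL : 0 < L) : ∃ C : ℝ, 0 < C ∧ ∀ (ι Ω : Type) [Fintype ι] [Fintype Ω] (T : (Fin (D + 1) → ι) → Ω → ℝ) (ρ : ℝ),
    0 < ρ → ρ ≤ (Measure.pi fun _ : Fin (D + 1) => gs ι).real {x | ∑ w, (bf T x w) ^ 2 ≤ 1} →
    (ρ / 2) ^ (2 ^ (D * L)) ≤ (Measure.pi fun _ : Fin D × Fin L => gs ι).real {Y | SS T Y ≤ C / ρ ^ 2} := by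
  refine ⟨(2 * L) ^ (D * L) * (3 * (L.factorial : ℝ) ^ 2 * (L : ℝ) ^ L * 4), by positivity, ?_⟩
  intro ι Ω _ _ T ρ hρ h
  set b : ℝ := (√(L:ℝ))⁻¹ with hb
  have hLr : (0:ℝ) < L := by exact_mod_cast hL
  have hb2 : b ^ 2 * L = 1 := by
    rw [hb, inv_pow, Real.sq_sqrt hLr.le]; field_simp
  -- good set in x
  let A : Set ((Fin D → ι → ℝ) × (ι → ℝ)) := {p | ∑ w, (bf T (Fin.cons p.2 p.1 : Fin (D + 1) → ι → ℝ) w) ^ 2 ≤ 1}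
  have hcons : MeasurePreserving (fun p : (Fin D → ι → ℝ) × (ι → ℝ) => (Fin.cons p.2 p.1 : Fin (D + 1) → ι → ℝ))
      ((Measure.pi fun _ => gs ι).prod (gs ι)) (Measure.pi fun _ => gs ι) :=
    (mp_cons (l := D) (gs ι)).comp Measure.measurePreserving_swap
  have hmeas : MeasurableSet {x : Fin (D + 1) → ι → ℝ | ∑ w, (bf T x w) ^ 2 ≤ 1} := by
    refine measurableSet_le ?_ measurable_const
    exact (PG.sum _ fun w => (bf_ml T w).pg.pow 2).cont.measurable
  have hA : MeasurableSet A := hcons.measurable hmeas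
  have hA1 : ρ ≤ ((Measure.pi fun _ : Fin D => gs ι).prod (gs ι)).real A := by
    refine h.trans (le_of_eq ?_)
    rw [measureReal_def, measureReal_def, ← hcons.measure_preimage hmeas.nullMeasurableSet]
    rfl
  set G : Set (Fin D → ι → ℝ) := {x | ρ / 2 ≤ (gs ι).real (Prod.mk x ⁻¹' A)} with hG
  have hGm : MeasurableSet G := measurableSet_le measurable_const (measurable_measure_prodMk_left hA).ennreal_toReal
  have hGp : ρ / 2 ≤ (Measure.pi fun _ : Fin D => gs ι).real G := fub_good _ _ A hA ρ hρ.le hA1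
  -- copies
  let M : Matrix (Fin D) (Fin D × Fin L) ℝ := fun s q => if s = q.1 then b else 0
  have hM : M * M.transpose = 1 := by
    ext s s'
    rw [Matrix.mul_apply, Fintype.sum_prod_type, Matrix.one_apply]
    have ht : ∀ q s, M.transpose q s = if s = q.1 then b else 0 := fun _ _ => rfl
    simp only [ht]
    simp only [M]
    by_cases hs : s = s'
    · subst hs
      rw [Finset.sum_eq_single s]
      · simp; nlinarith
      · intro t _ ht; simp [Ne.symm ht]
      · simp
    · rw [if_neg hs]
      refine Finset.sum_eq_zero fun t _ => Finset.sum_eq_zero fun j _ => ?_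
      by_cases h1 : s = t
      · subst h1; simp [Ne.symm hs]
      · simp [h1]
  have hmp := mp_copies (ι := ι) M hM
  have hcopy : ∀ (z : Fin D × Fin L → ι → ℝ) s, ∑ k, M s k • z k = ∑ j, b • z (s, j) := by
    intro z s
    rw [Fintype.sum_prod_type, Finset.sum_eq_single s]
    · simp [M]
    · intro t _ ht; simp [M, Ne.symm ht]
    · simp
  set G' : Set (Fin D × Fin L → ι → ℝ) := (fun (z : Fin D × Fin L → ι → ℝ) (j : Fin D) => ∑ k, M j k • z k) ⁻¹' G with hG'
  have hG'm : MeasurableSet G' := hmp.measurable hGm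
  have hG'p : ρ / 2 ≤ (Measure.pi fun _ : Fin D × Fin L => gs ι).real G' := by
    refine hGp.trans (le_of_eq ?_)
    rw [measureReal_def, measureReal_def, ← hmp.measure_preimage hGm.nullMeasurableSet]
  have hbox := box_cs (gs ι) G' hG'm
  have hbox2 : (ρ / 2) ^ (2 ^ (D * L)) ≤ ((Measure.pi fun _ : Fin D × Fin L => gs ι).prod (Measure.pi fun _ : Fin D × Fin L => gs ι)).real
      {p | ∀ ω : Finset (Fin D × Fin L), ω.piecewise p.2 p.1 ∈ G'} := by
    refine (pow_le_pow_left₀ (by positivity) hG'p _).trans ?_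
    have := ENNReal.toReal_mono (measure_ne_top _ _) hbox
    rw [ENNReal.toReal_pow, Fintype.card_prod, Fintype.card_fin, Fintype.card_fin] at this
    exact this
  refine hbox2.trans ?_
  have hSm : MeasurableSet {Y : Fin D × Fin L → ι → ℝ | SS T Y ≤ (2 * L) ^ (D * L) * (3 * (L.factorial : ℝ) ^ 2 * (L : ℝ) ^ L * 4) / ρ ^ 2} :=
    measurableSet_le (SS_pg T).cont.measurable measurable_const
  rw [measureReal_def (Measure.pi _) _, ← (mp_diff (J := Fin D × Fin L) (ι := ι)).measure_preimage hSm.nullMeasurableSet, ← measureReal_def]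
  refine measureReal_mono ?_ (measure_ne_top _ _)
  rintro ⟨p0, p1⟩ hp
  simp only [Set.mem_ofPred_eq, Set.mem_preimage] at hp ⊢
  set Y : Fin D × Fin L → ι → ℝ := fun j => (-(√2)⁻¹) • p0 j + (√2)⁻¹ • p1 j with hY
  have hYe : ∀ q, b • p1 q - b • p0 q = (b * √2) • Y q := by
    intro q
    have : b * √2 * (√2)⁻¹ = b := by field_simp
    simp only [hY, smul_add, smul_smul, mul_neg, this]
    simp only [neg_smul]; abel
  have hdet : ∀ ω : Finset (Fin D × Fin L), ∑ w : Fin L → Ω, ∑ a : Fin L → ι, Matrix.det (Matrix.of fun r c =>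
        bf T (Fin.cons (bs (a c)) (fun s => ∑ j, if (s, j) ∈ ω then b • p1 (s, j) else b • p0 (s, j)) : Fin (D + 1) → ι → ℝ) (w r)) ^ 2
        ≤ 3 * (L.factorial : ℝ) ^ 2 * (L : ℝ) ^ L * ((ρ / 2) ^ 2)⁻¹ := by
    intro ω
    have h1 := hp ω
    rw [hG', Set.mem_preimage, hG, Set.mem_ofPred_eq] at h1
    simp only [hcopy] at h1
    have h2 := det_disc (κ := Fin L) (fun w a => bf T (Fin.cons (bs a) (fun s => ∑ j, b • (ω.piecewise p1 p0) (s, j)) : Fin (D + 1) → ι → ℝ) w) (ρ / 2) (by positivity) (by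
      refine h1.trans (le_of_eq ?_)
      congr 1
      ext v
      simp only [bf_row]
      rfl)
    rw [Fintype.card_fin] at h2
    refine le_trans (le_of_eq ?_) h2
    have e : (fun s => ∑ j, if (s, j) ∈ ω then b • p1 (s, j) else b • p0 (s, j)) = fun s => ∑ j, b • (ω.piecewise p1 p0) (s, j) := by
      funext s
      refine Finset.sum_congr rfl fun j _ => ?_
      by_cases hj : (s, j) ∈ ω <;> simp [Finset.piecewise, hj]
    rw [e]
  have hkey : ∀ (w : Fin L → Ω) (a : Fin L → ι), (2 / L : ℝ) ^ (D * L) * PP T (zc (fun r => bs (a r)) Y) w ^ 2 ≤ 2 ^ (D * L) * ∑ ω : Finset (Fin D × Fin L),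
      Matrix.det (Matrix.of fun r c =>
        bf T (Fin.cons (bs (a c)) (fun s => ∑ j, if (s, j) ∈ ω then b • p1 (s, j) else b • p0 (s, j)) : Fin (D + 1) → ι → ℝ) (w r)) ^ 2 := by
    intro w a
    have h1 := ryser_PP T (fun r => bs (a r)) w (fun q => b • p0 q) (fun q => b • p1 q)
    simp only [hYe] at h1
    rw [PP_scale, Fintype.card_fin] at h1
    have h2 := sq_sum_le_card_mul_sum_sq (s := (Finset.univ : Finset (Finset (Fin D × Fin L)))) (f := fun ω => (-1 : ℝ) ^ ωᶜ.card * Matrix.det (Matrix.of fun r c =>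
        bf T (Fin.cons (bs (a c)) (fun s => ∑ j, if (s, j) ∈ ω then b • p1 (s, j) else b • p0 (s, j)) : Fin (D + 1) → ι → ℝ) (w r)))
    rw [h1] at h2
    simp only [mul_pow, ← pow_mul, mul_comm _ 2, pow_mul (-1 : ℝ) 2, neg_one_sq, one_pow, one_mul] at h2
    rw [Finset.card_univ, Fintype.card_finset, Fintype.card_prod, Fintype.card_fin, Fintype.card_fin] at h2
    push_cast at h2
    refine le_trans (le_of_eq ?_) h2
    congr 1
    have hc : (2 / L : ℝ) = b ^ 2 * √2 ^ 2 := by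
      rw [Real.sq_sqrt (by norm_num)]; field_simp; linarith
    rw [hc, mul_pow, ← pow_mul, ← pow_mul]

  have hfin : (2 / L : ℝ) ^ (D * L) * SS T Y ≤ 2 ^ (D * L) * (2 ^ (D * L) * (3 * (L.factorial : ℝ) ^ 2 * (L : ℝ) ^ L * ((ρ / 2) ^ 2)⁻¹)) := by
    unfold SS
    simp only [Finset.mul_sum]
    refine (Finset.sum_le_sum fun w _ => Finset.sum_le_sum fun a _ => hkey w a).trans ?_
    simp only [← Finset.mul_sum]
    refine mul_le_mul_of_nonneg_left ?_ (by positivity)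
    refine le_trans (le_of_eq (Finset.sum_congr rfl fun w _ => Finset.sum_comm)) ?_
    rw [Finset.sum_comm]
    refine (Finset.sum_le_sum fun ω _ => hdet ω).trans (le_of_eq ?_)
    rw [Finset.sum_const, Finset.card_univ, Fintype.card_finset, Fintype.card_prod, Fintype.card_fin, Fintype.card_fin, nsmul_eq_mul]
    push_cast
    rfl
  have h2L : (0:ℝ) < (2 / L) ^ (D * L) := by positivity
  rw [← mul_le_mul_iff_right₀ h2L]
  refine hfin.trans (le_of_eq ?_)
  have : (2 / L : ℝ) ^ (D * L) * (2 * L) ^ (D * L) = 2 ^ (D * L) * 2 ^ (D * L) := by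
    rw [← mul_pow, ← mul_pow]; congr 1; field_simp
  rw [mul_div_assoc', ← mul_assoc, ← mul_assoc ((2 / L : ℝ) ^ (D * L)), this]
  field_simp
  ring

end Prob


section Ext
open Function

lemma mp_cb {S : Type} [Fintype S] {l : ℕ} {V : Type} [MeasurableSpace V] (μ : Measure V) [SigmaFinite μ] :
    MeasurePreserving (fun p : (S × Fin l → V) × (S → V) => cb p.2 p.1)
      ((Measure.pi fun _ => μ).prod (Measure.pi fun _ => μ)) (Measure.pi fun _ => μ) := by
  have hm : Measurable (fun p : (S × Fin l → V) × (S → V) => cb p.2 p.1) := by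
    refine measurable_pi_lambda _ ?_
    rintro ⟨s, r⟩
    refine Fin.cases ?_ (fun r => ?_) r
    · simp only [cb_zero]; fun_prop
    · simp only [cb_succ]; fun_prop
  refine ⟨hm, ?_⟩
  refine (Measure.pi_eq fun s hs => ?_).symm
  rw [Measure.map_apply hm (MeasurableSet.univ_pi hs)]
  have e : (fun p : (S × Fin l → V) × (S → V) => cb p.2 p.1) ⁻¹' Set.univ.pi s =
      (Set.univ.pi fun q : S × Fin l => s (q.1, q.2.succ)) ×ˢ (Set.univ.pi fun t : S => s (t, 0)) := by
    ext ⟨Y, y⟩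
    simp only [Set.mem_preimage, Set.mem_prod, Set.mem_univ_pi]
    constructor
    · intro h
      exact ⟨fun q => by simpa using h (q.1, q.2.succ), fun t => by simpa using h (t, 0)⟩
    · rintro ⟨h1, h2⟩ ⟨t, r⟩
      refine Fin.cases ?_ (fun r => ?_) r
      · exact h2 t
      · exact h1 (t, r)
  rw [e, Measure.prod_prod, Measure.pi_pi, Measure.pi_pi, Fintype.prod_prod_type, Fintype.prod_prod_type, mul_comm, ← Finset.prod_mul_distrib]
  refine Finset.prod_congr rfl fun t _ => ?_
  rw [Fin.prod_univ_succ]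

lemma SS_zero {D : ℕ} {ι Ω : Type} [Fintype ι] [Fintype Ω] (T : (Fin (D + 1) → ι) → Ω → ℝ)
    (Y : Fin D × Fin 0 → ι → ℝ) : SS T Y = 1 := by
  unfold SS PP FF
  simp

lemma SS_succ {D l : ℕ} {ι Ω : Type} [Fintype ι] [Fintype Ω] (T : (Fin (D + 1) → ι) → Ω → ℝ)
    (Y : Fin D × Fin l → ι → ℝ) (y : Fin D → ι → ℝ) : SS T (cb y Y) =
      ∑ w : Fin l → Ω, ∑ a : Fin l → ι, ∑ w0, ∑ a0,
        PP T (cb (Fin.cons (bs a0) y : Fin (D + 1) → ι → ℝ) (zc (fun r => bs (a r)) Y)) (Fin.cons w0 w : Fin (l + 1) → Ω) ^ 2 := by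
  unfold SS
  have e : ∀ (a0 : ι) (a : Fin l → ι), (fun r => bs ((Fin.cons a0 a : Fin (l + 1) → ι) r)) = (Fin.cons (bs a0) (fun r => bs (a r)) : Fin (l + 1) → ι → ℝ) := by
    intro a0 a
    funext r
    refine Fin.cases ?_ (fun r => ?_) r <;> simp
  simp only [sum_cons, e, zc_cb]
  rw [Finset.sum_comm]
  refine Finset.sum_congr rfl fun w _ => ?_
  symm
  rw [Finset.sum_comm]
  refine Finset.sum_congr rfl fun w0 _ => ?_
  rw [Finset.sum_comm]

/-- dependence only on slots in `S` -/
def Dep {D : ℕ} {ι : Type} (S : Finset (Fin D)) (f : (Fin D → ι) → ℝ) : Prop :=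
  ∀ i i', (∀ s ∈ S, i s = i' s) → f i = f i'

def Spl {D : ℕ} {ι Ω : Type} (T : (Fin D → ι) → Ω → ℝ) : Prop :=
  ∃ (S : Finset (Fin D)) (f : (Fin D → ι) → ℝ) (g : (Fin D → ι) → Ω → ℝ), S.Nonempty ∧ Dep S f ∧
    (∀ w, Dep Sᶜ (fun i => g i w)) ∧ ∀ i w, T i w = f i * g i w

lemma spl_FF {D l : ℕ} {ι Ω : Type} [Fintype ι] (T : (Fin (D + 1) → ι) → Ω → ℝ)
    (σ : Fin (D + 1) → Equiv.Perm (Fin (l + 1))) (hσ : ∃ s, σ s 0 ≠ 0) (Z : Fin (D + 1) × Fin l → ι → ℝ) (w : Fin l → Ω) (c : ℝ) :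
    Spl (fun i w0 => c * FF T σ (cb (fun s => bs (i s)) Z) (Fin.cons w0 w : Fin (l + 1) → Ω)) := by
  refine ⟨Finset.univ.filter fun s => σ s 0 ≠ 0,
    fun i => c * ∏ r : Fin l, bf T (fun s => cb (fun s => bs (i s)) Z (s, σ s r.succ)) (w r),
    fun i w0 => bf T (fun s => cb (fun s => bs (i s)) Z (s, σ s 0)) w0, ?_, ?_, ?_, ?_⟩
  · obtain ⟨s, hs⟩ := hσ
    exact ⟨s, by simpa using hs⟩
  · intro i i' h
    simp only
    congr 1
    refine Finset.prod_congr rfl fun r _ => ?_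
    congr 1
    funext s
    by_cases h0 : σ s r.succ = 0
    · have h1 : σ s 0 ≠ 0 := fun h => Fin.succ_ne_zero r ((σ s).injective (h0.trans h.symm))
      have h2 := h s (by simpa using h1)
      rw [h0, cb_zero, cb_zero, h2]
    · obtain ⟨t, ht⟩ := Fin.exists_succ_eq.2 h0
      rw [← ht, cb_succ, cb_succ]
  · intro w i i' h
    simp only
    congr 1
    funext s
    by_cases h0 : σ s 0 = 0
    · have h2 := h s (by simpa using h0)
      rw [h0, cb_zero, cb_zero, h2]
    · obtain ⟨t, ht⟩ := Fin.exists_succ_eq.2 h0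
      rw [← ht, cb_succ, cb_succ]
  · intro i w0
    unfold FF
    beta_reduce
    rw [Fin.prod_univ_succ]
    simp only [Fin.cons_zero, Fin.cons_succ]
    ring

lemma cb_ml {D l : ℕ} {ι Ω : Type} [Fintype ι] (T : (Fin (D + 1) → ι) → Ω → ℝ)
    (Z : Fin (D + 1) × Fin l → ι → ℝ) (w : Fin (l + 1) → Ω) :
    IsML (fun j : Fin (D + 1) → ι → ℝ => PP T (cb j Z) w) :=
  (PP_ml T w).comp _ (fun s => (s, 0)) fun y a x => by rw [cb_upd1]

lemma tele (q : ℕ → ℝ) (L : ℕ) (ρ : ℝ) (hρ : 0 < ρ) (h0 : q 0 = 0) (hL : ρ ≤ q L) : ∃ l < L, ρ / L ≤ q (l + 1) - q l := by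
  by_contra hne
  push Not at hne
  have h1 : ∑ l ∈ Finset.range L, (q (l + 1) - q l) = q L - q 0 := Finset.sum_range_sub q L
  rcases Nat.eq_zero_or_pos L with h | h
  · subst h; linarith
  have h2 : ∑ l ∈ Finset.range L, (q (l + 1) - q l) < ∑ l ∈ Finset.range L, ρ / L :=
    Finset.sum_lt_sum_of_nonempty (by simpa using h.ne') fun l hl => hne l (Finset.mem_range.1 hl)
  have h3 : (L:ℝ) ≠ 0 := by positivity
  rw [h1, Finset.sum_const, Finset.card_range, nsmul_eq_mul, mul_div_cancel₀ _ h3] at h2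
  linarith


lemma ext_sel {D L : ℕ} {ι Ω : Type} [Fintype ι] [Fintype Ω] (T : (Fin (D + 1) → ι) → Ω → ℝ) (B β ρ : ℝ)
    (hB : ∑ i, ∑ w, T i w ^ 2 ≤ B) (hB1 : 1 ≤ B) (hβ : 1 ≤ β) (hρ : 0 < ρ)
    (h : ρ ≤ (Measure.pi fun _ : Fin D × Fin L => gs ι).real {Y | SS T Y < β ^ L}) :
    ∃ l < L, ∃ Y : Fin D × Fin l → ι → ℝ, β ^ l ≤ SS T Y ∧
      ρ / (2 * L) ≤ (Measure.pi fun _ : Fin D => gs ι).real {y | SS T (cb y Y) < β ^ (l + 1)} ∧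
      ∑ σ : Fin (D + 1) → Equiv.Perm (Fin (l + 1)), ∑ w, ∑ a, szf T σ a w Y ≤ 4 * L * ((L.factorial : ℝ) ^ (D + 1) * B ^ L + 1) / ρ := by
  obtain ⟨l, hl, hq⟩ := tele (fun l => (Measure.pi fun _ : Fin D × Fin l => gs ι).real {Y | SS T Y < β ^ l}) L ρ hρ
    (by simp [SS_zero]) h
  refine ⟨l, hl, ?_⟩
  have hL : (0:ℝ) < L := by exact_mod_cast (by omega : 0 < L)
  set ρ3 := ρ / L with hρ3
  have hρ3p : 0 < ρ3 := by positivity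
  let A : Set ((Fin D × Fin l → ι → ℝ) × (Fin D → ι → ℝ)) := {p | SS T (cb p.2 p.1) < β ^ (l + 1)}
  let A2 : Set ((Fin D × Fin l → ι → ℝ) × (Fin D → ι → ℝ)) := {p | SS T p.1 < β ^ l}
  have hm1 : MeasurableSet {Y : Fin D × Fin (l + 1) → ι → ℝ | SS T Y < β ^ (l + 1)} :=
    measurableSet_lt (SS_pg T).cont.measurable measurable_const
  have hm2 : MeasurableSet {Y : Fin D × Fin l → ι → ℝ | SS T Y < β ^ l} :=
    measurableSet_lt (SS_pg T).cont.measurable measurable_const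
  have hA : MeasurableSet A := (mp_cb (gs ι)).measurable hm1
  have hA2 : MeasurableSet A2 := measurable_fst hm2
  have hAq : ((Measure.pi fun _ : Fin D × Fin l => gs ι).prod (Measure.pi fun _ : Fin D => gs ι)).real A =
      (Measure.pi fun _ : Fin D × Fin (l + 1) => gs ι).real {Y | SS T Y < β ^ (l + 1)} := by
    rw [measureReal_def, measureReal_def, ← (mp_cb (gs ι)).measure_preimage hm1.nullMeasurableSet]
    rfl
  have hA2q : ((Measure.pi fun _ : Fin D × Fin l => gs ι).prod (Measure.pi fun _ : Fin D => gs ι)).real A2 =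
      (Measure.pi fun _ : Fin D × Fin l => gs ι).real {Y | SS T Y < β ^ l} := by
    rw [measureReal_def, measureReal_def, ← (measurePreserving_fst (μ := Measure.pi fun _ : Fin D × Fin l => gs ι) (ν := Measure.pi fun _ : Fin D => gs ι)).measure_preimage hm2.nullMeasurableSet]
    rfl
  have hAA : ρ3 ≤ ((Measure.pi fun _ : Fin D × Fin l => gs ι).prod (Measure.pi fun _ : Fin D => gs ι)).real (A \ A2) := by
    have := le_measureReal_sdiff (μ := (Measure.pi fun _ : Fin D × Fin l => gs ι).prod (Measure.pi fun _ : Fin D => gs ι)) (s₁ := A) (s₂ := A2)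
    rw [hAq, hA2q] at this
    exact hq.trans this
  have hfub := fub_good _ _ (A \ A2) (hA.diff hA2) ρ3 hρ3p.le hAA
  set θ : (Fin D × Fin l → ι → ℝ) → ℝ := fun Y => ∑ σ : Fin (D + 1) → Equiv.Perm (Fin (l + 1)), ∑ w, ∑ a, szf T σ a w Y with hθ
  have hθpg : PG θ := PG.sum _ fun σ => PG.sum _ fun w => PG.sum _ fun a => szf_pg T σ a w
  have hsz0 : ∀ σ a w Y, 0 ≤ szf (l := l) T σ a w Y := fun σ a w Y =>
    Finset.sum_nonneg fun j _ => Finset.sum_nonneg fun w0 _ => sq_nonneg _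
  have hθ0 : ∀ Y, 0 ≤ θ Y := fun Y => Finset.sum_nonneg fun σ _ => Finset.sum_nonneg fun w _ => Finset.sum_nonneg fun a _ => hsz0 _ _ _ _
  have hBB : ∑ i, ∑ w, T i w ^ 2 ≤ B := hB
  have hT0 : 0 ≤ ∑ i, ∑ w, T i w ^ 2 := Finset.sum_nonneg fun σ _ => Finset.sum_nonneg fun w _ => sq_nonneg _
  have hθi : ∫ Y, θ Y ∂(Measure.pi fun _ : Fin D × Fin l => gs ι) ≤ (L.factorial : ℝ) ^ (D + 1) * B ^ L := by
    rw [hθ, integral_finsetSum _ fun σ _ => (PG.sum _ fun w => PG.sum _ fun a => szf_pg T σ a w).integrable _]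
    have e : ∀ σ : Fin (D + 1) → Equiv.Perm (Fin (l + 1)), ∫ Y, ∑ w, ∑ a, szf T σ a w Y ∂(Measure.pi fun _ : Fin D × Fin l => gs ι) ≤ B ^ L := by
      intro σ
      rw [integral_finsetSum _ fun w _ => (PG.sum _ fun a => szf_pg T σ a w).integrable _]
      simp only [integral_finsetSum _ fun a _ => (szf_pg T σ a _).integrable _]
      refine (szf_energy T σ).trans ?_
      refine (pow_le_pow_left₀ hT0 hB _).trans (pow_le_pow_right₀ hB1 (by omega))
    refine (Finset.sum_le_sum fun σ _ => e σ).trans ?_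
    rw [Finset.sum_const, Finset.card_univ, Fintype.card_fun, Fintype.card_perm, Fintype.card_fin, Fintype.card_fin, nsmul_eq_mul]
    push_cast
    have : ((l + 1).factorial : ℝ) ≤ L.factorial := by exact_mod_cast Nat.factorial_le (by omega)
    gcongr
  set Θ := (L.factorial : ℝ) ^ (D + 1) * B ^ L + 1 with hΘ
  have hΘp : 0 < Θ := by positivity
  have hmk := markov_real (Measure.pi fun _ : Fin D × Fin l => gs ι) hθpg hθ0 (s := 4 * Θ / ρ3) (by positivity)
  have hmk2 : (Measure.pi fun _ : Fin D × Fin l => gs ι).real {x | 4 * Θ / ρ3 ≤ θ x} < ρ3 / 2 := by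
    refine hmk.trans_lt ?_
    rw [div_lt_iff₀ (by positivity)]
    have : ρ3 / 2 * (4 * Θ / ρ3) = 2 * Θ := by field_simp; ring
    rw [this]; linarith
  obtain ⟨Y, hY1, hY2⟩ : ∃ Y, ρ3 / 2 ≤ (Measure.pi fun _ : Fin D => gs ι).real (Prod.mk Y ⁻¹' (A \ A2)) ∧ θ Y < 4 * Θ / ρ3 := by
    by_contra hne
    push Not at hne
    have : (Measure.pi fun _ : Fin D × Fin l => gs ι).real {x | ρ3 / 2 ≤ (Measure.pi fun _ : Fin D => gs ι).real (Prod.mk x ⁻¹' (A \ A2))} ≤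
      (Measure.pi fun _ : Fin D × Fin l => gs ι).real {x | 4 * Θ / ρ3 ≤ θ x} :=
        measureReal_mono (fun x hx => hne x hx) (measure_ne_top _ _)
    linarith
  refine ⟨Y, ?_, ?_, ?_⟩
  · by_contra hne
    have : Prod.mk Y ⁻¹' (A \ A2) = ∅ := by
      ext y
      simp only [Set.mem_preimage, Set.mem_sdiff, Set.mem_empty_iff_false, iff_false, not_and, not_not]
      intro _
      exact not_le.1 hne
    rw [this] at hY1
    simp at hY1
    linarith
  · have e : ρ / (2 * L) = ρ3 / 2 := by rw [hρ3]; field_simp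
    rw [e]
    exact hY1.trans (measureReal_mono (fun y hy => hy.1) (measure_ne_top _ _))
  · refine hY2.le.trans (le_of_eq ?_)
    rw [hρ3]; field_simp


set_option maxHeartbeats 800000 in
lemma ext_step {D L : ℕ} {ι Ω : Type} [Fintype ι] [Fintype Ω] (T : (Fin (D + 1) → ι) → Ω → ℝ) (B β ρ : ℝ)
    (hB : ∑ i, ∑ w, T i w ^ 2 ≤ B) (hB1 : 1 ≤ B) (hβ : 1 ≤ β) (hρ : 0 < ρ)
    (h : ρ ≤ (Measure.pi fun _ : Fin D × Fin L => gs ι).real {Y | SS T Y < β ^ L}) :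
    ∃ (J : Type) (_ : Fintype J) (U : J → (Fin (D + 1) → ι) → Ω → ℝ) (E : (Fin (D + 1) → ι) → Ω → ℝ),
      Fintype.card J ≤ L.factorial ^ (D + 1) ∧ (∀ t, Spl (U t)) ∧
      (∀ t, ∑ i, ∑ w, U t i w ^ 2 ≤ 16 * L * ((L.factorial : ℝ) ^ (D + 1) * B ^ L + 1) / ρ) ∧
      (∀ i w, E i w = T i w + ∑ t, U t i w) ∧
      ρ / (4 * L) ≤ (Measure.pi fun _ : Fin D => gs ι).real
        {y | ∑ a0, ∑ w0, (bf E (Fin.cons (bs a0) y : Fin (D + 1) → ι → ℝ) w0) ^ 2 ≤ 8 * β} := by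
  obtain ⟨l, hl, Y, hY1, hY2, hY3⟩ := ext_sel T B β ρ hB hB1 hβ hρ h
  have hL : (0:ℝ) < L := by exact_mod_cast (by omega : 0 < L)
  set θ := 4 * L * ((L.factorial : ℝ) ^ (D + 1) * B ^ L + 1) / ρ with hθ
  have hθp : 0 < θ := by positivity
  set μ := Measure.pi fun _ : Fin D => gs ι with hμ
  set G := {y : Fin D → ι → ℝ | SS T (cb y Y) < β ^ (l + 1)} with hG
  set g := μ.real G with hg
  have hgp : 0 < g := lt_of_lt_of_le (by positivity) hY2
  have hβ0 : 0 < β := by linarith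
  have hS1 : 1 ≤ SS T Y := (one_le_pow₀ hβ).trans hY1
  have hS0 : 0 < SS T Y := by linarith
  -- the quadratic in y
  let q : (Fin l → ι) → (Fin l → Ω) → (Fin D → ι → ℝ) → ℝ := fun a w y => ∑ w0, ∑ a0,
    PP T (cb (Fin.cons (bs a0) y : Fin (D + 1) → ι → ℝ) (zc (fun r => bs (a r)) Y)) (Fin.cons w0 w : Fin (l + 1) → Ω) ^ 2
  have hq0 : ∀ a w y, 0 ≤ q a w y := fun a w y => Finset.sum_nonneg fun _ _ => Finset.sum_nonneg fun _ _ => sq_nonneg _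
  have hml : ∀ (a0 : ι) (Z : Fin (D + 1) × Fin l → ι → ℝ) (w : Fin (l + 1) → Ω),
      IsML (fun y : Fin D → ι → ℝ => PP T (cb (Fin.cons (bs a0) y : Fin (D + 1) → ι → ℝ) Z) w) := by
    intro a0 Z w
    exact (cb_ml T Z w).comp _ Fin.succ fun y s x => (Fin.cons_update _ _ _ _)
  have hqpg : ∀ a w, PG (q a w) := fun a w => PG.sum _ fun w0 => PG.sum _ fun a0 => (hml _ _ _).pg.pow 2
  have hSq : ∀ y, SS T (cb y Y) = ∑ w, ∑ a, q a w y := fun y => SS_succ T Y y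
  have hSpg : PG fun y => SS T (cb y Y) := by
    simp only [hSq]
    exact PG.sum _ fun w => PG.sum _ fun a => hqpg a w
  have hGm : MeasurableSet G := measurableSet_lt hSpg.cont.measurable measurable_const
  let Q : (Fin l → ι) → (Fin l → Ω) → ℝ := fun a w => ∫ y in G, q a w y ∂μ
  have hQ0 : ∀ a w, 0 ≤ Q a w := fun a w => integral_nonneg fun y => hq0 a w y
  have hQs : ∑ w, ∑ a, Q a w ≤ β * g * SS T Y := by
    have e : ∑ w, ∑ a, Q a w = ∫ y in G, SS T (cb y Y) ∂μ := by
      simp only [hSq]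
      rw [integral_finsetSum _ fun w _ => ((PG.sum _ fun a => hqpg a w).integrable _).integrableOn]
      refine Finset.sum_congr rfl fun w _ => ?_
      rw [integral_finsetSum _ fun a _ => ((hqpg a w).integrable _).integrableOn]
    rw [e]
    have e2 : ∫ y in G, SS T (cb y Y) ∂μ ≤ ∫ y in G, β ^ (l + 1) ∂μ :=
      setIntegral_mono_on (hSpg.integrable _).integrableOn (integrable_const _).integrableOn hGm fun y hy => le_of_lt hy
    refine e2.trans ?_
    rw [setIntegral_const, smul_eq_mul, ← hg, pow_succ]
    nlinarith [mul_le_mul_of_nonneg_left hY1 (mul_pos hβ0 hgp).le]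
  let sz : (Fin l → ι) → (Fin l → Ω) → ℝ := fun a w => ∑ σ : Fin (D + 1) → Equiv.Perm (Fin (l + 1)), szf T σ a w Y
  have hszf0 : ∀ σ a w, 0 ≤ szf T σ a w Y := fun σ a w =>
    Finset.sum_nonneg fun j _ => Finset.sum_nonneg fun w0 _ => sq_nonneg _
  have hszs : ∑ w, ∑ a, sz a w ≤ θ := by
    refine le_trans (le_of_eq ?_) hY3
    symm
    rw [Finset.sum_comm]
    refine Finset.sum_congr rfl fun w _ => ?_
    rw [Finset.sum_comm]
  obtain ⟨w, a, haw⟩ : ∃ (w : Fin l → Ω) (a : Fin l → ι), 0 < PP T (zc (fun r => bs (a r)) Y) w ^ 2 - Q a w / (4 * β * g) - SS T Y * sz a w / (4 * θ) := by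
    by_contra hne
    push Not at hne
    have h1 : ∑ w : Fin l → Ω, ∑ a : Fin l → ι, (PP T (zc (fun r => bs (a r)) Y) w ^ 2 - Q a w / (4 * β * g) - SS T Y * sz a w / (4 * θ)) ≤ 0 :=
      Finset.sum_nonpos fun w _ => Finset.sum_nonpos fun a _ => hne w a
    simp only [Finset.sum_sub_distrib, ← Finset.sum_div, ← Finset.mul_sum] at h1
    have h2 : (∑ w, ∑ a, Q a w) / (4 * β * g) ≤ SS T Y / 4 := by
      rw [div_le_iff₀ (by positivity)]; nlinarith
    have h3 : SS T Y * (∑ w, ∑ a, sz a w) / (4 * θ) ≤ SS T Y / 4 := by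
      rw [div_le_iff₀ (by positivity)]; nlinarith
    have h4 : SS T Y = ∑ w : Fin l → Ω, ∑ a : Fin l → ι, PP T (zc (fun r => bs (a r)) Y) w ^ 2 := rfl
    rw [← h4] at h1
    linarith
  set P := PP T (zc (fun r => bs (a r)) Y) w with hP
  have hsz0 : 0 ≤ sz a w := Finset.sum_nonneg fun σ _ => hszf0 _ _ _
  have hsg : 0 ≤ SS T Y * sz a w / (4 * θ) := by positivity
  have hQg : 0 ≤ Q a w / (4 * β * g) := div_nonneg (hQ0 a w) (by positivity)
  have hP2 : 0 < P ^ 2 := by linarith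
  have hP0 : P ≠ 0 := fun h => by rw [h] at hP2; simp at hP2
  have hQP : Q a w ≤ 4 * β * g * P ^ 2 := by
    have : Q a w / (4 * β * g) ≤ P ^ 2 := by linarith
    rw [div_le_iff₀ (by positivity)] at this; linarith
  have hszP : sz a w ≤ 4 * θ * P ^ 2 := by
    have : SS T Y * sz a w / (4 * θ) ≤ P ^ 2 := by linarith
    rw [div_le_iff₀ (by positivity)] at this
    nlinarith
  let E : (Fin (D + 1) → ι) → Ω → ℝ := fun i w0 =>
    PP T (cb (fun s => bs (i s)) (zc (fun r => bs (a r)) Y)) (Fin.cons w0 w : Fin (l + 1) → Ω) / P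
  have hbfE : ∀ y w0, bf E y w0 = PP T (cb y (zc (fun r => bs (a r)) Y)) (Fin.cons w0 w : Fin (l + 1) → Ω) / P := by
    intro y w0
    rw [(cb_ml T _ _).expand y, Finset.sum_div]
    refine Finset.sum_congr rfl fun i _ => ?_
    simp only [E]
    ring
  refine ⟨{σ : Fin (D + 1) → Equiv.Perm (Fin (l + 1)) // ∃ s, σ s 0 ≠ 0}, inferInstance,
    fun σ i w0 => (((Equiv.Perm.sign (σ.1 0) : ℤ) : ℝ) / P) * FF T σ.1 (cb (fun s => bs (i s)) (zc (fun r => bs (a r)) Y)) (Fin.cons w0 w : Fin (l + 1) → Ω),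
    E, ?_, ?_, ?_, ?_, ?_⟩
  · refine (Fintype.card_subtype_le _).trans ?_
    rw [Fintype.card_fun, Fintype.card_perm, Fintype.card_fin, Fintype.card_fin]
    exact Nat.pow_le_pow_left (Nat.factorial_le (by omega)) _
  · intro σ
    exact spl_FF T σ.1 σ.2 _ _ _
  · intro σ
    have hs : (((Equiv.Perm.sign (σ.1 0) : ℤ) : ℝ)) ^ 2 = 1 := by
      rcases Int.units_eq_one_or (Equiv.Perm.sign (σ.1 0)) with h | h <;> simp [h]
    simp only [mul_pow, div_pow, hs, ← Finset.mul_sum]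
    have h1 : szf T σ.1 a w Y ≤ sz a w := Finset.single_le_sum (f := fun σ => szf T σ a w Y) (fun σ _ => hszf0 σ a w) (Finset.mem_univ σ.1)
    have h2 : (1 / P ^ 2) * szf T σ.1 a w Y ≤ 4 * θ := by
      rw [one_div_mul_eq_div, div_le_iff₀ hP2]; linarith
    unfold szf at h2
    refine h2.trans (le_of_eq ?_)
    rw [hθ]; ring
  · intro i w0
    simp only [E]
    rw [PP_expand, bf_bs, ← hP, add_div, mul_div_cancel_right₀ _ hP0, Finset.sum_div]
    congr 1
    refine Finset.sum_congr rfl fun σ _ => ?_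
    ring
  · have hEq : ∀ y, ∑ a0, ∑ w0, (bf E (Fin.cons (bs a0) y : Fin (D + 1) → ι → ℝ) w0) ^ 2 = q a w y / P ^ 2 := by
      intro y
      simp only [hbfE, q]
      rw [Finset.sum_comm]
      simp only [Finset.sum_div, div_pow]
    simp only [hEq]
    -- markov on G
    have h1 : (8 * β * P ^ 2) * (μ.restrict G).real {y | 8 * β * P ^ 2 ≤ q a w y} ≤ Q a w :=
      mul_meas_ge_le_integral_of_nonneg (Filter.Eventually.of_forall fun y => hq0 a w y) ((hqpg a w).integrable μ).integrableOn _
    have hm : MeasurableSet {y | 8 * β * P ^ 2 ≤ q a w y} := measurableSet_le measurable_const (hqpg a w).cont.measurable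
    have h2 : (μ.restrict G).real {y | 8 * β * P ^ 2 ≤ q a w y} ≤ g / 2 := by
      have h3 : (8 * β * P ^ 2) * (μ.restrict G).real {y | 8 * β * P ^ 2 ≤ q a w y} ≤ (8 * β * P ^ 2) * (g / 2) := by
        refine h1.trans (hQP.trans (le_of_eq ?_)); ring
      exact le_of_mul_le_mul_left h3 (by positivity)
    rw [measureReal_def, Measure.restrict_apply hm, ← measureReal_def] at h2
    have h3 : g ≤ μ.real ({y | 8 * β * P ^ 2 ≤ q a w y} ∩ G) + μ.real {y | q a w y / P ^ 2 ≤ 8 * β} := by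
      refine le_trans ?_ (measureReal_union_le _ _)
      refine measureReal_mono ?_ (measure_ne_top _ _)
      intro y hy
      by_cases hc : 8 * β * P ^ 2 ≤ q a w y
      · exact Or.inl ⟨hc, hy⟩
      · right
        simp only [Set.mem_ofPred_eq]
        rw [div_le_iff₀ hP2]
        exact (not_le.1 hc).le
    have h4 : ρ / (4 * L) = ρ / (2 * L) / 2 := by field_simp; norm_num
    rw [h4]
    linarith

end Ext


section Claim
open Function

lemma spl_lift {D : ℕ} {ι Ω : Type} (U : (Fin D → ι) → (ι × Ω) → ℝ) (h : Spl U) (c : ℝ) :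
    Spl (fun (i : Fin (D + 1) → ι) w => c * U (Fin.tail i) (i 0, w)) := by
  obtain ⟨S, f, g, hS, hf, hg, hU⟩ := h
  refine ⟨S.map (Fin.succEmb D), fun i => c * f (Fin.tail i), fun i w => g (Fin.tail i) (i 0, w), by simpa using hS, ?_, ?_, ?_⟩
  · intro i i' h
    simp only
    rw [hf (Fin.tail i) (Fin.tail i') fun s hs => h s.succ (by simpa using hs)]
  · intro w i i' h
    have h0 : i 0 = i' 0 := h 0 (by simp)
    simp only
    rw [h0]
    refine hg (i' 0, w) _ _ fun s hs => h s.succ ?_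
    simpa using hs
  · intro i w
    simp only [hU]; ring

lemma bf_lift {D : ℕ} {ι Ω : Type} [Fintype ι] [Fintype Ω] (E : (Fin (D + 1) → ι) → Ω → ℝ) (b : ℝ) (y : Fin D → ι → ℝ) (p : ι × Ω) :
    bf (fun (i : Fin D → ι) (p : ι × Ω) => b * E (Fin.cons p.1 i) p.2) y p = b * bf E (Fin.cons (bs p.1) y : Fin (D + 1) → ι → ℝ) p.2 := by
  rw [bf_cons, sum_cons, Finset.sum_eq_single p.1]
  · unfold bf
    rw [Finset.mul_sum]
    refine Finset.sum_congr rfl fun i _ => ?_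
    simp [bs]; ring
  · intro a _ ha; simp [bs, ha]
  · simp

lemma sum_lift {D : ℕ} {ι Ω : Type} [Fintype ι] [Fintype Ω] (F : (Fin (D + 1) → ι) → Ω → ℝ) :
    ∑ i : Fin D → ι, ∑ p : ι × Ω, F (Fin.cons p.1 i) p.2 = ∑ i, ∑ w, F i w := by
  rw [sum_cons, Finset.sum_comm]
  simp only [Fintype.sum_prod_type]
  refine Finset.sum_congr rfl fun a _ => ?_
  rw [Finset.sum_comm]

lemma rp_mono {ε a b : ℝ} (h0 : 0 < ε) (h1 : ε ≤ 1) (hab : a ≤ b) : ε ^ b ≤ ε ^ a := Real.rpow_le_rpow_of_exponent_ge h0 h1 hab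

lemma claim_step {D L : ℕ} {ι Ω : Type} [Fintype ι] [Fintype Ω] (T : (Fin (D + 1) → ι) → Ω → ℝ) (B β ρ : ℝ)
    (hB : ∑ i, ∑ w, T i w ^ 2 ≤ B) (hB1 : 1 ≤ B) (hβ : 1 ≤ β) (hρ : 0 < ρ)
    (h : ρ ≤ (Measure.pi fun _ : Fin D × Fin L => gs ι).real {Y | SS T Y < β ^ L}) (B2 : ℝ)
    (hB2 : 16 * L * ((L.factorial : ℝ) ^ (D + 1) * B ^ L + 1) / ρ ≤ B2) (hBB2 : B ≤ B2) (B3 B4 : ℝ) (hB4 : 0 ≤ B4) (R : ℕ)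
    (hB3 : ((L.factorial : ℝ) ^ (D + 1) + 1) ^ 2 * B2 ≤ B3)
    (ih : ∀ (E : (Fin D → ι) → (ι × Ω) → ℝ), ∑ i, ∑ p, E i p ^ 2 ≤ B3 → ρ / (4 * L) ≤ (Measure.pi fun _ : Fin D => gs ι).real {y | ∑ p, bf E y p ^ 2 ≤ 1} →
      ∃ (J : Type) (_ : Fintype J) (U : J → (Fin D → ι) → (ι × Ω) → ℝ), Fintype.card J ≤ R ∧ (∀ t, Spl (U t)) ∧
        (∀ t, ∑ i, ∑ p, U t i p ^ 2 ≤ B4) ∧ ∑ i, ∑ p, (E i p - ∑ t, U t i p) ^ 2 ≤ β) :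
    ∃ (J : Type) (_ : Fintype J) (U : J → (Fin (D + 1) → ι) → Ω → ℝ), Fintype.card J ≤ L.factorial ^ (D + 1) + R ∧ (∀ t, Spl (U t)) ∧
        (∀ t, ∑ i, ∑ w, U t i w ^ 2 ≤ B2 + 8 * β * B4) ∧ ∑ i, ∑ w, (T i w - ∑ t, U t i w) ^ 2 ≤ 8 * β * β := by
  obtain ⟨J, _, U, E, hJ, hU1, hU2, hE, hp⟩ := ext_step T B β ρ hB hB1 hβ hρ h
  have hβ0 : 0 < β := by linarith
  set b := √(8 * β) with hb
  have hbp : 0 < b := by positivity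
  have hb2 : b ^ 2 = 8 * β := Real.sq_sqrt (by positivity)
  have hb2' : b⁻¹ ^ 2 = (8 * β)⁻¹ := by rw [inv_pow, hb2]
  have hB20 : 0 ≤ B2 := by linarith
  have hEe : ∑ i, ∑ w, E i w ^ 2 ≤ B3 := by
    have h1 : ∀ i w, E i w ^ 2 ≤ (Fintype.card J + 1) * (T i w ^ 2 + ∑ t, U t i w ^ 2) := by
      intro i w
      have := sq_sum_le_card_mul_sum_sq (s := (Finset.univ : Finset (Option J))) (f := fun o => o.elim (T i w) fun t => U t i w)
      rw [Finset.card_univ, Fintype.card_option, Fintype.sum_option, Fintype.sum_option] at this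
      push_cast at this
      rw [hE]
      exact this
    have h2 : ∑ i, ∑ w, E i w ^ 2 ≤ (Fintype.card J + 1) * (B2 + Fintype.card J * B2) := by
      refine (Finset.sum_le_sum fun i _ => Finset.sum_le_sum fun w _ => h1 i w).trans ?_
      simp only [← Finset.mul_sum, Finset.sum_add_distrib]
      refine mul_le_mul_of_nonneg_left (add_le_add (hB.trans hBB2) ?_) (by positivity)
      have e : ∑ i, ∑ w, ∑ t, U t i w ^ 2 = ∑ t, ∑ i, ∑ w, U t i w ^ 2 := by
        symm
        rw [Finset.sum_comm]
        refine Finset.sum_congr rfl fun i _ => ?_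
        rw [Finset.sum_comm]
      rw [e]
      refine (Finset.sum_le_sum fun t _ => (hU2 t).trans hB2).trans ?_
      simp
    refine h2.trans (le_trans ?_ hB3)
    have hJr : (Fintype.card J : ℝ) ≤ (L.factorial : ℝ) ^ (D + 1) := by exact_mod_cast hJ
    have : ((Fintype.card J : ℝ) + 1) * (B2 + Fintype.card J * B2) = ((Fintype.card J : ℝ) + 1) ^ 2 * B2 := by ring
    rw [this]
    gcongr
  obtain ⟨J', _, U', hJ', hU1', hU2', hE'⟩ := ih (fun i p => b⁻¹ * E (Fin.cons p.1 i) p.2) (by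
      have := sum_lift fun i w => (b⁻¹ * E i w) ^ 2
      rw [this]
      simp only [mul_pow, ← Finset.mul_sum, hb2']
      refine le_trans (mul_le_of_le_one_left (Finset.sum_nonneg fun i _ => Finset.sum_nonneg fun w _ => sq_nonneg _) ?_) hEe
      exact inv_le_one_of_one_le₀ (by linarith)) (by
      refine hp.trans (measureReal_mono ?_ (measure_ne_top _ _))
      intro y hy
      simp only [Set.mem_ofPred_eq, bf_lift] at hy ⊢
      rw [Fintype.sum_prod_type]
      simp only [mul_pow, ← Finset.mul_sum, hb2']
      rw [inv_mul_le_iff₀ (by positivity)]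
      linarith)
  refine ⟨J ⊕ J', inferInstance, Sum.elim (fun t i w => (-1) * U t i w) (fun t i w => b * U' t (Fin.tail i) (i 0, w)), ?_, ?_, ?_, ?_⟩
  · rw [Fintype.card_sum]; omega
  · rintro (t | t)
    · obtain ⟨S, f, g, h1, h2, h3, h4⟩ := hU1 t
      refine ⟨S, fun i => (-1) * f i, g, h1, ?_, h3, ?_⟩
      · intro i i' hi; simp only [h2 i i' hi]
      · intro i w; simp only [Sum.elim_inl, h4]; ring
    · exact spl_lift (U' t) (hU1' t) b
  · rintro (t | t)
    · have : 0 ≤ 8 * β * B4 := by positivity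
      simp only [Sum.elim_inl, mul_pow, neg_one_sq, one_mul]
      linarith [(hU2 t).trans hB2]
    · simp only [Sum.elim_inr]
      rw [← sum_lift]
      simp only [Fin.tail_cons, Fin.cons_zero, mul_pow, ← Finset.mul_sum, hb2]
      have := mul_le_mul_of_nonneg_left (hU2' t) (by positivity : 0 ≤ 8 * β)
      linarith
  · have e : ∀ (i : Fin D → ι) (p : ι × Ω), T (Fin.cons p.1 i) p.2 - ∑ t, Sum.elim (fun t i w => (-1) * U t i w) (fun t i w => b * U' t (Fin.tail i) (i 0, w)) t (Fin.cons p.1 i : Fin (D + 1) → ι) p.2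
        = b * (b⁻¹ * E (Fin.cons p.1 i) p.2 - ∑ t, U' t i p) := by
      intro i p
      rw [Fintype.sum_sum_type]
      simp only [Sum.elim_inl, Sum.elim_inr, Fin.tail_cons, Fin.cons_zero, hE, ← Finset.mul_sum]
      field_simp
      ring
    rw [← sum_lift]
    simp only [e, mul_pow, ← Finset.mul_sum, hb2]
    exact mul_le_mul_of_nonneg_left hE' (by positivity)


lemma claim (D : ℕ) : ∀ (M a K : ℝ), 0 < M → 0 < a → 0 ≤ K → ∃ (R : ℕ) (K' : ℝ), 0 ≤ K' ∧ ∀ᶠ ε in sm, ∀ (ι Ω : Type) [Fintype ι] [Fintype Ω]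
    (T : (Fin D → ι) → Ω → ℝ), ∑ i, ∑ w, T i w ^ 2 ≤ ε ^ (-K) →
    ε ^ M ≤ (Measure.pi fun _ : Fin D => gs ι).real {x | ∑ w, bf T x w ^ 2 ≤ 1} →
    ∃ (J : Type) (_ : Fintype J) (U : J → (Fin D → ι) → Ω → ℝ), Fintype.card J ≤ R ∧ (∀ t, Spl (U t)) ∧
      (∀ t, ∑ i, ∑ w, U t i w ^ 2 ≤ ε ^ (-K')) ∧ ∑ i, ∑ w, (T i w - ∑ t, U t i w) ^ 2 ≤ ε ^ (-a) := by
  induction D with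
  | zero =>
    intro M a K hM ha hK
    refine ⟨0, 0, le_rfl, ?_⟩
    filter_upwards [sm_pos, sm_lt one_pos] with ε h0 h1 ι Ω _ _ T hT hp
    refine ⟨Fin 0, inferInstance, fun t => t.elim0, by simp, fun t => t.elim0, fun t => t.elim0, ?_⟩
    have hne : {x : Fin 0 → ι → ℝ | ∑ w, bf T x w ^ 2 ≤ 1}.Nonempty := by
      by_contra hne
      rw [Set.not_nonempty_iff_eq_empty] at hne
      rw [hne] at hp
      simp at hp
      linarith [Real.rpow_pos_of_pos h0 M]
    obtain ⟨x, hx⟩ := hne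
    simp only [Set.mem_ofPred_eq, bf] at hx
    have : (1:ℝ) ≤ ε ^ (-a) := Real.one_le_rpow_of_pos_of_le_one_of_nonpos h0 h1.le (by linarith)
    simp at hx ⊢
    exact hx.trans this
  | succ D ih =>
    intro M a K hM ha hK
    obtain ⟨L, hL⟩ := exists_nat_gt (8 * M / a + 1)
    have hL1 : (1:ℝ) < L := lt_of_le_of_lt (by have : 0 ≤ 8 * M / a := by positivity
                                               linarith) hL
    have hL0 : 0 < L := by exact_mod_cast (by linarith : (0:ℝ) < L)
    have hLM : 2 * M + a / 4 < a / 4 * L := by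
      have : 8 * M / a + 1 < L := hL
      have h2 : a / 4 * (8 * M / a + 1) < a / 4 * L := by gcongr
      have h3 : a / 4 * (8 * M / a + 1) = 2 * M + a / 4 := by field_simp; ring
      linarith
    obtain ⟨C, hC, hSS⟩ := SS_prob D L hL0
    set M2 : ℝ := (M + 1) * (2 ^ (D * L) : ℕ) with hM2
    have hM2p : 0 < M2 := by positivity
    set K2 : ℝ := K * L + M2 + 1 with hK2
    have hKL : 0 ≤ K * L := by positivity
    obtain ⟨R, K4, hK4, hih⟩ := ih (M2 + 1) (a / 4) (K2 + 1) (by positivity) (by positivity) (by linarith)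
    set cL : ℝ := (L.factorial : ℝ) ^ (D + 1) with hcL
    have hcLp : 0 < cL := by positivity
    refine ⟨L.factorial ^ (D + 1) + R, K2 + K4 + a + 1, by positivity, ?_⟩
    filter_upwards [sm_pos, sm_lt (by norm_num : (0:ℝ) < 1 / 2), hih, sm_le (2 * C) (by linarith : - (a / 4 * L) < -(2 * M)),
      sm_le (16 * L * (2 * cL)) (by linarith : -K2 < -(K * L + M2)), sm_le ((cL + 1) ^ 2) (by linarith : -(K2 + 1) < -K2),
      sm_le (4 * L) (by linarith : M2 < M2 + 1), sm_le 8 (by linarith : -a < -(a / 2)), sm_le 9 (by linarith : -(K2 + K4 + a + 1) < -(K2 + K4 + a))] with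
      ε h0 h1 hih e1 e2 e3 e4 e5 e6 ι Ω _ _ T hT hp
    have h1' : ε ≤ 1 := by linarith
    have hM2' : ε ^ M2 ≤ (ε ^ M / 2) ^ (2 ^ (D * L)) := by
      rw [hM2, Real.rpow_mul h0.le, Real.rpow_natCast]
      refine pow_le_pow_left₀ (by positivity) ?_ _
      rw [Real.rpow_add h0, Real.rpow_one]
      have : 0 < ε ^ M := by positivity
      nlinarith
    have hβL : (ε ^ (-(a / 4))) ^ L = ε ^ (-(a / 4 * L)) := by
      rw [← Real.rpow_natCast, ← Real.rpow_mul h0.le]; ring_nf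
    have hKL' : (ε ^ (-K)) ^ L = ε ^ (-(K * L)) := by
      rw [← Real.rpow_natCast, ← Real.rpow_mul h0.le]; ring_nf
    have hone : ∀ x : ℝ, 0 ≤ x → 1 ≤ ε ^ (-x) := fun x hx =>
      Real.one_le_rpow_of_pos_of_le_one_of_nonpos h0 h1' (by linarith)
    have hSS2 := hSS ι Ω T (ε ^ M) (by positivity) hp
    have hprob : ε ^ M2 ≤ (Measure.pi fun _ : Fin D × Fin L => gs ι).real {Y | SS T Y < (ε ^ (-(a / 4))) ^ L} := by
      refine hM2'.trans (hSS2.trans (measureReal_mono ?_ (measure_ne_top _ _)))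
      intro Y hY
      simp only [Set.mem_ofPred_eq] at hY ⊢
      refine hY.trans_lt ?_
      rw [hβL]
      refine lt_of_lt_of_le ?_ e1
      have : C / (ε ^ M) ^ 2 = C * ε ^ (-(2 * M)) := by
        rw [Real.rpow_neg h0.le, mul_comm 2 M, Real.rpow_mul h0.le]; norm_num; rfl
      rw [this]
      have : 0 < ε ^ (-(2 * M)) := by positivity
      nlinarith [mul_pos hC this]
    have hKL1 : 1 ≤ ε ^ (-(K * L)) := hone _ hKL
    obtain ⟨J, _, U, hJ, hU1, hU2, hU3⟩ := claim_step T (ε ^ (-K)) (ε ^ (-(a / 4))) (ε ^ M2) hT (hone _ hK) (hone _ (by positivity))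
      (by positivity) hprob (ε ^ (-K2)) (by
        refine le_trans ?_ e2
        rw [hKL', div_eq_mul_inv, ← Real.rpow_neg h0.le, neg_add, Real.rpow_add h0, ← mul_assoc]
        refine mul_le_mul_of_nonneg_right ?_ (by positivity)
        have hc1 : 1 ≤ cL := by
          have : (1:ℝ) ≤ (L.factorial : ℝ) := by exact_mod_cast Nat.succ_le_of_lt (Nat.factorial_pos L)
          rw [hcL]; exact one_le_pow₀ this
        have h4 : 1 ≤ cL * ε ^ (-(K * L)) := one_le_mul_of_one_le_of_one_le hc1 hKL1
        have h5 : cL * ε ^ (-(K * L)) + 1 ≤ 2 * (cL * ε ^ (-(K * L))) := by linarith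
        have h6 := mul_le_mul_of_nonneg_left h5 (by positivity : (0:ℝ) ≤ 16 * L)
        linarith) (by
        refine rp_mono h0 h1' ?_
        rw [hK2]; nlinarith) (ε ^ (-(K2 + 1))) (ε ^ (-K4)) (by positivity) R e3 (by
        intro E hE1 hE2
        refine hih ι (ι × Ω) E hE1 (le_trans ?_ hE2)
        rw [le_div_iff₀ (by positivity)]
        linarith)
    have hbb : ε ^ (-(a / 4)) * ε ^ (-(a / 4)) = ε ^ (-(a / 2)) := by rw [← Real.rpow_add h0]; ring_nf
    refine ⟨J, inferInstance, U, hJ, hU1, fun t => (hU2 t).trans ?_, hU3.trans ?_⟩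
    · refine le_trans ?_ e6
      have h2 : ε ^ (-K2) ≤ ε ^ (-(K2 + K4 + a)) := rp_mono h0 h1' (by linarith)
      have h3 : ε ^ (-(a / 4)) * ε ^ (-K4) ≤ ε ^ (-(K2 + K4 + a)) := by
        rw [← Real.rpow_add h0]
        exact rp_mono h0 h1' (by linarith)
      linarith
    · rw [mul_assoc, hbb]; exact e5

end Claim


section SplPoly
open MvPolynomial

lemma bd_zero {ι : Type} [Fintype ι] (d : ℕ) : Bd (ι := ι) d 1 0 := ⟨by simp, by simp⟩

lemma wick1 (k : ℕ) : ∃ c : ℝ, 0 < c ∧ ∀ (ι S : Type) [Fintype ι] [Fintype S] [DecidableEq S],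
    Fintype.card S = k → ∀ (E : (S → ι) → ℝ),
    ∃ r : MvPolynomial ι ℝ, Bd k 1 r ∧ Lo k (C (√(c * ∑ i, E i ^ 2)) * r - tpoly E) := by
  obtain ⟨c, hc, H⟩ := wick' k
  refine ⟨c, hc, fun ι S _ _ _ hS E => ?_⟩
  have h0 : 0 ≤ ∑ i, E i ^ 2 := Finset.sum_nonneg fun i _ => sq_nonneg _
  rcases h0.eq_or_lt with h | h
  · refine ⟨0, bd_zero _, Or.inl ?_⟩
    have hE : ∀ i, E i = 0 := by
      intro i
      have := (Finset.sum_eq_zero_iff_of_nonneg (fun i _ => sq_nonneg (E i))).1 h.symm i (Finset.mem_univ _)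
      exact pow_eq_zero_iff (two_ne_zero) |>.1 this
    simp [tpoly, hE]
  · obtain ⟨r, h1, h2, h3⟩ := H ι S hS E
    have hs : 0 < √(c * ∑ i, E i ^ 2) := Real.sqrt_pos.2 (by positivity)
    have hs2 : √(c * ∑ i, E i ^ 2) ^ 2 = c * ∑ i, E i ^ 2 := Real.sq_sqrt (by positivity)
    set s := √(c * ∑ i, E i ^ 2)
    refine ⟨C s⁻¹ * r, ?_, ?_⟩
    · refine (bd_smul (⟨h1, h2⟩ : Bd k _ r) s⁻¹).mono le_rfl ?_
      rw [← hs2, ← mul_pow, inv_mul_cancel₀ hs.ne', one_pow]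
    · rw [← mul_assoc, ← map_mul, mul_inv_cancel₀ hs.ne', map_one, one_mul]
      exact h3

lemma sum_split {D : ℕ} {ι M : Type} [Fintype ι] [AddCommMonoid M] (S : Finset (Fin D)) (F : (Fin D → ι) → ι → M) :
    ∑ i, ∑ w, F i w = ∑ p : {s // s ∈ S} → ι, ∑ q : Option {s // ¬ s ∈ S} → ι,
      F (fun s => if h : s ∈ S then p ⟨s, h⟩ else q (some ⟨s, h⟩)) (q none) := by
  have e1 := Fintype.sum_equiv (Equiv.piEquivPiSubtypeProd (fun s => s ∈ S) (fun _ => ι)) (fun i => ∑ w, F i w)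
    (fun pq => ∑ w, F ((Equiv.piEquivPiSubtypeProd (fun s => s ∈ S) (fun _ => ι)).symm pq) w) (fun i => by rw [Equiv.symm_apply_apply])
  rw [e1, Fintype.sum_prod_type]
  refine Finset.sum_congr rfl fun p _ => ?_
  have e2 := Fintype.sum_equiv (Equiv.piOptionEquivProd (β := fun _ : Option {s // ¬ s ∈ S} => ι))
    (fun q => F (fun s => if h : s ∈ S then p ⟨s, h⟩ else q (some ⟨s, h⟩)) (q none))
    (fun wq => F (fun s => if h : s ∈ S then p ⟨s, h⟩ else wq.2 ⟨s, h⟩) wq.1) (fun q => rfl)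
  rw [e2, Fintype.sum_prod_type, Finset.sum_comm]
  rfl

lemma prod_split {D : ℕ} {ι M : Type} [CommMonoid M] (S : Finset (Fin D)) (F : ι → M) (p : {s // s ∈ S} → ι)
    (q : {s // ¬ s ∈ S} → ι) : ∏ s, F (if h : s ∈ S then p ⟨s, h⟩ else q ⟨s, h⟩) = (∏ s, F (p s)) * ∏ s, F (q s) := by
  rw [← Fintype.prod_subtype_mul_prod_subtype (fun s => s ∈ S)]
  congr 1
  · exact Finset.prod_congr (by ext; simp) fun s _ => by rw [dif_pos s.2]
  · exact Finset.prod_congr rfl fun s _ => by rw [dif_neg s.2]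

lemma spl_poly (D : ℕ) : ∃ c : ℝ, 0 < c ∧ ∀ (ι : Type) [Fintype ι] (T : (Fin D → ι) → ι → ℝ), Spl T →
    ∃ (α β : ℕ) (a b : MvPolynomial ι ℝ) (l : ℝ), 1 ≤ α ∧ 1 ≤ β ∧ α + β = D + 1 ∧ Bd α 1 a ∧ Bd β 1 b ∧
      l ^ 2 ≤ c * ∑ i, ∑ w, T i w ^ 2 ∧ Lo (D + 1) (C l * (a * b) - ∑ w, X w * tpoly (fun i => T i w)) := by
  classical
  choose cw hcw W using wick1
  refine ⟨(∑ j ∈ Finset.range (D + 2), cw j) ^ 2, ?_, ?_⟩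
  · have : 0 < ∑ j ∈ Finset.range (D + 2), cw j := Finset.sum_pos (fun j _ => hcw j) ⟨0, by simp⟩
    positivity
  intro ι _ T hT
  obtain ⟨S, f, g, hS, hf, hg, hfg⟩ := hT
  have hSD : S.card ≤ D := by simpa using S.card_le_univ
  have hS1 : 1 ≤ S.card := hS.card_pos
  rcases isEmpty_or_nonempty ι with he | ⟨⟨i0⟩⟩
  · refine ⟨1, D, 0, 0, 0, le_rfl, by omega, by omega, bd_zero _, bd_zero _, ?_, Or.inl ?_⟩
    · have : 0 ≤ ∑ i : Fin D → ι, ∑ w, T i w ^ 2 := Finset.sum_nonneg fun i _ => Finset.sum_nonneg fun w _ => sq_nonneg _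
      have := mul_nonneg (sq_nonneg (∑ j ∈ Finset.range (D + 2), cw j)) this
      simpa using this
    · simp
  let f' : ({s // s ∈ S} → ι) → ℝ := fun p => f (fun s => if h : s ∈ S then p ⟨s, h⟩ else i0)
  let g' : (Option {s // ¬ s ∈ S} → ι) → ℝ := fun q => g (fun s => if h : s ∈ S then i0 else q (some ⟨s, h⟩)) (q none)
  have hTe : ∀ (p : {s // s ∈ S} → ι) (q : Option {s // ¬ s ∈ S} → ι),
      T (fun s => if h : s ∈ S then p ⟨s, h⟩ else q (some ⟨s, h⟩)) (q none) = f' p * g' q := by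
    intro p q
    rw [hfg]
    congr 1
    · exact hf _ _ fun s hs => by simp [hs]
    · exact hg (q none) _ _ fun s hs => by
        have : s ∉ S := Finset.mem_compl.1 hs
        simp [this]
  have hsum : ∑ i, ∑ w, T i w ^ 2 = (∑ p, f' p ^ 2) * ∑ q, g' q ^ 2 := by
    rw [sum_split S, Finset.sum_mul]
    refine Finset.sum_congr rfl fun p _ => ?_
    rw [Finset.mul_sum]
    refine Finset.sum_congr rfl fun q _ => ?_
    rw [hTe, mul_pow]
  have hpoly : ∑ w, X w * tpoly (fun i => T i w) = tpoly f' * tpoly g' := by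
    have e1 : ∑ w, X w * tpoly (fun i => T i w) = ∑ i, ∑ w, C (T i w) * (X w * ∏ s, X (i s)) := by
      unfold tpoly
      simp only [Finset.mul_sum]
      rw [Finset.sum_comm]
      exact Finset.sum_congr rfl fun i _ => Finset.sum_congr rfl fun w _ => by ring
    rw [e1, sum_split S]
    unfold tpoly
    rw [Finset.sum_mul]
    refine Finset.sum_congr rfl fun p _ => ?_
    rw [Finset.mul_sum]
    refine Finset.sum_congr rfl fun q _ => ?_
    rw [hTe, map_mul, Fintype.prod_option, prod_split S (fun j => (X j : MvPolynomial ι ℝ)) p (fun s => q (some s))]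
    ring
  have c1 : Fintype.card {s // s ∈ S} = S.card := by simp
  have c2 : Fintype.card (Option {s // ¬ s ∈ S}) = D - S.card + 1 := by
    rw [Fintype.card_option, Fintype.card_subtype_compl]; simp
  obtain ⟨a, ha, hla⟩ := W _ ι _ c1 f'
  obtain ⟨b, hb, hlb⟩ := W _ ι _ c2 g'
  set s1 := √(cw S.card * ∑ i, f' i ^ 2) with hs1
  set s2 := √(cw (D - S.card + 1) * ∑ i, g' i ^ 2) with hs2
  have hf0 : 0 ≤ ∑ i, f' i ^ 2 := Finset.sum_nonneg fun i _ => sq_nonneg _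
  have hg0 : 0 ≤ ∑ i, g' i ^ 2 := Finset.sum_nonneg fun i _ => sq_nonneg _
  refine ⟨S.card, D - S.card + 1, a, b, s1 * s2, hS1, by omega, by omega, ha, hb, ?_, ?_⟩
  · rw [mul_pow, hs1, hs2, Real.sq_sqrt (mul_nonneg (hcw _).le hf0), Real.sq_sqrt (mul_nonneg (hcw _).le hg0), hsum]
    have k1 : cw S.card ≤ ∑ j ∈ Finset.range (D + 2), cw j :=
      Finset.single_le_sum (fun j _ => (hcw j).le) (Finset.mem_range.2 (by omega))
    have k2 : cw (D - S.card + 1) ≤ ∑ j ∈ Finset.range (D + 2), cw j :=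
      Finset.single_le_sum (fun j _ => (hcw j).le) (Finset.mem_range.2 (by omega))
    have k3 := mul_le_mul k1 k2 (hcw _).le ((hcw _).le.trans k1)
    have := mul_le_mul_of_nonneg_right k3 (mul_nonneg hf0 hg0)
    calc _ = _ := by ring
      _ ≤ _ := this
      _ = _ := by ring
  · rw [hpoly]
    have e : C (s1 * s2) * (a * b) - tpoly f' * tpoly g' =
        (C s1 * a - tpoly f') * (C s2 * b) + (C s2 * b - tpoly g') * tpoly f' := by
      rw [map_mul]; ring
    rw [e]
    have d1 : S.card + (D - S.card + 1) = D + 1 := by omega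
    refine Lo.add ?_ ?_
    · have := hla.mul (bd_smul hb s2).1
      rwa [d1] at this
    · have := hlb.mul (tpoly_deg f')
      rw [c1] at this
      rwa [add_comm, d1] at this
end SplPoly


section GradFix
open MvPolynomial

lemma adj_last {ι : Type} [Fintype ι] (R : ℕ → MvPolynomial ι ℝ) (m : ℕ) :
    (GM R (m + 1)).adjugate (Fin.last m) (Fin.last m) = Gam R m := by
  rw [Matrix.adjugate_fin_succ_eq_det_submatrix]
  have : (-1 : MvPolynomial ι ℝ) ^ (((Fin.last m : Fin (m + 1)) : ℕ) + ((Fin.last m : Fin (m + 1)) : ℕ)) = 1 := by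
    rw [← two_mul, pow_mul]; simp
  rw [this, one_mul, Gam]
  congr 1
  ext a b
  simp [GM]

lemma grad_exact {ι : Type} [Fintype ι] (R : ℕ → MvPolynomial ι ℝ) (m : ℕ) (x : ι → ℝ) (hG : 0 < eval x (Gam R m)) :
    ∑ i, (eval x (pderiv i (R m)) - ∑ j : Fin m, (-(eval x ((GM R (m + 1)).adjugate (Fin.last m) j.castSucc)) / eval x (Gam R m)) *
      eval x (pderiv i (R j))) ^ 2 = eval x (Gam R (m + 1)) / eval x (Gam R m) := by
  have h1 : ∀ i, eval x (pderiv i (R m)) - ∑ j : Fin m, (-(eval x ((GM R (m + 1)).adjugate (Fin.last m) j.castSucc)) / eval x (Gam R m)) *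
      eval x (pderiv i (R j)) = eval x (wf R m i) / eval x (Gam R m) := by
    intro i
    rw [eq_div_iff hG.ne', wf, Fin.sum_univ_castSucc, map_add, map_sum, adj_last, sub_mul, Finset.sum_mul]
    simp only [map_mul, Fin.val_castSucc, Fin.val_last]
    rw [sub_eq_iff_eq_add, add_assoc, add_comm, add_assoc, ← Finset.sum_add_distrib]
    rw [Finset.sum_eq_zero]
    · ring
    · intro j _
      field_simp
      ring
  have h2 : ∑ i, eval x (wf R m i) ^ 2 = eval x (Gam R m) * eval x (Gam R (m + 1)) := by
    have e : ∀ i, eval x (wf R m i) ^ 2 = ∑ a : Fin (m + 1), eval x ((GM R (m + 1)).adjugate (Fin.last m) a) *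
        (eval x (wf R m i) * eval x (pderiv i (R a))) := by
      intro i
      have : eval x (wf R m i) = ∑ a : Fin (m + 1), eval x ((GM R (m + 1)).adjugate (Fin.last m) a) * eval x (pderiv i (R a)) := by
        simp [wf]
      rw [sq]
      nth_rw 2 [this]
      rw [Finset.mul_sum]
      exact Finset.sum_congr rfl fun a _ => by ring
    simp only [e]
    rw [Finset.sum_comm]
    simp only [← Finset.mul_sum]
    have e2 : ∀ a : Fin (m + 1), ∑ i, eval x (wf R m i) * eval x (pderiv i (R a)) = if a = Fin.last m then eval x (Gam R (m + 1)) else 0 := by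
      intro a
      have := congrArg (eval x) (wf_pair R m a)
      simp only [map_sum, map_mul] at this
      rw [this]
      split_ifs <;> simp
    simp only [e2]
    simp [adj_last]
  simp only [h1, div_pow]
  rw [← Finset.sum_div, h2]
  field_simp

lemma grad_round {ι : Type} [Fintype ι] {m : ℕ} (A : ι → ℝ) (B : Fin m → ι → ℝ) (u v : Fin m → ℝ) (η : ℝ)
    (h : ∀ j, |v j - u j| ≤ η) :
    ∑ i, (A i - ∑ j, v j * B j i) ^ 2 ≤ 2 * ∑ i, (A i - ∑ j, u j * B j i) ^ 2 + 2 * m * η ^ 2 * ∑ j, ∑ i, B j i ^ 2 := by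
  have h1 : ∀ i, (A i - ∑ j, v j * B j i) ^ 2 ≤ 2 * (A i - ∑ j, u j * B j i) ^ 2 + 2 * m * η ^ 2 * ∑ j, B j i ^ 2 := by
    intro i
    have e : A i - ∑ j, v j * B j i = (A i - ∑ j, u j * B j i) - ∑ j, (v j - u j) * B j i := by
      simp only [sub_mul, Finset.sum_sub_distrib]; ring
    have k : (∑ j, (v j - u j) * B j i) ^ 2 ≤ m * η ^ 2 * ∑ j, B j i ^ 2 := by
      refine (Finset.sum_mul_sq_le_sq_mul_sq _ _ _).trans ?_
      refine mul_le_mul_of_nonneg_right ?_ (Finset.sum_nonneg fun j _ => sq_nonneg _)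
      refine (Finset.sum_le_sum (g := fun _ => η ^ 2) fun j _ => ?_).trans (by simp)
      rw [← sq_abs]
      exact pow_le_pow_left₀ (abs_nonneg _) (h j) 2
    rw [e]
    nlinarith [sq_nonneg ((A i - ∑ j, u j * B j i) + ∑ j, (v j - u j) * B j i)]
  refine (Finset.sum_le_sum fun i _ => h1 i).trans (le_of_eq ?_)
  rw [Finset.sum_add_distrib, ← Finset.mul_sum, ← Finset.mul_sum, Finset.sum_comm]

lemma grad_markov (k m : ℕ) : ∃ B : ℝ, 0 ≤ B ∧ ∀ (ι : Type) [Fintype ι] (R : ℕ → MvPolynomial ι ℝ), (∀ j ≤ m, Bd k 1 (R j)) →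
    ∀ s : ℝ, 0 < s → (gs ι).real {x | s ≤ ∑ a, eval x ((GM R (m + 1)).adjugate (Fin.last m) a) ^ 2 +
      ∑ j : Fin m, ∑ i, eval x (pderiv i (R j)) ^ 2} ≤ B / s := by
  obtain ⟨d', B', h1⟩ := bd_adj m k
  obtain ⟨c, hc, h2⟩ := energy k
  refine ⟨(m + 1) * |B'| + m * c, by positivity, fun ι _ R hR s hs => ?_⟩
  refine (markov_real (gs ι) (by fun_prop) (fun x => by positivity) hs).trans ?_
  gcongr
  rw [integral_add ((by fun_prop : PG _).integrable _) ((by fun_prop : PG _).integrable _),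
    integral_finsetSum _ fun i _ => (by fun_prop : PG _).integrable _,
    integral_finsetSum _ fun i _ => (by fun_prop : PG _).integrable _]
  refine add_le_add ?_ ?_
  · refine (Finset.sum_le_sum (g := fun _ => |B'|) fun a _ => ?_).trans (by simp)
    exact (h1 ι R hR _ _).2.trans (le_abs_self _)
  · refine (Finset.sum_le_sum (g := fun _ => c) fun a _ => ?_).trans (by simp)
    rw [integral_finsetSum _ fun i _ => (by fun_prop : PG _).integrable _]
    refine (h2 ι _ (hR a (by omega)).1).trans ?_
    exact mul_le_of_le_one_right hc.le (hR a (by omega)).2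

lemma rp_le_one {ε a : ℝ} (h0 : 0 < ε) (h1 : ε ≤ 1) (ha : 0 ≤ a) : ε ^ a ≤ 1 := Real.rpow_le_one h0.le h1 ha
lemma one_le_rp {ε a : ℝ} (h0 : 0 < ε) (h1 : ε ≤ 1) (ha : 0 ≤ a) : 1 ≤ ε ^ (-a) :=
  Real.one_le_rpow_of_pos_of_le_one_of_nonpos h0 h1 (by linarith)

lemma grad_fix (k m : ℕ) (δs : ℕ → ℝ) (hδs : ∀ j, 0 ≤ δs j) (δ : ℝ) (hδ : 0 < δ) (M : ℝ) (hM : 0 ≤ M) :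
    ∃ K M1 : ℝ, 0 ≤ K ∧ 0 ≤ M1 ∧ ∀ᶠ ε in sm, ∀ (ι : Type) [Fintype ι] (R : ℕ → MvPolynomial ι ℝ), (∀ j ≤ m, Bd k 1 (R j)) →
      (∀ j < m, (gs ι).real (Bad R j (ε ^ δs j)) ≤ ε ^ (M + 1)) → ε ^ M < (gs ι).real (Bad R m (ε ^ δ)) →
      ∃ u : Fin m → ℝ, (∀ j, |u j| ≤ ε ^ (-K)) ∧
        ε ^ M1 ≤ (gs ι).real {x | ∑ i, eval x (pderiv i (R m - ∑ j : Fin m, C (u j) * R j)) ^ 2 ≤ ε ^ δ} := by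
  classical
  obtain ⟨B, hB, hmk⟩ := grad_markov k m
  set Δ := ∑ j ∈ Finset.range m, δs j with hΔ
  have hΔ0 : 0 ≤ Δ := Finset.sum_nonneg fun j _ => hδs j
  set K := 2 * Δ + (M + 2) / 2 with hK
  set e := δ + (M + 2) / 2 with he
  have hK0 : 0 ≤ K := by positivity
  have he0 : 0 ≤ e := by positivity
  refine ⟨K + 1, M + 1 + (K + e + 1) * m, by positivity, by positivity, ?_⟩
  filter_upwards [sm_pos, sm_lt one_pos, sm_le (m + B + 1) (show M < M + 1 by linarith), sm_le 2 (show -(K + 1) < -K by linarith),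
    sm_le (2 + 2 * m) (show δ < 2 * δ by linarith), sm_le 7 (show -(K + e + 1) < -(K + e) by linarith)]
    with ε h0 h1 hm1 hm2 hm3 hm4 ι _ R hR hbad hbig
  have hadd : ∀ a b : ℝ, ε ^ a * ε ^ b = ε ^ (a + b) := fun a b => (Real.rpow_add h0 a b).symm
  set Exc : Set (ι → ℝ) := {x | ε ^ (-(M + 2)) ≤ ∑ a, eval x ((GM R (m + 1)).adjugate (Fin.last m) a) ^ 2 +
      ∑ j : Fin m, ∑ i, eval x (pderiv i (R j)) ^ 2} with hExc
  have hE : (gs ι).real Exc ≤ B * ε ^ (M + 1) := by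
    refine (hmk ι R hR _ (by positivity)).trans ?_
    rw [div_eq_mul_inv, ← Real.rpow_neg h0.le, neg_neg]
    exact mul_le_mul_of_nonneg_left (rp_mono h0 h1.le (by linarith)) hB
  set N : ℕ := ⌈ε ^ (-(K + e))⌉₊ + 1 with hN
  let P : Finset (Fin m → ℤ) := Fintype.piFinset fun _ => Finset.Icc (-(N : ℤ)) N
  let g : (Fin m → ℝ) → MvPolynomial ι ℝ := fun u => R m - ∑ j : Fin m, C (u j) * R j
  have hgrad : ∀ u i x, eval x (pderiv i (g u)) = eval x (pderiv i (R m)) - ∑ j : Fin m, u j * eval x (pderiv i (R j)) := by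
    intro u i x
    simp [g]
  let W : (Fin m → ℝ) → Set (ι → ℝ) := fun u => {x | ∑ i, eval x (pderiv i (g u)) ^ 2 ≤ ε ^ δ}
  have hcover : Bad R m (ε ^ δ) ⊆ (⋃ j ∈ Finset.range m, Bad R j (ε ^ δs j)) ∪ Exc ∪
      ⋃ n ∈ P.filter (fun n => ∀ j, |(n j : ℝ) * ε ^ e| ≤ ε ^ (-(K + 1))), W (fun j => n j * ε ^ e) := by
    intro x hx
    by_cases hx1 : x ∈ ⋃ j ∈ Finset.range m, Bad R j (ε ^ δs j)
    · exact Or.inl (Or.inl hx1)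
    by_cases hx2 : x ∈ Exc
    · exact Or.inl (Or.inr hx2)
    right
    have hgood : ∀ j < m, x ∉ Bad R j (ε ^ δs j) := by
      intro j hj hh
      exact hx1 (Set.mem_biUnion (Finset.mem_coe.2 (Finset.mem_range.2 hj)) hh)
    have hGm := Gam_good R (fun j => ε ^ δs j) m x hgood
    have hprod : ∏ j ∈ Finset.range m, (ε ^ δs j) ^ 2 = ε ^ (2 * Δ) := by
      rw [Finset.prod_pow, ← Real.rpow_sum_of_pos h0, ← Real.rpow_natCast, ← Real.rpow_mul h0.le]
      congr 1; push_cast; ring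
    simp only [hprod] at hGm
    have hGp : 0 < eval x (Gam R m) := lt_of_lt_of_le (by positivity) hGm
    rw [hExc, Set.mem_ofPred_eq, not_le] at hx2
    set u : Fin m → ℝ := fun j => -(eval x ((GM R (m + 1)).adjugate (Fin.last m) j.castSucc)) / eval x (Gam R m) with hu
    have hu_bd : ∀ j, |u j| ≤ ε ^ (-K) := by
      intro j
      rw [hu]; simp only
      rw [abs_div, abs_neg, abs_of_pos hGp, div_le_iff₀ hGp]
      have a1 : |eval x ((GM R (m + 1)).adjugate (Fin.last m) j.castSucc)| ≤ ε ^ (-((M + 2) / 2)) := by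
        refine abs_le_of_sq_le_sq ?_ (by positivity)
        have : (ε ^ (-((M + 2) / 2))) ^ 2 = ε ^ (-(M + 2)) := by
          rw [sq, hadd]; congr 1; ring
        rw [this]
        refine le_trans ?_ hx2.le
        refine le_trans ?_ (le_add_of_nonneg_right (Finset.sum_nonneg fun _ _ => Finset.sum_nonneg fun _ _ => sq_nonneg _))
        exact Finset.single_le_sum (f := fun a => eval x ((GM R (m + 1)).adjugate (Fin.last m) a) ^ 2) (fun _ _ => sq_nonneg _) (Finset.mem_univ _)
      refine a1.trans ?_
      refine le_trans (le_of_eq ?_) (mul_le_mul_of_nonneg_left hGm (by positivity))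
      rw [hadd]; congr 1; rw [hK]; ring
    have hexact := grad_exact R m x hGp
    have hΓ : eval x (Gam R (m + 1)) / eval x (Gam R m) ≤ ε ^ (2 * δ) := by
      have : eval x (Gam R (m + 1)) < (ε ^ δ) ^ 2 * eval x (Gam R m) := hx
      rw [div_le_iff₀ hGp]
      refine this.le.trans (le_of_eq ?_)
      rw [sq, hadd]; congr 2; ring
    have hη : 0 < ε ^ e := by positivity
    set n : Fin m → ℤ := fun j => ⌊u j / ε ^ e⌋ with hn
    have hround : ∀ j, |(n j : ℝ) * ε ^ e - u j| ≤ ε ^ e := by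
      intro j
      have b1 := Int.floor_le (u j / ε ^ e)
      have b2 := Int.lt_floor_add_one (u j / ε ^ e)
      rw [le_div_iff₀ hη] at b1
      rw [div_lt_iff₀ hη] at b2
      rw [abs_le]; constructor <;> simp only [hn] <;> linarith
    have hroundbd : ∀ j, |(n j : ℝ) * ε ^ e| ≤ ε ^ (-K) + ε ^ e := by
      intro j
      have := abs_add_le ((n j : ℝ) * ε ^ e - u j) (u j)
      rw [sub_add_cancel] at this
      linarith [hround j, hu_bd j]
    have hnN : ∀ j, |(n j : ℝ)| ≤ N := by
      intro j
      have := hroundbd j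
      rw [abs_mul, abs_of_pos hη] at this
      have b3 : |(n j : ℝ)| ≤ ε ^ (-(K + e)) + 1 := by
        refine le_of_mul_le_mul_right (this.trans (le_of_eq ?_)) hη
        rw [add_mul, hadd, one_mul]; congr 2; ring
      rw [hN]; push_cast
      linarith [Nat.le_ceil (ε ^ (-(K + e)))]
    refine Set.mem_biUnion (x := n) ?_ ?_
    · simp only [Finset.coe_filter, Set.mem_ofPred_eq]
      refine ⟨?_, fun j => (hroundbd j).trans ?_⟩
      · refine Fintype.mem_piFinset.2 fun j => Finset.mem_Icc.2 ?_
        have := abs_le.1 (hnN j)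
        constructor
        · exact_mod_cast this.1
        · exact_mod_cast this.2
      · refine le_trans ?_ hm2
        have := rp_le_one h0 h1.le he0
        have := one_le_rp h0 h1.le hK0
        linarith
    · simp only [W, Set.mem_ofPred_eq, hgrad]
      refine (grad_round (fun i => eval x (pderiv i (R m))) (fun (j : Fin m) i => eval x (pderiv i (R j))) u _ _ hround).trans ?_
      refine le_trans ?_ hm3
      have c1 : ∑ i, (eval x (pderiv i (R m)) - ∑ j : Fin m, u j * eval x (pderiv i (R j))) ^ 2 ≤ ε ^ (2 * δ) := by
        rw [hu]; exact (le_of_eq hexact).trans hΓ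
      have c2 : ∑ j : Fin m, ∑ i, eval x (pderiv i (R j)) ^ 2 ≤ ε ^ (-(M + 2)) := by
        refine le_trans (le_add_of_nonneg_left (Finset.sum_nonneg fun _ _ => sq_nonneg _)) hx2.le
      have c3 : (ε ^ e) ^ 2 * ∑ j : Fin m, ∑ i, eval x (pderiv i (R j)) ^ 2 ≤ ε ^ (2 * δ) := by
        refine (mul_le_mul_of_nonneg_left c2 (by positivity)).trans (le_of_eq ?_)
        rw [sq, hadd, hadd]; congr 1; rw [he]; ring
      have hm0 : (0:ℝ) ≤ m := by positivity
      nlinarith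
  by_contra hno
  push Not at hno
  have hle : (gs ι).real (Bad R m (ε ^ δ)) ≤ m * ε ^ (M + 1) + B * ε ^ (M + 1) + ε ^ (M + 1) := by
    refine (measureReal_mono hcover (measure_ne_top _ _)).trans ?_
    refine (measureReal_union_le _ _).trans (add_le_add ((measureReal_union_le _ _).trans (add_le_add ?_ hE)) ?_)
    · refine (measureReal_biUnion_finset_le _ _).trans ?_
      refine (Finset.sum_le_sum (g := fun _ => ε ^ (M + 1)) fun j hj => hbad j (Finset.mem_range.1 hj)).trans (by simp)
    · refine (measureReal_biUnion_finset_le _ _).trans ?_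
      refine (Finset.sum_le_sum (g := fun _ => ε ^ (M + 1 + (K + e + 1) * m)) fun n hn => ?_).trans ?_
      · exact (hno _ (Finset.mem_filter.1 hn).2).le
      rw [Finset.sum_const, nsmul_eq_mul]
      have hc : (((P.filter (fun n => ∀ j, |(n j : ℝ) * ε ^ e| ≤ ε ^ (-(K + 1)))).card : ℕ) : ℝ) ≤ ε ^ (-((K + e + 1) * m)) := by
        have d1 : (P.filter (fun n => ∀ j, |(n j : ℝ) * ε ^ e| ≤ ε ^ (-(K + 1)))).card ≤ (2 * N + 1) ^ m := by
          refine (Finset.card_filter_le _ _).trans (le_of_eq ?_)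
          simp only [P, Fintype.card_piFinset_const, Int.card_Icc]
          congr 1
          omega
        have d2 : ((2 * N + 1 : ℕ) : ℝ) ≤ ε ^ (-(K + e + 1)) := by
          refine le_trans ?_ hm4
          have := Nat.ceil_lt_add_one (a := ε ^ (-(K + e))) (by positivity)
          have := one_le_rp h0 h1.le (add_nonneg hK0 he0)
          rw [hN]; push_cast
          linarith
        calc _ ≤ (((2 * N + 1) ^ m : ℕ) : ℝ) := by exact_mod_cast d1
          _ = ((2 * N + 1 : ℕ) : ℝ) ^ m := by push_cast; ring
          _ ≤ (ε ^ (-(K + e + 1))) ^ m := pow_le_pow_left₀ (by positivity) d2 m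
          _ = _ := by rw [← Real.rpow_natCast, ← Real.rpow_mul h0.le]; congr 1; ring
      refine (mul_le_mul_of_nonneg_right hc (by positivity)).trans (le_of_eq ?_)
      rw [hadd]; congr 1; ring
  have : (m + B + 1) * ε ^ (M + 1) < (m + B + 1) * ε ^ (M + 1) := by
    calc _ ≤ ε ^ M := hm1
      _ < _ := hbig
      _ ≤ _ := hle
      _ = _ := by ring
  exact lt_irrefl _ this

end GradFix


section TensProb
open MvPolynomial

lemma tens_prob (D : ℕ) : ∀ (ι : Type) [Fintype ι] (g : MvPolynomial ι ℝ) (T : (Fin D → ι) → ι → ℝ),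
    (∀ w, TopT D (pderiv w g) (fun i => T i w)) → ∀ (ρ s : ℝ), 0 < ρ →
    ρ ≤ (gs ι).real {x | ∑ i, eval x (pderiv i g) ^ 2 ≤ s} →
    (ρ / 2) ^ (2 ^ D) ≤ (Measure.pi fun _ : Fin D => gs ι).real {x | ∑ w, bf T x w ^ 2 ≤ (2 * (D + 1)) ^ D * s} := by
  classical
  intro ι _ g T hT ρ s hρ h
  set a : ℝ := (√(D + 1 : ℝ))⁻¹ with ha
  have ha0 : 0 < a := by positivity
  have ha2 : a ^ 2 = (D + 1 : ℝ)⁻¹ := by rw [ha, inv_pow, Real.sq_sqrt (by positivity)]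
  have hmeas : MeasurableSet {x : ι → ℝ | ∑ i, eval x (pderiv i g) ^ 2 ≤ s} := by
    refine measurableSet_le ?_ measurable_const
    exact (by fun_prop : PG fun x => ∑ i, eval x (pderiv i g) ^ 2).cont.measurable
  have hmp := mp_point (k := D) (ι := ι)
  let A : Set ((ι → ℝ) × (Fin D → ι → ℝ)) := (fun (p : (ι → ℝ) × (Fin D → ι → ℝ)) => a • p.1 + ∑ j, a • p.2 j) ⁻¹'
    {x : ι → ℝ | ∑ i, eval x (pderiv i g) ^ 2 ≤ s}
  have hA : MeasurableSet A := hmp.measurable hmeas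
  have hA1 : ρ ≤ ((gs ι).prod (Measure.pi fun _ : Fin D => gs ι)).real A := by
    refine h.trans (le_of_eq ?_)
    rw [measureReal_def, measureReal_def, ← hmp.measure_preimage hmeas.nullMeasurableSet]
  have hz := fub_good _ _ A hA ρ hρ.le hA1
  obtain ⟨z, hz⟩ : ∃ z, ρ / 2 ≤ (Measure.pi fun _ : Fin D => gs ι).real (Prod.mk z ⁻¹' A) := by
    by_contra hne
    push Not at hne
    have : {x | ρ / 2 ≤ (Measure.pi fun _ : Fin D => gs ι).real (Prod.mk x ⁻¹' A)} = ∅ := by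
      ext x; simp only [Set.mem_ofPred_eq, Set.mem_empty_iff_false, iff_false, not_le]; exact hne x
    rw [this] at hz
    simp at hz
    linarith
  set G := Prod.mk z ⁻¹' A with hG
  have hGm : MeasurableSet G := measurable_prodMk_left hA
  have hbox := box_cs (gs ι) G hGm
  have hbox2 : (ρ / 2) ^ (2 ^ D) ≤ ((Measure.pi fun _ : Fin D => gs ι).prod (Measure.pi fun _ : Fin D => gs ι)).real
      {p | ∀ ω : Finset (Fin D), ω.piecewise p.2 p.1 ∈ G} := by
    refine (pow_le_pow_left₀ (by positivity) hz _).trans ?_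
    have := ENNReal.toReal_mono (measure_ne_top _ _) hbox
    rw [ENNReal.toReal_pow, Fintype.card_fin] at this
    exact this
  refine hbox2.trans ?_
  have hSm : MeasurableSet {x : Fin D → ι → ℝ | ∑ w, bf T x w ^ 2 ≤ (2 * (D + 1)) ^ D * s} :=
    measurableSet_le (PG.sum _ fun w => (bf_ml T w).pg.pow 2).cont.measurable measurable_const
  rw [measureReal_def (Measure.pi _) _, ← (mp_diff (J := Fin D) (ι := ι)).measure_preimage hSm.nullMeasurableSet, ← measureReal_def]
  refine measureReal_mono ?_ (measure_ne_top _ _)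
  rintro ⟨p0, p1⟩ hp
  simp only [Set.mem_ofPred_eq, Set.mem_preimage] at hp ⊢
  set Y : Fin D → ι → ℝ := fun j => (-(√2)⁻¹) • p0 j + (√2)⁻¹ • p1 j with hY
  have hYe : ∀ j i, a * p1 j i - a * p0 j i = (a * √2) * Y j i := by
    intro q i
    have : √2 * (√2)⁻¹ = (1:ℝ) := by field_simp
    simp only [hY, Pi.add_apply, Pi.smul_apply, smul_eq_mul]
    linear_combination (-a * p1 q i + a * p0 q i) * this
  let pt : Finset (Fin D) → ι → ℝ := fun ω i => a * z i + ∑ j, if j ∈ ω then a * p1 j i else a * p0 j i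
  have hpt : ∀ ω, ∑ i, eval (pt ω) (pderiv i g) ^ 2 ≤ s := by
    intro ω
    have h1 := hp ω
    simp only [hG, A, Set.mem_preimage, Set.mem_ofPred_eq] at h1
    have e : pt ω = a • z + ∑ j, a • ω.piecewise p1 p0 j := by
      funext i
      simp only [pt, Pi.add_apply, Pi.smul_apply, smul_eq_mul, Finset.sum_apply]
      congr 1
      refine Finset.sum_congr rfl fun j _ => ?_
      by_cases hj : j ∈ ω <;> simp [hj]
    rw [e]; exact h1
  have hid : ∀ w, (a * √2) ^ D * bf T Y w = ∑ ω : Finset (Fin D), (-1 : ℝ) ^ ωᶜ.card * eval (pt ω) (pderiv w g) := by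
    intro w
    have h1 := (hT w).1 (fun i => a * z i) (fun j i => a * p0 j i) (fun j i => a * p1 j i)
    rw [h1]
    unfold bf
    rw [Finset.mul_sum]
    refine Finset.sum_congr rfl fun i _ => ?_
    simp only [hYe, Finset.prod_mul_distrib, Finset.prod_const, Finset.card_univ, Fintype.card_fin]
    ring
  have hsq : ∀ w, ((a * √2) ^ D * bf T Y w) ^ 2 ≤ 2 ^ D * ∑ ω : Finset (Fin D), eval (pt ω) (pderiv w g) ^ 2 := by
    intro w
    rw [hid]
    refine (sq_sum_le_card_mul_sum_sq).trans (le_of_eq ?_)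
    simp only [Finset.card_univ, Fintype.card_finset, Fintype.card_fin, mul_pow, ← pow_mul, Nat.cast_pow, Nat.cast_ofNat]
    congr 1
    refine Finset.sum_congr rfl fun ω _ => ?_
    rw [mul_comm _ 2, pow_mul]; simp
  have hfin : ((a * √2) ^ D) ^ 2 * ∑ w, bf T Y w ^ 2 ≤ 4 ^ D * s := by
    calc _ = ∑ w, ((a * √2) ^ D * bf T Y w) ^ 2 := by simp only [mul_pow, Finset.mul_sum]
      _ ≤ ∑ w, 2 ^ D * ∑ ω : Finset (Fin D), eval (pt ω) (pderiv w g) ^ 2 := Finset.sum_le_sum fun w _ => hsq w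
      _ = 2 ^ D * ∑ ω : Finset (Fin D), ∑ w, eval (pt ω) (pderiv w g) ^ 2 := by rw [← Finset.mul_sum, Finset.sum_comm]
      _ ≤ 2 ^ D * ∑ ω : Finset (Fin D), s := by gcongr with ω; exact hpt ω
      _ = _ := by
        simp only [Finset.sum_const, Finset.card_univ, Fintype.card_finset, Fintype.card_fin, nsmul_eq_mul, Nat.cast_pow, Nat.cast_ofNat]
        rw [← mul_assoc, ← mul_pow]; norm_num
  have hc : ((a * √2) ^ D) ^ 2 = (2 * (D + 1 : ℝ)⁻¹) ^ D := by
    rw [← pow_mul, mul_comm D 2, pow_mul, mul_pow, ha2, Real.sq_sqrt (by norm_num), mul_comm]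
  rw [hc] at hfin
  have hpos : (0:ℝ) < (2 * (D + 1 : ℝ)⁻¹) ^ D := by positivity
  refine le_of_mul_le_mul_left (hfin.trans (le_of_eq ?_)) hpos
  rw [← mul_assoc, ← mul_pow]
  congr 2
  field_simp
  norm_num

end TensProb


section StepL
open MvPolynomial

lemma bd_add {ι : Type} [Fintype ι] {d : ℕ} {A B : ℝ} {f g : MvPolynomial ι ℝ} (hf : Bd d A f) (hg : Bd d B g) :
    Bd d (2 * A + 2 * B) (f + g) := by
  refine ⟨(totalDegree_add _ _).trans (max_le hf.1 hg.1), ?_⟩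
  calc _ ≤ ∫ x, (2 * eval x f ^ 2 + 2 * eval x g ^ 2) ∂(gs ι) := by
        refine integral_mono ((by fun_prop : PG _).integrable _) ((by fun_prop : PG _).integrable _) fun x => ?_
        simp only [map_add]
        nlinarith [sq_nonneg (eval x f - eval x g)]
    _ = 2 * ∫ x, eval x f ^ 2 ∂(gs ι) + 2 * ∫ x, eval x g ^ 2 ∂(gs ι) := by
        rw [integral_add ((by fun_prop : PG _).integrable _) ((by fun_prop : PG _).integrable _), integral_const_mul, integral_const_mul]
    _ ≤ _ := by linarith [hf.2, hg.2]

/-- polynomial of a tensor with a distinguished slot -/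
noncomputable def sp {D : ℕ} {ι : Type} [Fintype ι] (T : (Fin D → ι) → ι → ℝ) : MvPolynomial ι ℝ :=
  ∑ w, X w * tpoly (fun i => T i w)

lemma sp_lin {D : ℕ} {ι J : Type} [Fintype ι] [Fintype J] (T : (Fin D → ι) → ι → ℝ) (U : J → (Fin D → ι) → ι → ℝ) :
    sp T = ∑ t, sp (U t) + sp (fun i w => T i w - ∑ t, U t i w) := by
  unfold sp tpoly
  rw [Finset.sum_comm, ← Finset.sum_add_distrib]
  refine Finset.sum_congr rfl fun w _ => ?_
  rw [← Finset.mul_sum, ← mul_add, Finset.sum_comm, ← Finset.sum_add_distrib]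
  congr 1
  refine Finset.sum_congr rfl fun i _ => ?_
  rw [← Finset.sum_mul, ← add_mul, ← map_sum, ← map_add]
  congr 2
  ring

lemma sp_top {D : ℕ} {ι : Type} [Fintype ι] (g : MvPolynomial ι ℝ) (hg : g.totalDegree ≤ D + 1) (T : (Fin D → ι) → ι → ℝ)
    (hT : ∀ w, TopT D (pderiv w g) (fun i => T i w)) : Lo (D + 1) (C ((D + 1).factorial : ℝ) * g - sp T) := by
  have h1 := (euler_lo g hg).smul (D.factorial : ℝ)
  have h2 : Lo (D + 1) (∑ w, (C (D.factorial : ℝ) * pderiv w g - tpoly (fun i => T i w)) * X w) :=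
    lo_sum _ _ fun w _ => (hT w).2.mul (l := 1) (by simp)
  have e : C ((D + 1).factorial : ℝ) * g - sp T = C (D.factorial : ℝ) * (C ((D + 1 : ℕ) : ℝ) * g - ∑ w, X w * pderiv w g) +
      ∑ w, (C (D.factorial : ℝ) * pderiv w g - tpoly (fun i => T i w)) * X w := by
    unfold sp
    simp only [sub_mul, Finset.sum_sub_distrib, mul_sub, Finset.mul_sum]
    rw [← mul_assoc, ← map_mul, Nat.factorial_succ]
    push_cast
    have e1 : ∑ x : ι, C (D.factorial : ℝ) * pderiv x g * X x = ∑ x, C (D.factorial : ℝ) * (X x * pderiv x g) :=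
      Finset.sum_congr rfl fun x _ => by ring
    have e2 : ∑ x : ι, tpoly (fun i => T i x) * X x = ∑ x, X x * tpoly (fun i => T i x) :=
      Finset.sum_congr rfl fun x _ => by ring
    rw [e1, e2, mul_comm ((D : ℝ) + 1)]
    ring
  rw [e]
  exact h1.add h2

lemma spl_smul {D : ℕ} {ι Ω : Type} {T : (Fin D → ι) → Ω → ℝ} (h : Spl T) (c : ℝ) : Spl (fun i w => c * T i w) := by
  obtain ⟨S, f, g, h1, h2, h3, h4⟩ := h
  refine ⟨S, fun i => c * f i, g, h1, fun i i' hh => by simp only [h2 i i' hh], h3, fun i w => by simp only [h4]; ring⟩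

lemma bf_smul {D : ℕ} {ι Ω : Type} [Fintype ι] (T : (Fin D → ι) → Ω → ℝ) (c : ℝ) (z : Fin D → ι → ℝ) (w : Ω) :
    bf (fun i w => c * T i w) z w = c * bf T z w := by
  unfold bf
  rw [Finset.mul_sum]
  exact Finset.sum_congr rfl fun i _ => by ring

lemma abs_le_of_sq_le {x y : ℝ} (hy : 1 ≤ y) (h : x ^ 2 ≤ y) : |x| ≤ y := by
  refine abs_le_of_sq_le_sq ?_ (by linarith)
  nlinarith

set_option maxHeartbeats 1000000 in
lemma step_g (D : ℕ) (δ : ℝ) (hδ : 0 < δ) (M : ℝ) (hM : 0 ≤ M) (K : ℝ) (hK : 0 ≤ K) : ∃ (R0 : ℕ) (K' : ℝ), 0 ≤ K' ∧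
    ∀ᶠ ε in sm, ∀ (ι : Type) [Fintype ι] (g : MvPolynomial ι ℝ), Bd (D + 1) (ε ^ (-K)) g →
      ε ^ M ≤ (gs ι).real {x | ∑ i, eval x (pderiv i g) ^ 2 ≤ ε ^ δ} →
      ∃ (J : Type) (_ : Fintype J) (al be : J → ℕ) (a b : J → MvPolynomial ι ℝ) (l : J → ℝ) (q r : MvPolynomial ι ℝ) (l0 : ℝ),
        Fintype.card J ≤ R0 ∧ (∀ t, |l t| ≤ ε ^ (-K')) ∧ |l0| ≤ ε ^ (-K') ∧
        (∀ t, al t ≤ D ∧ be t ≤ D ∧ al t + be t ≤ D + 1 ∧ Bd (al t) 1 (a t) ∧ Bd (be t) 1 (b t)) ∧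
        Bd D 1 q ∧ Bd (D + 1) 1 r ∧
        g = ∑ t, C (l t) * (a t * b t) + C l0 * q + C (ε ^ (δ / 8)) * r := by
  classical
  obtain ⟨ce, hce, hen⟩ := energy (D + 1)
  obtain ⟨cw, hcw, hwick⟩ := wick1 (D + 1)
  obtain ⟨cs, hcs, hspl⟩ := spl_poly D
  obtain ⟨Cn, hCn, hnm⟩ := norm_mul_bd (D + 1)
  set c1 : ℝ := (4 * (D + 1)) ^ D * ce with hc1
  set M2 : ℝ := (M + 1) * (2 ^ D : ℕ) with hM2
  obtain ⟨R0, K4, hK4, hclaim⟩ := claim D (M2 + 1) (δ / 8) (K + 1 + δ / 2) (by positivity) (by positivity) (by positivity)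
  set F : ℝ := ((D + 1).factorial : ℝ) with hF
  have hF1 : 1 ≤ F := by rw [hF]; exact_mod_cast Nat.one_le_iff_ne_zero.2 (Nat.factorial_ne_zero _)
  set Kt := K + (K4 + 1) with hKt
  refine ⟨R0, Kt + 1, by positivity, ?_⟩
  filter_upwards [sm_pos, sm_lt one_pos, sm_lt (show (0:ℝ) < 1 / 2 by norm_num), hclaim, sm_le c1 (show -(K + 1) < -K by linarith),
    sm_le ((2 * (D + 1)) ^ D) (show δ / 2 < δ by linarith), sm_le cs (show -(K4 + 1) < -K4 by linarith),
    sm_le cw (show δ / 4 < 3 * δ / 8 by linarith),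
    sm_le (2 * (2 * F ^ 2 + 2 * (R0 * (R0 * Cn))) + 2) (show -(Kt + 1) < -Kt by linarith)]
    with ε h0 h1 h12 hcl hm1 hm2 hm3 hm4 hm5 ι _ g hg hpr
  have hadd : ∀ a b : ℝ, ε ^ a * ε ^ b = ε ^ (a + b) := fun a b => (Real.rpow_add h0 a b).symm
  have hsq : ∀ a : ℝ, (ε ^ a) ^ 2 = ε ^ (2 * a) := fun a => by rw [sq, hadd]; congr 1; ring
  have hT := fun w => topT_ex (k := D) (pderiv w g) (by have := td_pderiv g w; have := hg.1; omega)
  choose T0 hT0 using hT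
  set T : (Fin D → ι) → ι → ℝ := fun i w => T0 w i with hTd
  have hTT : ∀ w, TopT D (pderiv w g) (fun i => T i w) := hT0
  have hTe : ∑ i, ∑ w, T i w ^ 2 ≤ ε ^ (-(K + 1)) := by
    rw [Finset.sum_comm]
    calc _ ≤ ∑ w, (4 * (D + 1 : ℝ)) ^ D * ∫ x, eval x (pderiv w g) ^ 2 ∂(gs ι) := Finset.sum_le_sum fun w _ => topT_bd (hTT w)
      _ = (4 * (D + 1 : ℝ)) ^ D * ∑ w, ∫ x, eval x (pderiv w g) ^ 2 ∂(gs ι) := by rw [Finset.mul_sum]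
      _ ≤ (4 * (D + 1 : ℝ)) ^ D * (ce * ε ^ (-K)) := by
          gcongr
          exact (hen ι g hg.1).trans (mul_le_mul_of_nonneg_left hg.2 hce.le)
      _ = c1 * ε ^ (-K) := by rw [hc1]; ring
      _ ≤ _ := hm1
  have htp := tens_prob D ι g T hTT (ε ^ M) (ε ^ δ) (by positivity) hpr
  set σ : ℝ := ε ^ (-(δ / 4)) with hσ
  have hσ2 : σ ^ 2 = ε ^ (-(δ / 2)) := by rw [hσ, hsq]; congr 1; ring
  obtain ⟨J, _, U, hJ, hSpl, hUe, hErr⟩ := hcl ι ι (fun i w => σ * T i w) (by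
    simp only [mul_pow, ← Finset.mul_sum]
    rw [hσ2]
    refine (mul_le_mul_of_nonneg_left hTe (by positivity)).trans (le_of_eq ?_)
    rw [hadd]; congr 1; ring) (by
    have e1 : ε ^ (M2 + 1) ≤ (ε ^ M / 2) ^ (2 ^ D) := by
      have : ε ^ (M + 1) ≤ ε ^ M / 2 := by
        rw [Real.rpow_add_one h0.ne']
        have : 0 < ε ^ M := by positivity
        nlinarith
      refine le_trans ?_ (pow_le_pow_left₀ (by positivity) this _)
      rw [← Real.rpow_natCast, ← Real.rpow_mul h0.le]
      exact rp_mono h0 h1.le (by rw [hM2]; linarith)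
    refine e1.trans (htp.trans (measureReal_mono ?_ (measure_ne_top _ _)))
    intro x hx
    simp only [Set.mem_ofPred_eq] at hx ⊢
    simp only [bf_smul, mul_pow, ← Finset.mul_sum]
    rw [hσ2]
    refine (mul_le_mul_of_nonneg_left (hx.trans hm2) (by positivity)).trans (le_of_eq ?_)
    rw [hadd, neg_add_cancel, Real.rpow_zero])
  set τ : ℝ := ε ^ (δ / 4) with hτ
  have hτσ : τ * σ = 1 := by rw [hτ, hσ, hadd, add_neg_cancel, Real.rpow_zero]
  have hτ1 : τ ^ 2 ≤ 1 := by rw [hτ, hsq]; exact rp_le_one h0 h1.le (by linarith)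
  choose al be a b l hl1 hl2 hl3 ha hb hl hlo using fun t => hspl ι (fun i w => τ * U t i w) (spl_smul (hSpl t) τ)
  have hl' : ∀ t, l t ^ 2 ≤ ε ^ (-(K4 + 1)) := by
    intro t
    refine (hl t).trans (le_trans ?_ hm3)
    refine mul_le_mul_of_nonneg_left ?_ hcs.le
    simp only [mul_pow, ← Finset.mul_sum]
    refine (mul_le_of_le_one_left (Finset.sum_nonneg fun _ _ => Finset.sum_nonneg fun _ _ => sq_nonneg _) hτ1).trans (hUe t)
  -- error
  set Er : (Fin D → ι) → ι → ℝ := fun i w => T i w - ∑ t, τ * U t i w with hEr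
  have hEre : ∑ i, ∑ w, Er i w ^ 2 ≤ ε ^ (3 * δ / 8) := by
    have e : ∀ i w, Er i w = τ * (σ * T i w - ∑ t, U t i w) := by
      intro i w
      rw [hEr]; simp only
      rw [mul_sub, ← mul_assoc, hτσ, one_mul, Finset.mul_sum]
    simp only [e, mul_pow, ← Finset.mul_sum]
    rw [hτ, hsq]
    refine (mul_le_mul_of_nonneg_left hErr (by positivity)).trans (le_of_eq ?_)
    rw [hadd]; congr 1; ring
  obtain ⟨r0, hr0, hr0l⟩ := hwick ι (Fin (D + 1)) (by simp) (fun i => Er (Fin.tail i) (i 0))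
  set μ := √(cw * ∑ i : Fin (D + 1) → ι, Er (Fin.tail i) (i 0) ^ 2) with hμ
  have hμ2 : μ ^ 2 ≤ ε ^ (δ / 4) := by
    rw [hμ, Real.sq_sqrt (mul_nonneg hcw.le (Finset.sum_nonneg fun _ _ => sq_nonneg _))]
    refine le_trans (mul_le_mul_of_nonneg_left ?_ hcw.le) hm4
    rw [sum_cons, Finset.sum_comm]
    simpa using hEre
  have hsp : sp Er = tpoly (fun i : Fin (D + 1) → ι => Er (Fin.tail i) (i 0)) := by
    rw [tpoly_cons, sp]
    simp
  rw [← hsp] at hr0l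
  set L : MvPolynomial ι ℝ := C F * g - ∑ t, C (l t) * (a t * b t) - C μ * r0 with hL
  have hLlo : Lo (D + 1) L := by
    have e1 := sp_top g hg.1 T hTT
    have e2 : Lo (D + 1) (∑ t, (C (l t) * (a t * b t) - sp (fun i w => τ * U t i w))) := lo_sum _ _ fun t _ => hlo t
    have e3 := sp_lin T (fun t i w => τ * U t i w)
    have e4 : L = (C F * g - sp T) - (∑ t, (C (l t) * (a t * b t) - sp (fun i w => τ * U t i w))) - (C μ * r0 - sp Er) := by
      rw [e3, hL, Finset.sum_sub_distrib]
      simp only [hEr]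
      ring
    rw [e4]
    exact (e1.sub e2).sub hr0l
  have hLb : ∫ x, eval x L ^ 2 ∂(gs ι) ≤ ε ^ (-(Kt + 1)) := by
    have b1 := (bd_smul hg F).mono (show D + 1 ≤ 2 * (D + 1) by omega) le_rfl
    have b2 : Bd (2 * (D + 1)) (R0 * (R0 * (ε ^ (-(K4 + 1)) * Cn))) (∑ t, C (-l t) * (a t * b t)) := by
      refine (bd_sum Finset.univ (2 * (D + 1)) (ε ^ (-(K4 + 1)) * Cn) _ fun t _ => ?_).mono le_rfl ?_
      · have hab : Bd (2 * (D + 1)) Cn (a t * b t) := by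
          have := (ha t).1; have := (hb t).1; have := hl3 t
          refine ⟨(totalDegree_mul _ _).trans (by omega), ?_⟩
          simp only [map_mul]
          refine (hnm ι _ _ (by omega) (by omega)).trans ?_
          have h3 : (∫ x, eval x (a t) ^ 2 ∂(gs ι)) * ∫ x, eval x (b t) ^ 2 ∂(gs ι) ≤ 1 :=
            mul_le_one₀ (ha t).2 (integral_nonneg fun _ => sq_nonneg _) (hb t).2
          rw [mul_assoc]
          exact mul_le_of_le_one_right (by linarith) h3
        refine (bd_smul hab _).mono le_rfl ?_
        rw [neg_sq]
        exact mul_le_mul_of_nonneg_right (hl' t) (by linarith)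
      · have : ((Finset.univ : Finset J).card : ℝ) ≤ R0 := by exact_mod_cast hJ
        gcongr
    have b3 := (bd_smul hr0 (-μ)).mono (show D + 1 ≤ 2 * (D + 1) by omega) le_rfl
    have b4 := bd_add (bd_add b1 b2) b3
    have e : L = C F * g + ∑ t, C (-l t) * (a t * b t) + C (-μ) * r0 := by
      rw [hL]; simp only [map_neg, neg_mul, Finset.sum_neg_distrib]; ring
    rw [e]
    refine b4.2.trans (le_trans ?_ hm5)
    have k1 : ε ^ (-K) ≤ ε ^ (-Kt) := rp_mono h0 h1.le (by rw [hKt]; linarith)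
    have k2 : ε ^ (-(K4 + 1)) ≤ ε ^ (-Kt) := rp_mono h0 h1.le (by rw [hKt]; linarith)
    have k3 : (-μ) ^ 2 * 1 ≤ ε ^ (-Kt) := by
      rw [neg_sq, mul_one]
      exact hμ2.trans (rp_mono h0 h1.le (by rw [hKt]; linarith))
    have k4 : F ^ 2 * ε ^ (-K) ≤ F ^ 2 * ε ^ (-Kt) := by gcongr
    have k5 : R0 * (R0 * (ε ^ (-(K4 + 1)) * Cn)) ≤ R0 * (R0 * (ε ^ (-Kt) * Cn)) := by gcongr
    calc _ ≤ 2 * (2 * (F ^ 2 * ε ^ (-Kt)) + 2 * (R0 * (R0 * (ε ^ (-Kt) * Cn)))) + 2 * ε ^ (-Kt) := by linarith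
      _ = _ := by ring
  have hFp : 0 < F := by linarith
  have habs : ∀ x y : ℝ, |x| ≤ y → |x / F| ≤ y := by
    intro x y h
    rw [abs_div, abs_of_pos hFp, div_le_iff₀ hFp]
    nlinarith [abs_nonneg x]
  refine ⟨J, inferInstance, al, be, a, b, fun t => l t / F, C (ε ^ (Kt + 1)) * L, C (μ / F * ε ^ (-(δ / 8))) * r0, ε ^ (-(Kt + 1)) / F, hJ, ?_, ?_, ?_, ?_, ?_, ?_⟩
  · intro t
    refine habs _ _ ?_
    refine (abs_le_of_sq_le (one_le_rp h0 h1.le (by linarith)) (hl' t)).trans ?_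
    exact rp_mono h0 h1.le (by rw [hKt]; linarith)
  · exact habs _ _ (le_of_eq (abs_of_pos (by positivity)))
  · intro t
    have := hl1 t; have := hl2 t; have := hl3 t
    exact ⟨by omega, by omega, by omega, ha t, hb t⟩
  · refine (bd_smul (⟨hLlo.deg, hLb⟩ : Bd D _ L) _).mono le_rfl ?_
    rw [hsq, hadd]
    exact rp_le_one h0 h1.le (by rw [hKt]; linarith)
  · refine (bd_smul hr0 _).mono le_rfl ?_
    rw [mul_one, mul_pow, div_pow, hsq]
    have : μ ^ 2 / F ^ 2 ≤ ε ^ (δ / 4) := by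
      refine (div_le_self (sq_nonneg _) ?_).trans hμ2
      nlinarith
    refine (mul_le_mul_of_nonneg_right this (by positivity)).trans ?_
    rw [hadd]
    exact rp_le_one h0 h1.le (by linarith)
  · have hCF : (C F : MvPolynomial ι ℝ) * C F⁻¹ = 1 := by rw [← map_mul, mul_inv_cancel₀ hFp.ne', map_one]
    have e1 : (C (ε ^ (-(Kt + 1)) / F) : MvPolynomial ι ℝ) * (C (ε ^ (Kt + 1)) * L) = C F⁻¹ * L := by
      rw [← mul_assoc, ← map_mul]
      congr 2
      rw [div_mul_eq_mul_div, hadd, neg_add_cancel, Real.rpow_zero, one_div]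
    have e2 : (C (ε ^ (δ / 8)) : MvPolynomial ι ℝ) * (C (μ / F * ε ^ (-(δ / 8))) * r0) = C F⁻¹ * (C μ * r0) := by
      rw [← mul_assoc, ← map_mul, ← mul_assoc (C F⁻¹), ← map_mul]
      congr 2
      rw [mul_comm (μ / F), ← mul_assoc, hadd, add_neg_cancel, Real.rpow_zero, one_mul, div_eq_inv_mul]
    have e3 : ∑ t, C (l t / F) * (a t * b t) = C F⁻¹ * ∑ t, C (l t) * (a t * b t) := by
      rw [Finset.mul_sum]
      refine Finset.sum_congr rfl fun t _ => ?_
      rw [div_eq_inv_mul, map_mul, mul_assoc]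
    rw [e1, e2, e3, hL]
    linear_combination (-g) * hCF

lemma step (D m : ℕ) (δs : ℕ → ℝ) (hδs : ∀ j, 0 ≤ δs j) (δ : ℝ) (hδ : 0 < δ) (M : ℝ) (hM : 0 ≤ M) : ∃ (R0 : ℕ) (K' : ℝ), 0 ≤ K' ∧
    ∀ᶠ ε in sm, ∀ (ι : Type) [Fintype ι] (R : ℕ → MvPolynomial ι ℝ), (∀ j ≤ m, Bd (D + 1) 1 (R j)) →
      (∀ j < m, (gs ι).real (Bad R j (ε ^ δs j)) ≤ ε ^ (M + 1)) → ε ^ M < (gs ι).real (Bad R m (ε ^ δ)) →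
      ∃ (J : Type) (_ : Fintype J) (al be : J → ℕ) (a b : J → MvPolynomial ι ℝ) (l : J → ℝ) (q r : MvPolynomial ι ℝ) (l0 : ℝ)
        (u : Fin m → ℝ),
        Fintype.card J ≤ R0 ∧ (∀ t, |l t| ≤ ε ^ (-K')) ∧ |l0| ≤ ε ^ (-K') ∧ (∀ j, |u j| ≤ ε ^ (-K')) ∧
        (∀ t, al t ≤ D ∧ be t ≤ D ∧ al t + be t ≤ D + 1 ∧ Bd (al t) 1 (a t) ∧ Bd (be t) 1 (b t)) ∧
        Bd D 1 q ∧ Bd (D + 1) 1 r ∧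
        R m = ∑ j : Fin m, C (u j) * R j + ∑ t, C (l t) * (a t * b t) + C l0 * q + C (ε ^ (δ / 8)) * r := by
  obtain ⟨K, M1, hK, hM1, h1⟩ := grad_fix (D + 1) m δs hδs δ hδ M hM
  obtain ⟨R0, K', hK', h2⟩ := step_g D δ hδ M1 hM1 (2 * K + 1) (by linarith)
  refine ⟨R0, K + K', by positivity, ?_⟩
  filter_upwards [sm_pos, sm_lt one_pos, h1, h2, sm_le (2 + 2 * (m * m)) (show -(2 * K + 1) < -(2 * K) by linarith)]
    with ε h0 h01 h1 h2 hm ι _ R hR hbad hbig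
  obtain ⟨u, hu, hpr⟩ := h1 ι R hR hbad hbig
  set g := R m - ∑ j : Fin m, C (u j) * R j with hg
  have hgb : Bd (D + 1) (ε ^ (-(2 * K + 1))) g := by
    have b2 : Bd (D + 1) (m * (m * ε ^ (-(2 * K)))) (∑ j : Fin m, C (-u j) * R j) := by
      refine (bd_sum Finset.univ (D + 1) (ε ^ (-(2 * K))) _ fun j _ => ?_).mono le_rfl (by simp)
      refine (bd_smul (hR j (by omega)) _).mono le_rfl ?_
      rw [mul_one, neg_sq, ← sq_abs]
      refine (pow_le_pow_left₀ (abs_nonneg _) (hu j) 2).trans (le_of_eq ?_)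
      rw [← Real.rpow_natCast, ← Real.rpow_mul h0.le]; congr 1; push_cast; ring
    have b := bd_add (hR m le_rfl) b2
    have e : g = R m + ∑ j : Fin m, C (-u j) * R j := by
      rw [hg]; simp only [map_neg, neg_mul, Finset.sum_neg_distrib]; ring
    rw [e]
    refine b.mono le_rfl (le_trans ?_ hm)
    have := one_le_rp h0 h01.le (show 0 ≤ 2 * K by linarith)
    nlinarith
  obtain ⟨J, i1, al, be, a, b, l, q, r, l0, c1, c2, c3, c4, c5, c6, c7⟩ := h2 ι g hgb hpr
  have k1 : ε ^ (-K') ≤ ε ^ (-(K + K')) := rp_mono h0 h01.le (by linarith)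
  have k2 : ε ^ (-K) ≤ ε ^ (-(K + K')) := rp_mono h0 h01.le (by linarith)
  refine ⟨J, i1, al, be, a, b, l, q, r, l0, u, c1, fun t => (c2 t).trans k1, c3.trans k1, fun j => (hu j).trans k2, c4, c5, c6, ?_⟩
  have : R m = ∑ j : Fin m, C (u j) * R j + g := by rw [hg]; ring
  rw [this, c7]
  ring

end StepL


section Repr
open MvPolynomial

/-- Linear combination bound. -/
lemma bd_lin {ι T : Type} [Fintype ι] [Fintype T] {e : ℕ} {B L : ℝ} (c : T → ℝ) (v : T → MvPolynomial ι ℝ)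
    (hB : 0 ≤ B) (hc : ∑ t, |c t| ≤ L) (hv : ∀ t, Bd e B (v t)) : Bd e (L ^ 2 * B) (∑ t, C (c t) * v t) := by
  refine ⟨totalDegree_finsetSum_le fun t _ => (bd_smul (hv t) (c t)).1, ?_⟩
  have hS : 0 ≤ ∑ t, |c t| := Finset.sum_nonneg fun t _ => abs_nonneg _
  calc ∫ x, eval x (∑ t, C (c t) * v t) ^ 2 ∂(gs ι)
      ≤ ∫ x, (∑ t, |c t|) * ∑ t, |c t| * eval x (v t) ^ 2 ∂(gs ι) := by
        refine integral_mono ((by fun_prop : PG _).integrable _) ((by fun_prop : PG _).integrable _) fun x => ?_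
        have h := Finset.sum_sq_le_sum_mul_sum_of_sq_le_mul Finset.univ (r := fun t => c t * eval x (v t))
          (f := fun t => |c t|) (g := fun t => |c t| * eval x (v t) ^ 2)
          (fun t _ => abs_nonneg _) (fun t _ => by positivity) (fun t _ => le_of_eq <| by
            rw [mul_pow, ← mul_assoc, ← sq, sq_abs])
        simpa using h
    _ = (∑ t, |c t|) * ∑ t, |c t| * ∫ x, eval x (v t) ^ 2 ∂(gs ι) := by
        rw [integral_const_mul, integral_finsetSum _ fun t _ => (by fun_prop : PG _).integrable _]
        simp only [integral_const_mul]
    _ ≤ (∑ t, |c t|) * ∑ t, |c t| * B := by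
        refine mul_le_mul_of_nonneg_left (Finset.sum_le_sum fun t _ => ?_) hS
        exact mul_le_mul_of_nonneg_left (hv t).2 (abs_nonneg _)
    _ = (∑ t, |c t|) ^ 2 * B := by rw [← Finset.sum_mul]; ring
    _ ≤ L ^ 2 * B := by gcongr

/-- Polynomial expressions in `R 0, …, R (m-1)` of weighted degree at most `e`, with coefficient sum at most `B`. -/
def Rp {ι : Type} (R : ℕ → MvPolynomial ι ℝ) (m : ℕ) (f : ℕ → ℕ) (e : ℕ) (B : ℝ) (P : MvPolynomial ι ℝ) : Prop :=
  ∃ (T : Type) (_ : Fintype T) (c : T → ℝ) (α : T → ℕ → ℕ),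
    (∀ t, ∑ j ∈ Finset.range m, α t j * f j ≤ e) ∧ ∑ t, |c t| ≤ B ∧
    P = ∑ t, C (c t) * ∏ j ∈ Finset.range m, R j ^ α t j

variable {ι : Type} {R : ℕ → MvPolynomial ι ℝ} {m : ℕ} {f : ℕ → ℕ} {e : ℕ} {B : ℝ} {P : MvPolynomial ι ℝ}

lemma Rp.mono {e' : ℕ} {B' : ℝ} (h : Rp R m f e B P) (he : e ≤ e') (hB : B ≤ B') : Rp R m f e' B' P := by
  obtain ⟨T, _, c, α, h1, h2, h3⟩ := h
  exact ⟨T, inferInstance, c, α, fun t => (h1 t).trans he, h2.trans hB, h3⟩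

lemma rp_zero (hB : 0 ≤ B) : Rp R m f e B 0 :=
  ⟨Empty, inferInstance, fun _ => 0, fun _ _ => 0, fun t => t.elim, by simpa, by simp⟩

lemma rp_const (a : ℝ) (ha : |a| ≤ B) : Rp R m f e B (C a) :=
  ⟨Unit, inferInstance, fun _ => a, fun _ _ => 0, fun t => by simp, by simpa, by simp⟩

lemma rp_var (j : ℕ) (hj : j < m) (hB : 1 ≤ B) : Rp R m f (f j) B (R j) := by
  refine ⟨Unit, inferInstance, fun _ => 1, fun _ i => if i = j then 1 else 0, fun t => ?_, by simpa, ?_⟩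
  · simp [hj]
  · simp [hj, Finset.prod_ite_eq']

lemma rp_mul {e' : ℕ} {B' : ℝ} {P' : MvPolynomial ι ℝ} (h : Rp R m f e B P) (h' : Rp R m f e' B' P') :
    Rp R m f (e + e') (B * B') (P * P') := by
  obtain ⟨T, _, c, α, h1, h2, h3⟩ := h
  obtain ⟨T', _, c', α', h1', h2', h3'⟩ := h'
  refine ⟨T × T', inferInstance, fun t => c t.1 * c' t.2, fun t j => α t.1 j + α' t.2 j, fun t => ?_, ?_, ?_⟩
  · simp only [add_mul, Finset.sum_add_distrib]
    exact add_le_add (h1 _) (h1' _)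
  · have : ∑ t : T × T', |c t.1 * c' t.2| = (∑ t, |c t|) * ∑ t, |c' t| := by
      rw [Fintype.sum_prod_type, Finset.sum_mul_sum]
      simp only [abs_mul]
    rw [this]
    have : 0 ≤ ∑ t, |c t| := Finset.sum_nonneg fun t _ => abs_nonneg _
    exact mul_le_mul h2 h2' (Finset.sum_nonneg fun t _ => abs_nonneg _) (this.trans h2)
  · rw [h3, h3', Finset.sum_mul_sum, Fintype.sum_prod_type]
    refine Finset.sum_congr rfl fun t _ => Finset.sum_congr rfl fun t' _ => ?_
    simp only [pow_add, Finset.prod_mul_distrib, map_mul]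
    ring

lemma rp_lin {A : Type} [Fintype A] {L : ℝ} (hB : 0 ≤ B) (c : A → ℝ) (v : A → MvPolynomial ι ℝ) (hc : ∑ a, |c a| ≤ L)
    (hv : ∀ a, Rp R m f e B (v a)) : Rp R m f e (L * B) (∑ a, C (c a) * v a) := by
  choose T hT c' α h1 h2 h3 using hv
  refine ⟨Σ a, T a, inferInstance, fun x => c x.1 * c' x.1 x.2, fun x => α x.1 x.2, fun x => h1 _ _, ?_, ?_⟩
  · rw [Fintype.sum_sigma]
    calc ∑ a, ∑ t, |c a * c' a t| = ∑ a, |c a| * ∑ t, |c' a t| := by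
          simp only [abs_mul, Finset.mul_sum]
      _ ≤ ∑ a, |c a| * B := Finset.sum_le_sum fun a _ => mul_le_mul_of_nonneg_left (h2 a) (abs_nonneg _)
      _ ≤ L * B := by rw [← Finset.sum_mul]; gcongr
  · rw [Fintype.sum_sigma]
    refine Finset.sum_congr rfl fun a _ => ?_
    rw [h3 a, Finset.mul_sum]
    refine Finset.sum_congr rfl fun t _ => ?_
    rw [map_mul, mul_assoc]

lemma rp_snoc {R' : ℕ → MvPolynomial ι ℝ} {f' : ℕ → ℕ} (h : Rp R m f e B P) (hR : ∀ j < m, R' j = R j)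
    (hf : ∀ j < m, f' j = f j) : Rp R' (m + 1) f' e B P := by
  obtain ⟨T, _, c, α, h1, h2, h3⟩ := h
  refine ⟨T, inferInstance, c, fun t j => if j < m then α t j else 0, fun t => ?_, h2, ?_⟩
  · rw [Finset.sum_range_succ]
    simp only [lt_irrefl, if_false, zero_mul, add_zero]
    refine le_of_eq_of_le (Finset.sum_congr rfl fun j hj => ?_) (h1 t)
    rw [if_pos (Finset.mem_range.1 hj), hf j (Finset.mem_range.1 hj)]
  · rw [h3]
    refine Finset.sum_congr rfl fun t _ => ?_
    rw [Finset.prod_range_succ]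
    simp only [lt_irrefl, if_false, pow_zero, mul_one]
    congr 1
    refine Finset.prod_congr rfl fun j hj => ?_
    rw [if_pos (Finset.mem_range.1 hj), hR j (Finset.mem_range.1 hj)]

/-- Approximate representability. -/
def Ap [Fintype ι] (ε : ℝ) (R : ℕ → MvPolynomial ι ℝ) (m : ℕ) (f : ℕ → ℕ) (e : ℕ) (A K N : ℝ) (P : MvPolynomial ι ℝ) : Prop :=
  ∃ P' : MvPolynomial ι ℝ, Bd e (ε ^ (-A)) P ∧ Bd e (ε ^ (-A)) P' ∧ Rp R m f e (ε ^ (-K)) P' ∧ Bd e (ε ^ N) (P - P')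

variable [Fintype ι] {ε A K N : ℝ}

lemma Ap.mono {e' : ℕ} {A' K' N' : ℝ} (h0 : 0 < ε) (h1 : ε ≤ 1) (h : Ap ε R m f e A K N P) (he : e ≤ e') (hA : A ≤ A') (hK : K ≤ K')
    (hN : N' ≤ N) : Ap ε R m f e' A' K' N' P := by
  obtain ⟨P', a1, a2, a3, a4⟩ := h
  have hk := rp_mono h0 h1 (neg_le_neg hK)
  have ha := rp_mono h0 h1 (neg_le_neg hA)
  exact ⟨P', a1.mono he ha, a2.mono he ha, a3.mono he hk, a4.mono he (rp_mono h0 h1 hN)⟩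

/-- Resetting the norm bound. -/
lemma Ap.reset (h0 : 0 < ε) (h1 : ε ≤ 1) (h2 : 4 ≤ ε ^ (-1 : ℝ)) (hN : 0 ≤ N) (hP : Bd e 1 P) (h : Ap ε R m f e A K N P) :
    Ap ε R m f e 1 K N P := by
  obtain ⟨P', a1, a2, a3, a4⟩ := h
  refine ⟨P', hP.mono le_rfl (by linarith), ?_, a3, a4⟩
  have a5 : Bd e (ε ^ N) (P' - P) := by
    have := bd_smul a4 (-1)
    have e1 : C (-1 : ℝ) * (P - P') = P' - P := by rw [map_neg, map_one]; ring
    rw [e1] at this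
    exact this.mono le_rfl (by linarith)
  have := bd_add hP a5
  rw [add_sub_cancel] at this
  exact this.mono le_rfl (by have := rp_le_one h0 h1 hN; linarith)

lemma bd_zero' {ι : Type} [Fintype ι] (d : ℕ) {B : ℝ} (hB : 0 ≤ B) : Bd (ι := ι) d B 0 := ⟨by simp, by simpa⟩

lemma ap_exact (h0 : 0 < ε) (h1 : Bd e (ε ^ (-A)) P) (h2 : Rp R m f e (ε ^ (-K)) P) : Ap ε R m f e A K N P :=
  ⟨P, h1, h1, h2, by rw [sub_self]; exact bd_zero' _ (by positivity)⟩

lemma ap_zero (h0 : 0 < ε) (h1 : ε ≤ 1) (hA : 0 ≤ A) (h : Bd e 1 P) (h' : Bd e (ε ^ N) P) : Ap ε R m f e A K N P :=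
  ⟨0, h.mono le_rfl (one_le_rp h0 h1 hA), bd_zero' _ (by positivity), rp_zero (by positivity), by rwa [sub_zero]⟩

lemma ap_snoc {R' : ℕ → MvPolynomial ι ℝ} {f' : ℕ → ℕ} (h : Ap ε R m f e A K N P) (hR : ∀ j < m, R' j = R j)
    (hf : ∀ j < m, f' j = f j) : Ap ε R' (m + 1) f' e A K N P := by
  obtain ⟨P', a1, a2, a3, a4⟩ := h
  exact ⟨P', a1, a2, rp_snoc a3 hR hf, a4⟩

lemma ap_lin {T : Type} [Fintype T] {K1 : ℝ} (h0 : 0 < ε) (c : T → ℝ) (v : T → MvPolynomial ι ℝ)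
    (hc : ∑ a, |c a| ≤ ε ^ (-K1)) (hv : ∀ a, Ap ε R m f e A K N (v a)) :
    Ap ε R m f e (2 * K1 + A) (K1 + K) (N - 2 * K1) (∑ a, C (c a) * v a) := by
  choose v' a1 a2 a3 a4 using hv
  have hsq : ∀ x : ℝ, (ε ^ (-K1)) ^ 2 * ε ^ x = ε ^ (x - 2 * K1) := fun x => by
    rw [sq, ← Real.rpow_add h0, ← Real.rpow_add h0]; ring_nf
  have e1 : -A - 2 * K1 = -(2 * K1 + A) := by ring
  have b1 := bd_lin c v (by positivity) hc a1
  have b2 := bd_lin c v' (by positivity) hc a2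
  have b4 := bd_lin c (fun a => v a - v' a) (by positivity) hc a4
  rw [hsq, e1] at b1 b2
  rw [hsq] at b4
  refine ⟨∑ a, C (c a) * v' a, b1, b2, (rp_lin (by positivity) c v' hc a3).mono le_rfl ?_, ?_⟩
  · rw [← Real.rpow_add h0]
    exact le_of_eq (by ring_nf)
  · simpa only [mul_sub, Finset.sum_sub_distrib] using b4

lemma ap_smul {K1 : ℝ} (h0 : 0 < ε) (c : ℝ) (hc : |c| ≤ ε ^ (-K1)) (hP : Ap ε R m f e A K N P) :
    Ap ε R m f e (2 * K1 + A) (K1 + K) (N - 2 * K1) (C c * P) := by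
  simpa using ap_lin (T := Unit) h0 (fun _ => c) (fun _ => P) (by simpa) (fun _ => hP)

lemma ap_add {P' : MvPolynomial ι ℝ} {θ : ℝ} (h0 : 0 < ε) (h2 : 2 ≤ ε ^ (-θ))
    (hP : Ap ε R m f e A K N P) (hP' : Ap ε R m f e A K N P') :
    Ap ε R m f e (2 * θ + A) (θ + K) (N - 2 * θ) (P + P') := by
  have := ap_lin (T := Fin 2) h0 (fun _ => 1) ![P, P'] (by simpa) (fun a => by fin_cases a <;> assumption)
  simpa using this

lemma ap_trans {P' : MvPolynomial ι ℝ} {θ : ℝ} (h0 : 0 < ε) (h2 : 4 ≤ ε ^ (-θ))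
    (hP : Bd e (ε ^ (-A)) P) (hd : Bd e (ε ^ N) (P - P')) (hP' : Ap ε R m f e A K N P') :
    Ap ε R m f e A K (N - θ) P := by
  obtain ⟨P2, a1, a2, a3, a4⟩ := hP'
  refine ⟨P2, hP, a2, a3, ?_⟩
  have := bd_add hd a4
  rw [sub_add_sub_cancel] at this
  refine this.mono le_rfl ?_
  have e : ε ^ (N - θ) = ε ^ (-θ) * ε ^ N := by rw [← Real.rpow_add h0]; ring_nf
  rw [e]
  have : 0 < ε ^ N := by positivity
  nlinarith

lemma ap_mul (d : ℕ) : ∀ᶠ ε in sm, ∀ (ι : Type) [Fintype ι] (R : ℕ → MvPolynomial ι ℝ) (m : ℕ) (f : ℕ → ℕ) (e e' : ℕ)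
    (A A' K K' N N' : ℝ) (P P' : MvPolynomial ι ℝ), e ≤ d → e' ≤ d → 0 ≤ A → 0 ≤ A' → Ap ε R m f e A K N P → Ap ε R m f e' A' K' N' P' →
    Ap ε R m f (e + e') (A + A' + 1) (K + K') (min N N' - (A + A' + 1)) (P * P') := by
  obtain ⟨Cn, hCn, hnm⟩ := norm_mul_bd d
  filter_upwards [sm_pos, sm_lt one_pos, sm_le (4 * Cn) (show (0:ℝ) < 1 by norm_num)] with ε h0 h1 hC
  intro ι _ R m f e e' A A' K K' N N' P P' he he' hA hA' hP hP'
  rw [Real.rpow_one, Real.rpow_zero] at hC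
  have hC' : 4 * Cn ≤ ε ^ (-1 : ℝ) := by
    rw [Real.rpow_neg h0.le, Real.rpow_one, ← one_div, le_div_iff₀ h0]; exact hC
  obtain ⟨Q, a1, a2, a3, a4⟩ := hP
  obtain ⟨Q', b1, b2, b3, b4⟩ := hP'
  have hm : ∀ (A B : ℝ) (F G : MvPolynomial ι ℝ), Bd e A F → Bd e' B G → Bd (e + e') (Cn * A * B) (F * G) := by
    intro A B F G hF hG
    refine ⟨(totalDegree_mul _ _).trans (add_le_add hF.1 hG.1), ?_⟩
    simp only [map_mul]
    refine (hnm ι F G (hF.1.trans he) (hG.1.trans he')).trans ?_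
    have h1 := hF.2; have h2 := hG.2
    have h3 : 0 ≤ ∫ x, eval x G ^ 2 ∂(gs ι) := integral_nonneg fun x => sq_nonneg _
    have := hF.nonneg
    gcongr
  have hb : ∀ x y z : ℝ, z ≤ x + y - 1 → 4 * Cn * ε ^ x * ε ^ y ≤ ε ^ z := by
    intro x y z hz
    calc 4 * Cn * ε ^ x * ε ^ y ≤ ε ^ (-1 : ℝ) * ε ^ x * ε ^ y := by gcongr
      _ = ε ^ (x + y - 1) := by rw [← Real.rpow_add h0, ← Real.rpow_add h0]; ring_nf
      _ ≤ ε ^ z := rp_mono h0 h1.le hz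
  have hpos : ∀ x y : ℝ, 0 ≤ Cn * ε ^ x * ε ^ y := fun x y => by positivity
  have hs : Cn * ε ^ (-A) * ε ^ (-A') ≤ ε ^ (-(A + A' + 1)) := by
    have := hb (-A) (-A') (-(A + A' + 1)) (by linarith)
    have := hpos (-A) (-A')
    linarith
  refine ⟨Q * Q', (hm _ _ _ _ a1 b1).mono le_rfl hs, (hm _ _ _ _ a2 b2).mono le_rfl hs, (rp_mul a3 b3).mono le_rfl ?_, ?_⟩
  · rw [← Real.rpow_add h0]
    exact le_of_eq (by ring_nf)
  · have := bd_add (hm _ _ _ _ a1 b4) (hm _ _ _ _ a4 b2)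
    have e1 : P * (P' - Q') + (P - Q) * Q' = P * P' - Q * Q' := by ring
    rw [e1] at this
    refine this.mono le_rfl ?_
    have c1 := hb (-A) N' (min N N' - (A + A' + 1)) (by have := min_le_right N N'; linarith)
    have c2 := hb N (-A') (min N N' - (A + A' + 1)) (by have := min_le_left N N'; linarith)
    linarith

end Repr


section Subst
open MvPolynomial

lemma ap_prod (d : ℕ) (A K N : ℝ) (hA : 0 ≤ A) (hK : 0 ≤ K) : ∀ᶠ ε in sm, ∀ (ι : Type) [Fintype ι] (R S : ℕ → MvPolynomial ι ℝ) (m m1 : ℕ)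
    (f g α : ℕ → ℕ), (∀ j < m1, 1 ≤ g j ∧ Ap ε R m f (g j) A K N (S j)) → ∑ j ∈ Finset.range m1, α j * g j ≤ d →
    Ap ε R m f (∑ j ∈ Finset.range m1, α j * g j) (d * (A + 1)) (d * K) (N - d ^ 2 * (A + 1)) (∏ j ∈ Finset.range m1, S j ^ α j) := by
  filter_upwards [sm_pos, sm_lt one_pos, ap_mul d] with ε h0 h1 hmul
  intro ι _ R S m m1 f g α hS hd
  -- invariant
  set I : ℕ → ℕ → MvPolynomial ι ℝ → Prop := fun n e P => n ≤ e ∧ Ap ε R m f e (n * (A + 1)) (n * K) (N - n ^ 2 * (A + 1)) P with hI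
  have hone : I 0 0 1 := by
    refine ⟨le_rfl, ?_⟩
    refine ap_exact h0 ?_ ?_
    · have := bd_const (ι := ι) 0 1
      simpa using this
    · have := rp_const (R := R) (m := m) (f := f) (e := 0) (B := 1) 1 (by simp)
      simpa using this
  have hstep : ∀ n e P j, j < m1 → e + g j ≤ d → I n e P → I (n + 1) (e + g j) (P * S j) := by
    intro n e P j hj he hP
    obtain ⟨hg, hSj⟩ := hS j hj
    refine ⟨by have := hP.1; omega, ?_⟩
    have := hmul ι R m f e (g j) _ _ _ _ _ _ _ _ (by omega) (by omega) (by positivity) hA hP.2 hSj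
    refine this.mono h0 h1.le le_rfl ?_ ?_ ?_
    · push_cast; linarith
    · push_cast; linarith
    · have : N - n ^ 2 * (A + 1) ≤ N := by
        have : 0 ≤ (n:ℝ) ^ 2 * (A + 1) := by positivity
        linarith
      rw [min_eq_left this]
      push_cast
      have : 0 ≤ (n:ℝ) * (A + 1) := by positivity
      nlinarith
  have hpow : ∀ b n e P j, j < m1 → e + b * g j ≤ d → I n e P → I (n + b) (e + b * g j) (P * S j ^ b) := by
    intro b
    induction b with
    | zero => intro n e P j _ _ h; simpa using h
    | succ b ih =>
      intro n e P j hj he h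
      have e1 : e + (b + 1) * g j = (e + b * g j) + g j := by ring
      rw [e1] at he ⊢
      rw [pow_succ, ← mul_assoc, ← add_assoc]
      exact hstep _ _ _ j hj he (ih n e P j hj (by omega) h)
  have hmain : ∀ k ≤ m1, ∃ n, I n (∑ j ∈ Finset.range k, α j * g j) (∏ j ∈ Finset.range k, S j ^ α j) := by
    intro k
    induction k with
    | zero => intro _; exact ⟨0, by simpa using hone⟩
    | succ k ih =>
      intro hk
      obtain ⟨n, hn⟩ := ih (by omega)
      rw [Finset.sum_range_succ, Finset.prod_range_succ]
      refine ⟨_, hpow (α k) n _ _ k (by omega) ?_ hn⟩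
      rw [← Finset.sum_range_succ (fun j => α j * g j)]
      refine le_trans (Finset.sum_le_sum_of_subset ?_) hd
      exact Finset.range_subset_range.2 hk
  obtain ⟨n, hn, h⟩ := hmain m1 le_rfl
  have hnd : (n:ℝ) ≤ d := by exact_mod_cast hn.trans hd
  refine h.mono h0 h1.le le_rfl (by gcongr) (by gcongr) ?_
  have : (n:ℝ) ^ 2 * (A + 1) ≤ d ^ 2 * (A + 1) := by gcongr
  linarith

lemma ap_subst (d : ℕ) (A K N K1 : ℝ) (hA : 0 ≤ A) (hK : 0 ≤ K) : ∀ᶠ ε in sm, ∀ (ι : Type) [Fintype ι] (R S : ℕ → MvPolynomial ι ℝ) (m m1 : ℕ)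
    (f g : ℕ → ℕ) (e : ℕ) (P : MvPolynomial ι ℝ), (∀ j < m1, 1 ≤ g j ∧ Ap ε R m f (g j) A K N (S j)) → e ≤ d → Rp S m1 g e (ε ^ (-K1)) P →
    Ap ε R m f e (2 * K1 + d * (A + 1)) (K1 + d * K) (N - d ^ 2 * (A + 1) - 2 * K1) P := by
  filter_upwards [sm_pos, sm_lt one_pos, ap_prod d A K N hA hK] with ε h0 h1 hp
  intro ι _ R S m m1 f g e P hS he hP
  obtain ⟨T, _, c, α, a1, a2, a3⟩ := hP
  rw [a3]
  refine ap_lin h0 c _ a2 fun t => ?_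
  exact (hp ι R S m m1 f g (α t) hS ((a1 t).trans he)).mono h0 h1.le (a1 t) le_rfl le_rfl le_rfl

lemma gm_congr {ι : Type} [Fintype ι] {R R' : ℕ → MvPolynomial ι ℝ} (k : ℕ) (h : ∀ j < k, R' j = R j) : Gam R' k = Gam R k := by
  unfold Gam
  congr 1
  ext1 i j
  simp [GM, h i i.2, h j j.2]

lemma bad_congr {ι : Type} [Fintype ι] {R R' : ℕ → MvPolynomial ι ℝ} (k : ℕ) (h : ∀ j ≤ k, R' j = R j) (s : ℝ) : Bad R' k s = Bad R k s := by
  unfold Bad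
  rw [gm_congr (k + 1) fun j hj => h j (by omega), gm_congr k fun j hj => h j (by omega)]

/-- Regular lists. -/
def RegL {ι : Type} [Fintype ι] (c1 ε : ℝ) (u m : ℕ) (R : ℕ → MvPolynomial ι ℝ) (f : ℕ → ℕ) : Prop :=
  ∀ j < m, 1 ≤ f j ∧ Bd (f j) 1 (R j) ∧ ∀ w, j + 1 + w = u + m →
    (gs ι).real (Bad R j (ε ^ (c1 / 4 ^ w))) ≤ ε ^ ((u + m + w : ℕ) : ℝ)

/-- The regularisation statement. -/
def Reg (c1 : ℝ) (k t : ℕ) : Prop := ∀ (s u : ℕ) (N : ℝ), 0 ≤ N → ∃ (m' : ℕ) (K : ℝ), 0 ≤ K ∧ ∀ᶠ ε in sm,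
  ∀ (ι κ : Type) [Fintype ι] [Fintype κ] (Q : κ → MvPolynomial ι ℝ) (e : κ → ℕ), Fintype.card κ ≤ s →
    (∀ i, Bd (e i) 1 (Q i)) → (∀ i, e i ≤ k) → (Finset.univ.filter fun i => e i = k).card ≤ t →
    ∃ m ≤ m', ∃ (R : ℕ → MvPolynomial ι ℝ) (f : ℕ → ℕ), (∀ j < m, f j ≤ k) ∧
      ((Finset.range m).filter fun j => f j = k).card ≤ t ∧ RegL c1 ε u m R f ∧ ∀ i, Ap ε R m f (e i) 1 K N (Q i)

lemma reg_zero (c1 : ℝ) (t : ℕ) : Reg c1 0 t := by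
  intro s u N hN
  refine ⟨0, 0, le_rfl, ?_⟩
  filter_upwards [sm_pos, sm_lt one_pos] with ε h0 h1
  intro ι κ _ _ Q e hs hQ he ht
  refine ⟨0, le_rfl, fun _ => 0, fun _ => 0, by simp, by simp, fun j hj => by omega, fun i => ?_⟩
  have h := hQ i
  have hei : e i = 0 := by have := he i; omega
  rw [hei] at h ⊢
  obtain ⟨a, ha⟩ : ∃ a, Q i = C a := ⟨_, totalDegree_eq_zero_iff_eq_C.1 (by have := h.1; omega)⟩
  rw [ha] at h ⊢
  refine ap_exact h0 (h.mono le_rfl (one_le_rp h0 h1.le zero_le_one)) ?_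
  refine rp_const a ?_
  have := h.2
  simp at this
  simpa using this

lemma reg_succ_zero (c1 : ℝ) (k : ℕ) (h : ∀ t, Reg c1 k t) : Reg c1 (k + 1) 0 := by
  intro s u N hN
  obtain ⟨m', K, hK, H⟩ := h s s u N hN
  refine ⟨m', K, hK, ?_⟩
  filter_upwards [H] with ε H
  intro ι κ _ _ Q e hs hQ he ht
  have he' : ∀ i, e i ≤ k := by
    intro i
    by_contra hi
    have : i ∈ Finset.univ.filter fun i => e i = k + 1 := by simp; have := he i; omega
    rw [Finset.card_eq_zero.1 (Nat.le_zero.1 ht)] at this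
    simp at this
  obtain ⟨m, hm, R, f, a1, a2, a3, a4⟩ := H ι κ Q e hs hQ he' ((Finset.card_le_univ _).trans hs)
  refine ⟨m, hm, R, f, fun j hj => (a1 j hj).trans (by omega), ?_, a3, a4⟩
  rw [Nat.le_zero, Finset.card_eq_zero, Finset.filter_eq_empty_iff]
  intro j hj
  have := a1 j (Finset.mem_range.1 hj)
  omega

/-- The inner loop. -/
def LoopP (c1 : ℝ) (k t u : ℕ) (lam : ℕ) : Prop := ∀ (s : ℕ) (N N0 a : ℝ), 0 ≤ N → 0 ≤ N0 → 0 ≤ a → N0 ≤ 2 * a + lam * (c1 / 4 ^ u / 8) →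
  ∃ (m' : ℕ) (K : ℝ), 0 ≤ K ∧ ∀ᶠ ε in sm,
  ∀ (ι κ : Type) [Fintype ι] [Fintype κ] (Q : κ → MvPolynomial ι ℝ) (e : κ → ℕ) (r : MvPolynomial ι ℝ), Fintype.card κ ≤ s →
    (∀ i, Bd (e i) 1 (Q i)) → (∀ i, e i ≤ k + 1) → (Finset.univ.filter fun i => e i = k + 1).card ≤ t → Bd (k + 1) 1 r →
    ∃ m ≤ m', ∃ (R : ℕ → MvPolynomial ι ℝ) (f : ℕ → ℕ), (∀ j < m, f j ≤ k + 1) ∧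
      ((Finset.range m).filter fun j => f j = k + 1).card ≤ t + 1 ∧ RegL c1 ε u m R f ∧ (∀ i, Ap ε R m f (e i) 1 K N (Q i)) ∧
      Ap ε R m f (k + 1) 1 K N0 (C (ε ^ a) * r)

lemma loop_zero (c1 : ℝ) (k t u : ℕ) (h : Reg c1 (k + 1) t) : LoopP c1 k t u 0 := by
  intro s N N0 a hN hN0' ha hN0
  obtain ⟨m', K, hK, H⟩ := h s u N hN
  refine ⟨m', K, hK, ?_⟩
  filter_upwards [H, sm_pos, sm_lt one_pos] with ε H h0 h1
  intro ι κ _ _ Q e r hs hQ he ht hr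
  obtain ⟨m, hm, R, f, a1, a2, a3, a4⟩ := H ι κ Q e hs hQ he ht
  refine ⟨m, hm, R, f, a1, by omega, a3, a4, ?_⟩
  have hb := bd_smul hr (ε ^ a)
  rw [mul_one, sq, ← Real.rpow_add h0] at hb
  refine ap_zero h0 h1.le zero_le_one (hb.mono le_rfl (rp_le_one h0 h1.le (by linarith))) (hb.mono le_rfl (rp_mono h0 h1.le ?_))
  simp at hN0
  linarith

lemma reg_of_loop (c1 : ℝ) (hc1 : 0 < c1) (k t : ℕ) (h : ∀ u lam, LoopP c1 k t u lam) : Reg c1 (k + 1) (t + 1) := by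
  intro s u N hN
  obtain ⟨lam, hlam⟩ := exists_nat_ge (N / (c1 / 4 ^ u / 8))
  have hp : 0 < c1 / 4 ^ u / 8 := by positivity
  rw [div_le_iff₀ hp] at hlam
  obtain ⟨m', K, hK, H⟩ := h u lam s N N 0 hN hN le_rfl (by linarith)
  refine ⟨m', K, hK, ?_⟩
  filter_upwards [H, sm_pos, sm_lt one_pos] with ε H h0 h1
  intro ι κ _ _ Q e hs hQ he ht
  classical
  by_cases hcase : (Finset.univ.filter fun i => e i = k + 1).card ≤ t
  · obtain ⟨m, hm, R, f, a1, a2, a3, a4, a5⟩ := H ι κ Q e 0 hs hQ he hcase (bd_zero _)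
    exact ⟨m, hm, R, f, a1, a2, a3, a4⟩
  · obtain ⟨i0, hi0⟩ : (Finset.univ.filter fun i => e i = k + 1).Nonempty := by
      rw [← Finset.card_pos]; omega
    have hi0' : e i0 = k + 1 := by simpa using hi0
    obtain ⟨m, hm, R, f, a1, a2, a3, a4, a5⟩ := H ι κ (Function.update Q i0 0) (Function.update e i0 0) (Q i0) hs
      (fun i => by
        by_cases hi : i = i0
        · subst hi; simpa using bd_zero 0
        · simpa [hi] using hQ i)
      (fun i => by
        by_cases hi : i = i0
        · subst hi; simp
        · simpa [hi] using he i)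
      (by
        have : (Finset.univ.filter fun i => Function.update e i0 0 i = k + 1) ⊆ (Finset.univ.filter fun i => e i = k + 1).erase i0 := by
          intro i hi
          by_cases hi' : i = i0
          · subst hi'; simp at hi
          · simpa [hi'] using hi
        have := Finset.card_le_card this
        rw [Finset.card_erase_of_mem hi0] at this
        omega)
      (by have := hQ i0; rwa [hi0'] at this)
    refine ⟨m, hm, R, f, a1, a2, a3, fun i => ?_⟩
    by_cases hi : i = i0
    · subst hi
      rw [hi0']
      simpa using a5
    · simpa [hi] using a4 i

lemma reg_of (c1 : ℝ) (hc1 : 0 < c1) (H : ∀ k t u lam, Reg c1 (k + 1) t → LoopP c1 k t u lam → LoopP c1 k t u (lam + 1)) : ∀ k t, Reg c1 k t := by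
  intro k
  induction k with
  | zero => exact reg_zero c1
  | succ k ih =>
    intro t
    induction t with
    | zero => exact reg_succ_zero c1 k ih
    | succ t iht =>
      refine reg_of_loop c1 hc1 k t fun u lam => ?_
      induction lam with
      | zero => exact loop_zero c1 k t u iht
      | succ lam ihl => exact H k t u lam iht ihl

end Subst


section LoopStep
open MvPolynomial

lemma top_count {J : Type} [Fintype J] (k t m1 : ℕ) (f1 : ℕ → ℕ) (al be : J → ℕ) (hal : ∀ x, al x ≤ k) (hbe : ∀ x, be x ≤ k)
    (h : ((Finset.range m1).filter fun j => f1 j = k + 1).card ≤ t) :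
    (Finset.univ.filter fun i : (Fin m1 ⊕ Unit) ⊕ (J ⊕ J) =>
      Sum.elim (Sum.elim (fun j : Fin m1 => f1 j) (fun _ => k)) (Sum.elim al be) i = k + 1).card ≤ t := by
  classical
  refine le_trans (le_trans (Finset.card_le_card ?_) (Finset.card_image_le (s := (Finset.range m1).filter fun j => f1 j = k + 1)
    (f := fun j : ℕ => if h : j < m1 then (Sum.inl (Sum.inl ⟨j, h⟩) : (Fin m1 ⊕ Unit) ⊕ (J ⊕ J)) else Sum.inl (Sum.inr ())))) h
  intro i hi
  rw [Finset.mem_filter] at hi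
  rcases i with (j | x) | (x | x)
  · rw [Finset.mem_image]
    refine ⟨j, ?_, by simp⟩
    simpa using hi
  · simp at hi
  · have h1 := hi.2
    simp only [Sum.elim_inr, Sum.elim_inl] at h1
    have := hal x; omega
  · have h1 := hi.2
    simp only [Sum.elim_inr] at h1
    have := hbe x; omega

/-- Combining the pieces of the step lemma. -/
lemma ap_comb {ι J : Type} [Fintype ι] [Fintype J] {ε : ℝ} {R : ℕ → MvPolynomial ι ℝ} {m : ℕ} {f : ℕ → ℕ} {k m1 : ℕ} {Ks K2 N2 : ℝ}
    (h0 : 0 < ε) (h1 : ε ≤ 1) (h4 : 4 ≤ ε ^ (-1 : ℝ)) (hKs : 0 ≤ Ks) (hK2 : 0 ≤ K2)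
    (hmul : ∀ (e e' : ℕ) (A A' K K' N N' : ℝ) (P P' : MvPolynomial ι ℝ), e ≤ k → e' ≤ k → 0 ≤ A → 0 ≤ A' →
      Ap ε R m f e A K N P → Ap ε R m f e' A' K' N' P' → Ap ε R m f (e + e') (A + A' + 1) (K + K') (min N N' - (A + A' + 1)) (P * P'))
    (u : Fin m1 → ℝ) (l : J → ℝ) (l0 : ℝ) (S : Fin m1 → MvPolynomial ι ℝ) (g : Fin m1 → ℕ) (al be : J → ℕ) (a b : J → MvPolynomial ι ℝ) (q : MvPolynomial ι ℝ)
    (hu : ∑ j, |u j| ≤ ε ^ (-(Ks + 1))) (hl : ∑ t, |l t| ≤ ε ^ (-(Ks + 1))) (hl0 : |l0| ≤ ε ^ (-Ks))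
    (hg : ∀ j, g j ≤ k + 1) (hab : ∀ t, al t ≤ k ∧ be t ≤ k ∧ al t + be t ≤ k + 1)
    (hS : ∀ j, Ap ε R m f (g j) 1 K2 N2 (S j)) (ha : ∀ t, Ap ε R m f (al t) 1 K2 N2 (a t)) (hb : ∀ t, Ap ε R m f (be t) 1 K2 N2 (b t))
    (hq : Ap ε R m f k 1 K2 N2 q) :
    Ap ε R m f (k + 1) (2 * Ks + 9) (Ks + 3 + 2 * K2) (N2 - 2 * Ks - 9) (∑ j, C (u j) * S j + ∑ t, C (l t) * (a t * b t) + C l0 * q) := by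
  have h2 : 2 ≤ ε ^ (-1 : ℝ) := by linarith
  have s1 := ap_lin h0 u S hu fun j => (hS j).mono h0 h1 (hg j) le_rfl le_rfl le_rfl
  have s2 := ap_lin h0 l (fun t => a t * b t) hl fun t =>
    (hmul _ _ _ _ _ _ _ _ _ _ (hab t).1 (hab t).2.1 zero_le_one zero_le_one (ha t) (hb t)).mono h0 h1 (hab t).2.2 le_rfl le_rfl le_rfl
  have s3 := ap_smul h0 l0 hl0 hq
  rw [min_self] at s2
  have t1 := ap_add h0 h2 (s1.mono h0 h1 (A' := 2 * Ks + 5) (K' := Ks + 1 + 2 * K2) (N' := N2 - 2 * Ks - 5) le_rfl (by linarith) (by linarith) (by linarith))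
    (s2.mono h0 h1 le_rfl (by linarith) (by linarith) (by linarith))
  have t2 := ap_add h0 h2 t1 (s3.mono h0 h1 (by omega) (by linarith) (by linarith) (by linarith))
  exact t2.mono h0 h1 le_rfl (by linarith) (by linarith) (by linarith)

set_option maxHeartbeats 1000000 in
lemma loop_succ (c1 : ℝ) (hc1 : 0 < c1) (k t u lam : ℕ) (hReg : Reg c1 (k + 1) t) (hL : LoopP c1 k t u lam) : LoopP c1 k t u (lam + 1) := by
  intro s N N0 a hN hN0 ha hcond
  set δ : ℝ := c1 / 4 ^ u with hδ
  have hδp : 0 < δ := by positivity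
  obtain ⟨m1', K1, hK1, H1⟩ := hReg s (u + 1) (N + 1) (by linarith)
  have hst := fun m1 : ℕ => step k m1 (fun j => c1 / 4 ^ (u + m1 - j)) (fun j => by positivity) δ hδp ((2 * u + m1 + 1 : ℕ) : ℝ) (by positivity)
  choose Rf Kf hKf Hst using hst
  set R0 := ∑ i ∈ Finset.range (m1' + 1), Rf i with hR0
  set Ks := ∑ i ∈ Finset.range (m1' + 1), Kf i with hKs
  have hRle : ∀ i ≤ m1', Rf i ≤ R0 := fun i hi => Finset.single_le_sum (fun j _ => Nat.zero_le _) (Finset.mem_range.2 (by omega))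
  have hKle : ∀ i ≤ m1', Kf i ≤ Ks := fun i hi => Finset.single_le_sum (fun j _ => hKf j) (Finset.mem_range.2 (by omega))
  have hKs0 : 0 ≤ Ks := Finset.sum_nonneg fun j _ => hKf j
  set N2 : ℝ := N + 1 + (k + 1 : ℕ) ^ 2 * (1 + 1) + 2 * K1 + N0 + δ + 2 * Ks + 9 with hN2
  have hsqn : (0:ℝ) ≤ (k + 1 : ℕ) ^ 2 * (1 + 1) := by positivity
  obtain ⟨m2, K2, hK2, H2⟩ := hL (m1' + 1 + R0 + R0) N2 (N0 + δ / 8) (a + δ / 8) (by positivity) (by positivity) (by positivity)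
    (by push_cast at hcond; linarith)
  have hall : ∀ᶠ ε in sm, ∀ i ∈ Finset.range (m1' + 1), _ := (Filter.eventually_all_finset (Finset.range (m1' + 1))).2 fun i _ => Hst i
  refine ⟨max (m1' + 1) m2, K1 + (k + 1 : ℕ) * K2 + Ks + 3 + 2 * K2 + δ, by positivity, ?_⟩
  filter_upwards [H1, H2, hall, sm_pos, sm_lt one_pos, sm_le 4 (show -1 < (0:ℝ) by norm_num), sm_le 2 (show -(δ / 16) < (0:ℝ) by linarith),
    sm_le (m1' + R0 : ℝ) (show -(Ks + 1) < -Ks by linarith), ap_mul k, ap_subst (k + 1) 1 K2 N2 K1 zero_le_one hK2]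
    with ε H1 H2 hall h0 h1 h4 h2 hcnt hmul hsub
  rw [Real.rpow_zero, mul_one] at h4 h2
  intro ι κ _ _ Q e r hs hQ he ht hr
  obtain ⟨m1, hm1, R1, f1, b1, b2, b3, b4⟩ := H1 ι κ Q e hs hQ he ht
  set Rs : ℕ → MvPolynomial ι ℝ := Function.update R1 m1 r with hRs
  set fs : ℕ → ℕ := Function.update f1 m1 (k + 1) with hfs
  have hRlt : ∀ j < m1, Rs j = R1 j := fun j hj => by simp [hRs, hj.ne]
  have hflt : ∀ j < m1, fs j = f1 j := fun j hj => by simp [hfs, hj.ne]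
  have hRm : Rs m1 = r := by simp [hRs]
  have hfm : fs m1 = k + 1 := by simp [hfs]
  have hbr : Bd (k + 1) 1 (C (ε ^ a) * r) := by
    refine (bd_smul hr (ε ^ a)).mono le_rfl ?_
    rw [mul_one, sq, ← Real.rpow_add h0]
    exact rp_le_one h0 h1.le (by linarith)
  have hea : |ε ^ a| ≤ ε ^ (-0 : ℝ) := by
    rw [neg_zero, Real.rpow_zero, abs_of_pos (by positivity)]
    exact rp_le_one h0 h1.le ha
  by_cases hgood : (gs ι).real (Bad Rs m1 (ε ^ δ)) ≤ ε ^ ((2 * u + m1 + 1 : ℕ) : ℝ)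
  · -- good case: append `r`
    refine ⟨m1 + 1, (by omega : m1 + 1 ≤ m1' + 1).trans (le_max_left _ _), Rs, fs, ?_, ?_, ?_, ?_, ?_⟩
    · intro j hj
      rcases Nat.lt_succ_iff_lt_or_eq.1 hj with h | h
      · rw [hflt j h]; exact b1 j h
      · rw [h, hfm]
    · rw [Finset.range_add_one, Finset.filter_insert, if_pos hfm]
      refine (Finset.card_insert_le _ _).trans ?_
      have : ((Finset.range m1).filter fun j => fs j = k + 1) = (Finset.range m1).filter fun j => f1 j = k + 1 :=
        Finset.filter_congr fun j hj => by rw [hflt j (Finset.mem_range.1 hj)]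
      rw [this]
      omega
    · intro j hj
      rcases Nat.lt_succ_iff_lt_or_eq.1 hj with h | h
      · obtain ⟨c1', c2', c3'⟩ := b3 j h
        rw [hflt j h, hRlt j h]
        refine ⟨c1', c2', fun w hw => ?_⟩
        rw [bad_congr j fun i hi => hRlt i (by omega)]
        have := c3' w (by omega)
        have e1 : u + 1 + m1 + w = u + (m1 + 1) + w := by omega
        rwa [e1] at this
      · subst h
        rw [hfm, hRm]
        refine ⟨by omega, hr, fun w hw => ?_⟩
        have e1 : w = u := by omega
        subst e1
        have e2 : w + (j + 1) + w = 2 * w + j + 1 := by omega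
        rw [e2]
        exact hgood
    · intro i
      exact (ap_snoc (b4 i) hRlt hflt).mono h0 h1.le le_rfl le_rfl
        (by have : 0 ≤ ((k + 1 : ℕ) : ℝ) * K2 := by positivity
            linarith) (by linarith)
    · have hv := rp_var (R := Rs) (m := m1 + 1) (f := fs) (B := 1) m1 (by omega) le_rfl
      rw [hfm, hRm] at hv
      have hx : Ap ε Rs (m1 + 1) fs (k + 1) 0 0 N0 r := ap_exact h0 (by simpa using hr) (by simpa using hv)
      have := ap_smul h0 (ε ^ a) hea hx
      exact this.mono h0 h1.le le_rfl (by linarith)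
        (by have : 0 ≤ ((k + 1 : ℕ) : ℝ) * K2 := by positivity
            linarith) (by linarith)
  · -- bad case
    push Not at hgood
    obtain ⟨J, _, al, be, aa, bb, l, q, r', l0, v, hJ, hl, hl0, hv, hab, hq, hr', heq⟩ := hall m1 (Finset.mem_range.2 (by omega)) ι Rs
      (fun j hj => by
        rcases Nat.lt_or_eq_of_le hj with h | h
        · rw [hRlt j h]; exact (b3 j h).2.1.mono (b1 j h) le_rfl
        · rw [h, hRm]; exact hr)
      (fun j hj => by
        rw [bad_congr j fun i hi => hRlt i (by omega)]
        refine ((b3 j hj).2.2 (u + m1 - j) (by omega)).trans (rp_mono h0 h1.le ?_)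
        have : 2 * u + m1 + 1 + 1 ≤ u + 1 + m1 + (u + m1 - j) := by omega
        exact_mod_cast this)
      hgood
    rw [hRm] at heq
    have hKm := rp_mono h0 h1.le (neg_le_neg (hKle m1 hm1))
    obtain ⟨m, hm, R, f, g1, g2, g3, g4, g5⟩ := H2 ι ((Fin m1 ⊕ Unit) ⊕ (J ⊕ J))
      (Sum.elim (Sum.elim (fun j : Fin m1 => R1 j) (fun _ => q)) (Sum.elim aa bb))
      (Sum.elim (Sum.elim (fun j : Fin m1 => f1 j) (fun _ => k)) (Sum.elim al be)) r'
      (by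
        have := hRle m1 hm1
        simp only [Fintype.card_sum, Fintype.card_fin, Fintype.card_unit]
        omega)
      (by
        rintro ((j | x) | (x | x))
        · exact (b3 j j.2).2.1
        · exact hq
        · exact (hab x).2.2.2.1
        · exact (hab x).2.2.2.2)
      (by
        rintro ((j | x) | (x | x))
        · exact b1 j j.2
        · simp
        · have := (hab x).1; simp only [Sum.elim_inr, Sum.elim_inl]; omega
        · have := (hab x).2.1; simp only [Sum.elim_inr]; omega)
      (top_count k t m1 f1 al be (fun x => (hab x).1) (fun x => (hab x).2.1) b2) hr'
    have gS : ∀ j : Fin m1, Ap ε R m f (f1 j) 1 K2 N2 (R1 j) := fun j => g4 (Sum.inl (Sum.inl j))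
    have gq : Ap ε R m f k 1 K2 N2 q := g4 (Sum.inl (Sum.inr ()))
    have ga : ∀ x, Ap ε R m f (al x) 1 K2 N2 (aa x) := fun x => g4 (Sum.inr (Sum.inl x))
    have gb : ∀ x, Ap ε R m f (be x) 1 K2 N2 (bb x) := fun x => g4 (Sum.inr (Sum.inr x))
    refine ⟨m, hm.trans (le_max_right _ _), R, f, g1, g2, g3, ?_, ?_⟩
    · intro i
      obtain ⟨P', p1, p2, p3, p4⟩ := b4 i
      have hx := hsub ι R R1 m m1 f f1 (e i) P' (fun j hj => ⟨(b3 j hj).1, gS ⟨j, hj⟩⟩) (he i) p3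
      set A' : ℝ := 2 * K1 + (k + 1 : ℕ) * (1 + 1) with hA'
      have hA0 : 0 ≤ A' := by positivity
      have hx2 := hx.mono h0 h1.le le_rfl le_rfl le_rfl (N' := N + 1) (by linarith)
      have hx3 := ap_trans h0 h4 ((hQ i).mono le_rfl (one_le_rp h0 h1.le hA0)) p4 hx2
      have hx4 := (hx3.mono h0 h1.le le_rfl le_rfl le_rfl (N' := N) (by linarith)).reset h0 h1.le h4 hN (hQ i)
      exact hx4.mono h0 h1.le le_rfl le_rfl (by linarith) le_rfl
    · have hsum : ∀ (X : Type) [Fintype X] (c : X → ℝ), (Fintype.card X ≤ m1' + R0) → (∀ x, |c x| ≤ ε ^ (-Ks)) → ∑ x, |c x| ≤ ε ^ (-(Ks + 1)) := by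
        intro X _ c hX hc
        refine le_trans ?_ hcnt
        refine (Finset.sum_le_card_nsmul _ _ _ fun x _ => hc x).trans ?_
        rw [nsmul_eq_mul]
        refine mul_le_mul_of_nonneg_right ?_ (by positivity)
        exact_mod_cast hX
      have hX := ap_comb h0 h1.le h4 hKs0 hK2 (fun e e' A A' K K' N N' P P' => hmul ι R m f e e' A A' K K' N N' P P')
        v l l0 (fun j : Fin m1 => R1 j) (fun j : Fin m1 => f1 j) al be aa bb q
        (hsum _ v (by simp; omega) fun x => (hv x).trans hKm) (hsum _ l (by have := hRle m1 hm1; omega) fun x => (hl x).trans hKm)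
        (hl0.trans hKm) (fun j => b1 j j.2) (fun x => ⟨(hab x).1, (hab x).2.1, (hab x).2.2.1⟩) gS ga gb gq
      have hX2 := ap_smul h0 (ε ^ a) hea hX
      have hX3 := ap_add h0 h2 (hX2.mono h0 h1.le le_rfl (A' := 2 * Ks + 9) (K' := Ks + 3 + 2 * K2) (N' := N0 + δ / 8) (by linarith) (by linarith) (by linarith))
        (g5.mono h0 h1.le le_rfl (by linarith) (by linarith) le_rfl)
      have e1 : ∑ j : Fin m1, C (v j) * Rs j = ∑ j : Fin m1, C (v j) * R1 j :=
        Finset.sum_congr rfl fun j _ => by rw [hRlt j j.2]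
      have e2 : C (ε ^ a) * (∑ j : Fin m1, C (v j) * R1 j + ∑ x, C (l x) * (aa x * bb x) + C l0 * q) + C (ε ^ (a + δ / 8)) * r' = C (ε ^ a) * r := by
        rw [heq, e1, Real.rpow_add h0, map_mul]
        ring
      rw [e2] at hX3
      have hX4 := (hX3.mono h0 h1.le le_rfl le_rfl le_rfl (N' := N0) (by linarith)).reset h0 h1.le h4 hN0 hbr
      exact hX4.mono h0 h1.le le_rfl le_rfl
        (by have : 0 ≤ ((k + 1 : ℕ) : ℝ) * K2 := by positivity
            linarith) le_rfl

lemma reg_all (c1 : ℝ) (hc1 : 0 < c1) (k t : ℕ) : Reg c1 k t := reg_of c1 hc1 (fun k t u lam => loop_succ c1 hc1 k t u lam) k t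

end LoopStep


section Final
open MvPolynomial

lemma geo_inner (c1 : ℝ) (hc1 : 0 ≤ c1) (m i : ℕ) (hi : i < m) :
    ∑ j ∈ Finset.range (i + 1), c1 / 4 ^ (m - 1 - j) ≤ 2 * (c1 / 4 ^ (m - 1 - i)) := by
  induction i with
  | zero =>
    simp only [zero_add, Finset.sum_range_one]
    have : 0 ≤ c1 / 4 ^ (m - 1 - 0) := by positivity
    linarith
  | succ i ih =>
    rw [Finset.sum_range_succ]
    have h := ih (by omega)
    have e : m - 1 - i = (m - 1 - (i + 1)) + 1 := by omega
    rw [e, pow_succ] at h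
    have h2 : c1 / (4 ^ (m - 1 - (i + 1)) * 4) = c1 / 4 ^ (m - 1 - (i + 1)) / 4 := by rw [div_div]
    rw [h2] at h
    have : 0 ≤ c1 / 4 ^ (m - 1 - (i + 1)) := by positivity
    linarith

lemma geo_total (c : ℝ) (hc : 0 < c) (m : ℕ) :
    ∑ i ∈ Finset.range m, ∑ j ∈ Finset.range (i + 1), 2 * (c / 16 / 4 ^ (m - 1 - j)) < c := by
  have h1 : ∀ i ∈ Finset.range m, ∑ j ∈ Finset.range (i + 1), 2 * (c / 16 / 4 ^ (m - 1 - j)) ≤ 4 * (c / 16 / 4 ^ (m - 1 - i)) := by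
    intro i hi
    rw [← Finset.mul_sum]
    have := geo_inner (c / 16) (by positivity) m i (Finset.mem_range.1 hi)
    linarith
  refine (Finset.sum_le_sum h1).trans_lt ?_
  rw [← Finset.mul_sum]
  rcases m with _ | m
  · simpa
  · have := geo_inner (c / 16) (by positivity) (m + 1) m (by omega)
    simp only [add_tsub_cancel_right, tsub_self, pow_zero, div_one] at this ⊢
    linarith

lemma triv_dec {n d : ℕ} (ε c : ℝ) (h0 : 0 < ε) (h1 : ε ≤ 1) (hc : 0 ≤ c) :
    HasDiffuseDecomposition (n := n) d 0 ε (ε ^ (-c)) 0 := by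
  refine ⟨0, fun i => i.elim0, ⟨by simp, by simp⟩, fun i => i.elim0, fun a => ?_⟩
  have : IsProbabilityMeasure (stdGaussian n) := by unfold _root_.stdGaussian; infer_instance
  refine prob_le_one.trans ?_
  rw [pow_zero, one_mul, ENNReal.one_le_ofReal]
  exact one_le_rp h0 h1 hc

lemma rp_dec {n d m : ℕ} (ε c : ℝ) (h0 : 0 < ε) (R : ℕ → MvPolynomial (Fin n) ℝ) (f : ℕ → ℕ) (B g : ℝ) (P : MvPolynomial (Fin n) ℝ)
    (hR : ∀ j < m, Bd (f j) 1 (R j)) (hP : Rp R m f d B P)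
    (han : ∀ a : ℕ → ℝ, (gs (Fin n)).real {x | ∀ j < m, |eval x (R j) - a j| ≤ ε} ≤ ε ^ ((m:ℝ) - c)) :
    HasDiffuseDecomposition d m ε (ε ^ (-c)) (C g * P) := by
  classical
  obtain ⟨T, _, b, α, a1, a2, a3⟩ := hP
  set A : T → (Fin m →₀ ℕ) := fun t => Finsupp.equivFunOnFinite.symm fun j : Fin m => α t j with hA
  refine ⟨∑ t, monomial (A t) (g * b t), fun j => R j, ⟨?_, ?_⟩, fun i => (hR i i.2).2, fun a => ?_⟩
  · rw [map_sum, a3, Finset.mul_sum]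
    refine Finset.sum_congr rfl fun t _ => ?_
    rw [aeval_monomial, Finsupp.prod_fintype _ _ (fun i => pow_zero _), ← mul_assoc, ← map_mul, algebraMap_eq]
    congr 1
    rw [Finset.prod_range]
    rfl
  · intro x hx
    obtain ⟨t, _, ht⟩ := Finset.mem_biUnion.1 (support_sum hx)
    have hxt : x = A t := by
      have := support_monomial_subset ht
      simpa using this
    rw [hxt]
    refine le_trans ?_ (a1 t)
    rw [Finset.sum_range]
    exact Finset.sum_le_sum fun j _ => Nat.mul_le_mul le_rfl (hR j j.2).1
  · have h := han fun j => if h : j < m then a ⟨j, h⟩ else 0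
    have hset : {x : Fin n → ℝ | ∀ i : Fin m, |eval x (R i) - a i| ≤ ε} =
        {x | ∀ j < m, |eval x (R j) - (if h : j < m then a ⟨j, h⟩ else 0)| ≤ ε} := by
      ext x
      constructor
      · intro hx j hj
        rw [dif_pos hj]
        exact hx ⟨j, hj⟩
      · intro hx i
        have := hx i i.2
        rw [dif_pos i.2] at this
        exact this
    have he : stdGaussian n = gs (Fin n) := rfl
    rw [he, hset, ← ofReal_measureReal]
    refine ENNReal.ofReal_le_ofReal (h.trans (le_of_eq ?_))
    rw [sub_eq_add_neg, Real.rpow_add h0, Real.rpow_natCast]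

lemma main_small (d : ℕ) (c N : ℝ) (hc : 0 < c) (hN : 0 < N) : ∃ m₀ : ℕ, ∀ᶠ ε in sm, ∀ (n : ℕ) (p : MvPolynomial (Fin n) ℝ), p.totalDegree ≤ d →
    ∃ p₀ : MvPolynomial (Fin n) ℝ, p₀.totalDegree ≤ d ∧ gaussL2 (p - p₀) ≤ ε ^ N * gaussL2 p ∧
      ∃ m ≤ m₀, HasDiffuseDecomposition d m ε (ε ^ (-c)) p₀ := by
  obtain ⟨m', K, hK, H⟩ := reg_all (c / 16) (by positivity) d 1 1 0 (2 * N) (by positivity)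
  refine ⟨m', ?_⟩
  have hall : ∀ᶠ ε in sm, ∀ i ∈ Finset.range (m' + 1), _ := (Filter.eventually_all_finset (Finset.range (m' + 1))).2 fun m _ =>
    antic_meas d (fun j => c / 16 / 4 ^ (m - 1 - j)) (fun j => by positivity) m c (geo_total c hc m)
  filter_upwards [H, hall, sm_pos, sm_lt one_pos] with ε H hall h0 h1
  intro n p hp
  have hsq : gaussL2 p ^ 2 = ∫ x, eval x p ^ 2 ∂(gs (Fin n)) := Real.sq_sqrt (integral_nonneg fun x => sq_nonneg _)
  have hg0 : 0 ≤ gaussL2 p := Real.sqrt_nonneg _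
  rcases hg0.eq_or_lt with hz | hpos
  · refine ⟨0, by simp, ?_, 0, by omega, triv_dec ε c h0 h1.le hc.le⟩
    rw [sub_zero, ← hz, mul_zero]
  · set g := gaussL2 p with hg
    have hQ : Bd d 1 (C g⁻¹ * p) := by
      have := bd_smul (⟨hp, le_of_eq hsq.symm⟩ : Bd d (g ^ 2) p) g⁻¹
      refine this.mono le_rfl (le_of_eq ?_)
      rw [← mul_pow, inv_mul_cancel₀ hpos.ne', one_pow]
    obtain ⟨m, hm, R, f, b1, b2, b3, b4⟩ := H (Fin n) Unit (fun _ => C g⁻¹ * p) (fun _ => d) (by simp) (fun _ => hQ) (fun _ => le_rfl)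
      ((Finset.card_le_univ _).trans (by simp))
    obtain ⟨P', p1, p2, p3, p4⟩ := b4 ()
    have hb := bd_smul p4 g
    have e1 : C g * (C g⁻¹ * p - P') = p - C g * P' := by
      rw [mul_sub, ← mul_assoc, ← map_mul, mul_inv_cancel₀ hpos.ne', map_one, one_mul]
    rw [e1] at hb
    refine ⟨C g * P', (bd_smul p2 g).1, ?_, m, hm, ?_⟩
    · refine Real.sqrt_le_iff.2 ⟨by positivity, hb.2.trans (le_of_eq ?_)⟩
      rw [mul_pow, mul_comm, sq (ε ^ N), ← Real.rpow_add h0, two_mul]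
    · refine rp_dec ε c h0 R f _ g P' (fun j hj => (b3 j hj).2.1) p3 fun a => ?_
      refine hall m (Finset.mem_range.2 (by omega)) (Fin n) R (fun j hj => (b3 j hj).2.1.mono (b1 j hj) le_rfl) (fun j hj => ?_) a
      refine ((b3 j hj).2.2 (m - 1 - j) (by omega)).trans (rp_mono h0 h1.le ?_)
      have : m ≤ 0 + m + (m - 1 - j) := by omega
      exact_mod_cast this

end Final

/-- **The Diffuse Decomposition Theorem.**  For all `c, N > 0` and every positive integer `d`
there are constants `C > 0` and `m₀` (depending only on `c, d, N`) such that for every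
`0 < ε < 1/2`, every `n ≥ 1`, and every polynomial `p` on `ℝⁿ` of degree at most `d`, there is a
polynomial `p₀` of degree at most `d` with `|p - p₀|₂ ≤ C · ε^N · |p|₂` admitting an
`(ε, ε^{-c})`-diffuse decomposition of size at most `m₀`. -/
theorem diffuse_decomposition_theorem (d : ℕ) (hd : 0 < d) (c N : ℝ) (hc : 0 < c) (hN : 0 < N) :
    ∃ (C : ℝ) (m₀ : ℕ), 0 < C ∧
      ∀ (ε : ℝ), 0 < ε → ε < 1 / 2 →
        ∀ (n : ℕ), 1 ≤ n → ∀ p : MvPolynomial (Fin n) ℝ, p.totalDegree ≤ d →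
          ∃ p₀ : MvPolynomial (Fin n) ℝ, p₀.totalDegree ≤ d ∧
            gaussL2 (p - p₀) ≤ C * ε ^ N * gaussL2 p ∧
            ∃ m ≤ m₀, HasDiffuseDecomposition d m ε (ε ^ (-c)) p₀ := by
  obtain ⟨m₀, H⟩ := main_small d c N hc hN
  obtain ⟨ε₀, hε₀, hH⟩ := mem_nhdsGT_iff_exists_Ioo_subset.1 H
  have hε₀' : (0:ℝ) < ε₀ := hε₀
  refine ⟨1 + ε₀ ^ (-N), m₀, by positivity, fun ε h0 hhalf n hn p hp => ?_⟩
  have hgn : 0 ≤ gaussL2 p := Real.sqrt_nonneg _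
  rcases lt_or_ge ε ε₀ with hlt | hge
  · obtain ⟨p₀, a1, a2, a3⟩ := hH ⟨h0, hlt⟩ n p hp
    refine ⟨p₀, a1, a2.trans ?_, a3⟩
    refine mul_le_mul_of_nonneg_right ?_ hgn
    have : 0 ≤ ε₀ ^ (-N) * ε ^ N := by positivity
    linarith
  · refine ⟨0, by simp, ?_, 0, by omega, triv_dec ε c h0 (by linarith) hc.le⟩
    rw [sub_zero]
    have h1 : 1 ≤ ε₀ ^ (-N) * ε ^ N := by
      rw [Real.rpow_neg hε₀'.le, inv_mul_eq_div, one_le_div (by positivity)]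
      exact Real.rpow_le_rpow hε₀'.le hge hN.le
    have : 0 ≤ ε ^ N := by positivity
    exact le_mul_of_one_le_left hgn (by linarith)
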